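/- A set A ⊆ ω is not K-trivial if and only if for every non-computable set D there exists a Martin-Löf random sequence R with R ≱_T D and A ⊕ R ≥_T D. -/

import Mathlib

open MeasureTheory ENNReal

/-! ### Cantor space and the uniform (coin-flipping) measure -/

/-- The binary digits of a real number in `[0,1)`, giving a point of Cantor space. -/
noncomputable def binaryDigits (x : ℝ) : ℕ → Bool :=
  fun n => decide (⌊x * 2 ^ (n + 1)⌋ % 2 = 1)

/-- The uniform (Lebesgue / coin-flipping) measure on Cantor space `2^ω`,
obtained as the pushforward of Lebesgue measure on `[0,1)` under binary expansion. -/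
noncomputable def μCantor : Measure (ℕ → Bool) :=
  Measure.map binaryDigits (volume.restrict (Set.Ico (0 : ℝ) 1))

/-- `σ` is an initial segment of the infinite sequence `X`. -/
def IsPrefixOf (σ : List Bool) (X : ℕ → Bool) : Prop :=
  ∀ i : Fin σ.length, X i = σ.get i

/-- The cylinder determined by a finite binary string. -/
def cylinder (σ : List Bool) : Set (ℕ → Bool) := {X | IsPrefixOf σ X}

/-- The open set generated by a set of finite binary strings. -/
def openOf (S : Set (List Bool)) : Set (ℕ → Bool) := ⋃ σ ∈ S, cylinder σ

/-- The density of a set `P` above the string `τ`: `μ([τ] ∩ P) · 2^{|τ|}`. -/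
noncomputable def dens (τ : List Bool) (P : Set (ℕ → Bool)) : ℝ≥0∞ :=
  μCantor (cylinder τ ∩ P) * 2 ^ τ.length

/-- The length-`n` initial segment of `X`, as a finite binary string. -/
def strPrefix (X : ℕ → Bool) (n : ℕ) : List Bool := (List.range n).map X

/-- A set of strings is prefix-free if no element is a proper prefix of another. -/
def PrefixFreeSet (S : Set (List Bool)) : Prop :=
  ∀ σ ∈ S, ∀ τ ∈ S, σ <+: τ → σ = τ

/-- The weight `∑_{σ ∈ S} 2^{-|σ|}` of a set of strings. -/
noncomputable def weight (S : Set (List Bool)) : ℝ≥0∞ :=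
  ∑' σ : S, 2⁻¹ ^ (σ : List Bool).length

/-- A set of strings is bounded if its weight is finite. -/
def BoundedStr (S : Set (List Bool)) : Prop := weight S < ⊤

/-- The tail `X(·+k)` of an infinite binary sequence. -/
def tailSeq (X : ℕ → Bool) (k : ℕ) : ℕ → Bool := fun n => X (n + k)

/-! ### Oracle computability -/

/-- The `e`-th computably enumerable set of naturals (the domain of the `e`-th
partial computable function). -/
def WEnum (e n : ℕ) : Prop := ((Denumerable.ofNat Nat.Partrec.Code e).eval n).Dom

/-- `OracleComputes e X n m` holds if the `e`-th Turing functional with oracle `X`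
outputs `m` on input `n`; a Turing functional is presented by the c.e. set `W_e`
of coded axioms `(σ, n, m)`, and `Γ_e^X(n) = m` iff some initial segment `σ` of `X`
has `(σ, n, m) ∈ W_e`. -/
def OracleComputes (e : ℕ) (X : ℕ → Bool) (n m : ℕ) : Prop :=
  ∃ σ : List Bool, IsPrefixOf σ X ∧
    WEnum e (Nat.pair (Encodable.encode σ) (Nat.pair n m))

def natOfBool (b : Bool) : ℕ := cond b 1 0

/-- `f : ℕ → ℕ` is computable with oracle `A`: some Turing functional with oracle `A`
has graph exactly `f`. -/
def FnComputableIn (f : ℕ → ℕ) (A : ℕ → Bool) : Prop :=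
  ∃ e, ∀ n m, OracleComputes e A n m ↔ m = f n

/-- Turing reducibility `B ≤_T A` for subsets of `ω` (as elements of Cantor space). -/
def TuringLE (B A : ℕ → Bool) : Prop := FnComputableIn (fun n => natOfBool (B n)) A

/-- Turing equivalence. -/
def TuringEquiv (A B : ℕ → Bool) : Prop := TuringLE A B ∧ TuringLE B A

/-- The Turing join `A ⊕ B`. -/
def joinSet (A B : ℕ → Bool) : ℕ → Bool :=
  fun n => if n % 2 = 0 then A (n / 2) else B (n / 2)

open Classical in
/-- The Turing jump `A′ = {e : Γ_e^A(e)↓}`. -/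
noncomputable def jump (A : ℕ → Bool) : ℕ → Bool :=
  fun e => decide (∃ m, OracleComputes e A e m)

/-- The empty oracle. -/
def emptyOracle : ℕ → Bool := fun _ => false

/-- The halting problem `∅′`. -/
noncomputable def zeroJump : ℕ → Bool := jump emptyOracle

/-- A set is computable iff it is Turing reducible to the empty oracle. -/
def ComputableSet (A : ℕ → Bool) : Prop := TuringLE A emptyOracle

/-- A set of naturals is c.e. in `A`. -/
def CeIn (A : ℕ → Bool) (S : Set ℕ) : Prop :=
  ∃ e, ∀ n, n ∈ S ↔ ∃ m, OracleComputes e A n m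

/-- A set of strings is c.e. in `A`. -/
def CeStrIn (A : ℕ → Bool) (S : Set (List Bool)) : Prop :=
  ∃ e, ∀ σ : List Bool, σ ∈ S ↔ ∃ m, OracleComputes e A (Encodable.encode σ) m

/-- A c.e. set of strings. -/
def CeStr (S : Set (List Bool)) : Prop := CeStrIn emptyOracle S

/-! ### Π⁰₁ classes, Martin-Löf randomness, K-triviality -/

/-- A `Π⁰₁(A)` class: the complement of the union of cylinders over an `A`-c.e.
set of strings. -/
def Pi01In (A : ℕ → Bool) (P : Set (ℕ → Bool)) : Prop :=
  ∃ S : Set (List Bool), CeStrIn A S ∧ P = (openOf S)ᶜ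

/-- A `Π⁰₁` class. -/
def Pi01 (P : Set (ℕ → Bool)) : Prop := Pi01In emptyOracle P

/-- The `n`-th level of the `e`-th `A`-effective sequence of open sets. -/
def testLevel (e : ℕ) (A : ℕ → Bool) (n : ℕ) : Set (ℕ → Bool) :=
  openOf {σ | ∃ m, OracleComputes e A (Nat.pair n (Encodable.encode σ)) m}

/-- A Martin-Löf test relative to `A`: a uniformly `A`-c.e. sequence of open sets
`G n` with `μ(G n) ≤ 2^{-n}`. -/
def MLTestIn (A : ℕ → Bool) (G : ℕ → Set (ℕ → Bool)) : Prop :=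
  (∃ e, ∀ n, G n = testLevel e A n) ∧ ∀ n, μCantor (G n) ≤ 2⁻¹ ^ n

/-- `X` is Martin-Löf random relative to `A`: it passes every `A`-Martin-Löf test. -/
def MLRandomIn (A X : ℕ → Bool) : Prop :=
  ∀ G : ℕ → Set (ℕ → Bool), MLTestIn A G → ∃ n, X ∉ G n

/-- `X` is Martin-Löf random. -/
def MLRandom (X : ℕ → Bool) : Prop := MLRandomIn emptyOracle X

/-- The domain of the `e`-th machine, viewed as a set of binary strings. -/
def machineDom (e : ℕ) : Set (List Bool) :=
  {σ | ((Denumerable.ofNat Nat.Partrec.Code e).eval (Encodable.encode σ)).Dom}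

/-- The `e`-th machine is prefix-free. -/
def PrefixFreeMachine (e : ℕ) : Prop := PrefixFreeSet (machineDom e)

/-- Prefix-free Kolmogorov complexity (defined, up to an additive constant, as the
least `|σ| + 2e + 2` over prefix-free machines `e` and programs `σ` producing `x`). -/
noncomputable def Kcpx (x : ℕ) : ℕ :=
  sInf {k | ∃ e, ∃ σ : List Bool, PrefixFreeMachine e ∧
    x ∈ (Denumerable.ofNat Nat.Partrec.Code e).eval (Encodable.encode σ) ∧
    k = σ.length + 2 * e + 2}

/-- `K(n)` means `K(1^n)`. -/
noncomputable def KofNat (n : ℕ) : ℕ := Kcpx (Encodable.encode (List.replicate n true))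

/-- `A` is K-trivial: `K(A↾n) ≤ K(n) + c` for some constant `c`. -/
def KTrivial (A : ℕ → Bool) : Prop :=
  ∃ c, ∀ n, Kcpx (Encodable.encode (strPrefix A n)) ≤ KofNat n + c


/-! ### Toolkit: primitive recursive and computable functions via `fun_prop` -/

attribute [fun_prop] Primrec
attribute [fun_prop] Computable

namespace PR
variable {α β γ σ : Type*} [Primcodable α] [Primcodable β] [Primcodable γ] [Primcodable σ]

@[fun_prop] theorem id' : Primrec (fun a : α => a) := Primrec.id
@[fun_prop] theorem const' (x : σ) : Primrec fun _ : α => x := Primrec.const x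
@[fun_prop] theorem comp' {f : β → σ} {g : α → β} (hf : Primrec f) (hg : Primrec g) :
    Primrec fun a => f (g a) := hf.comp hg
@[fun_prop] theorem fst' {f : α → β × γ} (hf : Primrec f) : Primrec fun a => (f a).1 :=
  Primrec.fst.comp hf
@[fun_prop] theorem snd' {f : α → β × γ} (hf : Primrec f) : Primrec fun a => (f a).2 :=
  Primrec.snd.comp hf
@[fun_prop] theorem mk' {f : α → β} {g : α → γ} (hf : Primrec f) (hg : Primrec g) :
    Primrec fun a => (f a, g a) := hf.pair hg
@[fun_prop] theorem add' {f g : α → ℕ} (hf : Primrec f) (hg : Primrec g) :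
    Primrec fun a => f a + g a := Primrec.nat_add.comp hf hg
@[fun_prop] theorem sub' {f g : α → ℕ} (hf : Primrec f) (hg : Primrec g) :
    Primrec fun a => f a - g a := Primrec.nat_sub.comp hf hg
@[fun_prop] theorem mul' {f g : α → ℕ} (hf : Primrec f) (hg : Primrec g) :
    Primrec fun a => f a * g a := Primrec.nat_mul.comp hf hg
@[fun_prop] theorem div' {f g : α → ℕ} (hf : Primrec f) (hg : Primrec g) :
    Primrec fun a => f a / g a := Primrec.nat_div.comp hf hg
@[fun_prop] theorem mod' {f g : α → ℕ} (hf : Primrec f) (hg : Primrec g) :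
    Primrec fun a => f a % g a := Primrec.nat_mod.comp hf hg
@[fun_prop] theorem pow' {f g : α → ℕ} (hf : Primrec f) (hg : Primrec g) :
    Primrec fun a => f a ^ g a := (Primrec₂.unpaired'.1 Nat.Primrec.pow).comp hf hg
@[fun_prop] theorem max' {f g : α → ℕ} (hf : Primrec f) (hg : Primrec g) :
    Primrec fun a => max (f a) (g a) := Primrec.nat_max.comp hf hg
@[fun_prop] theorem min' {f g : α → ℕ} (hf : Primrec f) (hg : Primrec g) :
    Primrec fun a => min (f a) (g a) := Primrec.nat_min.comp hf hg
@[fun_prop] theorem succ' {f : α → ℕ} (hf : Primrec f) :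
    Primrec fun a => Nat.succ (f a) := Primrec.succ.comp hf
@[fun_prop] theorem natPair' {f g : α → ℕ} (hf : Primrec f) (hg : Primrec g) :
    Primrec fun a => Nat.pair (f a) (g a) := Primrec₂.natPair.comp hf hg
@[fun_prop] theorem unpair' {f : α → ℕ} (hf : Primrec f) :
    Primrec fun a => Nat.unpair (f a) := Primrec.unpair.comp hf
@[fun_prop] theorem le' {f g : α → ℕ} {i : ∀ a, Decidable (f a ≤ g a)} (hf : Primrec f) (hg : Primrec g) :
    Primrec fun a => @decide (f a ≤ g a) (i a) := by
  exact (Primrec.nat_le.comp hf hg).decide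
@[fun_prop] theorem lt' {f g : α → ℕ} {i : ∀ a, Decidable (f a < g a)} (hf : Primrec f) (hg : Primrec g) :
    Primrec fun a => @decide (f a < g a) (i a) := by
  exact (Primrec.nat_lt.comp hf hg).decide
@[fun_prop] theorem eq' {f g : α → β} {i : ∀ a, Decidable (f a = g a)} (hf : Primrec f)
    (hg : Primrec g) : Primrec fun a => @decide (f a = g a) (i a) := by
  classical
  exact (Primrec.eq.comp hf hg).decide
@[fun_prop] theorem dand' {p q : α → Prop} [DecidablePred p] [DecidablePred q]
    (hp : Primrec fun a => decide (p a)) (hq : Primrec fun a => decide (q a)) :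
    Primrec fun a => decide (p a ∧ q a) :=
  (PrimrecPred.and (Primrec.primrecPred hp) (Primrec.primrecPred hq)).decide
theorem dor' {p q : α → Prop} [DecidablePred p] [DecidablePred q]
    (hp : Primrec fun a => decide (p a)) (hq : Primrec fun a => decide (q a)) :
    Primrec fun a => decide (p a ∨ q a) :=
  (PrimrecPred.or (Primrec.primrecPred hp) (Primrec.primrecPred hq)).decide
@[fun_prop] theorem dnot' {p : α → Prop} [DecidablePred p]
    (hp : Primrec fun a => decide (p a)) :
    Primrec fun a => decide (¬ p a) := (PrimrecPred.not (Primrec.primrecPred hp)).decide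
@[fun_prop] theorem band' {f g : α → Bool} (hf : Primrec f) (hg : Primrec g) :
    Primrec fun a => (f a && g a) := Primrec.and.comp hf hg
@[fun_prop] theorem bor' {f g : α → Bool} (hf : Primrec f) (hg : Primrec g) :
    Primrec fun a => (f a || g a) := Primrec.or.comp hf hg
@[fun_prop] theorem bnot' {f : α → Bool} (hf : Primrec f) :
    Primrec fun a => (! f a) := Primrec.not.comp hf
@[fun_prop] theorem ite' {c : α → Prop} [DecidablePred c] {f g : α → β}
    (hc : Primrec fun a => decide (c a)) (hf : Primrec f) (hg : Primrec g) :
    Primrec fun a => if c a then f a else g a := Primrec.ite (Primrec.primrecPred hc) hf hg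
@[fun_prop] theorem cond' {c : α → Bool} {f g : α → β}
    (hc : Primrec c) (hf : Primrec f) (hg : Primrec g) :
    Primrec fun a => bif c a then f a else g a := Primrec.cond hc hf hg

@[fun_prop] theorem map' {f : α → List β} {g : α → β → γ} (hf : Primrec f)
    (hg : Primrec fun p : α × β => g p.1 p.2) : Primrec fun a => (f a).map (g a) :=
  Primrec.list_map hf hg
@[fun_prop] theorem flatMap' {f : α → List β} {g : α → β → List γ} (hf : Primrec f)
    (hg : Primrec fun p : α × β => g p.1 p.2) : Primrec fun a => (f a).flatMap (g a) :=
  Primrec.list_flatMap hf hg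
@[fun_prop] theorem filterMap' {f : α → List β} {g : α → β → Option γ} (hf : Primrec f)
    (hg : Primrec fun p : α × β => g p.1 p.2) : Primrec fun a => (f a).filterMap (g a) :=
  Primrec.listFilterMap hf hg
@[fun_prop] theorem foldr' {f : α → List β} {g : α → σ} {h : α → β → σ → σ} (hf : Primrec f)
    (hg : Primrec g) (hh : Primrec fun p : α × β × σ => h p.1 p.2.1 p.2.2) :
    Primrec fun a => (f a).foldr (h a) (g a) :=
  Primrec.list_foldr (h := fun a p => h a p.1 p.2) hf hg hh
@[fun_prop] theorem foldl' {f : α → List β} {g : α → σ} {h : α → σ → β → σ} (hf : Primrec f)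
    (hg : Primrec g) (hh : Primrec fun p : α × σ × β => h p.1 p.2.1 p.2.2) :
    Primrec fun a => (f a).foldl (h a) (g a) :=
  Primrec.list_foldl (h := fun a p => h a p.1 p.2) hf hg hh
@[fun_prop] theorem range' {f : α → ℕ} (hf : Primrec f) : Primrec fun a => List.range (f a) :=
  Primrec.list_range.comp hf
@[fun_prop] theorem append' {f g : α → List β} (hf : Primrec f) (hg : Primrec g) :
    Primrec fun a => f a ++ g a := Primrec.list_append.comp hf hg
@[fun_prop] theorem cons' {f : α → β} {g : α → List β} (hf : Primrec f) (hg : Primrec g) :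
    Primrec fun a => f a :: g a := Primrec.list_cons.comp hf hg
@[fun_prop] theorem length' {f : α → List β} (hf : Primrec f) : Primrec fun a => (f a).length :=
  Primrec.list_length.comp hf
@[fun_prop] theorem reverse' {f : α → List β} (hf : Primrec f) : Primrec fun a => (f a).reverse :=
  Primrec.list_reverse.comp hf
@[fun_prop] theorem head?' {f : α → List β} (hf : Primrec f) : Primrec fun a => (f a).head? :=
  Primrec.list_head?.comp hf
@[fun_prop] theorem tail' {f : α → List β} (hf : Primrec f) : Primrec fun a => (f a).tail :=
  Primrec.list_tail.comp hf
@[fun_prop] theorem take' {f : α → ℕ} {g : α → List β} (hf : Primrec f) (hg : Primrec g) :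
    Primrec fun a => (g a).take (f a) := Primrec.list_take.comp hf hg
@[fun_prop] theorem drop' {f : α → ℕ} {g : α → List β} (hf : Primrec f) (hg : Primrec g) :
    Primrec fun a => (g a).drop (f a) := Primrec.list_drop.comp hf hg
@[fun_prop] theorem getElem?' {f : α → ℕ} {g : α → List β} (hf : Primrec f) (hg : Primrec g) :
    Primrec fun a => (g a)[f a]? := Primrec.list_getElem?.comp hg hf
@[fun_prop] theorem isSome' {f : α → Option β} (hf : Primrec f) : Primrec fun a => (f a).isSome :=
  Primrec.option_isSome.comp hf
@[fun_prop] theorem some' {f : α → β} (hf : Primrec f) : Primrec fun a => some (f a) :=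
  Primrec.option_some.comp hf
@[fun_prop] theorem getD' {f : α → Option β} {g : α → β} (hf : Primrec f) (hg : Primrec g) :
    Primrec fun a => (f a).getD (g a) := Primrec.option_getD.comp hf hg
@[fun_prop] theorem obind' {f : α → Option β} {g : α → β → Option γ} (hf : Primrec f)
    (hg : Primrec fun p : α × β => g p.1 p.2) : Primrec fun a => (f a).bind (g a) :=
  Primrec.option_bind hf hg
@[fun_prop] theorem omap' {f : α → Option β} {g : α → β → γ} (hf : Primrec f)
    (hg : Primrec fun p : α × β => g p.1 p.2) : Primrec fun a => (f a).map (g a) :=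
  Primrec.option_map hf hg
@[fun_prop] theorem oelim' {f : α → Option β} {d : α → γ} {g : α → β → γ} (hf : Primrec f)
    (hd : Primrec d) (hg : Primrec fun p : α × β => g p.1 p.2) :
    Primrec fun a => (f a).elim (d a) (g a) :=
  (Primrec.option_casesOn hf hd hg).of_eq fun a => by cases f a <;> rfl
@[fun_prop] theorem encode' {f : α → β} (hf : Primrec f) :
    Primrec fun a => Encodable.encode (f a) := Primrec.encode.comp hf
@[fun_prop] theorem decode' {f : α → ℕ} (hf : Primrec f) :
    Primrec fun a => (Encodable.decode (f a) : Option β) := Primrec.decode.comp hf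
@[fun_prop] theorem ofNat' {δ : Type*} [Denumerable δ] {f : α → ℕ} (hf : Primrec f) :
    Primrec fun a => Denumerable.ofNat δ (f a) := (Primrec.ofNat δ).comp hf
@[fun_prop] theorem evaln' {f g : α → ℕ} {c : α → Nat.Partrec.Code} (hf : Primrec f)
    (hc : Primrec c) (hg : Primrec g) :
    Primrec fun a => Nat.Partrec.Code.evaln (f a) (c a) (g a) :=
  Nat.Partrec.Code.primrec_evaln.comp ((hf.pair hc).pair hg)
@[fun_prop] theorem natRec' {f : α → ℕ} {g : α → β} {h : α → ℕ → β → β} (hf : Primrec f)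
    (hg : Primrec g) (hh : Primrec fun p : α × ℕ × β => h p.1 p.2.1 p.2.2) :
    Primrec fun a => (Nat.rec (g a) (h a) (f a) : β) :=
  Primrec.nat_rec' (h := fun a p => h a p.1 p.2) hf hg hh
@[fun_prop] theorem iterate' {f : α → ℕ} {g : α → β} {h : α → β → β} (hf : Primrec f)
    (hg : Primrec g) (hh : Primrec fun p : α × β => h p.1 p.2) :
    Primrec fun a => (h a)^[f a] (g a) := Primrec.nat_iterate hf hg hh
@[fun_prop] theorem all' {f : α → List β} {g : α → β → Bool} (hf : Primrec f)
    (hg : Primrec fun p : α × β => g p.1 p.2) : Primrec fun a => (f a).all (g a) :=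
  (foldr' (h := fun a b s => g a b && s) hf (const' true) (by fun_prop)).of_eq fun a => by
    induction f a <;> simp_all
@[fun_prop] theorem any' {f : α → List β} {g : α → β → Bool} (hf : Primrec f)
    (hg : Primrec fun p : α × β => g p.1 p.2) : Primrec fun a => (f a).any (g a) :=
  (foldr' (h := fun a b s => g a b || s) hf (const' false) (by fun_prop)).of_eq fun a => by
    induction f a <;> simp_all
@[fun_prop] theorem filter' {f : α → List β} {g : α → β → Bool} (hf : Primrec f)
    (hg : Primrec fun p : α × β => g p.1 p.2) : Primrec fun a => (f a).filter (g a) :=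
  (filterMap' (g := fun a b => if g a b then some b else none) hf (by fun_prop)).of_eq fun a => by
    rw [← List.filterMap_eq_filter]; rfl
@[fun_prop] theorem replicate' {f : α → ℕ} {g : α → β} (hf : Primrec f) (hg : Primrec g) :
    Primrec fun a => List.replicate (f a) (g a) :=
  (map' (g := fun a _ => g a) (range' hf) (by fun_prop)).of_eq fun a => by simp
@[fun_prop] theorem sum' {f : α → List ℕ} (hf : Primrec f) : Primrec fun a => (f a).sum :=
  (foldr' (h := fun _ b s => b + s) hf (const' 0) (by fun_prop)).of_eq fun a => by
    rw [List.sum]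
@[fun_prop] theorem isPre' [DecidableEq β] {f g : α → List β} (hf : Primrec f) (hg : Primrec g) :
    Primrec fun a => decide (f a <+: g a) :=
  Primrec.of_eq (f := fun a => decide ((g a).take (f a).length = f a)) (by fun_prop) fun a => by
    rw [decide_eq_decide, List.prefix_iff_eq_take]; exact eq_comm
@[fun_prop] theorem mem' [DecidableEq β] {f : α → β} {g : α → List β} (hf : Primrec f)
    (hg : Primrec g) : Primrec fun a => decide (f a ∈ g a) :=
  Primrec.of_eq (f := fun a => (g a).any fun b => decide (b = f a)) (by fun_prop) fun a => by
    rw [Bool.eq_iff_iff]; simp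
end PR

attribute [local irreducible] Primrec

namespace CR
variable {α β γ σ : Type*} [Primcodable α] [Primcodable β] [Primcodable γ] [Primcodable σ]

@[fun_prop] theorem id' : Computable (fun a : α => a) := Computable.id
@[fun_prop] theorem const' (x : σ) : Computable fun _ : α => x := Computable.const x
@[fun_prop] theorem comp' {f : β → σ} {g : α → β} (hf : Computable f) (hg : Computable g) :
    Computable fun a => f (g a) := hf.comp hg
@[fun_prop] theorem fst' {f : α → β × γ} (hf : Computable f) : Computable fun a => (f a).1 :=
  Computable.fst.comp hf
@[fun_prop] theorem snd' {f : α → β × γ} (hf : Computable f) : Computable fun a => (f a).2 :=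
  Computable.snd.comp hf
@[fun_prop] theorem mk' {f : α → β} {g : α → γ} (hf : Computable f) (hg : Computable g) :
    Computable fun a => (f a, g a) := hf.pair hg
@[fun_prop] theorem add' {f g : α → ℕ} (hf : Computable f) (hg : Computable g) :
    Computable fun a => f a + g a := Primrec.nat_add.to_comp.comp hf hg
@[fun_prop] theorem mul' {f g : α → ℕ} (hf : Computable f) (hg : Computable g) :
    Computable fun a => f a * g a := Primrec.nat_mul.to_comp.comp hf hg
@[fun_prop] theorem sub' {f g : α → ℕ} (hf : Computable f) (hg : Computable g) :
    Computable fun a => f a - g a := Primrec.nat_sub.to_comp.comp hf hg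
@[fun_prop] theorem pow' {f g : α → ℕ} (hf : Computable f) (hg : Computable g) :
    Computable fun a => f a ^ g a :=
  (Primrec₂.unpaired'.1 Nat.Primrec.pow).to_comp.comp hf hg
@[fun_prop] theorem natPair' {f g : α → ℕ} (hf : Computable f) (hg : Computable g) :
    Computable fun a => Nat.pair (f a) (g a) := Primrec₂.natPair.to_comp.comp hf hg
@[fun_prop] theorem unpair' {f : α → ℕ} (hf : Computable f) :
    Computable fun a => Nat.unpair (f a) := Primrec.unpair.to_comp.comp hf
@[fun_prop] theorem le' {f g : α → ℕ} {i : ∀ a, Decidable (f a ≤ g a)} (hf : Computable f) (hg : Computable g) :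
    Computable fun a => @decide (f a ≤ g a) (i a) := by
  refine Computable.of_eq (f := fun a => @decide (f a ≤ g a) (Nat.decLe _ _)) ?_
    fun a => by congr
  exact
  Computable.comp (PR.le' (i := fun _ => Nat.decLe _ _) Primrec.fst Primrec.snd).to_comp (hf.pair hg)
@[fun_prop] theorem lt' {f g : α → ℕ} {i : ∀ a, Decidable (f a < g a)} (hf : Computable f) (hg : Computable g) :
    Computable fun a => @decide (f a < g a) (i a) := by
  refine Computable.of_eq (f := fun a => @decide (f a < g a) (Nat.decLt _ _)) ?_
    fun a => by congr
  exact
  Computable.comp (PR.lt' (i := fun _ => Nat.decLt _ _) Primrec.fst Primrec.snd).to_comp (hf.pair hg)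
@[fun_prop] theorem eq' {f g : α → β} {i : ∀ a, Decidable (f a = g a)} (hf : Computable f)
    (hg : Computable g) : Computable fun a => @decide (f a = g a) (i a) := by
  classical
  refine Computable.of_eq (f := fun a => @decide (f a = g a) (Classical.propDecidable _)) ?_
    fun a => by congr
  exact
  Computable.comp (PR.eq' (i := fun _ => Classical.propDecidable _) Primrec.fst Primrec.snd).to_comp (hf.pair hg)
@[fun_prop] theorem dand' {p q : α → Prop} [DecidablePred p] [DecidablePred q]
    (hp : Computable fun a => decide (p a)) (hq : Computable fun a => decide (q a)) :
    Computable fun a => decide (p a ∧ q a) :=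
  (Computable.comp (PR.band' Primrec.fst Primrec.snd).to_comp (hp.pair hq)).of_eq
    fun a => by simp
@[fun_prop] theorem dnot' {p : α → Prop} [DecidablePred p]
    (hp : Computable fun a => decide (p a)) : Computable fun a => decide (¬ p a) :=
  (Computable.comp (PR.bnot' Primrec.id).to_comp hp).of_eq fun a => by simp
theorem dor' {p q : α → Prop} [DecidablePred p] [DecidablePred q]
    (hp : Computable fun a => decide (p a)) (hq : Computable fun a => decide (q a)) :
    Computable fun a => decide (p a ∨ q a) :=
  (Computable.comp (PR.bor' Primrec.fst Primrec.snd).to_comp (hp.pair hq)).of_eq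
    fun a => by simp
@[fun_prop] theorem band' {f g : α → Bool} (hf : Computable f) (hg : Computable g) :
    Computable fun a => (f a && g a) := Primrec.and.to_comp.comp hf hg
@[fun_prop] theorem bor' {f g : α → Bool} (hf : Computable f) (hg : Computable g) :
    Computable fun a => (f a || g a) := Primrec.or.to_comp.comp hf hg
@[fun_prop] theorem bnot' {f : α → Bool} (hf : Computable f) :
    Computable fun a => (! f a) := Primrec.not.to_comp.comp hf
@[fun_prop] theorem cond' {c : α → Bool} {f g : α → β}
    (hc : Computable c) (hf : Computable f) (hg : Computable g) :
    Computable fun a => bif c a then f a else g a := Computable.cond hc hf hg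
@[fun_prop] theorem ite' {c : α → Prop} [DecidablePred c] {f g : α → β}
    (hc : Computable fun a => decide (c a)) (hf : Computable f) (hg : Computable g) :
    Computable fun a => if c a then f a else g a :=
  (Computable.cond hc hf hg).of_eq fun a => by by_cases h : c a <;> simp [h]
@[fun_prop] theorem length' {f : α → List β} (hf : Computable f) :
    Computable fun a => (f a).length := Primrec.list_length.to_comp.comp hf
@[fun_prop] theorem append' {f g : α → List β} (hf : Computable f) (hg : Computable g) :
    Computable fun a => f a ++ g a := Primrec.list_append.to_comp.comp hf hg
@[fun_prop] theorem cons' {f : α → β} {g : α → List β} (hf : Computable f) (hg : Computable g) :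
    Computable fun a => f a :: g a := Primrec.list_cons.to_comp.comp hf hg
@[fun_prop] theorem take' {f : α → ℕ} {g : α → List β} (hf : Computable f) (hg : Computable g) :
    Computable fun a => (g a).take (f a) := Primrec.list_take.to_comp.comp hf hg
@[fun_prop] theorem getElem?' {f : α → ℕ} {g : α → List β} (hf : Computable f)
    (hg : Computable g) : Computable fun a => (g a)[f a]? :=
  Primrec.list_getElem?.to_comp.comp hg hf
@[fun_prop] theorem some' {f : α → β} (hf : Computable f) : Computable fun a => some (f a) :=
  Primrec.option_some.to_comp.comp hf
@[fun_prop] theorem isSome' {f : α → Option β} (hf : Computable f) :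
    Computable fun a => (f a).isSome := Primrec.option_isSome.to_comp.comp hf
@[fun_prop] theorem getD' {f : α → Option β} {g : α → β} (hf : Computable f)
    (hg : Computable g) : Computable fun a => (f a).getD (g a) :=
  Primrec.option_getD.to_comp.comp hf hg
@[fun_prop] theorem encode' {f : α → β} (hf : Computable f) :
    Computable fun a => Encodable.encode (f a) := Computable.encode.comp hf
@[fun_prop] theorem natRec' {f : α → ℕ} {g : α → β} {h : α → ℕ → β → β} (hf : Computable f)
    (hg : Computable g) (hh : Computable fun p : α × ℕ × β => h p.1 p.2.1 p.2.2) :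
    Computable fun a => (Nat.rec (g a) (h a) (f a) : β) :=
  Computable.nat_rec (h := fun a p => h a p.1 p.2) hf hg hh
theorem foldl' {f : α → List β} {g : α → σ} {h : α → σ → β → σ} (hf : Computable f)
    (hg : Computable g) (hh : Computable fun p : α × σ × β => h p.1 p.2.1 p.2.2) :
    Computable fun a => (f a).foldl (h a) (g a) := by
  have h1 : Computable fun a => (Nat.rec (g a) (fun n s =>
      ((f a)[n]?).elim s (fun b => h a s b)) (f a).length : σ) := by
    refine natRec' (by fun_prop) hg ?_
    have := Computable.option_casesOn (o := fun p : α × ℕ × σ => (f p.1)[p.2.1]?)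
      (f := fun p => p.2.2) (g := fun p b => h p.1 p.2.2 b) (by fun_prop) (by fun_prop)
      (hh.comp (by fun_prop : Computable fun q : (α × ℕ × σ) × β => (q.1.1, q.1.2.2, q.2)))
    exact this.of_eq fun p => by cases (f p.1)[p.2.1]? <;> rfl
  refine h1.of_eq fun a => ?_
  have key : ∀ n, n ≤ (f a).length → (Nat.rec (g a) (fun n s =>
      ((f a)[n]?).elim s (fun b => h a s b)) n : σ) = ((f a).take n).foldl (h a) (g a) := by
    intro n
    induction n with
    | zero => simp
    | succ n ih =>
      intro hn
      have hn' : n < (f a).length := hn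
      rw [List.take_add_one, List.getElem?_eq_getElem hn']
      simp only [List.foldl_append, ← ih hn'.le]
      simp [List.getElem?_eq_getElem hn']
  rw [key _ le_rfl, List.take_length]
@[fun_prop] theorem map' {f : α → List β} {g : α → β → γ} (hf : Computable f)
    (hg : Computable fun p : α × β => g p.1 p.2) : Computable fun a => (f a).map (g a) := by
  have := foldl' (h := fun a (s : List γ) b => s ++ [g a b]) (g := fun _ => []) hf (by fun_prop)
    (by
      have h2 : Computable fun p : α × List γ × β => g p.1 p.2.2 :=
        hg.comp (by fun_prop : Computable fun p : α × List γ × β => (p.1, p.2.2))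
      fun_prop)
  refine this.of_eq fun a => ?_
  have key : ∀ (l : List β) (s : List γ), l.foldl (fun s b => s ++ [g a b]) s = s ++ l.map (g a) := by
    intro l
    induction l with
    | nil => simp
    | cons b l ih => intro s; simp [ih]
  simp [key]
@[fun_prop] theorem range' {f : α → ℕ} (hf : Computable f) :
    Computable fun a => List.range (f a) := Primrec.list_range.to_comp.comp hf
end CR

attribute [local irreducible] Computable

/-! ### r.e. predicates -/
section RE
variable {α β γ σ : Type*} [Primcodable α] [Primcodable β] [Primcodable γ] [Primcodable σ]

/-- Normal form for r.e. predicates, monotone in the stage. -/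
theorem re_normal {p : α → Prop} (hp : REPred p) :
    ∃ f : α × ℕ → Bool, Primrec f ∧ (∀ a s t, s ≤ t → f (a, s) = true → f (a, t) = true) ∧
      ∀ a, p a ↔ ∃ s, f (a, s) = true := by
  obtain ⟨c, hc⟩ := Nat.Partrec.Code.exists_code.1 hp
  refine ⟨fun x => (Nat.Partrec.Code.evaln x.2 c (Encodable.encode x.1)).isSome, by fun_prop, ?_, ?_⟩
  · intro a s t hst h
    rw [Option.isSome_iff_exists] at h ⊢
    obtain ⟨y, hy⟩ := h
    exact ⟨y, Nat.Partrec.Code.evaln_mono hst hy⟩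
  · intro a
    have h1 : (c.eval (Encodable.encode a)).Dom ↔ p a := by
      rw [hc]; simp [Part.assert]
    rw [← h1, Part.dom_iff_mem]
    constructor
    · rintro ⟨y, hy⟩
      obtain ⟨s, hs⟩ := Nat.Partrec.Code.evaln_complete.1 hy
      exact ⟨s, Option.isSome_iff_exists.2 ⟨y, hs⟩⟩
    · rintro ⟨s, hs⟩
      obtain ⟨y, hy⟩ := Option.isSome_iff_exists.1 hs
      exact ⟨y, Nat.Partrec.Code.evaln_sound hy⟩

theorem re_of_comp {f : α × ℕ → Bool} (hf : Computable f) {p : α → Prop}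
    (h : ∀ a, p a ↔ ∃ s, f (a, s) = true) : REPred p := by
  have h1 : Partrec fun a => Nat.rfind fun s => (f (a, s) : Part Bool) :=
    Partrec.rfind (p := fun a s => (f (a, s) : Part Bool)) (by exact hf.partrec)
  refine h1.dom_re.of_eq fun a => ?_
  rw [h]
  refine Nat.rfind_dom.trans ?_
  constructor
  · rintro ⟨n, hn, _⟩; exact ⟨n, (Part.mem_some_iff.1 hn).symm⟩
  · rintro ⟨n, hn⟩; exact ⟨n, Part.mem_some_iff.2 hn.symm, fun _ => trivial⟩

theorem re_dec {p : α → Prop} [DecidablePred p] (hf : Computable fun a => decide (p a)) :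
    REPred p :=
  re_of_comp (f := fun x => decide (p x.1)) (hf.comp Computable.fst) fun a => by simp

theorem re_bool {f : α → Bool} (hf : Computable f) : REPred fun a => f a = true :=
  re_dec (by fun_prop)

theorem REPred.comp' {p : β → Prop} (hp : REPred p) {f : α → β} (hf : Computable f) :
    REPred fun a => p (f a) := Partrec.comp hp hf

theorem REPred.ex {p : α × β → Prop} (hp : REPred p) : REPred fun a => ∃ b, p (a, b) := by
  obtain ⟨f, hf, _, h⟩ := re_normal hp
  refine re_of_comp (f := fun x : α × ℕ =>
    ((Encodable.decode x.2.unpair.1 : Option β).map fun b => f ((x.1, b), x.2.unpair.2)).getD false)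
    (Primrec.to_comp (by fun_prop)) fun a => ?_
  constructor
  · rintro ⟨b, hb⟩
    obtain ⟨s, hs⟩ := (h _).1 hb
    exact ⟨Nat.pair (Encodable.encode b) s, by simp [hs]⟩
  · rintro ⟨s, hs⟩
    cases hd : (Encodable.decode s.unpair.1 : Option β) with
    | none => simp [hd] at hs
    | some b => exact ⟨b, (h _).2 ⟨s.unpair.2, by simpa [hd] using hs⟩⟩

theorem REPred.and' {p q : α → Prop} (hp : REPred p) (hq : REPred q) :
    REPred fun a => p a ∧ q a := by
  obtain ⟨f, hf, _, h⟩ := re_normal hp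
  obtain ⟨f', hf', _, h'⟩ := re_normal hq
  refine re_of_comp (f := fun x : α × ℕ => f (x.1, x.2.unpair.1) && f' (x.1, x.2.unpair.2))
    (Primrec.to_comp (by fun_prop)) fun a => ?_
  rw [h, h']
  constructor
  · rintro ⟨⟨s, hs⟩, t, ht⟩; exact ⟨Nat.pair s t, by simp [hs, ht]⟩
  · rintro ⟨s, hs⟩
    simp only [Bool.and_eq_true] at hs
    exact ⟨⟨_, hs.1⟩, _, hs.2⟩

theorem REPred.or' {p q : α → Prop} (hp : REPred p) (hq : REPred q) :
    REPred fun a => p a ∨ q a := by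
  obtain ⟨f, hf, _, h⟩ := re_normal hp
  obtain ⟨f', hf', _, h'⟩ := re_normal hq
  refine re_of_comp (f := fun x : α × ℕ => f (x.1, x.2) || f' (x.1, x.2))
    (Primrec.to_comp (by fun_prop)) fun a => ?_
  rw [h, h']
  simp [exists_or]

/-- bounded universal quantification over a computable list -/
theorem REPred.allList {p : α × β → Prop} (hp : REPred p) {L : α → List β} (hL : Primrec L) :
    REPred fun a => ∀ b ∈ L a, p (a, b) := by
  obtain ⟨f, hf, hm, h⟩ := re_normal hp
  refine re_of_comp (f := fun x : α × ℕ => (L x.1).all fun b => f ((x.1, b), x.2))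
    (Primrec.to_comp (by fun_prop)) fun a => ?_
  simp only [List.all_eq_true]
  constructor
  · intro H
    have : ∀ l : List β, (∀ b ∈ l, p (a, b)) → ∃ s, ∀ b ∈ l, f ((a, b), s) = true := by
      intro l
      induction l with
      | nil => simp
      | cons b l ih =>
        intro hl
        obtain ⟨s, hs⟩ := ih fun b hb => hl b (List.mem_cons_of_mem _ hb)
        obtain ⟨t, ht⟩ := (h _).1 (hl b List.mem_cons_self)
        refine ⟨max s t, fun b' hb' => ?_⟩
        rcases List.mem_cons.1 hb' with rfl | hb'
        · exact hm _ _ _ (le_max_right _ _) ht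
        · exact hm _ _ _ (le_max_left _ _) (hs _ hb')
    exact this _ H
  · rintro ⟨s, hs⟩ b hb
    exact (h _).2 ⟨s, hs b hb⟩

theorem REPred.code {p : α → Prop} (hp : REPred p) : ∃ e, ∀ a, WEnum e (Encodable.encode a) ↔ p a := by
  obtain ⟨c, hc⟩ := Nat.Partrec.Code.exists_code.1 hp
  refine ⟨Encodable.encode c, fun a => ?_⟩
  unfold WEnum
  rw [Denumerable.ofNat_encode, hc]; simp [Part.assert]

theorem REPred.codeNat {p : ℕ → Prop} (hp : REPred p) : ∃ e, ∀ a, WEnum e a ↔ p a := hp.code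

/-- stage approximation to `WEnum` -/
def wen (e n s : ℕ) : Bool :=
  (Nat.Partrec.Code.evaln s (Denumerable.ofNat Nat.Partrec.Code e) n).isSome

theorem wen_prim : Primrec fun x : ℕ × ℕ × ℕ => wen x.1 x.2.1 x.2.2 := by
  unfold wen; fun_prop
@[fun_prop] theorem wen_prim' {f g h : α → ℕ} (hf : Primrec f) (hg : Primrec g) (hh : Primrec h) :
    Primrec fun a => wen (f a) (g a) (h a) := wen_prim.comp (hf.pair (hg.pair hh))

theorem wen_mono {e n s t : ℕ} (h : s ≤ t) (hs : wen e n s = true) : wen e n t = true := by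
  unfold wen at *
  rw [Option.isSome_iff_exists] at *
  obtain ⟨y, hy⟩ := hs
  exact ⟨y, Nat.Partrec.Code.evaln_mono h hy⟩

theorem wenum_iff {e n : ℕ} : WEnum e n ↔ ∃ s, wen e n s = true := by
  unfold WEnum wen
  rw [Part.dom_iff_mem]
  constructor
  · rintro ⟨y, hy⟩
    obtain ⟨s, hs⟩ := Nat.Partrec.Code.evaln_complete.1 hy
    exact ⟨s, Option.isSome_iff_exists.2 ⟨y, hs⟩⟩
  · rintro ⟨s, hs⟩
    obtain ⟨y, hy⟩ := Option.isSome_iff_exists.1 hs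
    exact ⟨y, Nat.Partrec.Code.evaln_sound hy⟩

theorem wenum_re : REPred fun x : ℕ × ℕ => WEnum x.1 x.2 :=
  re_of_comp (f := fun x => wen x.1.1 x.1.2 x.2) (Primrec.to_comp (by fun_prop)) fun _ => wenum_iff

end RE

open MeasureTheory ENNReal

/-! ### Strings and prefixes -/

@[simp] theorem strPrefix_length (X : ℕ → Bool) (n : ℕ) : (strPrefix X n).length = n := by
  simp [strPrefix]

theorem strPrefix_take (X : ℕ → Bool) (n m : ℕ) :
    (strPrefix X n).take m = strPrefix X (min m n) := by
  simp [strPrefix, ← List.map_take, List.take_range]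

theorem strPrefix_take_of_le (X : ℕ → Bool) {n m : ℕ} (h : m ≤ n) :
    (strPrefix X n).take m = strPrefix X m := by rw [strPrefix_take, min_eq_left h]

theorem strPrefix_mono_len (X : ℕ → Bool) {n m : ℕ} (h : m ≤ n) :
    strPrefix X m <+: strPrefix X n := by
  rw [← strPrefix_take_of_le X h]; exact List.take_prefix _ _

theorem strPrefix_getElem? (X : ℕ → Bool) {n i : ℕ} (h : i < n) :
    (strPrefix X n)[i]? = some (X i) := by simp [strPrefix, h]

theorem strPrefix_succ (X : ℕ → Bool) (n : ℕ) : strPrefix X (n + 1) = strPrefix X n ++ [X n] := by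
  simp [strPrefix, List.range_succ]

theorem strPrefix_congr {X Y : ℕ → Bool} {n : ℕ} (h : ∀ i < n, X i = Y i) :
    strPrefix X n = strPrefix Y n := by
  unfold strPrefix
  exact List.map_congr_left fun i hi => h i (List.mem_range.1 hi)

theorem strPrefix_eq_iff {X Y : ℕ → Bool} {n : ℕ} :
    strPrefix X n = strPrefix Y n ↔ ∀ i < n, X i = Y i := by
  refine ⟨fun h i hi => ?_, strPrefix_congr⟩
  have := strPrefix_getElem? X hi
  rw [h, strPrefix_getElem? Y hi] at this
  exact (Option.some.inj this).symm

theorem isPrefixOf_iff {σ : List Bool} {X : ℕ → Bool} :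
    IsPrefixOf σ X ↔ strPrefix X σ.length = σ := by
  unfold IsPrefixOf
  constructor
  · intro h
    apply List.ext_getElem (by simp)
    intro i h1 h2
    simp only [strPrefix, List.getElem_map, List.getElem_range]
    exact h ⟨i, h2⟩
  · intro h i
    have := strPrefix_getElem? X i.2
    rw [h] at this
    simp at this
    simp [this]

theorem isPrefixOf_strPrefix (X : ℕ → Bool) (n : ℕ) : IsPrefixOf (strPrefix X n) X := by
  rw [isPrefixOf_iff]; simp

theorem isPrefixOf_iff_exists {σ : List Bool} {X : ℕ → Bool} :
    IsPrefixOf σ X ↔ ∃ n, σ = strPrefix X n :=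
  ⟨fun h => ⟨_, (isPrefixOf_iff.1 h).symm⟩, fun ⟨n, h⟩ => h ▸ isPrefixOf_strPrefix X n⟩

theorem mem_cylinder_iff {σ : List Bool} {X : ℕ → Bool} :
    X ∈ cylinder σ ↔ strPrefix X σ.length = σ := isPrefixOf_iff

theorem prefix_strPrefix_iff {σ : List Bool} {X : ℕ → Bool} {n : ℕ} (h : σ.length ≤ n) :
    σ <+: strPrefix X n ↔ X ∈ cylinder σ := by
  rw [mem_cylinder_iff, List.prefix_iff_eq_take, strPrefix_take_of_le X h]
  exact eq_comm

theorem prefix_strPrefix {σ : List Bool} {X : ℕ → Bool} {n : ℕ} (h : σ <+: strPrefix X n) :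
    σ = strPrefix X σ.length := by
  have := h.length_le
  rw [strPrefix_length] at this
  exact (mem_cylinder_iff.1 ((prefix_strPrefix_iff this).1 h)).symm

theorem mem_openOf {S : Set (List Bool)} {X : ℕ → Bool} :
    X ∈ openOf S ↔ ∃ n, strPrefix X n ∈ S := by
  unfold openOf
  simp only [Set.mem_iUnion, exists_prop]
  constructor
  · rintro ⟨σ, hσ, hX⟩
    exact ⟨σ.length, by rwa [mem_cylinder_iff.1 hX]⟩
  · rintro ⟨n, hn⟩
    exact ⟨_, hn, isPrefixOf_strPrefix X n⟩

/-! ### Oracle computations -/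

/-- stage approximation of oracle computations; the stage is the length of the oracle string -/
def oc (e : ℕ) (σ : List Bool) (n m : ℕ) : Bool :=
  (List.range (σ.length + 1)).any fun k =>
    wen e (Nat.pair (Encodable.encode (σ.take k)) (Nat.pair n m)) σ.length

theorem oc_prim : Primrec fun x : ℕ × List Bool × ℕ × ℕ => oc x.1 x.2.1 x.2.2.1 x.2.2.2 := by
  unfold oc; fun_prop
@[fun_prop] theorem oc_prim' {α : Type*} [Primcodable α] {e n m : α → ℕ} {σ : α → List Bool}
    (he : Primrec e) (hσ : Primrec σ) (hn : Primrec n) (hm : Primrec m) :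
    Primrec fun a => oc (e a) (σ a) (n a) (m a) :=
  oc_prim.comp (he.pair (hσ.pair (hn.pair hm)))

theorem oc_mono {e : ℕ} {σ τ : List Bool} {n m : ℕ} (h : σ <+: τ) (hs : oc e σ n m = true) :
    oc e τ n m = true := by
  unfold oc at *
  simp only [List.any_eq_true, List.mem_range] at *
  obtain ⟨k, hk, hw⟩ := hs
  refine ⟨k, by have := h.length_le; omega, ?_⟩
  obtain ⟨ρ, rfl⟩ := h
  rw [List.take_append_of_le_length (by omega)]
  exact wen_mono (by simp) hw

theorem oracleComputes_iff {e : ℕ} {X : ℕ → Bool} {n m : ℕ} :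
    OracleComputes e X n m ↔ ∃ ℓ, oc e (strPrefix X ℓ) n m = true := by
  unfold OracleComputes oc
  simp only [List.any_eq_true, List.mem_range, strPrefix_length]
  constructor
  · rintro ⟨σ, hσ, hw⟩
    obtain ⟨s, hs⟩ := wenum_iff.1 hw
    refine ⟨max s σ.length, σ.length, by omega, ?_⟩
    rw [strPrefix_take_of_le X (le_max_right _ _), isPrefixOf_iff.1 hσ]
    exact wen_mono (le_max_left _ _) hs
  · rintro ⟨ℓ, k, hk, hw⟩
    refine ⟨_, ?_, wenum_iff.2 ⟨_, hw⟩⟩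
    rw [strPrefix_take]
    exact isPrefixOf_strPrefix _ _

theorem turingLE_of {D X : ℕ → Bool} {p : List Bool × ℕ × Bool → Prop} (hp : REPred p)
    (h1 : ∀ n, ∃ ℓ, p (strPrefix X ℓ, n, D n))
    (h2 : ∀ n b ℓ, p (strPrefix X ℓ, n, b) → b = D n) : TuringLE D X := by
  have hq : REPred fun x : ℕ => ∃ b : Bool,
      p ((Encodable.decode x.unpair.1).getD [], x.unpair.2.unpair.1, b) ∧
        x.unpair.2.unpair.2 = natOfBool b := by
    refine REPred.ex (p := fun y : ℕ × Bool =>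
      p ((Encodable.decode y.1.unpair.1).getD [], y.1.unpair.2.unpair.1, y.2) ∧
        y.1.unpair.2.unpair.2 = natOfBool y.2) ?_
    refine REPred.and' (REPred.comp' hp (Primrec.to_comp ?_)) (re_dec (Primrec.to_comp ?_))
    · fun_prop
    · have : Primrec natOfBool := Primrec.dom_bool _
      fun_prop
  obtain ⟨e, he⟩ := hq.codeNat
  refine ⟨e, fun n m => ?_⟩
  unfold OracleComputes
  simp only [he, Nat.unpair_pair, Encodable.encodek, Option.getD_some]
  constructor
  · rintro ⟨σ, hσ, b, hb, rfl⟩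
    obtain ⟨ℓ, rfl⟩ := isPrefixOf_iff_exists.1 hσ
    rw [h2 _ _ _ hb]
  · rintro rfl
    obtain ⟨ℓ, hℓ⟩ := h1 n
    exact ⟨_, isPrefixOf_strPrefix X ℓ, _, hℓ, rfl⟩

theorem natOfBool_inj {a b : Bool} (h : natOfBool a = natOfBool b) : a = b := by
  cases a <;> cases b <;> simp_all [natOfBool]

/-- Elimination of Turing reducibility: monotone primitive recursive approximation. -/
theorem TuringLE.elim {D X : ℕ → Bool} (h : TuringLE D X) :
    ∃ e, (∀ n, ∃ ℓ, oc e (strPrefix X ℓ) n (natOfBool (D n)) = true) ∧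
      ∀ n m ℓ, oc e (strPrefix X ℓ) n m = true → m = natOfBool (D n) := by
  obtain ⟨e, he⟩ := h
  refine ⟨e, fun n => ?_, fun n m ℓ h => ?_⟩
  · exact oracleComputes_iff.1 ((he n _).2 rfl)
  · exact (he n m).1 (oracleComputes_iff.2 ⟨ℓ, h⟩)

theorem strPrefix_empty (n : ℕ) : strPrefix emptyOracle n = List.replicate n false := by
  apply List.ext_getElem (by simp)
  intro i h1 h2
  simp [strPrefix, emptyOracle]

theorem oracle_empty_re : REPred fun x : ℕ × ℕ => ∃ m, OracleComputes x.1 emptyOracle x.2 m := by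
  refine REPred.of_eq (p := fun x : ℕ × ℕ => ∃ y : ℕ × ℕ,
    oc x.1 (List.replicate y.1 false) x.2 y.2 = true) ?_ fun x => ?_
  · exact REPred.ex (p := fun z : (ℕ × ℕ) × (ℕ × ℕ) =>
      oc z.1.1 (List.replicate z.2.1 false) z.1.2 z.2.2 = true)
      (re_bool (Primrec.to_comp (by fun_prop)))
  · simp only [oracleComputes_iff, strPrefix_empty, Prod.exists]
    exact exists_comm

theorem computable_of_computableSet {D : ℕ → Bool} (h : ComputableSet D) : Computable D := by
  obtain ⟨e, h1, h2⟩ := TuringLE.elim h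
  have hp : Computable fun x : ℕ × ℕ =>
      (oc e (List.replicate x.2 false) x.1 1 || oc e (List.replicate x.2 false) x.1 0) :=
    Primrec.to_comp (by fun_prop)
  have h3 : Partrec fun n => (Nat.rfind fun s =>
      ((oc e (List.replicate s false) n 1 || oc e (List.replicate s false) n 0 : Bool) : Part Bool)).map
        fun s => oc e (List.replicate s false) n 1 := by
    refine Partrec.map (Partrec.rfind (p := fun n s =>
      ((oc e (List.replicate s false) n 1 || oc e (List.replicate s false) n 0 : Bool) : Part Bool)) (by exact hp.partrec)) ?_
    exact Primrec.to_comp (by fun_prop)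
  refine Partrec.of_eq_tot h3 fun n => ?_
  rw [Part.mem_map_iff]
  have hd : (Nat.rfind fun s =>
      ((oc e (List.replicate s false) n 1 || oc e (List.replicate s false) n 0 : Bool) : Part Bool)).Dom := by
    refine Nat.rfind_dom.2 ?_
    obtain ⟨ℓ, hℓ⟩ := h1 n
    rw [strPrefix_empty] at hℓ
    refine ⟨ℓ, Part.mem_some_iff.2 ?_, fun _ => trivial⟩
    cases hD : D n <;> simp [hD, natOfBool] at hℓ <;> simp [hℓ]
  obtain ⟨s, hs⟩ := Part.dom_iff_mem.1 hd
  refine ⟨s, hs, ?_⟩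
  have hs' := Part.mem_some_iff.1 (Nat.mem_rfind.1 hs).1
  have k1 := h2 n 1 s
  have k0 := h2 n 0 s
  rw [strPrefix_empty] at k1 k0
  cases hD : D n
  · cases ho : oc e (List.replicate s false) n 1
    · rfl
    · have := k1 ho; simp [hD, natOfBool] at this
  · cases ho : oc e (List.replicate s false) n 1
    · simp [ho] at hs'
      have := k0 hs'; simp [hD, natOfBool] at this
    · rfl

theorem computableSet_of_computable {D : ℕ → Bool} (h : Computable D) : ComputableSet D := by
  refine turingLE_of (p := fun x => x.2.2 = D x.2.1) (re_dec (by fun_prop)) (fun n => ⟨0, rfl⟩) ?_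
  intro n b ℓ h; exact h

/-- If the graph of `D` is r.e. then `D` is computable. -/
theorem computableSet_of_graph {D : ℕ → Bool} (h : REPred fun x : ℕ × Bool => x.2 = D x.1) :
    ComputableSet D :=
  turingLE_of (p := fun x => x.2.2 = D x.2.1)
    (REPred.comp' h (f := fun x : List Bool × ℕ × Bool => x.2) (by fun_prop))
    (fun n => ⟨0, rfl⟩) fun n b ℓ h => h

/-! ### The halting problem -/

theorem zeroJump_iff (e : ℕ) : zeroJump e = true ↔ ∃ m, OracleComputes e emptyOracle e m := by
  simp [zeroJump, jump]

theorem zeroJump_re : REPred fun e => zeroJump e = true :=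
  REPred.of_eq (oracle_empty_re.comp' (f := fun e : ℕ => (e, e)) (by fun_prop))
    fun e => (zeroJump_iff e).symm

theorem zeroJump_complete {α : Type*} [Primcodable α] {p : α → Prop} (hp : REPred p) :
    ∃ h : α → ℕ, Computable h ∧ ∀ a, zeroJump (h a) = true ↔ p a := by
  obtain ⟨e, he⟩ := hp.code
  obtain ⟨c, hc⟩ : ∃ c : Nat.Partrec.Code, ∀ x, (c.eval x).Dom ↔ WEnum e x.unpair.1 := by
    have h1 : REPred fun x : ℕ => WEnum e x.unpair.1 :=
      wenum_re.comp' (f := fun x : ℕ => (e, x.unpair.1)) (by fun_prop)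
    obtain ⟨e', he'⟩ := h1.codeNat
    exact ⟨Denumerable.ofNat _ e', he'⟩
  refine ⟨fun a => Encodable.encode (Nat.Partrec.Code.curry c (Encodable.encode a)), ?_, fun a => ?_⟩
  · have := Nat.Partrec.Code.primrec₂_curry
    have h2 : Primrec fun a : α => Nat.Partrec.Code.curry c (Encodable.encode a) :=
      this.comp (Primrec.const c) Primrec.encode
    exact (Primrec.encode.comp h2).to_comp
  · rw [zeroJump_iff, ← he]
    unfold OracleComputes WEnum
    simp only [Denumerable.ofNat_encode, Nat.Partrec.Code.eval_curry, hc, Nat.unpair_pair]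
    constructor
    · rintro ⟨m, σ, _, h⟩; exact h
    · intro h; exact ⟨0, [], isPrefixOf_strPrefix emptyOracle 0, h⟩

theorem zeroJump_not_computable : ¬ ComputableSet zeroJump := by
  intro h
  have hz := computable_of_computableSet h
  obtain ⟨f, hf, hp⟩ := zeroJump_complete (ComputablePred.halting_problem_re 0)
  apply ComputablePred.halting_problem 0
  classical
  have : Computable fun c => decide ((Nat.Partrec.Code.eval c 0).Dom) :=
    (hz.comp hf).of_eq fun c => by rw [Bool.eq_iff_iff]; simp [hp]
  exact this.computablePred

/-- limit lemma -/
theorem limit_lemma {B X : ℕ → Bool} {f : ℕ × ℕ → Bool} (hf : Computable f)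
    (hlim : ∀ n, ∃ s, ∀ t ≥ s, f (n, t) = B n) (hX : TuringLE zeroJump X) : TuringLE B X := by
  have hre : REPred fun x : ℕ × ℕ => ∃ t, x.2 ≤ t ∧ ¬ (f (x.1, t) = f x) := by
    refine REPred.ex (p := fun y : (ℕ × ℕ) × ℕ => y.1.2 ≤ y.2 ∧ ¬ (f (y.1.1, y.2) = f y.1)) ?_
    exact re_dec (by fun_prop)
  obtain ⟨h, hh, hz⟩ := zeroJump_complete hre
  obtain ⟨e, h1, h2⟩ := hX.elim
  refine turingLE_of (p := fun x => ∃ s, oc e x.1 (h (x.2.1, s)) 0 = true ∧ x.2.2 = f (x.2.1, s))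
    ?_ ?_ ?_
  · refine REPred.ex (p := fun y : (List Bool × ℕ × Bool) × ℕ =>
      oc e y.1.1 (h (y.1.2.1, y.2)) 0 = true ∧ y.1.2.2 = f (y.1.2.1, y.2)) ?_
    refine REPred.and' (re_bool ?_) (re_dec (by fun_prop))
    exact oc_prim.to_comp.comp (by fun_prop : Computable fun y : (List Bool × ℕ × Bool) × ℕ =>
      (e, y.1.1, h (y.1.2.1, y.2), 0))
  · intro n
    obtain ⟨s, hs⟩ := hlim n
    obtain ⟨ℓ, hℓ⟩ := h1 (h (n, s))
    have hzz : zeroJump (h (n, s)) = false := by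
      rw [← Bool.not_eq_true, hz]
      rintro ⟨t, ht, hne⟩
      exact hne (by rw [hs t ht, hs s le_rfl])
    rw [hzz] at hℓ
    exact ⟨ℓ, s, hℓ, (hs s le_rfl).symm⟩
  · rintro n b ℓ ⟨s, hs, hb⟩
    change b = f (n, s) at hb
    subst hb
    have h3 := h2 _ _ _ hs
    have hzz : zeroJump (h (n, s)) = false := by
      cases hc : zeroJump (h (n, s))
      · rfl
      · simp [hc, natOfBool] at h3
    obtain ⟨t, ht⟩ := hlim n
    by_contra hne
    rw [← Bool.not_eq_true, hz] at hzz
    exact hzz ⟨max s t, le_max_left _ _, by rw [ht _ (le_max_right _ _)]; exact fun h => hne h.symm⟩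

/-! ### Martin-Löf tests -/

theorem ceStr_of_re {S : Set (List Bool)} (h : REPred fun σ => σ ∈ S) : CeStr S := by
  obtain ⟨e, he⟩ := (REPred.comp' (α := ℕ) (f := fun x : ℕ =>
    (Encodable.decode x.unpair.2.unpair.1 : Option (List Bool)).getD []) h
    (Primrec.to_comp (by fun_prop))).codeNat
  refine ⟨e, fun σ => ?_⟩
  unfold OracleComputes
  simp only [he, Nat.unpair_pair, Encodable.encodek, Option.getD_some]
  exact ⟨fun h => ⟨0, [], isPrefixOf_strPrefix _ 0, h⟩, fun ⟨_, _, _, h⟩ => h⟩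

/-- A random sequence passes tests given by r.e. predicates. -/
theorem MLRandom.passes {R : ℕ → Bool} (hR : MLRandom R) {p : ℕ × List Bool → Prop}
    (hp : REPred p) (hμ : ∀ n, μCantor (openOf {σ | p (n, σ)}) ≤ 2⁻¹ ^ n) :
    ∃ n, ∀ ℓ, ¬ p (n, strPrefix R ℓ) := by
  obtain ⟨e, he⟩ := (REPred.comp' (α := ℕ) (f := fun x : ℕ =>
    (x.unpair.2.unpair.1.unpair.1,
      (Encodable.decode x.unpair.2.unpair.1.unpair.2 : Option (List Bool)).getD [])) hp
    (Primrec.to_comp (by fun_prop))).codeNat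
  have hT : ∀ n, openOf {σ | p (n, σ)} = testLevel e emptyOracle n := by
    intro n
    unfold testLevel OracleComputes
    simp only [he, Nat.unpair_pair, Encodable.encodek, Option.getD_some]
    congr 1
    ext σ
    exact ⟨fun h => ⟨0, [], isPrefixOf_strPrefix _ 0, h⟩, fun ⟨_, _, _, h⟩ => h⟩
  obtain ⟨n, hn⟩ := hR (fun n => openOf {σ | p (n, σ)}) ⟨⟨e, hT⟩, hμ⟩
  refine ⟨n, fun ℓ hℓ => hn ?_⟩
  rw [mem_openOf]; exact ⟨ℓ, hℓ⟩

theorem testLevel_re (e : ℕ) : REPred fun x : ℕ × List Bool =>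
    ∃ m, OracleComputes e emptyOracle (Nat.pair x.1 (Encodable.encode x.2)) m :=
  oracle_empty_re.comp' (f := fun x : ℕ × List Bool => (e, Nat.pair x.1 (Encodable.encode x.2)))
    (Primrec.to_comp (by fun_prop))

open MeasureTheory ENNReal

/-! ### measure -/

theorem floor_double (y : ℝ) : ⌊y * 2⌋ / 2 = ⌊y⌋ := by
  have h1 := Int.floor_le (y*2)
  have h2 := Int.lt_floor_add_one (y*2)
  symm
  rw [Int.floor_eq_iff]
  have h3 : ⌊y*2⌋ = 2 * (⌊y*2⌋/2) + ⌊y*2⌋ % 2 := by omega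
  have h4 : (⌊y*2⌋ : ℝ) = 2 * ((⌊y*2⌋/2 : ℤ) : ℝ) + ((⌊y*2⌋ % 2 : ℤ) : ℝ) := by exact_mod_cast h3
  have h5 : (0:ℝ) ≤ ((⌊y*2⌋ % 2 : ℤ) : ℝ) := by exact_mod_cast (by omega)
  have h6 : ((⌊y*2⌋ % 2 : ℤ) : ℝ) ≤ 1 := by exact_mod_cast (by omega)
  constructor <;> linarith

/-- numerical value of a string -/
def sval (σ : List Bool) : ℕ := σ.foldl (fun v b => 2 * v + cond b 1 0) 0

theorem sval_append (σ : List Bool) (b : Bool) : sval (σ ++ [b]) = 2 * sval σ + cond b 1 0 := by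
  simp [sval]

theorem sval_lt (σ : List Bool) : sval σ < 2 ^ σ.length := by
  induction σ using List.reverseRecOn with
  | nil => simp [sval]
  | append_singleton σ b ih =>
    rw [sval_append]; simp only [List.length_append, List.length_singleton, pow_succ]
    cases b <;> simp <;> omega

theorem strPrefix_binaryDigits {x : ℝ} (hx : x ∈ Set.Ico (0:ℝ) 1) (σ : List Bool) :
    strPrefix (binaryDigits x) σ.length = σ ↔ ⌊x * 2 ^ σ.length⌋ = (sval σ : ℤ) := by
  induction σ using List.reverseRecOn with
  | nil =>
    simp only [List.length_nil, pow_zero, mul_one, sval, List.foldl_nil, strPrefix]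
    simp [Int.floor_eq_iff, hx.1, hx.2]
  | append_singleton σ b ih =>
    have hl : (σ ++ [b]).length = σ.length + 1 := by simp
    rw [hl, strPrefix_succ, sval_append]
    have : strPrefix (binaryDigits x) σ.length ++ [binaryDigits x σ.length] = σ ++ [b] ↔
      strPrefix (binaryDigits x) σ.length = σ ∧ binaryDigits x σ.length = b := by
      constructor
      · intro h; exact ⟨List.append_inj_left' h rfl, by simpa using List.append_inj_right' h rfl⟩
      · rintro ⟨h1, h2⟩; rw [h1, h2]
    rw [this, ih]
    have h2 := floor_double (x * 2 ^ σ.length)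
    rw [show x * 2 ^ σ.length * 2 = x * 2 ^ (σ.length + 1) by ring] at h2
    unfold binaryDigits
    cases b <;> simp <;> omega

theorem binaryDigits_measurable : Measurable binaryDigits := by
  rw [measurable_pi_iff]
  intro n
  have : (fun x => binaryDigits x n) = (fun k : ℤ => decide (k % 2 = 1)) ∘ (fun x : ℝ => ⌊x * 2^(n+1)⌋) := rfl
  rw [this]
  exact (measurable_of_countable _).comp (Int.measurable_floor.comp (by fun_prop))

instance : IsProbabilityMeasure μCantor := by
  constructor
  rw [μCantor, Measure.map_apply binaryDigits_measurable MeasurableSet.univ]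
  simp

/-- real-valued measure -/
noncomputable abbrev mu (S : Set (ℕ → Bool)) : ℝ := μCantor.real S

theorem determined_measurable (N : ℕ) (Q : Set (List Bool)) :
    MeasurableSet {X : ℕ → Bool | strPrefix X N ∈ Q} := by
  let m : MeasurableSpace (List Bool) := ⊤
  have : Measurable fun X : ℕ → Bool => strPrefix X N := by
    induction N with
    | zero => simp [strPrefix]
    | succ n ih =>
      simp only [strPrefix_succ]
      have h2 : Measurable fun X : ℕ → Bool => X n := measurable_pi_apply n
      have h3 : Measurable (fun p : List Bool × Bool => p.1 ++ [p.2]) := by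
        refine measurable_from_prod_countable_left fun y => ?_
        exact measurable_from_top
      exact h3.comp (ih.prodMk h2)
  exact this trivial

theorem cylinder_eq (σ : List Bool) : cylinder σ = {X | strPrefix X σ.length = σ} := by
  ext X; rw [mem_cylinder_iff]; rfl

theorem cylinder_measurable (σ : List Bool) : MeasurableSet (cylinder σ) := by
  rw [cylinder_eq]; exact determined_measurable σ.length {σ}

theorem openOf_measurable (S : Set (List Bool)) : MeasurableSet (openOf S) :=
  MeasurableSet.biUnion (Set.to_countable _) fun σ _ => cylinder_measurable σ

theorem mu_cylinder (σ : List Bool) : mu (cylinder σ) = (1/2)^σ.length := by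
  have hp : (0:ℝ) < 2 ^ σ.length := by positivity
  have h1 : binaryDigits ⁻¹' (cylinder σ) ∩ Set.Ico 0 1 =
      Set.Ico ((sval σ : ℝ) / 2^σ.length) ((sval σ + 1 : ℝ)/2^σ.length) := by
    have hv : ((sval σ : ℝ) + 1) ≤ 2^σ.length := by exact_mod_cast sval_lt σ
    have key : ∀ x : ℝ, ⌊x * 2 ^ σ.length⌋ = (sval σ : ℤ) ↔
        x ∈ Set.Ico ((sval σ : ℝ) / 2^σ.length) ((sval σ + 1 : ℝ)/2^σ.length) := by
      intro x
      rw [Int.floor_eq_iff, Set.mem_Ico, div_le_iff₀ hp, lt_div_iff₀ hp]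
      simp
    ext x
    constructor
    · rintro ⟨hx, hx1⟩
      rw [Set.mem_preimage, cylinder_eq, Set.mem_ofPred_eq, strPrefix_binaryDigits hx1] at hx
      exact (key x).1 hx
    · intro hx
      have hx1 : x ∈ Set.Ico (0:ℝ) 1 := by
        refine ⟨le_trans (by positivity) hx.1, lt_of_lt_of_le hx.2 ?_⟩
        rw [div_le_one hp]; exact hv
      refine ⟨?_, hx1⟩
      rw [Set.mem_preimage, cylinder_eq, Set.mem_ofPred_eq, strPrefix_binaryDigits hx1]
      exact (key x).2 hx
  rw [mu, measureReal_def, μCantor, Measure.map_apply binaryDigits_measurable (cylinder_measurable σ),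
    Measure.restrict_apply (binaryDigits_measurable (cylinder_measurable σ)), h1, Real.volume_Ico]
  rw [ENNReal.toReal_ofReal]
  · rw [one_div_pow]; ring
  · rw [← sub_div]; simp

/-- all strings of length `N` -/
def strL (N : ℕ) : List (List Bool) :=
  Nat.rec [[]] (fun _ L => L.flatMap fun τ => [τ ++ [false], τ ++ [true]]) N

@[fun_prop] theorem strL_prim {α : Type*} [Primcodable α] {f : α → ℕ} (hf : Primrec f) :
    Primrec fun a => strL (f a) := by
  unfold strL; fun_prop

theorem strL_succ (N : ℕ) : strL (N+1) = (strL N).flatMap fun τ => [τ ++ [false], τ ++ [true]] := rfl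

@[simp] theorem mem_strL {N : ℕ} {σ : List Bool} : σ ∈ strL N ↔ σ.length = N := by
  induction N generalizing σ with
  | zero => simp [strL]
  | succ n ih =>
    simp only [strL_succ, List.mem_flatMap, ih]
    constructor
    · rintro ⟨τ, h, h'⟩; simp at h'; rcases h' with rfl | rfl <;> simp [h]
    · intro h
      induction σ using List.reverseRecOn with
      | nil => simp at h
      | append_singleton σ b _ =>
        refine ⟨σ, by simpa using h, ?_⟩
        cases b <;> simp

theorem strL_nodup (N : ℕ) : (strL N).Nodup := by
  induction N with
  | zero => simp [strL]
  | succ n ih =>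
    rw [strL_succ, List.nodup_flatMap]
    refine ⟨fun x _ => by simp, ih.imp ?_⟩
    intro a b hab
    simp only [Function.onFun, List.disjoint_left]
    intro x hx hx'
    simp at hx hx'
    apply hab
    rcases hx with rfl | rfl <;> rcases hx' with h | h <;> simp_all

theorem strL_length (N : ℕ) : (strL N).length = 2^N := by
  induction N with
  | zero => simp [strL]
  | succ n ih =>
    rw [strL_succ]; simp [List.length_flatMap, ih, pow_succ]

/-- number of strings of length `N` satisfying `q` -/
def cnt (N : ℕ) (q : List Bool → Bool) : ℕ := ((strL N).filter q).length

@[fun_prop] theorem cnt_prim {α : Type*} [Primcodable α] {f : α → ℕ} {q : α → List Bool → Bool}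
    (hf : Primrec f) (hq : Primrec fun p : α × List Bool => q p.1 p.2) :
    Primrec fun a => cnt (f a) (q a) := by
  unfold cnt; fun_prop

theorem cnt_mono {N : ℕ} {q q' : List Bool → Bool} (h : ∀ τ, τ.length = N → q τ = true → q' τ = true) :
    cnt N q ≤ cnt N q' := by
  unfold cnt
  rw [← List.countP_eq_length_filter, ← List.countP_eq_length_filter]
  exact List.countP_mono_left fun τ hτ => h τ (by simpa using hτ)

theorem mu_decomp (N : ℕ) (Q : List Bool → Bool) {S : Set (ℕ → Bool)} :
    mu ({X | Q (strPrefix X N) = true} ∩ S) =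
      ∑ τ ∈ ((strL N).filter Q).toFinset, mu (cylinder τ ∩ S) := by
  have : {X | Q (strPrefix X N) = true} ∩ S =
      ⋃ τ ∈ ((strL N).filter Q).toFinset, (cylinder τ ∩ S) := by
    ext X; simp only [Set.mem_iUnion, Set.mem_inter_iff, Set.mem_ofPred_eq, List.mem_toFinset, List.mem_filter, mem_strL,
      mem_cylinder_iff]
    constructor
    · rintro ⟨h, h'⟩; exact ⟨_, ⟨strPrefix_length X N, h⟩, by simp, h'⟩
    · rintro ⟨τ, ⟨h1, h2⟩, h3, h4⟩
      rw [h1] at h3; rw [h3]; exact ⟨h2, h4⟩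
  rw [this]
  have hd : (((strL N).filter Q).toFinset : Set (List Bool)).PairwiseDisjoint (fun τ => cylinder τ) := by
    intro τ hτ τ' hτ' hne
    simp at hτ hτ'
    rw [Function.onFun, Set.disjoint_left]
    intro X h1 h2
    rw [mem_cylinder_iff] at h1 h2
    rw [hτ.1] at h1; rw [hτ'.1] at h2
    exact hne (h1.symm.trans h2)
  have hS : ∀ T : Finset (List Bool), (T : Set (List Bool)).PairwiseDisjoint (fun τ => cylinder τ) →
     mu (⋃ τ ∈ T, (cylinder τ ∩ S)) = ∑ τ ∈ T, mu (cylinder τ ∩ S) := by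
    intro T hT
    induction T using Finset.induction_on with
    | empty => simp [mu]
    | insert a T ha ih =>
      rw [Finset.sum_insert ha, Finset.set_biUnion_insert, ← ih (hT.subset (by simp))]
      set V := ⋃ τ ∈ T, (cylinder τ ∩ S)
      have h := measureReal_inter_add_sdiff (μ := μCantor) (s := (cylinder a ∩ S) ∪ V) (t := cylinder a)
        (cylinder_measurable a)
      have hV : V ∩ cylinder a = ∅ := by
        rw [Set.eq_empty_iff_forall_notMem]
        rintro X ⟨h1, h2⟩
        simp only [V, Set.mem_iUnion] at h1
        obtain ⟨τ, hτ, h1, -⟩ := h1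
        have := hT (by simp) (show τ ∈ ((insert a T : Finset _) : Set _) by simp [hτ]) (show a ≠ τ by rintro rfl; exact ha hτ)
        exact Set.disjoint_left.1 this h2 h1
      have e1 : ((cylinder a ∩ S) ∪ V) ∩ cylinder a = cylinder a ∩ S := by
        rw [Set.union_inter_distrib_right, hV]; ext; simp; tauto
      have e2 : ((cylinder a ∩ S) ∪ V) \ cylinder a = V := by
        ext X
        have : X ∈ V → X ∉ cylinder a := fun h h' => by
          have : X ∈ V ∩ cylinder a := ⟨h, h'⟩
          rw [hV] at this; exact this
        simp; tauto
      rw [e1, e2] at h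
      exact h.symm
  exact hS _ hd

theorem toFinset_card_strL (N : ℕ) (Q : List Bool → Bool) :
    ((strL N).filter Q).toFinset.card = cnt N Q :=
  List.toFinset_card_of_nodup ((strL_nodup N).filter _)

theorem mu_cnt (N : ℕ) (Q : List Bool → Bool) : mu {X | Q (strPrefix X N) = true} = cnt N Q / 2 ^ N := by
  have := mu_decomp N Q (S := Set.univ)
  simp only [Set.inter_univ] at this
  rw [this, ← toFinset_card_strL]
  rw [Finset.sum_congr rfl (g := fun _ => (1/2:ℝ)^N)]
  · simp [div_eq_mul_inv]
  · intro τ hτ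
    simp at hτ
    rw [mu_cylinder, hτ.1]

theorem mu_split (N : ℕ) (S : Set (ℕ → Bool)) : mu S = ∑ τ ∈ (strL N).toFinset, mu (cylinder τ ∩ S) := by
  have := mu_decomp N (fun _ => true) (S := S)
  simpa using this

theorem cylinder_subset {σ τ : List Bool} (h : σ <+: τ) : cylinder τ ⊆ cylinder σ := by
  intro X hX
  change IsPrefixOf _ _ at hX; change IsPrefixOf _ _
  rw [isPrefixOf_iff_exists] at hX ⊢
  obtain ⟨n, hn⟩ := hX
  subst hn
  have := prefix_strPrefix h
  exact ⟨_, this⟩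

theorem mu_union_gt {q : ℕ → List Bool → Bool}
    (hq : ∀ N (X : ℕ → Bool), q N (strPrefix X N) = true → q (N+1) (strPrefix X (N+1)) = true) (c : ℝ) :
    c < mu {X | ∃ N, q N (strPrefix X N) = true} ↔ ∃ N, c * 2^N < cnt N (q N) := by
  have e : {X | ∃ N, q N (strPrefix X N) = true} = ⋃ N, {X | q N (strPrefix X N) = true} := by
    ext; simp
  have hm : Monotone fun N => {X : ℕ → Bool | q N (strPrefix X N) = true} :=
    monotone_nat_of_le_succ fun N X h => hq N X h
  have ht : Filter.Tendsto (fun N => mu {X : ℕ → Bool | q N (strPrefix X N) = true}) Filter.atTop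
      (nhds (mu {X | ∃ N, q N (strPrefix X N) = true})) := by
    rw [e]
    exact (ENNReal.tendsto_toReal (measure_ne_top _ _)).comp (tendsto_measure_iUnion_atTop hm)
  constructor
  · intro h
    obtain ⟨N, hN⟩ := (ht.eventually (lt_mem_nhds h)).exists
    refine ⟨N, ?_⟩
    rw [mu_cnt, lt_div_iff₀ (by positivity)] at hN
    exact hN
  · rintro ⟨N, hN⟩
    rw [← lt_div_iff₀ (by positivity), ← mu_cnt] at hN
    exact hN.trans_le (measureReal_mono (fun X hX => ⟨N, hX⟩))

theorem mu_half (N : ℕ) (Q : List Bool → Bool) (b : Bool) :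
    mu {X | Q (strPrefix X N) = true ∧ X N = b} = mu {X | Q (strPrefix X N) = true} / 2 := by
  have h1 : {X | Q (strPrefix X N) = true ∧ X N = b} = {X | Q (strPrefix X N) = true} ∩ {X | X N = b} := rfl
  rw [h1, mu_decomp, mu_cnt, ← toFinset_card_strL]
  rw [Finset.sum_congr rfl (g := fun _ => (1/2:ℝ)^(N+1))]
  · simp [div_eq_mul_inv, pow_succ]; ring
  · intro τ hτ
    simp at hτ
    have : cylinder τ ∩ {X | X N = b} = cylinder (τ ++ [b]) := by
      ext X
      simp only [Set.mem_inter_iff, mem_cylinder_iff, Set.mem_ofPred_eq, List.length_append, List.length_singleton]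
      rw [strPrefix_succ, hτ.1]
      constructor
      · rintro ⟨h1, h2⟩; rw [h1, h2]
      · intro h; exact ⟨List.append_inj_left' h rfl, by simpa using List.append_inj_right' h rfl⟩
    rw [this, mu_cylinder]; simp [hτ.1]

/-- subcube -/
def subC (F : Finset ℕ) (v : ℕ → Bool) : Set (ℕ → Bool) := {X | ∀ i ∈ F, X i = v i}

theorem subC_determined {F : Finset ℕ} {v : ℕ → Bool} {N : ℕ} (h : ∀ i ∈ F, i < N) :
    subC F v = {X | decide (∀ i ∈ F, (strPrefix X N)[i]? = some (v i)) = true} := by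
  ext X; simp only [subC, Set.mem_ofPred_eq, decide_eq_true_eq]
  refine forall₂_congr fun i hi => ?_
  rw [strPrefix_getElem? X (h i hi)]; simp

theorem subC_measurable (F : Finset ℕ) (v : ℕ → Bool) : MeasurableSet (subC F v) := by
  rw [subC_determined (N := F.sup id + 1) (fun i hi => Nat.lt_succ_of_le (Finset.le_sup (f := id) hi))]
  exact determined_measurable _ {τ | decide (∀ i ∈ F, τ[i]? = some (v i)) = true}

theorem mu_subC (F : Finset ℕ) (v : ℕ → Bool) : mu (subC F v) = (1/2)^F.card := by
  induction F using Finset.induction_on_max with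
  | empty => simp [subC, mu]
  | insert a s hs ih =>
    have h1 : subC (insert a s) v = {X | decide (∀ i ∈ s, (strPrefix X a)[i]? = some (v i)) = true ∧ X a = v a} := by
      have := subC_determined (v := v) hs
      ext X
      have h2 : X ∈ subC s v ↔ _ := Set.ext_iff.1 this X
      simp only [Set.mem_ofPred_eq] at h2 ⊢
      rw [← h2]; simp [subC]; tauto
    rw [h1, mu_half a (fun τ => decide (∀ i ∈ s, τ[i]? = some (v i))) (v a), ← subC_determined hs, ih, Finset.card_insert_of_notMem (fun h => (hs a h).false), pow_succ]
    ring

/-- Lebesgue density, weak form -/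
theorem exists_dense {Z : Set (ℕ → Bool)} {ρ : List Bool} (hpos : 0 < mu (cylinder ρ ∩ Z)) {δ : ℝ}
    (hδ : 0 < δ) : ∃ σ, ρ <+: σ ∧ (1 - δ) * (1/2)^σ.length < mu (cylinder σ ∩ Z) := by
  by_contra! hcon
  wlog hδ1 : δ < 1 generalizing δ
  · refine this (δ := 1/2) (by norm_num) (fun σ hσ => (hcon σ hσ).trans ?_) (by norm_num)
    gcongr; linarith
  set m := mu (cylinder ρ ∩ Z)
  have hm : m < m / (1-δ) := by
    rw [lt_div_iff₀ (by linarith)]; nlinarith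
  obtain ⟨U, hU, hUo, hUm⟩ := (cylinder ρ ∩ Z).exists_isOpen_lt_of_lt (μ := μCantor) (ENNReal.ofReal (m/(1-δ))) (by
    rw [← ofReal_measureReal (h := measure_ne_top _ _)]
    exact (ENNReal.ofReal_lt_ofReal_iff (by linarith)).2 hm)
  have hUm' : mu U < m / (1-δ) := by
    rw [mu, measureReal_def]
    exact (ENNReal.lt_ofReal_iff_toReal_lt (measure_ne_top _ _)).1 hUm
  let q : ℕ → List Bool → Prop := fun N τ => ρ <+: τ ∧ cylinder τ ⊆ U
  classical
  have hle : ∀ N, mu ({X | decide (q N (strPrefix X N)) = true} ∩ Z) ≤ (1-δ) * mu U := by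
    intro N
    rw [mu_decomp N (fun τ => decide (q N τ))]
    calc _ ≤ ∑ τ ∈ ((strL N).filter (fun τ => decide (q N τ))).toFinset, (1-δ) * (1/2)^N := by
          apply Finset.sum_le_sum
          intro τ hτ
          simp [q] at hτ
          have := hcon τ hτ.2.1
          rwa [hτ.1] at this
      _ = (1-δ) * mu {X | decide (q N (strPrefix X N)) = true} := by
          rw [mu_cnt N (fun τ => decide (q N τ)), ← toFinset_card_strL]; simp [div_eq_mul_inv]; ring
      _ ≤ _ := by
          refine mul_le_mul_of_nonneg_left (measureReal_mono ?_) (by linarith)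
          intro X hX
          simp [q] at hX
          exact hX.2 (isPrefixOf_strPrefix X N)
  have hmono : Monotone fun N => {X : ℕ → Bool | decide (q N (strPrefix X N)) = true} ∩ Z := by
    refine monotone_nat_of_le_succ fun N X h => ⟨?_, h.2⟩
    have h1 := h.1
    simp [q] at h1 ⊢
    have hp := strPrefix_mono_len X (Nat.le_succ N)
    exact ⟨h1.1.trans hp, (cylinder_subset hp).trans h1.2⟩
  have ht : Filter.Tendsto (fun N => mu ({X : ℕ → Bool | decide (q N (strPrefix X N)) = true} ∩ Z)) Filter.atTop
      (nhds (mu (⋃ N, {X : ℕ → Bool | decide (q N (strPrefix X N)) = true} ∩ Z))) :=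
    (ENNReal.tendsto_toReal (measure_ne_top _ _)).comp (tendsto_measure_iUnion_atTop hmono)
  have hsub : cylinder ρ ∩ Z ⊆ ⋃ N, {X : ℕ → Bool | decide (q N (strPrefix X N)) = true} ∩ Z := by
    rintro X ⟨h1, h2⟩
    have hXU := hU ⟨h1, h2⟩
    obtain ⟨I, u, hI, hu⟩ := isOpen_pi_iff.1 hUo X hXU
    change IsPrefixOf _ _ at h1
    rw [isPrefixOf_iff_exists] at h1
    obtain ⟨n, rfl⟩ := h1
    refine Set.mem_iUnion.2 ⟨max n (I.sup id + 1), ?_, h2⟩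
    simp only [q, Set.mem_ofPred_eq, decide_eq_true_eq]
    refine ⟨strPrefix_mono_len X (le_max_left _ _), ?_⟩
    intro Y hY
    apply hu
    intro i hi
    rw [mem_cylinder_iff, strPrefix_length, strPrefix_eq_iff] at hY
    have : i < max n (I.sup id + 1) := lt_max_of_lt_right (Nat.lt_succ_of_le (Finset.le_sup (f := id) hi))
    rw [hY i this]
    exact (hI i hi).2
  have h3 := le_of_tendsto' ht hle
  have h4 : m ≤ (1-δ) * mu U := (measureReal_mono hsub).trans h3
  rw [lt_div_iff₀ (by linarith)] at hUm'
  linarith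

open MeasureTheory ENNReal

/-! ### bounded request sets, `K` and Kraft-Chaitin -/

/-- weight of a request `z = pair r x` -/
noncomputable def wt (z : ℕ) : ℝ := (1/2)^(Nat.unpair z).1

theorem wt_pos (z : ℕ) : 0 < wt z := by unfold wt; positivity
@[simp] theorem wt_pair (r x : ℕ) : wt (Nat.pair r x) = (1/2)^r := by simp [wt]

/-- bounded request set -/
def Bdd (M : Set ℕ) (C : ℝ) : Prop := ∀ F : Finset ℕ, ↑F ⊆ M → ∑ z ∈ F, wt z ≤ C

theorem Bdd.mono {M M' : Set ℕ} {C C' : ℝ} (h : Bdd M C) (hM : M' ⊆ M) (hC : C ≤ C') : Bdd M' C' :=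
  fun F hF => (h F (hF.trans hM)).trans hC

theorem prefix_comparable {σ τ ρ : List Bool} (h1 : σ <+: ρ) (h2 : τ <+: ρ) : σ <+: τ ∨ τ <+: σ :=
  List.prefix_or_prefix_of_prefix h1 h2

theorem cylinder_disjoint {σ τ : List Bool} (h1 : ¬ σ <+: τ) (h2 : ¬ τ <+: σ) :
    Disjoint (cylinder σ) (cylinder τ) := by
  rw [Set.disjoint_left]
  intro X hX hX'
  rw [mem_cylinder_iff] at hX hX'
  have e1 := strPrefix_mono_len X (le_max_left σ.length τ.length)
  have e2 := strPrefix_mono_len X (le_max_right σ.length τ.length)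
  rw [hX] at e1; rw [hX'] at e2
  rcases prefix_comparable e1 e2 with h | h
  · exact h1 h
  · exact h2 h

/-- Kraft inequality inside a set -/
theorem kraft_mu {ι : Type*} {T : Finset ι} {f : ι → List Bool}
    (h : ∀ a ∈ T, ∀ b ∈ T, f a <+: f b → a = b) {U : Set (ℕ → Bool)} (hU : ∀ a ∈ T, cylinder (f a) ⊆ U) :
    ∑ a ∈ T, (1/2:ℝ)^(f a).length ≤ mu U := by
  have hd : (T : Set ι).PairwiseDisjoint (fun a => cylinder (f a)) := by
    intro a ha b hb hab
    exact cylinder_disjoint (fun h' => hab (h a ha b hb h')) (fun h' => hab (h b hb a ha h').symm)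
  calc ∑ a ∈ T, (1/2:ℝ)^(f a).length = ∑ a ∈ T, mu (cylinder (f a)) :=
        Finset.sum_congr rfl fun a _ => (mu_cylinder _).symm
    _ = mu (⋃ a ∈ T, cylinder (f a)) :=
        (measureReal_biUnion_finset hd fun a _ => cylinder_measurable _).symm
    _ ≤ _ := measureReal_mono (by simpa using hU)

theorem kraft {ι : Type*} {T : Finset ι} {f : ι → List Bool}
    (h : ∀ a ∈ T, ∀ b ∈ T, f a <+: f b → a = b) :
    ∑ a ∈ T, (1/2:ℝ)^(f a).length ≤ 1 := by
  have := kraft_mu h (U := Set.univ) (by simp)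
  simpa [mu] using this

/-- decoding of strings -/
def dstr (n : ℕ) : List Bool := (Encodable.decode n : Option (List Bool)).getD []

@[simp] theorem dstr_encode (σ : List Bool) : dstr (Encodable.encode σ) = σ := by simp [dstr]

@[fun_prop] theorem dstr_prim {α : Type*} [Primcodable α] {f : α → ℕ} (hf : Primrec f) :
    Primrec fun a => dstr (f a) := by
  unfold dstr; fun_prop

/-- acceptance of a program at its first stage -/
def kacc (e : ℕ) (σ : List Bool) (s : ℕ) : Bool :=
  wen e (Encodable.encode σ) s && !(wen e (Encodable.encode σ) (s-1)) &&
  (List.range (s+1)).all fun i => !(decide (Encodable.encode (dstr i) = i)) || decide (dstr i = σ) ||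
    !(decide (dstr i <+: σ) || decide (σ <+: dstr i)) ||
    (!wen e i (s-1) && (!wen e i s || decide (Encodable.encode σ < i)))

theorem wen_bound {e n s : ℕ} (h : wen e n s = true) : n < s := by
  unfold wen at h
  obtain ⟨y, hy⟩ := Option.isSome_iff_exists.1 h
  exact Nat.Partrec.Code.evaln_bound hy

theorem kacc_prefixFree {e : ℕ} {σ τ : List Bool} {s t : ℕ} (hs : kacc e σ s = true) (ht : kacc e τ t = true)
    (hp : σ <+: τ) : σ = τ := by
  by_contra hne
  simp only [kacc, Bool.and_eq_true, Bool.or_eq_true, Bool.not_eq_true', List.all_eq_true, List.mem_range,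
    decide_eq_true_eq, Bool.or_eq_false_iff, decide_eq_false_iff_not] at hs ht
  obtain ⟨⟨hs1, hs2⟩, hs3⟩ := hs
  obtain ⟨⟨ht1, ht2⟩, ht3⟩ := ht
  rcases lt_trichotomy s t with h | h | h
  · have hb := wen_bound hs1
    have := ht3 (Encodable.encode σ) (by omega)
    simp only [dstr_encode, not_true_eq_false, false_or, hne, hp, not_true_eq_false, false_and, false_or] at this
    have h2 := wen_mono (show s ≤ t - 1 by omega) hs1
    rw [this.1] at h2; exact absurd h2 (by simp)
  · subst h
    have h1 := ht3 (Encodable.encode σ) (by have := wen_bound hs1; omega)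
    have h2 := hs3 (Encodable.encode τ) (by have := wen_bound ht1; omega)
    simp only [dstr_encode, not_true_eq_false, false_or, hne, hp, not_true_eq_false, false_and, false_or, hs1] at h1
    simp only [dstr_encode, not_true_eq_false, false_or, Ne.symm hne, hp, not_true_eq_false, and_false, false_or, ht1] at h2
    have a := h1.2; have b := h2.2
    simp at a b; omega
  · have hb := wen_bound ht1
    have := hs3 (Encodable.encode τ) (by omega)
    simp only [dstr_encode, not_true_eq_false, false_or, Ne.symm hne, hp, not_true_eq_false, and_false, false_or] at this
    have h2 := wen_mono (show t ≤ s - 1 by omega) ht1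
    rw [this.1] at h2; exact absurd h2 (by simp)

theorem kacc_complete {e : ℕ} (he : PrefixFreeMachine e) {σ : List Bool} {s : ℕ}
    (hs : wen e (Encodable.encode σ) s = true) : ∃ s, kacc e σ s = true := by
  classical
  have hex : ∃ s, wen e (Encodable.encode σ) s = true := ⟨s, hs⟩
  refine ⟨Nat.find hex, ?_⟩
  have h1 := Nat.find_spec hex
  have h0 : Nat.find hex ≠ 0 := by have := wen_bound h1; omega
  have h2 : wen e (Encodable.encode σ) (Nat.find hex - 1) = false := by
    have := Nat.find_min hex (m := Nat.find hex - 1) (by omega)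
    simpa using this
  have hdom : ∀ {τ : List Bool} {t}, wen e (Encodable.encode τ) t = true → τ ∈ machineDom e :=
    fun h => wenum_iff.2 ⟨_, h⟩
  simp only [kacc, h1, h2, Bool.not_false, Bool.and_self, Bool.true_and, List.all_eq_true]
  intro i _
  by_cases hi : Encodable.encode (dstr i) = i
  swap
  · simp [hi]
  obtain ⟨τ, rfl⟩ : ∃ τ : List Bool, Encodable.encode τ = i := ⟨_, hi⟩
  by_cases hτ : τ = σ
  · simp [hτ]
  by_cases hc : τ <+: σ ∨ σ <+: τ
  · have : ∀ t, wen e (Encodable.encode τ) t = false := by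
      intro t
      by_contra hne
      have h3 := hdom (τ := τ) (t := t) (by simpa using hne)
      have h4 := hdom h1
      rcases hc with h | h
      · exact hτ (he _ h3 _ h4 h)
      · exact hτ (he _ h4 _ h3 h).symm
    simp [this]
  · have : ¬ τ <+: σ ∧ ¬ σ <+: τ := by tauto
    simp [this]

/-- the universal request set -/
def KK : Set ℕ := {z | ∃ (e : ℕ) (σ : List Bool) (s : ℕ), kacc e σ s = true ∧
  Nat.Partrec.Code.evaln s (Denumerable.ofNat Nat.Partrec.Code e) (Encodable.encode σ) = some (Nat.unpair z).2 ∧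
  (Nat.unpair z).1 = σ.length + 2 * e + 2}

theorem KK_re : REPred fun z => z ∈ KK := by
  have : REPred fun z : ℕ => ∃ b : ℕ × List Bool × ℕ, kacc b.1 b.2.1 b.2.2 = true ∧
    (Nat.Partrec.Code.evaln b.2.2 (Denumerable.ofNat Nat.Partrec.Code b.1) (Encodable.encode b.2.1) = some (Nat.unpair z).2 ∧
    (Nat.unpair z).1 = b.2.1.length + 2 * b.1 + 2) := by
    refine REPred.ex (p := fun x : ℕ × ℕ × List Bool × ℕ => kacc x.2.1 x.2.2.1 x.2.2.2 = true ∧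
    (Nat.Partrec.Code.evaln x.2.2.2 (Denumerable.ofNat Nat.Partrec.Code x.2.1) (Encodable.encode x.2.2.1) = some (Nat.unpair x.1).2 ∧
    (Nat.unpair x.1).1 = x.2.2.1.length + 2 * x.2.1 + 2)) ?_
    refine re_dec (Primrec.to_comp ?_)
    unfold kacc
    fun_prop
  refine this.of_eq fun z => ?_
  simp [KK]

theorem geom4 (S : Finset ℕ) : ∑ e ∈ S, (1/2:ℝ)^(2*e+2) ≤ 1 := by
  have h1 : HasSum (fun e : ℕ => (1/4:ℝ)^e) (1 - 1/4)⁻¹ := hasSum_geometric_of_lt_one (by norm_num) (by norm_num)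
  have h2 := h1.mul_left (1/4)
  have h3 : ∀ e : ℕ, (1/2:ℝ)^(2*e+2) = 1/4 * (1/4)^e := by
    intro e; rw [pow_add, pow_mul]; norm_num; ring
  simp only [h3]
  refine (sum_le_hasSum S (fun i _ => by positivity) h2).trans (by norm_num)

theorem KK_bdd : Bdd KK 1 := by
  intro F hF
  have hF' : ∀ z, z ∈ F → z ∈ KK := fun z hz => hF hz
  simp only [KK, Set.mem_ofPred_eq] at hF'
  choose! e σ s h1 h2 h3 using hF'
  classical
  have hf : ∀ i ∈ F.image e, ∑ z ∈ F with e z = i, wt z ≤ (1/2:ℝ)^(2*i+2) := by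
    intro i _
    have : ∀ z ∈ F.filter (fun z => e z = i), wt z = (1/2:ℝ)^(2*i+2) * (1/2)^(σ z).length := by
      intro z hz
      rw [Finset.mem_filter] at hz
      rw [wt, h3 _ hz.1, hz.2, ← pow_add]; congr 1; ring
    rw [Finset.sum_congr rfl this, ← Finset.mul_sum]
    refine mul_le_of_le_one_right (by positivity) (kraft ?_)
    intro a ha b hb hab
    rw [Finset.mem_filter] at ha hb
    have hσ := kacc_prefixFree (h1 _ ha.1) (by have := h1 _ hb.1; rwa [hb.2, ← ha.2] at this) hab
    have ea := h2 _ ha.1; have eb := h2 _ hb.1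
    have ra := h3 _ ha.1; have rb := h3 _ hb.1
    rw [ha.2, hσ] at ea ra; rw [hb.2] at eb rb
    have hx := Part.mem_unique (Nat.Partrec.Code.evaln_sound ea) (Nat.Partrec.Code.evaln_sound eb)
    have : Nat.unpair a = Nat.unpair b := Prod.ext (by omega) hx
    simpa using congrArg (fun p => Nat.pair p.1 p.2) this
  rw [← Finset.sum_fiberwise_of_maps_to (g := e) (t := F.image e) (fun z hz => Finset.mem_image_of_mem _ hz)]
  exact (Finset.sum_le_sum hf).trans (geom4 _)

theorem Kcpx_le {e : ℕ} (he : PrefixFreeMachine e) {σ : List Bool} {x : ℕ}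
    (h : x ∈ (Denumerable.ofNat Nat.Partrec.Code e).eval (Encodable.encode σ)) :
    Kcpx x ≤ σ.length + 2 * e + 2 := Nat.sInf_le ⟨e, σ, he, h, rfl⟩

theorem KK_mem (x : ℕ) : Nat.pair (Kcpx x) x ∈ KK := by
  have hne : {k | ∃ e, ∃ σ : List Bool, PrefixFreeMachine e ∧
    x ∈ (Denumerable.ofNat Nat.Partrec.Code e).eval (Encodable.encode σ) ∧
    k = σ.length + 2 * e + 2}.Nonempty := by
    have hp : Partrec fun n : ℕ => (((if n = 0 then some x else none : Option ℕ)) : Part ℕ) := by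
      refine Computable.ofOption (Primrec.to_comp ?_)
      fun_prop
    obtain ⟨c, hc⟩ := Nat.Partrec.Code.exists_code.1 (Partrec.nat_iff.1 hp)
    have hd : machineDom (Encodable.encode c) ⊆ {[]} := by
      intro σ hσ
      simp only [machineDom, Denumerable.ofNat_encode, Set.mem_ofPred_eq, hc] at hσ
      by_contra hne
      have : Encodable.encode σ ≠ 0 := by
        intro h; apply hne
        have h' : Encodable.encode σ = Encodable.encode ([] : List Bool) := by rw [h]; rfl
        exact Encodable.encode_injective h'
      simp [this] at hσ
    refine ⟨_, Encodable.encode c, [], ?_, ?_, rfl⟩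
    · intro σ hσ τ hτ _
      rw [hd hσ, hd hτ]
    · rw [Denumerable.ofNat_encode, hc]; simp
  obtain ⟨e, σ, he, hx, hk⟩ := Nat.sInf_mem hne
  change Kcpx x = _ at hk
  obtain ⟨s, hs⟩ := Nat.Partrec.Code.evaln_complete.1 hx
  obtain ⟨t, ht⟩ := kacc_complete he (σ := σ) (s := s) (by unfold wen; exact Option.isSome_iff_exists.2 ⟨_, hs⟩)
  refine ⟨e, σ, t, ht, ?_, by simpa using hk⟩
  have : wen e (Encodable.encode σ) t = true := by
    simp only [kacc, Bool.and_eq_true] at ht; exact ht.1.1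
  obtain ⟨y, hy⟩ := Option.isSome_iff_exists.1 this
  rw [hy, Part.mem_unique (Nat.Partrec.Code.evaln_sound hy) hx]; simp

/-- injective enumeration of r.e. sets -/
theorem re_enum {M : Set ℕ} (hM : REPred fun z => z ∈ M) : ∃ q : ℕ → Option ℕ, Primrec q ∧
    (∀ s t z, q s = some z → q t = some z → s = t) ∧ ∀ z, z ∈ M ↔ ∃ s, q s = some z := by
  obtain ⟨f, hf, hm, h⟩ := re_normal hM
  refine ⟨fun s => if (f s.unpair && (decide (s.unpair.2 = 0) || !f (s.unpair.1, s.unpair.2 - 1))) = true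
    then some s.unpair.1 else none, by fun_prop, ?_, ?_⟩
  · intro s t z hs ht
    simp only [Bool.and_eq_true, Bool.or_eq_true, decide_eq_true_eq, Bool.not_eq_true', Option.ite_none_right_eq_some,
      Option.some.injEq] at hs ht
    obtain ⟨⟨a1, a2⟩, a3⟩ := hs
    obtain ⟨⟨b1, b2⟩, b3⟩ := ht
    have key : ∀ {i j : ℕ}, f (z, i) = true → (j = 0 ∨ f (z, j - 1) = false) → j ≤ i := by
      intro i j hi hj
      by_contra hlt
      rcases hj with hj | hj
      · omega
      · rw [hm _ _ _ (show i ≤ j - 1 by omega) hi] at hj; simp at hj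
    have ea : Nat.unpair s = (z, (Nat.unpair s).2) := Prod.ext a3 rfl
    have eb : Nat.unpair t = (z, (Nat.unpair t).2) := Prod.ext b3 rfl
    rw [a3] at a2; rw [b3] at b2; rw [ea] at a1; rw [eb] at b1
    have h2 := le_antisymm (key a1 b2) (key b1 a2)
    rw [← Nat.pair_unpair s, ← Nat.pair_unpair t, a3, b3, h2]
  · intro z
    rw [h]
    constructor
    · intro hex
      classical
      refine ⟨Nat.pair z (Nat.find hex), ?_⟩
      have h1 := Nat.find_spec hex
      simp only [Nat.unpair_pair, h1, Bool.true_and, Bool.or_eq_true, decide_eq_true_eq, Bool.not_eq_true',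
        Option.ite_none_right_eq_some, and_true]
      by_cases h0 : Nat.find hex = 0
      · exact Or.inl h0
      · right; have := Nat.find_min hex (m := Nat.find hex - 1) (by omega); simpa using this
    · rintro ⟨s, hs⟩
      simp only [Bool.and_eq_true, Option.ite_none_right_eq_some, Option.some.injEq] at hs
      refine ⟨s.unpair.2, ?_⟩
      rw [← hs.2]; exact hs.1.1

theorem exists_sval {n k : ℕ} (h : k < 2^n) : ∃ σ : List Bool, σ.length = n ∧ sval σ = k := by
  induction n generalizing k with
  | zero => exact ⟨[], rfl, by simp at h; simp [sval, h]⟩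
  | succ n ih =>
    obtain ⟨σ, h1, h2⟩ := ih (k := k/2) (by rw [pow_succ] at h; omega)
    refine ⟨σ ++ [decide (k % 2 = 1)], by simp [h1], ?_⟩
    rw [sval_append, h2]
    by_cases hk : k % 2 = 1 <;> simp [hk] <;> omega

theorem sval_pre_of {σ τ : List Bool} (h : σ <+: τ) :
    (sval σ : ℝ) / 2^σ.length ≤ (sval τ : ℝ) / 2^τ.length ∧
      ((sval τ : ℝ) + 1) / 2^τ.length ≤ ((sval σ : ℝ) + 1) / 2^σ.length := by
  obtain ⟨ρ, rfl⟩ := h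
  induction ρ using List.reverseRecOn with
  | nil => simp
  | append_singleton ρ b ih =>
    rw [← List.append_assoc, sval_append]
    have hl : ((σ ++ ρ) ++ [b]).length = (σ ++ ρ).length + 1 := by simp; ring
    rw [hl, pow_succ]
    obtain ⟨h1, h2⟩ := ih
    generalize (σ ++ ρ).length = l at *
    generalize sval (σ ++ ρ) = v at *
    have hp : (0:ℝ) < 2 ^ l := by positivity
    constructor
    · refine h1.trans ?_
      rw [div_le_div_iff₀ hp (by positivity)]
      cases b <;> simp <;> nlinarith
    · refine le_trans ?_ h2
      rw [div_le_div_iff₀ (by positivity) hp]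
      cases b <;> simp <;> nlinarith

/-- Kraft-Chaitin -/
theorem kraft_chaitin {M : Set ℕ} (hM : REPred fun z => z ∈ M) {C : ℝ} (hB : Bdd M C) :
    ∃ c, ∀ r x, Nat.pair r x ∈ M → Kcpx x ≤ r + c := by
  obtain ⟨q, hq, hinj, hmem⟩ := re_enum hM
  obtain ⟨c1, hc1⟩ : ∃ c1 : ℕ, C ≤ 2^c1 := by
    obtain ⟨n, hn⟩ := pow_unbounded_of_one_lt C (one_lt_two)
    exact ⟨n, hn.le⟩
  let rr : ℕ → ℕ := fun s => ((q s).getD 0).unpair.1 + c1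
  let w : ℕ → ℝ := fun s => if (q s).isSome then (1/2)^(rr s) else 0
  let p : ℕ → ℝ := fun s => ∑ t ∈ Finset.range s, w t
  let B : ℕ → ℕ := fun s => ((List.range s).map rr).sum
  let num : ℕ → ℕ := fun s => ((List.range s).map fun t => if (q t).isSome then 2^(B s - rr t) else 0).sum
  have hrr : Primrec rr := by fun_prop
  have hBp : Primrec B := by fun_prop
  have hnp : Primrec num := by fun_prop
  let kk : ℕ → ℕ := fun s => (num s * 2^(rr s + 1) + (2^(B s) - 1)) / 2^(B s)
  have hkk : Primrec kk := by fun_prop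
  have hw0 : ∀ s, 0 ≤ w s := by intro s; simp only [w]; split_ifs <;> positivity
  have hpm : Monotone p := monotone_nat_of_le_succ fun s => by
    simp only [p, Finset.sum_range_succ]; linarith [hw0 s]
  have hp1 : ∀ s, p s ≤ 1 := by
    intro s
    classical
    have h1 : p s = (1/2)^c1 * ∑ t ∈ (Finset.range s).filter (fun t => (q t).isSome), wt ((q t).getD 0) := by
      simp only [p, w, Finset.mul_sum, Finset.sum_filter]
      refine Finset.sum_congr rfl fun t _ => ?_
      split_ifs
      · simp only [rr, wt]; ring
      · simp
    have h2 : ∑ t ∈ (Finset.range s).filter (fun t => (q t).isSome), wt ((q t).getD 0) ≤ C := by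
      rw [← Finset.sum_image (f := wt) (g := fun t => (q t).getD 0)]
      · apply hB
        intro z hz
        simp at hz
        obtain ⟨t, ⟨_, ht⟩, rfl⟩ := hz
        obtain ⟨y, hy⟩ := Option.isSome_iff_exists.1 ht
        exact (hmem _).2 ⟨t, by rw [hy]; rfl⟩
      · intro t ht t' ht' he
        simp at ht ht'
        obtain ⟨y, hy⟩ := Option.isSome_iff_exists.1 ht.2
        obtain ⟨y', hy'⟩ := Option.isSome_iff_exists.1 ht'.2
        simp [hy, hy'] at he
        exact hinj t t' y hy (by rw [hy', he])
    rw [h1]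
    calc _ ≤ (1/2:ℝ)^c1 * 2^c1 := by gcongr; exact h2.trans hc1
      _ = 1 := by rw [← mul_pow]; norm_num
  have hnum : ∀ s, (num s : ℝ) = p s * 2^(B s) := by
    intro s
    have : ∀ n, n ≤ s → (((List.range n).map fun t => if (q t).isSome then 2^(B s - rr t) else 0).sum : ℕ) =
        p n * (2:ℝ)^(B s) := by
      intro n
      induction n with
      | zero => simp [p]
      | succ n ih =>
        intro hn
        rw [List.range_succ, List.map_append, List.sum_append, Nat.cast_add, ih (by omega)]
        simp only [p, Finset.sum_range_succ, add_mul, List.map_cons, List.map_nil, List.sum_cons, List.sum_nil, w]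
        congr 1
        have hle : rr n ≤ B s := by
          apply List.single_le_sum (fun _ _ => Nat.zero_le _)
          exact List.mem_map.2 ⟨n, List.mem_range.2 hn, rfl⟩
        split_ifs
        · push_cast
          rw [add_zero]
          obtain ⟨j, hj⟩ := Nat.exists_eq_add_of_le hle
          rw [hj, Nat.add_sub_cancel_left, pow_add (2:ℝ) (rr n) j, ← mul_assoc, ← mul_pow]; norm_num
        · simp
    exact this s le_rfl
  have hk : ∀ s, p s * 2^(rr s+1) ≤ kk s ∧ (kk s : ℝ) < p s * 2^(rr s + 1) + 1 := by
    intro s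
    have hd := Nat.div_add_mod (num s * 2^(rr s + 1) + (2^(B s) - 1)) (2^(B s))
    have hlt := Nat.mod_lt (num s * 2^(rr s + 1) + (2^(B s) - 1)) (show 0 < 2^(B s) by positivity)
    change 2^(B s) * kk s + _ = _ at hd
    have hp : 1 ≤ 2^(B s) := Nat.one_le_two_pow
    generalize (num s * 2^(rr s + 1) + (2^(B s) - 1)) % 2^(B s) = m at *
    have h1 : num s * 2^(rr s + 1) ≤ 2^(B s) * kk s := by omega
    have h2 : 2^(B s) * kk s < num s * 2^(rr s + 1) + 2^(B s) := by omega
    have h1' : (num s : ℝ) * 2^(rr s + 1) ≤ 2^(B s) * kk s := by exact_mod_cast h1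
    have h2' : (2:ℝ)^(B s) * kk s < num s * 2^(rr s + 1) + 2^(B s) := by exact_mod_cast h2
    rw [hnum] at h1' h2'
    have hpos : (0:ℝ) < 2^(B s) := by positivity
    constructor
    · refine le_of_mul_le_mul_left ?_ hpos; linarith
    · refine lt_of_mul_lt_mul_left ?_ hpos.le; linarith
  -- interval facts
  have hI : ∀ s σ, (q s).isSome → List.length σ = rr s + 1 → sval σ = kk s →
      p s ≤ (sval σ : ℝ) / 2^σ.length ∧ ((sval σ : ℝ)+1) / 2^σ.length ≤ p (s+1) := by
    intro s σ hs h1 h2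
    obtain ⟨a, b⟩ := hk s
    rw [h1, h2]
    constructor
    · rw [le_div_iff₀ (by positivity)]; exact a
    · have : p (s+1) = p s + (1/2)^(rr s) := by simp [p, Finset.sum_range_succ, w, hs]
      rw [this, div_le_iff₀ (by positivity), add_mul]
      have : (1/2:ℝ)^(rr s) * 2^(rr s+1) = 2 := by rw [pow_succ, ← mul_assoc, ← mul_pow]; norm_num
      linarith
  let test : List Bool → ℕ → Bool := fun σ s => (q s).isSome && decide (σ.length = rr s + 1) && decide (sval σ = kk s)
  have htest : ∀ σ s, test σ s = true ↔ (q s).isSome ∧ σ.length = rr s + 1 ∧ sval σ = kk s := by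
    intro σ s; simp [test, and_assoc]
  have hlt1 : ∀ σ : List Bool, (sval σ : ℝ)/2^σ.length < ((sval σ : ℝ)+1)/2^σ.length := by
    intro σ; gcongr; linarith
  have huniq : ∀ σ τ s t, σ <+: τ → test σ s = true → test τ t = true → s = t := by
    intro σ τ s t hst h1 h2
    rw [htest] at h1 h2
    obtain ⟨a1, a2⟩ := hI s σ h1.1 h1.2.1 h1.2.2
    obtain ⟨b1, b2⟩ := hI t τ h2.1 h2.2.1 h2.2.2
    obtain ⟨c1, c2⟩ := sval_pre_of hst
    have := hlt1 σ; have := hlt1 τ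
    rcases lt_trichotomy s t with h | h | h
    · have := hpm (show s+1 ≤ t from h); linarith
    · exact h
    · have := hpm (show t+1 ≤ s from h); linarith
  have hsv : Primrec sval := by unfold sval; fun_prop
  have htp : Primrec fun x : List Bool × ℕ => test x.1 x.2 := by fun_prop
  have hpart : Partrec fun n : ℕ => (Nat.rfind fun s => (test (dstr n) s : Part Bool)).map
      fun s => ((q s).getD 0).unpair.2 := by
    refine Partrec.map (Partrec.rfind (p := fun n s => (test (dstr n) s : Part Bool)) ?_) ?_
    · refine Computable.partrec (f := fun x : ℕ × ℕ => test (dstr x.1) x.2) (Primrec.to_comp ?_)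
      fun_prop
    · exact Primrec.to_comp (f := fun x : ℕ × ℕ => ((q x.2).getD 0).unpair.2) (by fun_prop)
  obtain ⟨c, hc⟩ := Nat.Partrec.Code.exists_code.1 (Partrec.nat_iff.1 hpart)
  have hdom : ∀ σ ∈ machineDom (Encodable.encode c), ∃ s, test σ s = true := by
    intro σ hσ
    simp only [machineDom, Denumerable.ofNat_encode, Set.mem_ofPred_eq, hc] at hσ
    obtain ⟨n, hn, -⟩ := Nat.rfind_dom.1 hσ
    exact ⟨n, by simpa using (Part.mem_some_iff.1 hn).symm⟩
  have hpf : PrefixFreeMachine (Encodable.encode c) := by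
    intro σ hσ τ hτ hst
    obtain ⟨s, hs⟩ := hdom σ hσ
    obtain ⟨t, ht⟩ := hdom τ hτ
    have := huniq σ τ s t hst hs ht
    subst this
    exact hst.eq_of_length (by rw [((htest _ _).1 hs).2.1, ((htest _ _).1 ht).2.1])
  refine ⟨c1 + 1 + 2 * Encodable.encode c + 2, fun r x hz => ?_⟩
  obtain ⟨s, hs⟩ := (hmem _).1 hz
  have hks : kk s < 2^(rr s+1) := by
    have h1 := (hk s).2
    have h2 : p s + (1/2)^(rr s) ≤ 1 := by
      have := hp1 (s+1)
      simpa [p, Finset.sum_range_succ, w, hs] using this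
    have h3 : (kk s : ℝ) < 2^(rr s + 1) := by
      have h4 := mul_le_mul_of_nonneg_right h2 (show (0:ℝ) ≤ 2^(rr s+1) by positivity)
      rw [add_mul] at h4
      have : (1/2:ℝ)^(rr s) * 2^(rr s+1) = 2 := by rw [pow_succ, ← mul_assoc, ← mul_pow]; norm_num
      linarith
    exact_mod_cast h3
  obtain ⟨σ, hl, hv⟩ := exists_sval hks
  have ht : test σ s = true := (htest _ _).2 ⟨by simp [hs], hl, hv⟩
  have hx : x ∈ (Denumerable.ofNat Nat.Partrec.Code (Encodable.encode c)).eval (Encodable.encode σ) := by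
    rw [Denumerable.ofNat_encode, hc]
    simp only [dstr_encode, Part.mem_map_iff]
    refine ⟨s, Nat.mem_rfind.2 ⟨by simp [ht], fun {m} hm => ?_⟩, by simp [hs]⟩
    have hfalse : test σ m = false := by
      by_contra hne
      have h1 : test σ m = true := by simpa using hne
      have := huniq σ σ m s (List.prefix_refl _) h1 ht
      omega
    simp [hfalse]
  have := Kcpx_le hpf hx
  have hr : rr s = r + c1 := by simp [rr, hs]
  omega

open MeasureTheory ENNReal

/-! ### the forward direction -/

/-- stage approximation of the universal request set -/
noncomputable def kkf : ℕ × ℕ → Bool := Classical.choose (re_normal KK_re)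
theorem kkf_prim0 : Primrec kkf := (Classical.choose_spec (re_normal KK_re)).1
theorem kkf_mono {z s t : ℕ} (h : s ≤ t) (hs : kkf (z, s) = true) : kkf (z, t) = true :=
  (Classical.choose_spec (re_normal KK_re)).2.1 z s t h hs
theorem kkf_iff {z : ℕ} : z ∈ KK ↔ ∃ s, kkf (z, s) = true :=
  (Classical.choose_spec (re_normal KK_re)).2.2 z

@[fun_prop] theorem kkf_prim {α : Type*} [Primcodable α] {f : α → ℕ × ℕ} (hf : Primrec f) :
    Primrec fun a => kkf (f a) := kkf_prim0.comp hf

/-- the code of `1^n` -/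
def one (n : ℕ) : ℕ := Encodable.encode (List.replicate n true)
@[fun_prop] theorem one_prim {α : Type*} [Primcodable α] {f : α → ℕ} (hf : Primrec f) :
    Primrec fun a => one (f a) := by unfold one; fun_prop
theorem one_inj {n m : ℕ} (h : one n = one m) : n = m := by
  have := Encodable.encode_injective h
  simpa using congrArg List.length this

/-- requests derived from an oracle -/
noncomputable def zs (α : List Bool) (j : ℕ) : Option ℕ :=
  if kkf (Nat.pair j.unpair.1.unpair.1 (one j.unpair.1.unpair.2), j.unpair.2) = true then
    some (Nat.pair (j.unpair.1.unpair.1 + 3) (Encodable.encode (α.take j.unpair.1.unpair.2))) else none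

@[fun_prop] theorem zs_prim {α : Type*} [Primcodable α] {f : α → List Bool} {g : α → ℕ} (hf : Primrec f)
    (hg : Primrec g) : Primrec fun a => zs (f a) (g a) := by unfold zs; fun_prop

/-- requests derived from `A` -/
noncomputable def zA (A : ℕ → Bool) (j : ℕ) : Option ℕ := zs (strPrefix A j) j

theorem zs_eq (A : ℕ → Bool) {ℓ j : ℕ} (h : j ≤ ℓ) : zs (strPrefix A ℓ) j = zA A j := by
  unfold zA zs
  have : j.unpair.1.unpair.2 ≤ j := (Nat.unpair_right_le _).trans (Nat.unpair_left_le _)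
  rw [strPrefix_take_of_le _ (this.trans h), strPrefix_take_of_le _ this]

/-- the request set -/
def LL (A : ℕ → Bool) : Set ℕ := {z | ∃ j, zA A j = some z}

theorem mem_LL {A : ℕ → Bool} {z : ℕ} : z ∈ LL A ↔ ∃ k n, Nat.pair k (one n) ∈ KK ∧
    z = Nat.pair (k+3) (Encodable.encode (strPrefix A n)) := by
  constructor
  · rintro ⟨j, hj⟩
    simp only [zA, zs, Option.ite_none_right_eq_some, Option.some.injEq] at hj
    refine ⟨_, _, kkf_iff.2 ⟨_, hj.1⟩, ?_⟩
    rw [← hj.2, strPrefix_take_of_le _ ((Nat.unpair_right_le _).trans (Nat.unpair_left_le _))]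
  · rintro ⟨k, n, h, rfl⟩
    obtain ⟨s, hs⟩ := kkf_iff.1 h
    refine ⟨Nat.pair (Nat.pair k n) s, ?_⟩
    have : n ≤ Nat.pair (Nat.pair k n) s := (Nat.right_le_pair _ _).trans (Nat.left_le_pair _ _)
    simp [zA, zs, hs, strPrefix_take_of_le _ this]

theorem LL_three {A : ℕ → Bool} {z : ℕ} (h : z ∈ LL A) : 3 ≤ (Nat.unpair z).1 := by
  obtain ⟨k, n, -, rfl⟩ := mem_LL.1 h; simp

theorem LL_bdd (A : ℕ → Bool) : Bdd (LL A) (1/8) := by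
  intro F hF
  have hF' : ∀ z, z ∈ F → ∃ k n, Nat.pair k (one n) ∈ KK ∧
    z = Nat.pair (k+3) (Encodable.encode (strPrefix A n)) := fun z hz => mem_LL.1 (hF hz)
  choose! k n h1 h2 using hF'
  have : ∀ z ∈ F, wt z = 1/8 * wt (Nat.pair (k z) (one (n z))) := by
    intro z hz; rw [h2 z hz, wt_pair, ← h2 z hz, wt_pair, pow_add]; norm_num; ring
  rw [Finset.sum_congr rfl this, ← Finset.mul_sum]
  classical
  rw [← Finset.sum_image (f := wt) (g := fun z => Nat.pair (k z) (one (n z)))]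
  · have := KK_bdd (F.image fun z => Nat.pair (k z) (one (n z))) (by
      intro y hy; simp at hy; obtain ⟨z, hz, rfl⟩ := hy; exact h1 z hz)
    linarith
  · intro a ha b hb hab
    simp at hab
    have := one_inj hab.2
    rw [h2 a ha, h2 b hb, hab.1, this]

theorem Bdd.union_fin {M : Set ℕ} {C : ℝ} (h : Bdd M C) (m : ℕ) :
    Bdd {z | z ∈ M ∨ z < m} (C + ∑ z ∈ Finset.range m, wt z) := by
  intro F hF
  classical
  have : ∑ z ∈ F, wt z ≤ ∑ z ∈ F.filter (· ∈ M), wt z + ∑ z ∈ F.filter (¬ · ∈ M), wt z :=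
    (Finset.sum_filter_add_sum_filter_not _ _ _).ge
  refine this.trans (add_le_add (h _ ?_) (Finset.sum_le_sum_of_subset_of_nonneg ?_ fun i _ _ => (wt_pos i).le))
  · intro z hz; simp at hz; exact hz.2
  · intro z hz
    simp at hz ⊢
    rcases hF hz.1 with h | h
    · exact absurd h hz.2
    · exact h

theorem LL_uncovered {A : ℕ → Bool} (hA : ¬ KTrivial A) {M : Set ℕ} (hM : REPred fun z => z ∈ M) {C : ℝ}
    (hB : Bdd M C) (m : ℕ) : ∃ z ∈ LL A, z ∉ M ∧ m ≤ z := by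
  by_contra! hcon
  obtain ⟨c, hc⟩ := kraft_chaitin (M := {z | z ∈ M ∨ z < m}) (hM.or' (re_dec (Primrec.to_comp (by fun_prop))))
    (hB.union_fin m)
  refine hA ⟨3 + c, fun n => ?_⟩
  have h1 : Nat.pair (KofNat n + 3) (Encodable.encode (strPrefix A n)) ∈ LL A :=
    mem_LL.2 ⟨_, _, KK_mem (one n), rfl⟩
  have := hc _ _ (show _ ∈ {z | z ∈ M ∨ z < m} from (by
    by_cases h : Nat.pair (KofNat n + 3) (Encodable.encode (strPrefix A n)) ∈ M
    · exact Or.inl h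
    · exact Or.inr (hcon _ h1 h)))
  omega

/-- requirement: can be met by removing a c.e. open set of small measure -/
def Meetable (Good : Set (ℕ → Bool)) : Prop := ∀ ε : ℝ, 0 < ε → ∃ T : Set (List Bool),
  (REPred fun σ => σ ∈ T) ∧ mu (openOf T) < ε ∧ (openOf T)ᶜ ⊆ Good

theorem exists_half_pow_lt {ε : ℝ} (h : 0 < ε) : ∃ n : ℕ, (1/2:ℝ)^n < ε :=
  exists_pow_lt_of_lt_one h (by norm_num)

theorem meet_test (e : ℕ) : Meetable {X | (∀ n, μCantor (testLevel e emptyOracle n) ≤ 2⁻¹ ^ n) →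
    ∃ n, X ∉ testLevel e emptyOracle n} := by
  intro ε hε
  by_cases h : ∀ n, μCantor (testLevel e emptyOracle n) ≤ 2⁻¹ ^ n
  · obtain ⟨n, hn⟩ := exists_half_pow_lt hε
    refine ⟨{σ | ∃ m, OracleComputes e emptyOracle (Nat.pair n (Encodable.encode σ)) m}, ?_, ?_, ?_⟩
    · have := (testLevel_re e).comp' (f := fun σ : List Bool => (n, σ)) (Primrec.to_comp (by fun_prop))
      exact this
    · refine lt_of_le_of_lt ?_ hn
      have h1 := ENNReal.toReal_mono (by simp) (h n)
      simpa [mu, measureReal_def, testLevel] using h1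
    · intro X hX _
      exact ⟨n, hX⟩
  · refine ⟨∅, re_dec (Primrec.to_comp (by simp; fun_prop)), ?_, ?_⟩
    · simpa [openOf, mu] using hε
    · intro X _ h'; exact absurd h' h

theorem sacks_null {D : ℕ → Bool} (hD : ¬ ComputableSet D) (e : ℕ) :
    mu {X | ∀ n m, OracleComputes e X n m ↔ m = natOfBool (D n)} = 0 := by
  set Z := {X | ∀ n m, OracleComputes e X n m ↔ m = natOfBool (D n)} with hZ
  by_contra hne
  have hpos : 0 < mu Z := lt_of_le_of_ne measureReal_nonneg (Ne.symm hne)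
  obtain ⟨σ, -, hσ⟩ := exists_dense (Z := Z) (ρ := []) (δ := 1/4) (by
    have : cylinder [] ∩ Z = Z := by
      rw [Set.inter_eq_right]; intro X _; rw [mem_cylinder_iff]; simp [strPrefix]
    rwa [this]) (by norm_num)
  apply hD
  apply computableSet_of_graph
  let q : ℕ × Bool → ℕ → List Bool → Bool := fun x _ τ => decide (σ <+: τ) && oc e τ x.1 (natOfBool x.2)
  have hq : ∀ x N (X : ℕ → Bool), q x N (strPrefix X N) = true → q x (N+1) (strPrefix X (N+1)) = true := by
    intro x N X h
    simp only [q, Bool.and_eq_true, decide_eq_true_eq] at h ⊢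
    have hp := strPrefix_mono_len X (Nat.le_succ N)
    exact ⟨h.1.trans hp, oc_mono hp h.2⟩
  have hset : ∀ x, {X | ∃ N, q x N (strPrefix X N) = true} = cylinder σ ∩ {X | OracleComputes e X x.1 (natOfBool x.2)} := by
    intro x; ext X
    simp only [Set.mem_ofPred_eq, q, Bool.and_eq_true, decide_eq_true_eq, Set.mem_inter_iff, oracleComputes_iff]
    constructor
    · rintro ⟨N, h1, h2⟩
      refine ⟨?_, N, h2⟩
      rw [mem_cylinder_iff]; exact (prefix_strPrefix h1).symm
    · rintro ⟨h1, N, h2⟩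
      rw [mem_cylinder_iff] at h1
      refine ⟨max σ.length N, ?_, oc_mono (strPrefix_mono_len X (le_max_right _ _)) h2⟩
      conv_lhs => rw [← h1]
      exact strPrefix_mono_len X (le_max_left _ _)
  have hiff : ∀ x : ℕ × Bool, x.2 = D x.1 ↔ (1/2:ℝ) * (1/2)^σ.length < mu {X | ∃ N, q x N (strPrefix X N) = true} := by
    intro x
    rw [hset]
    have hp : (0:ℝ) < (1/2)^σ.length := by positivity
    constructor
    · intro hx
      have : mu (cylinder σ ∩ Z) ≤ mu (cylinder σ ∩ {X | OracleComputes e X x.1 (natOfBool x.2)}) := by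
        refine measureReal_mono (Set.inter_subset_inter_right _ fun X hX => ?_)
        exact (hX x.1 _).2 (by rw [hx])
      linarith
    · intro hx
      by_contra hne
      have hd : Disjoint (cylinder σ ∩ {X | OracleComputes e X x.1 (natOfBool x.2)}) (cylinder σ ∩ Z) := by
        rw [Set.disjoint_left]
        rintro X ⟨-, h1⟩ ⟨-, h2⟩
        exact hne (natOfBool_inj ((h2 _ _).1 h1))
      have hm : MeasurableSet (cylinder σ ∩ {X | OracleComputes e X x.1 (natOfBool x.2)}) := by
        rw [← hset]
        have : {X | ∃ N, q x N (strPrefix X N) = true} = ⋃ N, {X | strPrefix X N ∈ {τ | q x N τ = true}} := by ext; simp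
        rw [this]
        exact MeasurableSet.iUnion fun N => determined_measurable _ _
      have h3 := measureReal_union' (μ := μCantor) hd hm
      have h4 : mu (cylinder σ ∩ {X | OracleComputes e X x.1 (natOfBool x.2)} ∪ cylinder σ ∩ Z) ≤ mu (cylinder σ) :=
        measureReal_mono (by intro X; simp; tauto)
      rw [mu_cylinder] at h4
      simp only [mu] at *
      linarith
  have hre : REPred fun x : ℕ × Bool => ∃ N, 2^N < cnt N (q x N) * 2 * 2^σ.length := by
    have hnb : Primrec natOfBool := by unfold natOfBool; fun_prop
    refine REPred.ex (p := fun x : (ℕ × Bool) × ℕ => 2^x.2 < cnt x.2 (q x.1 x.2) * 2 * 2^σ.length) (re_dec (Primrec.to_comp ?_))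
    simp only [q]
    fun_prop
  refine hre.of_eq fun x => ?_
  rw [hiff, mu_union_gt (hq x)]
  refine exists_congr fun N => ?_
  have : (2^N < cnt N (q x N) * 2 * 2^σ.length) ↔ ((2:ℝ)^N < cnt N (q x N) * 2 * 2^σ.length) := by exact_mod_cast Iff.rfl
  rw [this, one_div_pow, mul_comm (1/2:ℝ) _, mul_one_div, div_div, div_mul_eq_mul_div, one_mul, div_lt_iff₀ (by positivity)]
  rw [mul_comm ((2:ℝ)^σ.length) 2, mul_assoc]

theorem meet_sacks {D : ℕ → Bool} (hD : ¬ ComputableSet D) (e : ℕ) :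
    Meetable {X | ¬ ∀ n m, OracleComputes e X n m ↔ m = natOfBool (D n)} := by
  intro ε hε
  have hnull := sacks_null hD e
  set Z := {X | ∀ n m, OracleComputes e X n m ↔ m = natOfBool (D n)} with hZ
  let T : ℕ → Set (List Bool) := fun n => {τ | n ≤ τ.length ∧
    (∀ i ∈ List.range n, oc e τ i (natOfBool (((List.range n).map D)[i]?.getD false)) = true) ∧
    ¬ ∃ i ∈ List.range n, ∃ m ∈ List.range n, m ≠ natOfBool (((List.range n).map D)[i]?.getD false) ∧ oc e (τ.take n) i m = true}
  have hmem : ∀ n X, X ∈ openOf (T n) ↔ (∀ i < n, OracleComputes e X i (natOfBool (D i))) ∧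
      ¬ ∃ i < n, ∃ m < n, m ≠ natOfBool (D i) ∧ oc e (strPrefix X n) i m = true := by
    intro n X
    have hg : ∀ i < n, ((List.range n).map D)[i]?.getD false = D i := by
      intro i hi; simp [hi]
    rw [mem_openOf]
    simp only [T, Set.mem_ofPred_eq, strPrefix_length, List.mem_range]
    constructor
    · rintro ⟨N, h1, h2, h3⟩
      rw [strPrefix_take_of_le _ h1] at h3
      refine ⟨fun i hi => oracleComputes_iff.2 ⟨N, by have := h2 i hi; rwa [hg i hi] at this⟩, ?_⟩
      rintro ⟨i, hi, m, hm, h4, h5⟩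
      exact h3 ⟨i, hi, m, hm, by rwa [hg i hi], h5⟩
    · rintro ⟨h1, h2⟩
      have h1' : ∀ i, ∃ N, i < n → oc e (strPrefix X N) i (natOfBool (D i)) = true := by
        intro i
        by_cases hi : i < n
        · obtain ⟨N, hN⟩ := oracleComputes_iff.1 (h1 i hi); exact ⟨N, fun _ => hN⟩
        · exact ⟨0, fun h => absurd h hi⟩
      choose N hN using h1'
      refine ⟨max n ((Finset.range n).sup N), le_max_left _ _, ?_, ?_⟩
      · intro i hi
        rw [hg i hi]
        exact oc_mono (strPrefix_mono_len X ((Finset.le_sup (f := N) (by simpa using hi)).trans (le_max_right _ _))) (hN i hi)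
      · rw [strPrefix_take_of_le _ (le_max_left _ _)]
        rintro ⟨i, hi, m, hm, h4, h5⟩
        exact h2 ⟨i, hi, m, hm, by rwa [hg i hi] at h4, h5⟩
  have hanti : Antitone fun n => openOf (T n) := by
    refine antitone_nat_of_succ_le fun n X hX => ?_
    rw [hmem] at hX ⊢
    refine ⟨fun i hi => hX.1 i (by omega), ?_⟩
    rintro ⟨i, hi, m, hm, h4, h5⟩
    exact hX.2 ⟨i, by omega, m, by omega, h4, oc_mono (strPrefix_mono_len X (Nat.le_succ n)) h5⟩
  have hInter : ⋂ n, openOf (T n) = Z := by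
    ext X
    simp only [Set.mem_iInter, hmem, hZ, Set.mem_ofPred_eq]
    constructor
    · intro h n m
      constructor
      · intro hm
        by_contra hne
        obtain ⟨ℓ, hℓ⟩ := oracleComputes_iff.1 hm
        refine (h (max ℓ (max n m + 1))).2 ⟨n, by omega, m, by omega, hne, oc_mono (strPrefix_mono_len X (le_max_left _ _)) hℓ⟩
      · rintro rfl; exact (h (n+1)).1 n (by omega)
    · intro h n
      refine ⟨fun i _ => (h i _).2 rfl, ?_⟩
      rintro ⟨i, hi, m, hm, h4, h5⟩
      exact h4 ((h i m).1 (oracleComputes_iff.2 ⟨_, h5⟩))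
  have ht : Filter.Tendsto (fun n => mu (openOf (T n))) Filter.atTop (nhds (mu Z)) := by
    rw [← hInter]
    exact (ENNReal.tendsto_toReal (measure_ne_top _ _)).comp
      (tendsto_measure_iInter_atTop (fun n => (openOf_measurable _).nullMeasurableSet) hanti ⟨0, measure_ne_top _ _⟩)
  rw [hnull] at ht
  obtain ⟨n, hn⟩ := (ht.eventually (gt_mem_nhds hε)).exists
  refine ⟨T n, ?_, hn, ?_⟩
  · refine re_of_comp (f := fun x : List Bool × ℕ => decide (n ≤ x.1.length) &&
      ((List.range n).all fun i => oc e x.1 i (natOfBool (((List.range n).map D)[i]?.getD false))) &&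
      !((List.range n).any fun i => (List.range n).any fun m => decide (¬ m = natOfBool (((List.range n).map D)[i]?.getD false)) &&
        oc e (x.1.take n) i m)) (Primrec.to_comp ?_) ?_
    · have hnb : Primrec natOfBool := by unfold natOfBool; fun_prop
      generalize (List.range n).map D = d
      fun_prop
    · intro τ
      simp [T, and_assoc]
  · intro X hX hZX
    apply hX
    have : X ∈ ⋂ n, openOf (T n) := by rw [hInter]; exact hZX
    exact Set.mem_iInter.1 this n

open MeasureTheory ENNReal

theorem subC_inter {F G : Finset ℕ} (h : Disjoint F G) (v v' : ℕ → Bool) :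
    subC F v ∩ subC G v' = subC (F ∪ G) (fun i => if i ∈ F then v i else v' i) := by
  ext X
  simp only [subC, Set.mem_inter_iff, Set.mem_ofPred_eq, Finset.mem_union]
  constructor
  · rintro ⟨h1, h2⟩ i hi
    by_cases hF : i ∈ F
    · simp [hF, h1 i hF]
    · simp [hF, h2 i (by tauto)]
  · intro h1
    refine ⟨fun i hi => by simpa [hi] using h1 i (Or.inl hi), fun i hi => ?_⟩
    have : i ∉ F := fun hF => Finset.disjoint_left.1 h hF hi
    simpa [this] using h1 i (Or.inr hi)

theorem mu_subC_inter {F G : Finset ℕ} (h : Disjoint F G) (v v' : ℕ → Bool) :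
    mu (subC F v ∩ subC G v') = (1/2)^F.card * (1/2)^G.card := by
  rw [subC_inter h, mu_subC, Finset.card_union_of_disjoint h, pow_add]

theorem mu_subC_inter3 {F G H : Finset ℕ} (h : Disjoint F G) (h1 : Disjoint F H) (h2 : Disjoint G H) (v v' v'' : ℕ → Bool) :
    mu (subC F v ∩ subC G v' ∩ subC H v'') = (1/2)^F.card * (1/2)^G.card * (1/2)^H.card := by
  rw [subC_inter h, mu_subC_inter (Finset.disjoint_union_left.2 ⟨h1, h2⟩), Finset.card_union_of_disjoint h, pow_add]

theorem cylinder_subC (σ : List Bool) : cylinder σ = subC (Finset.range σ.length) (fun i => σ[i]?.getD false) := by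
  ext X
  rw [cylinder_eq]
  simp only [Set.mem_ofPred_eq, subC, Finset.mem_range]
  constructor
  · intro h i hi
    rw [← h, strPrefix_getElem? X (by simpa using hi)]; simp
  · intro h
    apply List.ext_getElem (by simp)
    intro i h1 h2
    have := h i h2
    simp [strPrefix, this, h2]

/-- block of positions -/
def blk (off z r : ℕ) : Finset ℕ := (Finset.range r).image fun i => off + Nat.pair z i

theorem blk_card (off z r : ℕ) : (blk off z r).card = r := by
  rw [blk, Finset.card_image_of_injective]
  · simp
  · intro a b h; simpa using h

theorem blk_disjoint {off z z' r r' : ℕ} (h : z ≠ z') : Disjoint (blk off z r) (blk off z' r') := by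
  rw [Finset.disjoint_left]
  intro p hp hp'
  simp [blk] at hp hp'
  obtain ⟨i, _, rfl⟩ := hp
  obtain ⟨j, _, h2⟩ := hp'
  have : Nat.pair z' j = Nat.pair z i := by omega
  rw [Nat.pair_eq_pair] at this
  exact h this.1.symm

theorem blk_range {off z r n : ℕ} (h : n ≤ off + z) : Disjoint (Finset.range n) (blk off z r) := by
  rw [Finset.disjoint_left]
  intro p hp hp'
  simp [blk] at hp hp'
  obtain ⟨i, _, rfl⟩ := hp'
  have := Nat.left_le_pair z i
  omega

/-- `z` is hit -/
def hitS (off z : ℕ) : Set (ℕ → Bool) := {X | ∀ i < (Nat.unpair z).1, X (off + Nat.pair z i) = false}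

theorem hitS_eq (off z : ℕ) : hitS off z = subC (blk off z (Nat.unpair z).1) (fun _ => false) := by
  ext X; simp [hitS, subC, blk]

/-- `z` is hit and the code bit is `b` -/
def EE (off z : ℕ) (b : Bool) : Set (ℕ → Bool) :=
  {X | (∀ i < (Nat.unpair z).1, X (off + Nat.pair z i) = false) ∧ X (off + Nat.pair z (Nat.unpair z).1) = b}

theorem EE_eq (off z : ℕ) (b : Bool) : EE off z b = subC (blk off z ((Nat.unpair z).1 + 1))
    (fun p => if p = off + Nat.pair z (Nat.unpair z).1 then b else false) := by
  ext X
  simp only [EE, subC, blk, Finset.mem_image, Finset.mem_range, Set.mem_ofPred_eq, forall_exists_index, and_imp,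
    forall_apply_eq_imp_iff₂, Nat.add_left_cancel_iff, Nat.pair_eq_pair, true_and]
  constructor
  · rintro ⟨h1, h2⟩ i hi
    split_ifs with h
    · rw [h, h2]
    · exact h1 i (by omega)
  · intro h
    refine ⟨fun i hi => ?_, ?_⟩
    · have := h i (by omega); rwa [if_neg (by omega)] at this
    · have := h _ (Nat.lt_succ_self _); rwa [if_pos rfl] at this

theorem hitS_measurable (off z : ℕ) : MeasurableSet (hitS off z) := by rw [hitS_eq]; exact subC_measurable _ _
theorem EE_measurable (off z : ℕ) (b : Bool) : MeasurableSet (EE off z b) := by rw [EE_eq]; exact subC_measurable _ _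

theorem mu_cyl_hit {σ : List Bool} {off z : ℕ} (h : σ.length ≤ off + z) :
    mu (cylinder σ ∩ hitS off z) = (1/2)^σ.length * wt z := by
  rw [cylinder_subC, hitS_eq, mu_subC_inter (blk_range h), blk_card, Finset.card_range, wt]

theorem mu_cyl_EE {σ : List Bool} {off z : ℕ} {b : Bool} (h : σ.length ≤ off + z) :
    mu (cylinder σ ∩ EE off z b) = (1/2)^σ.length * (wt z / 2) := by
  rw [cylinder_subC, EE_eq, mu_subC_inter (blk_range h), blk_card, Finset.card_range, wt, pow_succ]; ring

theorem mu_cyl_EE_hit {σ : List Bool} {off z z' : ℕ} {b : Bool} (h : σ.length ≤ off + z) (h' : σ.length ≤ off + z')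
    (hne : z ≠ z') :
    mu (cylinder σ ∩ EE off z b ∩ hitS off z') = (1/2)^σ.length * (wt z / 2) * wt z' := by
  rw [cylinder_subC, EE_eq, hitS_eq, mu_subC_inter3 (blk_range h) (blk_range h') (blk_disjoint hne)]
  simp only [blk_card, Finset.card_range, wt, pow_succ]; ring

theorem mu_cyl_EE_EE {σ : List Bool} {off z z' : ℕ} {b b' : Bool} (h : σ.length ≤ off + z) (h' : σ.length ≤ off + z')
    (hne : z ≠ z') :
    mu (cylinder σ ∩ EE off z b ∩ EE off z' b') = (1/2)^σ.length * (wt z / 2) * (wt z' / 2) := by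
  rw [cylinder_subC, EE_eq, EE_eq, mu_subC_inter3 (blk_range h) (blk_range h') (blk_disjoint hne)]
  simp only [blk_card, Finset.card_range, wt, pow_succ]; ring

theorem mu_biUnion_le (U : ℕ → Set (ℕ → Bool)) (L : Set ℕ) {C : ℝ}
    (h : ∀ F : Finset ℕ, ↑F ⊆ L → ∑ z ∈ F, mu (U z) ≤ C) : mu (⋃ z ∈ L, U z) ≤ C := by
  classical
  have e : (⋃ z ∈ L, U z) = ⋃ n : ℕ, ⋃ z ∈ (Finset.range n).filter (· ∈ L), U z := by
    ext X; simp only [Set.mem_iUnion, Finset.mem_filter, Finset.mem_range, exists_prop]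
    constructor
    · rintro ⟨z, hz, h⟩; exact ⟨z+1, z, ⟨by omega, hz⟩, h⟩
    · rintro ⟨n, z, hz, h⟩; exact ⟨z, hz.2, h⟩
  have hmono : Monotone fun n : ℕ => ⋃ z ∈ (Finset.range n).filter (· ∈ L), U z := by
    intro n m hnm X
    simp only [Set.mem_iUnion, Finset.mem_filter, Finset.mem_range, exists_prop]
    rintro ⟨z, hz, h⟩; exact ⟨z, ⟨by omega, hz.2⟩, h⟩
  have ht : Filter.Tendsto (fun n : ℕ => mu (⋃ z ∈ (Finset.range n).filter (· ∈ L), U z)) Filter.atTop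
      (nhds (mu (⋃ z ∈ L, U z))) := by
    rw [e]
    exact (ENNReal.tendsto_toReal (measure_ne_top _ _)).comp (tendsto_measure_iUnion_atTop hmono)
  refine le_of_tendsto' ht fun n => ?_
  refine (measureReal_biUnion_finset_le _ _).trans (h _ ?_)
  intro z hz; simp at hz; exact hz.2

theorem subset_sum {F : Finset ℕ} (hw : ∀ z ∈ F, wt z ≤ 1/8) (h : 1/4 < ∑ z ∈ F, wt z) :
    ∃ G ⊆ F, 1/4 < ∑ z ∈ G, wt z ∧ ∑ z ∈ G, wt z ≤ 3/8 := by
  induction F using Finset.strongInduction with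
  | H F ih =>
    by_cases h2 : ∑ z ∈ F, wt z ≤ 3/8
    · exact ⟨F, subset_rfl, h, h2⟩
    · have hne : F.Nonempty := by
        rw [Finset.nonempty_iff_ne_empty]; rintro rfl; simp at h; linarith
      obtain ⟨a, ha⟩ := hne
      have hs := Finset.add_sum_erase F wt ha
      obtain ⟨G, hG, h3⟩ := ih (F.erase a) (Finset.erase_ssubset ha) (fun z hz => hw z (Finset.mem_of_mem_erase hz))
        (by linarith [hw a ha])
      exact ⟨G, hG.trans (Finset.erase_subset _ _), h3⟩

/-- Bonferroni-type estimate -/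
theorem bonf {σ : List Bool} {off : ℕ} {b : Bool} {V : Set (ℕ → Bool)} (F : Finset ℕ)
    (hF : ∀ z ∈ F, σ.length ≤ z) (hV : V ⊆ cylinder σ)
    (hVE : ∀ z ∈ F, (1/2)^σ.length * (wt z / 4) ≤ mu (V ∩ EE off z b)) :
    (1/2)^σ.length * ((∑ z ∈ F, wt z) / 4 - (∑ z ∈ F, wt z)^2/8) ≤ mu (V ∩ ⋃ z ∈ F, EE off z b) := by
  induction F using Finset.induction_on with
  | empty => simp [mu]
  | insert a F ha ih =>
    have ih := ih (fun z hz => hF z (by simp [hz])) (fun z hz => hVE z (by simp [hz]))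
    rw [Finset.sum_insert ha, Finset.set_biUnion_insert]
    set w := ∑ z ∈ F, wt z
    set U := ⋃ z ∈ F, EE off z b
    have hU : MeasurableSet U := Finset.measurableSet_biUnion _ fun z _ => EE_measurable _ _ _
    have hE := EE_measurable off a b
    have h1 := measureReal_inter_add_sdiff (μ := μCantor) (s := V ∩ (EE off a b ∪ U)) (t := EE off a b) hE
    have h2 := measureReal_inter_add_sdiff (μ := μCantor) (s := V ∩ U) (t := EE off a b) hE
    have e1 : V ∩ (EE off a b ∪ U) ∩ EE off a b = V ∩ EE off a b := by ext; simp; tauto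
    have e2 : (V ∩ (EE off a b ∪ U)) \ EE off a b = (V ∩ U) \ EE off a b := by ext; simp; tauto
    rw [e1, e2] at h1
    have h3 : mu (V ∩ U ∩ EE off a b) ≤ (1/2)^σ.length * (wt a * w / 4) := by
      have hs : V ∩ U ∩ EE off a b ⊆ ⋃ z ∈ F, (cylinder σ ∩ EE off a b ∩ EE off z b) := by
        rintro X ⟨⟨h1, h2⟩, h3⟩
        simp only [U, Set.mem_iUnion] at h2 ⊢
        obtain ⟨z, hz, h2⟩ := h2
        exact ⟨z, hz, ⟨hV h1, h3⟩, h2⟩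
      refine (measureReal_mono hs (measure_ne_top _ _)).trans ((measureReal_biUnion_finset_le _ _).trans ?_)
      have : ∀ z ∈ F, mu (cylinder σ ∩ EE off a b ∩ EE off z b) = (1/2)^σ.length * (wt a / 4) * wt z := by
        intro z hz
        have e1 := hF a (by simp); have e2 := hF z (by simp [hz])
        rw [mu_cyl_EE_EE (by omega) (by omega) (by rintro rfl; exact ha hz)]; ring
      rw [Finset.sum_congr rfl this, ← Finset.mul_sum]
      apply le_of_eq; ring
    have h4 := hVE a (by simp)
    simp only [mu] at *
    have hp : (0:ℝ) ≤ (1/2)^σ.length * (wt a)^2 := by positivity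
    nlinarith

theorem openOf_union (S T : Set (List Bool)) : openOf (S ∪ T) = openOf S ∪ openOf T := by
  unfold openOf; exact Set.biUnion_union S T _

/-- bound on the positions used -/
noncomputable def nb (off : ℕ) (α : List Bool) (j : ℕ) : ℕ :=
  off + ((List.range (j+1)).map fun j' => ((zs α j').map fun z => Nat.pair z (Nat.unpair z).1 + 1).getD 0).sum

@[fun_prop] theorem nb_prim {α : Type*} [Primcodable α] {f : α → ℕ} {g : α → List Bool} {h : α → ℕ} (hf : Primrec f)
    (hg : Primrec g) (hh : Primrec h) : Primrec fun a => nb (f a) (g a) (h a) := by unfold nb; fun_prop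

theorem nb_lt {off : ℕ} {α : List Bool} {j j' z i : ℕ} (hj : j' ≤ j) (hz : zs α j' = some z) (hi : i ≤ (Nat.unpair z).1) :
    off + Nat.pair z i < nb off α j := by
  have h1 : Nat.pair z i ≤ Nat.pair z (Nat.unpair z).1 := by
    rcases hi.lt_or_eq with h | h
    · exact (Nat.pair_lt_pair_right _ h).le
    · rw [h]
  have h2 : Nat.pair z (Nat.unpair z).1 + 1 ≤ ((List.range (j+1)).map fun j' => ((zs α j').map fun z => Nat.pair z (Nat.unpair z).1 + 1).getD 0).sum := by
    apply List.single_le_sum (fun _ _ => Nat.zero_le _)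
    exact List.mem_map.2 ⟨j', List.mem_range.2 (by omega), by simp [hz]⟩
  unfold nb; omega

theorem nb_eq (A : ℕ → Bool) (off : ℕ) {j ℓ : ℕ} (h : j ≤ ℓ) : nb off (strPrefix A ℓ) j = nb off (strPrefix A j) j := by
  unfold nb
  congr 2
  apply List.map_congr_left
  intro i hi
  simp at hi
  rw [zs_eq A (by omega), zs_eq A (by omega)]

/-- one step of the construction -/
theorem forward_step {A : ℕ → Bool} (hA : ¬ KTrivial A) {Good : Set (ℕ → Bool)} (hG : Meetable Good) (b : Bool)
    {ρ : List Bool} {S : Set (List Bool)} (hS : REPred fun σ => σ ∈ S)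
    (hd : 1/4 * (1/2)^ρ.length ≤ mu (cylinder ρ ∩ (openOf S)ᶜ)) :
    ∃ ρ' S', (REPred fun σ => σ ∈ S') ∧ 1/4 * (1/2)^ρ'.length ≤ mu (cylinder ρ' ∩ (openOf S')ᶜ) ∧
      ρ <+: ρ' ∧ ρ.length < ρ'.length ∧ openOf S ⊆ openOf S' ∧ (openOf S')ᶜ ⊆ Good ∧
      ∃ j z, zA A j = some z ∧ ρ'.length = nb ρ.length (strPrefix A j) j ∧
        ∀ X ∈ cylinder ρ', X ∈ EE ρ.length z b ∧ ∀ j' < j, ∀ z', zA A j' = some z' → X ∉ hitS ρ.length z' := by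
  classical
  set off := ρ.length with hoff
  set P := (openOf S)ᶜ
  have hp0 : (0:ℝ) < (1/2)^off := by positivity
  obtain ⟨T, hT, hTm, hTG⟩ := hG ((1/2)^off/16) (by positivity)
  set Hu := ⋃ z ∈ LL A, (cylinder ρ ∩ hitS off z)
  have hHu : mu Hu ≤ (1/2)^off * (1/8) := by
    apply mu_biUnion_le
    intro F hF
    have : ∀ z ∈ F, mu (cylinder ρ ∩ hitS off z) = (1/2)^off * wt z := fun z _ => mu_cyl_hit (by omega)
    rw [Finset.sum_congr rfl this, ← Finset.mul_sum]
    exact mul_le_mul_of_nonneg_left (LL_bdd A F hF) hp0.le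
  -- positive measure
  have hpos : 0 < mu (cylinder ρ ∩ (P \ (Hu ∪ openOf T))) := by
    have h1 : cylinder ρ ∩ P ⊆ (cylinder ρ ∩ (P \ (Hu ∪ openOf T))) ∪ (Hu ∪ openOf T) := by
      intro X; simp; tauto
    have h2 := (measureReal_mono (μ := μCantor) h1).trans (measureReal_union_le _ _)
    have h3 := measureReal_union_le (μ := μCantor) Hu (openOf T)
    simp only [mu] at *
    linarith
  obtain ⟨σ, hρσ, hσ⟩ := exists_dense hpos (δ := 1/64) (by norm_num)
  have hσlen : off ≤ σ.length := hρσ.length_le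
  -- finite part of L
  let l : List ℕ := (List.range σ.length).filter fun z => decide (z ∈ LL A)
  have hl : ∀ z, z ∈ l ↔ z < σ.length ∧ z ∈ LL A := by intro z; simp [l]
  let HS : Set (List Bool) := {τ | ∃ z ∈ l, ∀ i ∈ List.range (Nat.unpair z).1, τ[off + Nat.pair z i]? = some false}
  have hHS : ∀ X, X ∈ openOf HS ↔ ∃ z, z < σ.length ∧ z ∈ LL A ∧ X ∈ hitS off z := by
    intro X
    rw [mem_openOf]
    simp only [HS, Set.mem_ofPred_eq, hl, List.mem_range, hitS]
    constructor
    · rintro ⟨n, z, hz, h⟩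
      refine ⟨z, hz.1, hz.2, fun i hi => ?_⟩
      have h1 := h i hi
      have hlt : off + Nat.pair z i < n := by
        have := (List.getElem?_eq_some_iff.1 h1).1; simpa using this
      rw [strPrefix_getElem? X hlt] at h1; simpa using h1
    · rintro ⟨z, h1, h2, h⟩
      refine ⟨off + Nat.pair z (Nat.unpair z).1, z, ⟨h1, h2⟩, fun i hi => ?_⟩
      rw [strPrefix_getElem? X (by have := Nat.pair_lt_pair_right z hi; omega), h i hi]
  have hHSre : REPred fun τ => τ ∈ HS := by
    refine re_of_comp (f := fun x : List Bool × ℕ => l.any fun z => (List.range (Nat.unpair z).1).all fun i =>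
      decide (x.1[off + Nat.pair z i]? = some false)) (Primrec.to_comp ?_) ?_
    · fun_prop
    · intro τ; simp [HS]
  set S' := (S ∪ T) ∪ HS with hS'
  have hS're : REPred fun τ => τ ∈ S' := (hS.or' hT).or' hHSre
  have hopen : openOf S' = openOf S ∪ openOf T ∪ openOf HS := by rw [hS', openOf_union, openOf_union]
  have hdens : (1 - 1/64) * (1/2)^σ.length < mu (cylinder σ ∩ (openOf S')ᶜ) := by
    refine hσ.trans_le (measureReal_mono ?_)
    rintro X ⟨h1, h2, h3⟩
    refine ⟨h1, ?_⟩
    rw [hopen]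
    rintro ((h | h) | h)
    · exact h2 h
    · exact h3 (Or.inr h)
    · obtain ⟨z, -, hz, hX⟩ := (hHS X).1 h
      refine h3 (Or.inl ?_)
      simp only [Hu, Set.mem_iUnion]
      exact ⟨z, hz, cylinder_subset hρσ h1, hX⟩
  have hp1 : (0:ℝ) < (1/2)^σ.length := by positivity
  have hmS' := openOf_measurable S'
  have hVsmall : mu (cylinder σ ∩ openOf S') < 1/64 * (1/2)^σ.length := by
    have h1 := measureReal_inter_add_sdiff (μ := μCantor) (s := cylinder σ) (t := openOf S') hmS'
    have h2 := mu_cylinder σ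
    rw [Set.diff_eq] at h1
    simp only [mu] at *
    linarith
  -- the request set M
  let M : Set ℕ := {z | σ.length ≤ z ∧ 3 ≤ (Nat.unpair z).1 ∧
    (1/2)^σ.length * (wt z / 4) < mu (cylinder σ ∩ openOf S' ∩ EE off z b)}
  have hMre : REPred fun z => z ∈ M := by
    obtain ⟨f, hf, hfm, hfi⟩ := re_normal hS're
    let q : ℕ → ℕ → List Bool → Bool := fun z N τ => decide (σ <+: τ) &&
      ((List.range (N+1)).any fun m => f (τ.take m, N)) &&
      ((List.range (Nat.unpair z).1).all fun i => decide (τ[off + Nat.pair z i]? = some false)) &&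
      decide (τ[off + Nat.pair z (Nat.unpair z).1]? = some b)
    have hget : ∀ (X : ℕ → Bool) p N c, (strPrefix X N)[p]? = some c ↔ p < N ∧ X p = c := by
      intro X p N c
      by_cases hp : p < N
      · rw [strPrefix_getElem? X hp]; simp [hp]
      · rw [List.getElem?_eq_none (by simpa using hp)]; simp [hp]
    have hqi : ∀ z N (X : ℕ → Bool), q z N (strPrefix X N) = true ↔ σ <+: strPrefix X N ∧
        (∃ m ≤ N, f (strPrefix X m, N) = true) ∧ (∀ i < (Nat.unpair z).1, off + Nat.pair z i < N ∧ X (off + Nat.pair z i) = false) ∧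
        (off + Nat.pair z (Nat.unpair z).1 < N ∧ X (off + Nat.pair z (Nat.unpair z).1) = b) := by
      intro z N X
      simp only [q, Bool.and_eq_true, decide_eq_true_eq, List.any_eq_true, List.mem_range, List.all_eq_true, hget, and_assoc]
      refine and_congr_right fun _ => and_congr_left fun _ => ?_
      constructor
      · rintro ⟨m, hm, h⟩; rw [strPrefix_take_of_le _ (by omega)] at h; exact ⟨m, by omega, h⟩
      · rintro ⟨m, hm, h⟩; exact ⟨m, by omega, by rwa [strPrefix_take_of_le _ (by omega)]⟩
    have hqm : ∀ z N (X : ℕ → Bool), q z N (strPrefix X N) = true → q z (N+1) (strPrefix X (N+1)) = true := by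
      intro z N X
      rw [hqi, hqi]
      rintro ⟨h1, ⟨m, hm, h2⟩, h3, h4⟩
      exact ⟨h1.trans (strPrefix_mono_len X (Nat.le_succ N)), ⟨m, by omega, hfm _ _ _ (Nat.le_succ N) h2⟩,
        fun i hi => ⟨by have := (h3 i hi).1; omega, (h3 i hi).2⟩, by omega, h4.2⟩
    have hqs : ∀ z, {X | ∃ N, q z N (strPrefix X N) = true} = cylinder σ ∩ openOf S' ∩ EE off z b := by
      intro z; ext X
      simp only [Set.mem_ofPred_eq, hqi, Set.mem_inter_iff, EE]
      constructor
      · rintro ⟨N, h1, ⟨m, hm, h2⟩, h3, h4⟩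
        refine ⟨⟨?_, mem_openOf.2 ⟨m, (hfi _).2 ⟨_, h2⟩⟩⟩, fun i hi => (h3 i hi).2, h4.2⟩
        rw [mem_cylinder_iff]; exact (prefix_strPrefix h1).symm
      · rintro ⟨⟨h1, h2⟩, h3, h4⟩
        rw [mem_cylinder_iff] at h1
        obtain ⟨m, hm⟩ := mem_openOf.1 h2
        obtain ⟨s, hs⟩ := (hfi _).1 hm
        have hbd : ∀ i < (Nat.unpair z).1, Nat.pair z i < Nat.pair z (Nat.unpair z).1 := fun i hi => Nat.pair_lt_pair_right z hi
        refine ⟨σ.length + m + s + (off + Nat.pair z (Nat.unpair z).1 + 1), ?_, ⟨m, by omega, hfm _ _ _ (by omega) hs⟩,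
          fun i hi => ⟨by have := hbd i hi; omega, h3 i hi⟩, by omega, h4⟩
        conv_lhs => rw [← h1]
        exact strPrefix_mono_len X (by omega)
    have hre : REPred fun z : ℕ => (σ.length ≤ z ∧ 3 ≤ (Nat.unpair z).1) ∧ ∃ N, 2^N < cnt N (q z N) * 4 * 2^(Nat.unpair z).1 * 2^σ.length := by
      refine REPred.and' (re_dec (Primrec.to_comp (by fun_prop))) ?_
      refine REPred.ex (p := fun x : ℕ × ℕ => 2^x.2 < cnt x.2 (q x.1 x.2) * 4 * 2^(Nat.unpair x.1).1 * 2^σ.length) (re_dec (Primrec.to_comp ?_))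
      simp only [q]
      fun_prop
    refine hre.of_eq fun z => ?_
    simp only [M, Set.mem_ofPred_eq, and_assoc]
    refine and_congr_right fun _ => and_congr_right fun _ => ?_
    rw [← hqs, mu_union_gt (hqm z)]
    refine exists_congr fun N => ?_
    have : (2^N < cnt N (q z N) * 4 * 2^(Nat.unpair z).1 * 2^σ.length) ↔
      ((2:ℝ)^N < cnt N (q z N) * 4 * 2^(Nat.unpair z).1 * 2^σ.length) := by exact_mod_cast Iff.rfl
    rw [this, wt, one_div_pow, one_div_pow]
    generalize ((cnt N (q z N) : ℕ) : ℝ) = c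
    have e1 : (0:ℝ) < 2^σ.length := by positivity
    have e2 : (0:ℝ) < 2^(Nat.unpair z).1 := by positivity
    have : (1 / (2:ℝ) ^ σ.length * (1 / 2 ^ (Nat.unpair z).1 / 4) * 2 ^ N) = 2^N / (4 * 2^(Nat.unpair z).1 * 2^σ.length) := by
      field_simp
    rw [this, div_lt_iff₀ (by positivity)]
    simp only [mul_assoc]
  have hMb : Bdd M (1/4) := by
    intro F hF
    by_contra! hcon
    obtain ⟨G, hGF, hG1, hG2⟩ := subset_sum (F := F) (by
      intro z hz
      have := (hF hz).2.1
      rw [wt]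
      calc (1/2:ℝ)^(Nat.unpair z).1 ≤ (1/2)^3 := pow_le_pow_of_le_one (by norm_num) (by norm_num) this
        _ ≤ _ := by norm_num) hcon
    have := bonf (σ := σ) (off := off) (b := b) (V := cylinder σ ∩ openOf S') G (fun z hz => (hF (hGF hz)).1)
      Set.inter_subset_left (fun z hz => (hF (hGF hz)).2.2.le)
    have h2 : mu (cylinder σ ∩ openOf S' ∩ ⋃ z ∈ G, EE off z b) ≤ mu (cylinder σ ∩ openOf S') :=
      measureReal_mono Set.inter_subset_left
    have h5 : (1/64:ℝ) ≤ (∑ z ∈ G, wt z)/4 - (∑ z ∈ G, wt z)^2/8 := by nlinarith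
    have h6 := mul_le_mul_of_nonneg_left h5 (show (0:ℝ) ≤ (1/2)^σ.length by positivity)
    simp only [mu] at *
    linarith
  obtain ⟨z, hzL, hzM, hzσ⟩ := LL_uncovered hA hMre hMb σ.length
  have hEP : (1/2)^σ.length * (wt z / 4) ≤ mu (cylinder σ ∩ EE off z b ∩ (openOf S')ᶜ) := by
    have h1 : mu (cylinder σ ∩ openOf S' ∩ EE off z b) ≤ (1/2)^σ.length * (wt z / 4) := by
      by_contra! h; exact hzM ⟨hzσ, LL_three hzL, h⟩
    have h2 := measureReal_inter_add_sdiff (μ := μCantor) (s := cylinder σ ∩ EE off z b) (t := openOf S') hmS'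
    have h3 := mu_cyl_EE (σ := σ) (off := off) (z := z) (b := b) (by omega)
    rw [Set.inter_right_comm] at h1
    rw [Set.diff_eq] at h2
    simp only [mu] at *
    linarith
  have hj : ∃ j, zA A j = some z := hzL
  set j := Nat.find hj
  have hjz : zA A j = some z := Nat.find_spec hj
  set off' := nb off (strPrefix A j) j with hoff'
  let G : Finset ℕ := (Finset.range j).biUnion fun j' => (zA A j').toFinset
  have hGm : ∀ z', z' ∈ G ↔ ∃ j' < j, zA A j' = some z' := by intro z'; simp [G]
  have hzG : z ∉ G := by
    intro h
    obtain ⟨j', h1, h2⟩ := (hGm z).1 h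
    exact Nat.find_min hj h1 h2
  let Bad := ⋃ z' ∈ G.filter (fun z' => σ.length ≤ z'), (cylinder σ ∩ EE off z b ∩ hitS off z')
  have hBad : mu Bad ≤ (1/2)^σ.length * (wt z / 2) * (1/8) := by
    refine (measureReal_biUnion_finset_le _ _).trans ?_
    have : ∀ z' ∈ G.filter (fun z' => σ.length ≤ z'), mu (cylinder σ ∩ EE off z b ∩ hitS off z') =
        (1/2)^σ.length * (wt z / 2) * wt z' := by
      intro z' hz'
      simp only [Finset.mem_filter] at hz'
      exact mu_cyl_EE_hit (by omega) (by omega) (by rintro rfl; exact hzG hz'.1)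
    simp only [mu] at this
    rw [Finset.sum_congr rfl this, ← Finset.mul_sum]
    refine mul_le_mul_of_nonneg_left (LL_bdd A _ ?_) (by have := wt_pos z; positivity)
    intro z' hz'
    simp only [Finset.coe_filter, Set.mem_ofPred_eq, hGm] at hz'
    obtain ⟨⟨j', _, h⟩, _⟩ := hz'
    exact ⟨j', h⟩
  -- the clopen condition
  let Wc : Set (ℕ → Bool) := (cylinder σ ∩ EE off z b) ∩ {X | ∀ j' < j, ∀ z', zA A j' = some z' → X ∉ hitS off z'}
  let Q : List Bool → Bool := fun τ => decide (cylinder τ ⊆ Wc)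
  have hzs : ∀ j' ≤ j, ∀ z', zA A j' = some z' → ∀ i ≤ (Nat.unpair z').1, off + Nat.pair z' i < off' := by
    intro j' hj' z' hz' i hi
    exact nb_lt hj' (by rw [zs_eq A hj']; exact hz') hi
  have hσoff : σ.length < off' := by
    have := hzs j le_rfl z hjz 0 (by omega)
    have := Nat.left_le_pair z 0; omega
  have hWQ : Wc = {X | Q (strPrefix X off') = true} := by
    ext X
    simp only [Q, Set.mem_ofPred_eq, decide_eq_true_eq]
    constructor
    · rintro ⟨⟨h1, h2⟩, h3⟩ Y hY
      rw [mem_cylinder_iff, strPrefix_length, strPrefix_eq_iff] at hY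
      refine ⟨⟨?_, fun i hi => ?_, ?_⟩, ?_⟩
      · rw [mem_cylinder_iff] at h1 ⊢
        exact Eq.trans (strPrefix_congr fun i hi => hY i (by omega)) h1
      · rw [hY _ (hzs j le_rfl z hjz i hi.le)]; exact h2.1 i hi
      · rw [hY _ (hzs j le_rfl z hjz _ le_rfl)]; exact h2.2
      · intro j' hj' z' hz' hh
        refine h3 j' hj' z' hz' fun i hi => ?_
        rw [← hY _ (hzs j' hj'.le z' hz' i hi.le)]; exact hh i hi
    · intro h
      exact h (isPrefixOf_strPrefix X off')
  have hWP : (1/2)^σ.length * (wt z / 2) * (3/8) ≤ mu (Wc ∩ (openOf S')ᶜ) := by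
    have hs : cylinder σ ∩ EE off z b ∩ (openOf S')ᶜ ⊆ (Wc ∩ (openOf S')ᶜ) ∪ Bad := by
      rintro X ⟨hX1, hX2⟩
      by_cases hB : X ∈ Bad
      · exact Or.inr hB
      · refine Or.inl ⟨⟨hX1, fun j' hj' z' hz' hh => ?_⟩, hX2⟩
        by_cases hlt : z' < σ.length
        · apply hX2
          rw [hopen]
          exact Or.inr ((hHS X).2 ⟨z', hlt, ⟨j', hz'⟩, hh⟩)
        · apply hB
          simp only [Bad, Set.mem_iUnion, Finset.mem_filter, hGm]
          exact ⟨z', ⟨⟨j', hj', hz'⟩, by omega⟩, hX1, hh⟩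
    have h2 := (measureReal_mono (μ := μCantor) hs).trans (measureReal_union_le _ _)
    simp only [mu] at *
    linarith
  have hWm : mu Wc ≤ (1/2)^σ.length * (wt z / 2) := by
    rw [← mu_cyl_EE (σ := σ) (off := off) (z := z) (b := b) (by omega)]
    exact measureReal_mono Set.inter_subset_left
  obtain ⟨τ, hτlen, hτQ, hτ⟩ : ∃ τ, τ.length = off' ∧ Q τ = true ∧ 1/4 * (1/2)^off' ≤ mu (cylinder τ ∩ (openOf S')ᶜ) := by
    by_contra! hcon
    have h1 := mu_decomp off' Q (S := (openOf S')ᶜ)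
    rw [← hWQ] at h1
    have h2 : ∑ τ ∈ ((strL off').filter Q).toFinset, mu (cylinder τ ∩ (openOf S')ᶜ) ≤
        ∑ τ ∈ ((strL off').filter Q).toFinset, (1/4 * (1/2)^off' : ℝ) := by
      refine Finset.sum_le_sum fun τ hτ => ?_
      simp at hτ
      exact (hcon τ hτ.1 hτ.2).le
    have h3 := mu_cnt off' Q
    rw [← hWQ, ← toFinset_card_strL] at h3
    rw [Finset.sum_const, nsmul_eq_mul] at h2
    have h4 : (((strL off').filter Q).toFinset.card : ℝ) * (1/4 * (1/2)^off') = 1/4 * mu Wc := by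
      clear_value off'
      rw [h3, one_div_pow]
      generalize (((strL off').filter Q).toFinset.card : ℝ) = c
      ring
    have := wt_pos z
    have : (0:ℝ) < (1/2)^σ.length * (wt z / 2) := by positivity
    rw [h4] at h2
    linarith
  have hτW : cylinder τ ⊆ Wc := by simpa [Q] using hτQ
  have hστ : σ <+: τ := by
    let X : ℕ → Bool := fun i => τ[i]?.getD false
    have hX : X ∈ cylinder τ := by rw [cylinder_subC]; intro i _; rfl
    have h1 := (hτW hX).1.1
    rw [mem_cylinder_iff] at hX h1
    rw [← h1, ← hX]
    exact strPrefix_mono_len X (by omega)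
  refine ⟨τ, S', hS're, by rw [hτlen]; exact hτ, hρσ.trans hστ, by omega, ?_, ?_, j, z, hjz, hτlen, ?_⟩
  · rw [hopen]; intro X hX; exact Or.inl (Or.inl hX)
  · rw [hopen]; intro X hX; exact hTG fun h => hX (Or.inl (Or.inr h))
  · intro X hX; exact ⟨(hτW hX).1.2, (hτW hX).2⟩

open MeasureTheory ENNReal

/-- even part of a string -/
def evs (η : List Bool) : List Bool := (List.range (η.length/2)).map fun m => η[2*m]?.getD false
/-- odd part of a string -/
def ods (η : List Bool) : List Bool := (List.range (η.length/2)).map fun m => η[2*m+1]?.getD false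
/-- join of two strings -/
def jn (α ρ : List Bool) : List Bool := (List.range (2*ρ.length)).map fun m =>
  if m % 2 = 0 then α[m/2]?.getD false else ρ[m/2]?.getD false

@[fun_prop] theorem evs_prim {α : Type*} [Primcodable α] {f : α → List Bool} (hf : Primrec f) : Primrec fun a => evs (f a) := by
  unfold evs; fun_prop
@[fun_prop] theorem ods_prim {α : Type*} [Primcodable α] {f : α → List Bool} (hf : Primrec f) : Primrec fun a => ods (f a) := by
  unfold ods; fun_prop
@[fun_prop] theorem jn_prim {α : Type*} [Primcodable α] {f g : α → List Bool} (hf : Primrec f) (hg : Primrec g) :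
    Primrec fun a => jn (f a) (g a) := by
  unfold jn; fun_prop

theorem evs_join (A R : ℕ → Bool) (ℓ : ℕ) : evs (strPrefix (joinSet A R) ℓ) = strPrefix A (ℓ/2) := by
  unfold evs
  rw [strPrefix_length]
  apply List.map_congr_left
  intro m hm
  simp at hm
  rw [strPrefix_getElem? _ (by omega)]
  simp [joinSet]

theorem ods_join (A R : ℕ → Bool) (ℓ : ℕ) : ods (strPrefix (joinSet A R) ℓ) = strPrefix R (ℓ/2) := by
  unfold ods
  rw [strPrefix_length]
  apply List.map_congr_left
  intro m hm
  simp at hm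
  rw [strPrefix_getElem? _ (by omega)]
  have : (2*m+1)/2 = m := by omega
  simp [joinSet, this]

theorem jn_join (A R : ℕ → Bool) {ℓ k : ℕ} (h : k ≤ ℓ) : jn (strPrefix A ℓ) (strPrefix R k) = strPrefix (joinSet A R) (2*k) := by
  unfold jn
  rw [strPrefix_length]
  conv_rhs => rw [strPrefix]
  apply List.map_congr_left
  intro m hm
  simp at hm
  rw [strPrefix_getElem? _ (by omega), strPrefix_getElem? _ (by omega)]
  simp [joinSet]

theorem turingLE_join_of {D A R : ℕ → Bool} {p : List Bool × List Bool × ℕ × Bool → Prop} (hp : REPred p)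
    (h1 : ∀ n, ∃ ℓ, p (strPrefix A ℓ, strPrefix R ℓ, n, D n))
    (h2 : ∀ n b ℓ, p (strPrefix A ℓ, strPrefix R ℓ, n, b) → b = D n) : TuringLE D (joinSet A R) := by
  refine turingLE_of (p := fun x => p (evs x.1, ods x.1, x.2.1, x.2.2))
    (REPred.comp' (f := fun x : List Bool × ℕ × Bool => (evs x.1, ods x.1, x.2.1, x.2.2)) hp (Primrec.to_comp (by fun_prop))) ?_ ?_
  · intro n
    obtain ⟨ℓ, h⟩ := h1 n
    refine ⟨2*ℓ, ?_⟩
    simp only [evs_join, ods_join]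
    have : 2*ℓ/2 = ℓ := by omega
    rwa [this]
  · intro n b ℓ h
    simp only [evs_join, ods_join] at h
    exact h2 n b _ h

/-- candidate test -/
noncomputable def dcand (α ρ : List Bool) (off j : ℕ) : Bool :=
  (zs α j).elim false fun z => (List.range (Nat.unpair z).1).all fun i => decide (ρ[off + Nat.pair z i]? = some false)

/-- decoder step -/
noncomputable def dstep (α ρ : List Bool) (off : ℕ) : Option (ℕ × Bool) :=
  (((List.range α.length).filter fun j => dcand α ρ off j).head?).bind fun j =>
    if nb off α j ≤ ρ.length then
      (zs α j).map fun z => (nb off α j, ρ[off + Nat.pair z (Nat.unpair z).1]?.getD false) else none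

@[fun_prop] theorem dcand_prim {β : Type*} [Primcodable β] {f g : β → List Bool} {h k : β → ℕ} (hf : Primrec f)
    (hg : Primrec g) (hh : Primrec h) (hk : Primrec k) : Primrec fun a => dcand (f a) (g a) (h a) (k a) := by
  unfold dcand; fun_prop

@[fun_prop] theorem dstep_prim {β : Type*} [Primcodable β] {f g : β → List Bool} {h : β → ℕ} (hf : Primrec f)
    (hg : Primrec g) (hh : Primrec h) : Primrec fun a => dstep (f a) (g a) (h a) := by
  unfold dstep; fun_prop

/-- decoder -/
noncomputable def drun (α ρ : List Bool) (n : ℕ) : Option (ℕ × Bool) :=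
  (fun p : Option (ℕ × Bool) => p.bind fun q => dstep α ρ q.1)^[n] (some (0, false))

@[fun_prop] theorem drun_prim {β : Type*} [Primcodable β] {f g : β → List Bool} {h : β → ℕ} (hf : Primrec f)
    (hg : Primrec g) (hh : Primrec h) : Primrec fun a => drun (f a) (g a) (h a) := by
  unfold drun; fun_prop

theorem drun_succ (α ρ : List Bool) (n : ℕ) : drun α ρ (n+1) = (drun α ρ n).bind fun q => dstep α ρ q.1 := by
  simp only [drun, Function.iterate_succ_apply']

theorem sp_get (X : ℕ → Bool) (p N : ℕ) (c : Bool) : (strPrefix X N)[p]? = some c ↔ p < N ∧ X p = c := by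
  by_cases hp : p < N
  · rw [strPrefix_getElem? X hp]; simp [hp]
  · rw [List.getElem?_eq_none (by simpa using hp)]; simp [hp]

theorem dcand_iff {A R : ℕ → Bool} {ℓ off j : ℕ} (hj : j < ℓ) : dcand (strPrefix A ℓ) (strPrefix R ℓ) off j = true ↔
    ∃ z, zA A j = some z ∧ ∀ i < (Nat.unpair z).1, off + Nat.pair z i < ℓ ∧ R (off + Nat.pair z i) = false := by
  unfold dcand
  rw [zs_eq A hj.le]
  cases h : zA A j <;> simp [sp_get]

theorem dstep_spec {A R : ℕ → Bool} {off j z : ℕ} {b : Bool} (hj : zA A j = some z) (hE : R ∈ EE off z b)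
    (hn : ∀ j' < j, ∀ z', zA A j' = some z' → R ∉ hitS off z') :
    (∀ ℓ x, dstep (strPrefix A ℓ) (strPrefix R ℓ) off = some x → x = (nb off (strPrefix A j) j, b)) ∧
    ∃ ℓ0, ∀ ℓ ≥ ℓ0, dstep (strPrefix A ℓ) (strPrefix R ℓ) off = some (nb off (strPrefix A j) j, b) := by
  have hnb : ∀ i ≤ (Nat.unpair z).1, off + Nat.pair z i < nb off (strPrefix A j) j := fun i hi => nb_lt le_rfl hj hi
  have hmin : ∀ ℓ j', j' < ℓ → dcand (strPrefix A ℓ) (strPrefix R ℓ) off j' = true → j ≤ j' := by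
    intro ℓ j' hj' hc
    by_contra! h
    obtain ⟨z', h1, h2⟩ := (dcand_iff hj').1 hc
    exact hn j' h z' h1 fun i hi => (h2 i hi).2
  have key : ∀ ℓ, j < ℓ → nb off (strPrefix A j) j ≤ ℓ →
      dstep (strPrefix A ℓ) (strPrefix R ℓ) off = some (nb off (strPrefix A j) j, b) := by
    intro ℓ h1 h2
    have hc : dcand (strPrefix A ℓ) (strPrefix R ℓ) off j = true :=
      (dcand_iff h1).2 ⟨z, hj, fun i hi => ⟨(hnb i hi.le).trans_le h2, hE.1 i hi⟩⟩
    have hh : ((List.range ℓ).filter fun j => dcand (strPrefix A ℓ) (strPrefix R ℓ) off j).head? = some j := by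
      rw [List.head?_filter, List.find?_range_eq_some]
      refine ⟨hc, by simpa using h1, fun j' hj' => ?_⟩
      by_contra h
      have := hmin ℓ j' (hj'.trans h1) (by simpa using h)
      omega
    unfold dstep
    rw [strPrefix_length, hh]
    simp only [Option.bind_some, strPrefix_length]
    rw [nb_eq A off h1.le, if_pos h2, zs_eq A h1.le, hj, Option.map_some,
      strPrefix_getElem? R ((hnb _ le_rfl).trans_le h2), hE.2]
    rfl
  refine ⟨?_, j + 1 + nb off (strPrefix A j) j, fun ℓ hℓ => key ℓ (by omega) (by omega)⟩
  intro ℓ x hx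
  have hx' := hx
  unfold dstep at hx
  rw [strPrefix_length] at hx
  cases hh : ((List.range ℓ).filter fun j => dcand (strPrefix A ℓ) (strPrefix R ℓ) off j).head? with
  | none => rw [hh] at hx; simp at hx
  | some j' =>
    rw [hh] at hx
    rw [List.head?_filter, List.find?_range_eq_some] at hh
    obtain ⟨h1, h2, h3⟩ := hh
    have h2 : j' < ℓ := by simpa using h2
    have hle := hmin ℓ j' h2 h1
    simp only [Option.bind_some, strPrefix_length] at hx
    split_ifs at hx with hle2
    have hnn : nb off (strPrefix A j) j ≤ ℓ := by
      refine le_trans ?_ hle2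
      rw [← nb_eq A off (hle.trans h2.le)]
      unfold nb
      have : (List.range (j'+1)) = List.range (j+1) ++ ((List.range (j'-j)).map (j + 1 + ·)) := by
        rw [← List.range_add]; congr 1; omega
      rw [this, List.map_append, List.sum_append]
      omega
    rw [key ℓ (by omega) hnn] at hx'
    simpa using hx'.symm

theorem forward {A D : ℕ → Bool} (hA : ¬ KTrivial A) (hD : ¬ ComputableSet D) :
    ∃ R, MLRandom R ∧ ¬ TuringLE D R ∧ TuringLE D (joinSet A R) := by
  classical
  let Good : ℕ → Set (ℕ → Bool) := fun i => if i % 2 = 0 then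
    {X | (∀ n, μCantor (testLevel (i/2) emptyOracle n) ≤ 2⁻¹ ^ n) → ∃ n, X ∉ testLevel (i/2) emptyOracle n} else
    {X | ¬ ∀ n m, OracleComputes (i/2) X n m ↔ m = natOfBool (D n)}
  have hGood : ∀ i, Meetable (Good i) := by
    intro i
    simp only [Good]
    split_ifs
    · exact meet_test _
    · exact meet_sacks hD _
  let St := {x : List Bool × Set (List Bool) // REPred (fun σ => σ ∈ x.2) ∧
    1/4*(1/2)^x.1.length ≤ mu (cylinder x.1 ∩ (openOf x.2)ᶜ)}
  have step : ∀ (i : ℕ) (x : St), ∃ y : St, x.1.1 <+: y.1.1 ∧ x.1.1.length < y.1.1.length ∧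
      openOf x.1.2 ⊆ openOf y.1.2 ∧ (openOf y.1.2)ᶜ ⊆ Good i ∧ ∃ j z, zA A j = some z ∧
      y.1.1.length = nb x.1.1.length (strPrefix A j) j ∧ ∀ X ∈ cylinder y.1.1, X ∈ EE x.1.1.length z (D i) ∧
        ∀ j' < j, ∀ z', zA A j' = some z' → X ∉ hitS x.1.1.length z' := by
    intro i x
    obtain ⟨ρ', S', h1, h2, h3⟩ := forward_step hA (hGood i) (D i) x.2.1 x.2.2
    exact ⟨⟨(ρ', S'), h1, h2⟩, h3⟩
  choose nxt hnxt using step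
  let x0 : St := ⟨([], ∅), by
    exact (re_dec (p := fun _ : List Bool => False) (Primrec.to_comp (by simp only [decide_false]; fun_prop))).of_eq (by simp), by
    have h1 : openOf (∅ : Set (List Bool)) = ∅ := by simp [openOf]
    simp only [h1]
    have := mu_cylinder []
    simp at this ⊢
    simp only [mu] at *
    rw [this]; norm_num⟩
  let xs : ℕ → St := fun i => Nat.rec x0 (fun i x => nxt i x) i
  have hxs : ∀ i, xs (i+1) = nxt i (xs i) := fun i => rfl
  let ρ := fun i => (xs i).1.1
  let S := fun i => (xs i).1.2
  have hst := fun i => hnxt i (xs i)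
  simp only [← hxs] at hst
  have hlen : ∀ i, i ≤ (ρ i).length := by
    intro i
    induction i with
    | zero => omega
    | succ i ih => have := (hst i).2.1; simp only [ρ] at *; omega
  have hpre : ∀ i k, ρ i <+: ρ (i+k) := by
    intro i k
    induction k with
    | zero => simp
    | succ k ih => exact ih.trans (hst (i+k)).1
  have hSm : ∀ i k, openOf (S i) ⊆ openOf (S (i+k)) := by
    intro i k
    induction k with
    | zero => simp
    | succ k ih => exact ih.trans (hst (i+k)).2.2.1
  let R : ℕ → Bool := fun n => (ρ (n+1))[n]?.getD false
  have hR : ∀ i, R ∈ cylinder (ρ i) := by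
    intro i
    rw [cylinder_subC]
    intro n hn
    simp only [Finset.mem_range] at hn
    have h1 : n < (ρ (n+1)).length := by have := hlen (n+1); omega
    simp only [R]
    rcases le_total i (n+1) with h | h
    · obtain ⟨k, hk⟩ := Nat.exists_eq_add_of_le h
      rw [hk, (List.prefix_iff_getElem?.1 (hpre i k)) n hn]
      simp [List.getElem?_eq_getElem hn]
    · obtain ⟨k, hk⟩ := Nat.exists_eq_add_of_le h
      conv_rhs => rw [hk]
      rw [(List.prefix_iff_getElem?.1 (hpre (n+1) k)) n h1]
      simp [List.getElem?_eq_getElem h1]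
  have hRS : ∀ i, R ∉ openOf (S i) := by
    intro i hi
    obtain ⟨m, hm⟩ := mem_openOf.1 hi
    have h1 : cylinder (ρ (i+m)) ⊆ openOf (S (i+m)) := by
      refine Set.Subset.trans ?_ (hSm i m)
      intro Y hY
      refine mem_openOf.2 ⟨m, ?_⟩
      convert hm using 1
      have e1 := hR (i+m)
      rw [mem_cylinder_iff] at hY e1
      have hl := hlen (i+m)
      rw [← strPrefix_take_of_le Y (show m ≤ (ρ (i+m)).length by omega), hY,
        ← strPrefix_take_of_le R (show m ≤ (ρ (i+m)).length by omega), e1]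
    have h2 := (xs (i+m)).2.2
    have h3 : cylinder (xs (i+m)).1.1 ∩ (openOf (xs (i+m)).1.2)ᶜ = ∅ := by
      rw [← Set.diff_eq]; exact Set.diff_eq_empty.2 h1
    rw [h3] at h2
    have : (0:ℝ) < 1/4*(1/2)^(xs (i+m)).1.1.length := by positivity
    simp only [mu, measureReal_empty] at h2
    linarith
  have hRG : ∀ i, R ∈ Good i := fun i => (hst i).2.2.2.1 (hRS (i+1))
  refine ⟨R, ?_, ?_, ?_⟩
  · rintro G ⟨⟨e, he⟩, hm⟩
    have h1 := hRG (2*e)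
    have e1 : 2*e/2 = e := by omega
    simp only [Good, e1, Nat.mul_mod_right, if_true] at h1
    obtain ⟨n, hn⟩ := h1 (fun n => he n ▸ hm n)
    exact ⟨n, by rw [he]; exact hn⟩
  · rintro ⟨e, he⟩
    have h1 := hRG (2*e+1)
    have e1 : (2*e+1)/2 = e := by omega
    have e2 : ¬ ((2*e+1)%2 = 0) := by omega
    simp only [Good, e1, e2, if_false] at h1
    exact h1 he
  · have hds : ∀ i, (∀ ℓ x, dstep (strPrefix A ℓ) (strPrefix R ℓ) (ρ i).length = some x → x = ((ρ (i+1)).length, D i)) ∧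
        ∃ ℓ0, ∀ ℓ ≥ ℓ0, dstep (strPrefix A ℓ) (strPrefix R ℓ) (ρ i).length = some ((ρ (i+1)).length, D i) := by
      intro i
      obtain ⟨j, z, h1, h2, h3⟩ := (hst i).2.2.2.2
      have h4 := h3 R (hR (i+1))
      have := dstep_spec h1 h4.1 h4.2
      rw [← h2] at this
      exact this
    refine turingLE_join_of (p := fun x => (drun x.1 x.2.1 (x.2.2.1+1)).map Prod.snd = some x.2.2.2)
      (re_dec (Primrec.to_comp (by fun_prop))) ?_ ?_
    · have : ∀ n, ∃ ℓ0, ∀ ℓ ≥ ℓ0, (drun (strPrefix A ℓ) (strPrefix R ℓ) n).map Prod.fst = some (ρ n).length := by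
        intro n
        induction n with
        | zero => exact ⟨0, fun ℓ _ => rfl⟩
        | succ n ih =>
          obtain ⟨a, ha⟩ := ih
          obtain ⟨b, hb⟩ := (hds n).2
          refine ⟨a + b, fun ℓ hℓ => ?_⟩
          obtain ⟨q, hq1, hq2⟩ := Option.map_eq_some_iff.1 (ha ℓ (by omega))
          rw [drun_succ, hq1, Option.bind_some, hq2, hb ℓ (by omega)]; rfl
      intro n
      obtain ⟨a, ha⟩ := this n
      obtain ⟨b, hb⟩ := (hds n).2
      refine ⟨a + b, ?_⟩
      obtain ⟨q, hq1, hq2⟩ := Option.map_eq_some_iff.1 (ha (a+b) (by omega))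
      simp only
      rw [drun_succ, hq1, Option.bind_some, hq2, hb _ (by omega)]; rfl
    · have : ∀ n ℓ q, drun (strPrefix A ℓ) (strPrefix R ℓ) n = some q → q.1 = (ρ n).length := by
        intro n ℓ
        induction n with
        | zero => intro q hq; simp [drun] at hq; rw [← hq]; rfl
        | succ n ih =>
          intro q hq
          rw [drun_succ] at hq
          obtain ⟨q', h1, h2⟩ := Option.bind_eq_some_iff.1 hq
          rw [ih q' h1] at h2
          rw [(hds n).1 ℓ q h2]
      intro n b ℓ h
      obtain ⟨q, hq1, hq2⟩ := Option.map_eq_some_iff.1 h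
      rw [drun_succ] at hq1
      obtain ⟨q', h1, h2⟩ := Option.bind_eq_some_iff.1 hq1
      simp only at h1
      rw [this n ℓ q' h1] at h2
      have := (hds n).1 ℓ q h2
      exact hq2.symm.trans (by rw [this])

open MeasureTheory ENNReal

/-! ### weights of lists of exponents -/

/-- weight of a list of exponents -/
noncomputable def lw (l : List ℕ) : ℝ := (l.map fun k => (1/2:ℝ)^k).sum

@[simp] theorem lw_nil : lw [] = 0 := by simp [lw]
@[simp] theorem lw_cons (k : ℕ) (l : List ℕ) : lw (k :: l) = (1/2)^k + lw l := by simp [lw]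
@[simp] theorem lw_append (l m : List ℕ) : lw (l ++ m) = lw l + lw m := by simp [lw]
theorem lw_nonneg (l : List ℕ) : 0 ≤ lw l := by
  induction l with
  | nil => simp
  | cons k l ih => rw [lw_cons]; positivity

/-- the scaled weight -/
def lws (l : List ℕ) : ℕ := (l.map fun k => 2^(l.sum - k)).sum

theorem lws_eq (l : List ℕ) : (lws l : ℝ) = lw l * 2^l.sum := by
  have h : ∀ (l : List ℕ) S, (∀ k ∈ l, k ≤ S) → (((l.map fun k => 2^(S - k)).sum : ℕ) : ℝ) = lw l * 2^S := by
    intro l S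
    induction l with
    | nil => simp
    | cons k l ih =>
      intro h
      simp only [List.mem_cons, forall_eq_or_imp] at h
      simp only [List.map_cons, List.sum_cons, lw_cons, Nat.cast_add, ih h.2, add_mul]
      congr 1
      push_cast
      rw [one_div_pow, pow_sub₀ _ (by norm_num) h.1]; ring
  exact h l _ fun k hk => List.single_le_sum (fun _ _ => Nat.zero_le _) _ hk

/-- weight at least `2^-e` -/
def wge (l : List ℕ) (e : ℕ) : Bool := decide (2^l.sum ≤ 2^e * lws l)
/-- weight at most one -/
def wle (l : List ℕ) : Bool := decide (lws l ≤ 2^l.sum)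

theorem wge_iff {l : List ℕ} {e : ℕ} : wge l e = true ↔ (1/2:ℝ)^e ≤ lw l := by
  rw [wge, decide_eq_true_eq]
  have : (2^l.sum ≤ 2^e * lws l) ↔ ((2:ℝ)^l.sum ≤ 2^e * lws l) := by exact_mod_cast Iff.rfl
  rw [this, lws_eq, one_div_pow, div_le_iff₀ (by positivity)]
  have : (2:ℝ)^e * (lw l * 2^l.sum) = (lw l * 2^e) * 2^l.sum := by ring
  rw [this]
  exact le_mul_iff_one_le_left (by positivity)

theorem wle_iff {l : List ℕ} : wle l = true ↔ lw l ≤ 1 := by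
  rw [wle, decide_eq_true_eq]
  have : (lws l ≤ 2^l.sum) ↔ ((lws l : ℝ) ≤ 2^l.sum) := by exact_mod_cast Iff.rfl
  rw [this, lws_eq]
  exact mul_le_iff_le_one_left (by positivity)

@[fun_prop] theorem wge_prim {α : Type*} [Primcodable α] {f : α → List ℕ} {h : α → ℕ} (hf : Primrec f) (hh : Primrec h) :
    Primrec fun a => wge (f a) (h a) := by unfold wge lws; fun_prop
@[fun_prop] theorem wle_prim {α : Type*} [Primcodable α] {f : α → List ℕ} (hf : Primrec f) :
    Primrec fun a => wle (f a) := by unfold wle lws; fun_prop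

/-! ### the machine -/

/-- chunks: (use string, request, exponent, label) -/
abbrev Chk := List Bool × ℕ × ℕ × ℕ
/-- frames: (level, goal, garbage), chunks, current chunk, promoted chunks, cancellations -/
abbrev Frame0 := (ℕ × ℕ × ℕ) × List Chk × Option Chk × List Chk × ℕ

/-- `z` appears with use `u` -/
def vz (g : List Bool × ℕ → Bool) (u : List Bool) (z : ℕ) : Bool :=
  decide (z < u.length) && (List.range (u.length + 1)).any fun ℓ => g (u.take ℓ, z)

/-- total weight with use `u` is at most one -/
def okv (g : List Bool × ℕ → Bool) (u : List Bool) : Bool :=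
  wle (((List.range u.length).filter fun z => vz g u z).map fun z => (Nat.unpair z).1)

/-- `z` newly appears with use `u` -/
def newv (g : List Bool × ℕ → Bool) (u : List Bool) (z : ℕ) : Bool :=
  vz g u z && !(vz g (u.take (u.length - 1)) z)

/-- enough weight has been allotted -/
def satv (y : ℕ) (chs : List Chk) (u : List Bool) (z : ℕ) : Bool :=
  wge ((chs.filter fun q => decide (q.1 = u) && decide (q.2.1 = z)).map fun q => q.2.2.1) (y + 4 + (Nat.unpair z).1)

/-- eligibility of a key -/
def eligk (g : List Bool × ℕ → Bool) (y : ℕ) (chs : List Chk) (a : List Bool) (k : ℕ) : Bool :=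
  newv g (a.take k.unpair.1) k.unpair.2 && okv g (a.take k.unpair.1) && !(satv y chs (a.take k.unpair.1) k.unpair.2)

/-- least eligible key -/
def elig (g : List Bool × ℕ → Bool) (y : ℕ) (chs : List Chk) (a : List Bool) : Option ℕ :=
  ((List.range a.length).filter fun k => eligk g y chs a k).head?

/-- initial state -/
def ini (L x y : ℕ) : List Frame0 := if L = 0 then [] else [((L-1, x, y), [], none, [], 0)]

/-- the chunk to be started -/
def mkc (p : ℕ × ℕ × ℕ) (c : ℕ) (a : List Bool) (k : ℕ) : Chk :=
  (a.take k.unpair.1, k.unpair.2, p.2.2 + 4 + (Nat.unpair k.unpair.2).1 + c, a.length)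

/-- choose the next chunk -/
def pick (g : List Bool × ℕ → Bool) (p : ℕ × ℕ × ℕ) (chs prom : List Chk) (c : ℕ) (a : List Bool) : List Frame0 :=
  (elig g p.2.2 chs a).elim [(p, chs, none, prom, c)] fun k =>
    (p, chs, some (mkc p c a k), prom, c) :: ini p.1 (mkc p c a k).2.2.1 (p.2.2 + 4 + a.length)

/-- one step of a frame -/
def comb (g : List Bool × ℕ → Bool) (a : List Bool) (f : Frame0) (acc : Option (List Frame0)) : Option (List Frame0) :=
  if wge ((f.2.2.2.1 ++ f.2.1.filter fun q => !(decide (q.1 <+: a))).map fun q => q.2.2.1) f.1.2.1 then none else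
  some (f.2.2.1.elim (pick g f.1 (f.2.1.filter fun q => decide (q.1 <+: a))
        (f.2.2.2.1 ++ f.2.1.filter fun q => !(decide (q.1 <+: a))) f.2.2.2.2 a)
    fun q => if q.1 <+: a then acc.elim (pick g f.1 (q :: f.2.1.filter fun q => decide (q.1 <+: a))
          (f.2.2.2.1 ++ f.2.1.filter fun q => !(decide (q.1 <+: a))) f.2.2.2.2 a)
        (fun rest => (f.1, f.2.1.filter fun q => decide (q.1 <+: a), some q,
          f.2.2.2.1 ++ f.2.1.filter fun q => !(decide (q.1 <+: a)), f.2.2.2.2) :: rest)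
      else pick g f.1 (f.2.1.filter fun q => decide (q.1 <+: a))
        (f.2.2.2.1 ++ f.2.1.filter fun q => !(decide (q.1 <+: a))) (f.2.2.2.2 + 1) a)

/-- one step of the machine -/
def mstep (g : List Bool × ℕ → Bool) (S : List Frame0) (a : List Bool) : Option (List Frame0) :=
  S.foldr (fun f acc => comb g a f acc) none

/-- the move of the machine -/
def mv (x : ℕ) (S : List Frame0) : Option ℕ :=
  S.foldl (fun o f => o.bind fun _ => f.2.2.1.map fun q => q.2.2.1) (some x)

section prim
variable {α : Type*} [Primcodable α] {g : List Bool × ℕ → Bool}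

@[fun_prop] theorem vz_prim (hg : Primrec g) {u : α → List Bool} {z : α → ℕ} (hu : Primrec u) (hz : Primrec z) :
    Primrec fun a => vz g (u a) (z a) := by unfold vz; fun_prop
@[fun_prop] theorem okv_prim (hg : Primrec g) {u : α → List Bool} (hu : Primrec u) :
    Primrec fun a => okv g (u a) := by unfold okv; fun_prop
@[fun_prop] theorem newv_prim (hg : Primrec g) {u : α → List Bool} {z : α → ℕ} (hu : Primrec u) (hz : Primrec z) :
    Primrec fun a => newv g (u a) (z a) := by unfold newv; fun_prop
@[fun_prop] theorem satv_prim {y : α → ℕ} {c : α → List Chk} {u : α → List Bool} {z : α → ℕ} (hy : Primrec y)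
    (hc : Primrec c) (hu : Primrec u) (hz : Primrec z) :
    Primrec fun a => satv (y a) (c a) (u a) (z a) := by unfold satv; fun_prop
@[fun_prop] theorem elig_prim (hg : Primrec g) {y : α → ℕ} {c : α → List Chk} {u : α → List Bool} (hy : Primrec y)
    (hc : Primrec c) (hu : Primrec u) :
    Primrec fun a => elig g (y a) (c a) (u a) := by unfold elig eligk; fun_prop
@[fun_prop] theorem ini_prim {L x y : α → ℕ} (hL : Primrec L) (hx : Primrec x) (hy : Primrec y) :
    Primrec fun a => ini (L a) (x a) (y a) := by unfold ini; fun_prop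
@[fun_prop] theorem mkc_prim {p : α → ℕ × ℕ × ℕ} {c k : α → ℕ} {a : α → List Bool} (hp : Primrec p) (hc : Primrec c)
    (ha : Primrec a) (hk : Primrec k) : Primrec fun v => mkc (p v) (c v) (a v) (k v) := by unfold mkc; fun_prop
@[fun_prop] theorem pick_prim (hg : Primrec g) {p : α → ℕ × ℕ × ℕ} {ch pr : α → List Chk} {c : α → ℕ} {a : α → List Bool} (hp : Primrec p)
    (hch : Primrec ch) (hpr : Primrec pr) (hc : Primrec c) (ha : Primrec a) :
    Primrec fun v => pick g (p v) (ch v) (pr v) (c v) (a v) := by unfold pick; fun_prop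
@[fun_prop] theorem comb_prim (hg : Primrec g) {a : α → List Bool} {f : α → Frame0} {acc : α → Option (List Frame0)} (ha : Primrec a)
    (hf : Primrec f) (hacc : Primrec acc) : Primrec fun v => comb g (a v) (f v) (acc v) := by unfold comb; fun_prop
@[fun_prop] theorem mstep_prim (hg : Primrec g) {a : α → List Bool} {S : α → List Frame0} (hS : Primrec S) (ha : Primrec a) :
    Primrec fun v => mstep g (S v) (a v) := by unfold mstep; fun_prop
@[fun_prop] theorem mv_prim {x : α → ℕ} {S : α → List Frame0} (hx : Primrec x) (hS : Primrec S) :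
    Primrec fun v => mv (x v) (S v) := by unfold mv; fun_prop
end prim

theorem mstep_nil (g : List Bool × ℕ → Bool) (a : List Bool) : mstep g [] a = none := rfl
theorem mstep_cons (g : List Bool × ℕ → Bool) (f : Frame0) (S : List Frame0) (a : List Bool) :
    mstep g (f :: S) a = comb g a f (mstep g S a) := rfl
theorem mv_nil (x : ℕ) : mv x [] = some x := rfl
theorem mv_none (x : ℕ) (p ch pr c) (S : List Frame0) : mv x ((p, ch, none, pr, c) :: S) = none := by
  unfold mv
  simp only [List.foldl_cons, Option.bind_some, Option.map_none]
  induction S with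
  | nil => rfl
  | cons f S ih => simpa using ih
theorem mv_some (x : ℕ) (p ch q pr c) (S : List Frame0) : mv x ((p, ch, some q, pr, c) :: S) = mv q.2.2.1 S := rfl

section machine
open MeasureTheory ENNReal

/-- run of the machine against `a` starting at time `t0` -/
def mrun (g : List Bool × ℕ → Bool) (a : ℕ → List Bool) (S0 : List Frame0) (t0 : ℕ) : ℕ → Option (List Frame0)
  | 0 => some S0
  | n+1 => (mrun g a S0 t0 n).bind fun S => mstep g S (a (t0+n))

/-- label of the active chunk -/
def lab (o : Option (List Frame0)) : Option ℕ := o.bind fun S => S.head?.bind fun f => f.2.2.1.map fun q => q.2.2.2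

/-- cost of the current move -/
noncomputable def cost (x : ℕ) (o : Option (List Frame0)) : ℝ := (o.bind (mv x)).elim 0 fun r => (1/2)^r

theorem cost_nonneg (x o) : 0 ≤ cost x o := by
  unfold cost
  cases o.bind (mv x) <;> simp

/-- number of different versions of the prefix of length `n` before time `t` -/
def dd (a : ℕ → List Bool) (t n : ℕ) : ℕ := ((Finset.Ico n t).image fun s => (a s).take n).card

theorem dd_mono (a : ℕ → List Bool) {t t' : ℕ} (h : t ≤ t') (n : ℕ) : dd a t n ≤ dd a t' n :=
  Finset.card_le_card (Finset.image_subset_image (Finset.Ico_subset_Ico_right h))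

theorem dd_succ {a : ℕ → List Bool} (ha : ∀ t, (a t).length = t + 1) {t n : ℕ} {u : List Bool} (hu : u.length ≤ n) (hn : n ≤ t)
    (h1 : ∀ s, n ≤ s → s < t → u <+: a s) (h2 : ¬ u <+: a t) : dd a t n + 1 ≤ dd a (t+1) n := by
  unfold dd
  rw [← Finset.insert_Ico_right_eq_Ico_add_one hn, Finset.image_insert, Finset.card_insert_of_notMem]
  intro hmem
  simp only [Finset.mem_image, Finset.mem_Ico] at hmem
  obtain ⟨s, ⟨hs1, hs2⟩, hs⟩ := hmem
  apply h2
  have : u <+: (a s).take n := by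
    rw [List.prefix_take_iff]; exact ⟨h1 s hs1 hs2, hu⟩
  rw [hs] at this
  exact this.trans (List.take_prefix _ _)

/-- exponents of chunks -/
def bts (l : List Chk) : List ℕ := l.map fun q => q.2.2.1
/-- labels of chunks -/
def lbs (l : List Chk) : List ℕ := l.map fun q => q.2.2.2
@[simp] theorem bts_nil : bts [] = [] := rfl
@[simp] theorem bts_cons (q l) : bts (q :: l) = q.2.2.1 :: bts l := rfl
@[simp] theorem bts_append (l m) : bts (l ++ m) = bts l ++ bts m := by simp [bts]

theorem lw_filter (l : List Chk) (p : Chk → Bool) :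
    lw (bts (l.filter p)) + lw (bts (l.filter fun q => !(p q))) = lw (bts l) := by
  induction l with
  | nil => simp
  | cons q l ih =>
    cases h : p q <;> simp [h, List.filter_cons] <;> linarith

theorem lw_sublist {l m : List Chk} (h : l.Sublist m) : lw (bts l) ≤ lw (bts m) := by
  induction h with
  | slnil => simp
  | cons q h ih =>
    have : (0:ℝ) ≤ (1/2)^q.2.2.1 := by positivity
    simp only [bts_cons, lw_cons]; linarith
  | cons_cons q h ih => simp only [bts_cons, lw_cons]; linarith

theorem lw_perm {l m : List Chk} (h : l.Perm m) : lw (bts l) = lw (bts m) := by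
  unfold lw bts
  exact ((h.map _).map _).sum_eq

theorem lw_subperm {l m : List Chk} (h : l.Subperm m) : lw (bts l) ≤ lw (bts m) := by
  obtain ⟨l', hl', hs⟩ := h
  rw [← lw_perm hl']; exact lw_sublist hs

/-- chunks with given key -/
def key (u : List Bool) (z : ℕ) (l : List Chk) : List Chk := l.filter fun q => decide (q.1 = u) && decide (q.2.1 = z)

/-- the invariant -/
structure Core (g : List Bool × ℕ → Bool) (a : ℕ → List Bool) (i x y t0 n : ℕ) (ch : List Chk) (cur : Option Chk)
    (pr : List Chk) (c : ℕ) (rest : List Frame0) : Prop where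
  sub : ∀ q ∈ cur, t0 < q.2.2.2 ∧ q.2.2.2 ≤ t0 + n ∧ mrun g a (ini i q.2.2.1 (y+4+q.2.2.2)) q.2.2.2 (t0+n-q.2.2.2) = some rest
  cst : ∀ q ∈ cur, ∀ m < n, q.2.2.2 ≤ t0 + m → lab (mrun g a (ini (i+1) x y) t0 m) = some q.2.2.2 ∧
    cost x (mrun g a (ini (i+1) x y) t0 m) = cost q.2.2.1 (mrun g a (ini i q.2.2.1 (y+4+q.2.2.2)) q.2.2.2 (t0+m-q.2.2.2))
  tot : lw (bts pr) + lw (bts (cur.toList ++ ch)) ≤ (1/2)^x + (1/2)^(y+3)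
  it : ∀ q ∈ cur.toList ++ ch, q.1.length ≤ q.2.2.2 ∧ (∀ s, q.2.2.2 ≤ s+1 → s < t0+n → q.1 <+: a s) ∧
    newv g q.1 q.2.1 = true ∧ okv g q.1 = true
  per : ∀ u z, lw (bts (key u z (cur.toList ++ ch))) ≤ 2 * (1/2)^(y+4+(Nat.unpair z).1)
  curb : ∀ q ∈ cur, y + 4 + c ≤ q.2.2.1
  nd : (lbs (pr ++ (cur.toList ++ ch))).Nodup
  lablt : ∀ q ∈ pr ++ ch, q.2.2.2 < t0 + n
  labm : ∀ m < n, ∀ l, lab (mrun g a (ini (i+1) x y) t0 m) = some l → l ≤ t0 + m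
  chk : ∀ q ∈ ch, (1/2)^q.2.2.1 ≤ ∑ m ∈ (Finset.range n).filter (fun m => lab (mrun g a (ini (i+1) x y) t0 m) = some q.2.2.2 ∧
    i+1 ≤ dd a (t0+n) (t0+m)), cost x (mrun g a (ini (i+1) x y) t0 m)
  prk : ∀ q ∈ pr, (1/2)^q.2.2.1 ≤ ∑ m ∈ (Finset.range n).filter (fun m => lab (mrun g a (ini (i+1) x y) t0 m) = some q.2.2.2 ∧
    i+2 ≤ dd a (t0+n) (t0+m)), cost x (mrun g a (ini (i+1) x y) t0 m)
  spent : ∑ m ∈ Finset.range n, cost x (mrun g a (ini (i+1) x y) t0 m) ≤ lw (bts pr) + lw (bts ch) + 2 * (1/2)^(y+3)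
    - (1/2)^(y+3+c) - cur.elim ((1/2)^(y+3+(t0+n))) (fun q => (1/2)^(y+3+q.2.2.2) -
      ∑ m ∈ Finset.range (t0+n-q.2.2.2), cost q.2.2.1 (mrun g a (ini i q.2.2.1 (y+4+q.2.2.2)) q.2.2.2 m))

theorem core_start (g a i x y t0) : Core g a i x y t0 0 [] none [] 0 [] where
  sub := by simp
  cst := by simp
  tot := by simp; positivity
  it := by simp
  per := by intro u z; simp [key]
  curb := by simp
  nd := by simp [lbs]
  lablt := by simp
  labm := by simp
  chk := by simp
  prk := by simp
  spent := by
    simp only [Finset.range_zero, Finset.sum_empty, bts_nil, lw_nil, add_zero, Option.elim_none]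
    have : (1/2:ℝ)^(y+3+t0) ≤ (1/2)^(y+3) := pow_le_pow_of_le_one (by norm_num) (by norm_num) (by omega)
    linarith

/-- hypotheses on the level below -/
structure Below (g : List Bool × ℕ → Bool) (a : ℕ → List Bool) (i : ℕ) : Prop where
  sp : ∀ t0 x y n, ∑ m ∈ Finset.range n, cost x (mrun g a (ini i x y) t0 m) ≤ (1/2)^x + (1/2)^y
  kk : ∀ t0 x y n, (mrun g a (ini i x y) t0 n).isSome = true → mrun g a (ini i x y) t0 (n+1) = none →
    (1/2)^x ≤ ∑ m ∈ (Finset.range (n+1)).filter (fun m => i + 1 ≤ dd a (t0+n+1) (t0+m)), cost x (mrun g a (ini i x y) t0 m)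

variable {g : List Bool × ℕ → Bool} {a : ℕ → List Bool} {i x y t0 n : ℕ} {ch pr : List Chk} {cur : Option Chk} {c : ℕ}
  {rest : List Frame0}

/-- transferring chunk weights one step further -/
theorem sum_filter_mono {F : ℕ → ℝ} (hF : ∀ m, 0 ≤ F m) {P Q : ℕ → Prop} [DecidablePred P] [DecidablePred Q] {n n' : ℕ} (hn : n ≤ n')
    (h : ∀ m < n, P m → Q m) : ∑ m ∈ (Finset.range n).filter P, F m ≤ ∑ m ∈ (Finset.range n').filter Q, F m := by
  apply Finset.sum_le_sum_of_subset_of_nonneg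
  · intro m hm
    simp only [Finset.mem_filter, Finset.mem_range] at hm ⊢
    exact ⟨by omega, h m hm.1 hm.2⟩
  · intro m _ _; exact hF m


theorem vz_mono {u v : List Bool} (h : u <+: v) {z : ℕ} (hz : vz g u z = true) : vz g v z = true := by
  unfold vz at hz ⊢
  simp only [Bool.and_eq_true, decide_eq_true_eq, List.any_eq_true, List.mem_range] at hz ⊢
  obtain ⟨h1, ℓ, h2, h3⟩ := hz
  refine ⟨h1.trans_le h.length_le, ℓ, by have := h.length_le; omega, ?_⟩
  rw [← h3]
  congr 2
  obtain ⟨w, rfl⟩ := h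
  rw [List.take_append_of_le_length (by omega)]

theorem newv_unique {u v : List Bool} {z : ℕ} (hu : newv g u z = true) (hv : newv g v z = true) (h : u <+: v) : u = v := by
  unfold newv at hu hv
  simp only [Bool.and_eq_true, Bool.not_eq_true'] at hu hv
  by_contra hne
  have hl : u.length < v.length := by
    rcases h.length_le.lt_or_eq with hh | hh
    · exact hh
    · exact absurd (h.eq_of_length hh) hne
  have : u <+: v.take (v.length - 1) := by
    rw [List.prefix_take_iff]; exact ⟨h, by omega⟩
  have := vz_mono this hu.1
  rw [hv.2] at this; simp at this

theorem lw_by_z (Z : Finset ℕ) (l : List Chk) (h : ∀ q ∈ l, q.2.1 ∈ Z) :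
    lw (bts l) = ∑ z ∈ Z, lw (bts (l.filter fun q => decide (q.2.1 = z))) := by
  induction l with
  | nil => simp
  | cons q l ih =>
    simp only [List.mem_cons, forall_eq_or_imp] at h
    have : ∀ z, lw (bts ((q :: l).filter fun q => decide (q.2.1 = z))) =
        (if q.2.1 = z then (1/2)^q.2.2.1 else 0) + lw (bts (l.filter fun q => decide (q.2.1 = z))) := by
      intro z
      by_cases hz : q.2.1 = z
      · simp only [List.filter_cons, hz, decide_true, if_true, bts_cons, lw_cons]
      · simp only [List.filter_cons, hz, decide_false, if_false, zero_add, Bool.false_eq_true]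
    rw [Finset.sum_congr rfl fun z _ => this z, Finset.sum_add_distrib, ← ih h.2, Finset.sum_ite_eq, if_pos h.1]
    simp only [bts_cons, lw_cons]

/-- total weight of valid items -/
theorem items_le {y : ℕ} (l : List Chk) (w : List Bool) (hw : ∀ q ∈ l, q.1 <+: w) (hnew : ∀ q ∈ l, newv g q.1 q.2.1 = true)
    (hok : ∀ q ∈ l, okv g q.1 = true) (hper : ∀ u z, lw (bts (key u z l)) ≤ 2 * (1/2)^(y+4+(Nat.unpair z).1)) :
    lw (bts l) ≤ (1/2)^(y+3) := by
  rcases l.eq_nil_or_concat with rfl | hl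
  · simp
  have hne : l.toFinset.Nonempty := by
    obtain ⟨l', b, rfl⟩ := hl
    exact ⟨b, by simp⟩
  obtain ⟨q0, hq0, hmax⟩ := Finset.exists_max_image l.toFinset (fun q => q.1.length) hne
  simp only [List.mem_toFinset] at hq0 hmax
  have hpre : ∀ q ∈ l, q.1 <+: q0.1 := fun q hq => List.prefix_of_prefix_length_le (hw q hq) (hw q0 hq0) (hmax q hq)
  let Zl := (List.range q0.1.length).filter fun z => vz g q0.1 z
  have hZ : ∀ q ∈ l, q.2.1 ∈ Zl.toFinset := by
    intro q hq
    have h1 : vz g q.1 q.2.1 = true := by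
      have := hnew q hq; unfold newv at this
      simp only [Bool.and_eq_true] at this; exact this.1
    have h2 := vz_mono (hpre q hq) h1
    simp only [Zl, List.mem_toFinset, List.mem_filter, List.mem_range]
    refine ⟨?_, h2⟩
    unfold vz at h2
    simp only [Bool.and_eq_true, decide_eq_true_eq] at h2
    exact h2.1
  have hone : ∑ z ∈ Zl.toFinset, (1/2:ℝ)^(Nat.unpair z).1 ≤ 1 := by
    have := hok q0 hq0
    unfold okv at this
    rw [wle_iff] at this
    rw [List.sum_toFinset _ (List.nodup_range.filter _)]
    unfold lw at this
    rw [List.map_map] at this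
    exact this
  rw [lw_by_z _ l hZ]
  calc ∑ z ∈ Zl.toFinset, lw (bts (l.filter fun q => decide (q.2.1 = z)))
      ≤ ∑ z ∈ Zl.toFinset, 2 * (1/2)^(y+4) * (1/2:ℝ)^(Nat.unpair z).1 := by
        apply Finset.sum_le_sum
        intro z _
        rw [mul_assoc, ← pow_add]
        by_cases hz : ∃ q1 ∈ l, q1.2.1 = z
        · obtain ⟨q1, hq1, rfl⟩ := hz
          have : (l.filter fun q => decide (q.2.1 = q1.2.1)) = key q1.1 q1.2.1 l := by
            unfold key
            apply List.filter_congr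
            intro q hq
            by_cases hh : q.2.1 = q1.2.1
            · have : q.1 = q1.1 := by
                rcases List.prefix_or_prefix_of_prefix (hw q hq) (hw q1 hq1) with h | h
                · exact newv_unique (z := q.2.1) (hnew q hq) (hh ▸ hnew q1 hq1) h
                · exact (newv_unique (z := q.2.1) (hh ▸ hnew q1 hq1) (hnew q hq) h).symm
              simp [hh, this]
            · simp [hh]
          rw [this]; exact hper _ _
        · have : (l.filter fun q => decide (q.2.1 = z)) = [] := by
            rw [List.filter_eq_nil_iff]
            intro q hq hh
            exact hz ⟨q, hq, by simpa using hh⟩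
          rw [this]; simp
    _ = (1/2)^(y+3) * ∑ z ∈ Zl.toFinset, (1/2:ℝ)^(Nat.unpair z).1 := by
        rw [← Finset.mul_sum]; congr 1; rw [pow_succ _ (y+3)]; ring
    _ ≤ (1/2)^(y+3) * 1 := by gcongr
    _ = _ := mul_one _

theorem lab_cons (p ch cur pr c) (rest : List Frame0) : lab (some ((p, ch, cur, pr, c) :: rest)) = cur.map fun q => q.2.2.2 := by
  simp [lab]

theorem mrun_succ (g a S t0 n) : mrun g a S t0 (n+1) = (mrun g a S t0 n).bind fun S => mstep g S (a (t0+n)) := rfl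

theorem Core.cst' (h : Core g a i x y t0 n ch cur pr c rest) (hrun : mrun g a (ini (i+1) x y) t0 n = some (((i,x,y),ch,cur,pr,c)::rest))
    {q : Chk} (hq : q ∈ cur) {m : ℕ} (hm : m < n+1) (hl : q.2.2.2 ≤ t0 + m) : lab (mrun g a (ini (i+1) x y) t0 m) = some q.2.2.2 ∧
    cost x (mrun g a (ini (i+1) x y) t0 m) = cost q.2.2.1 (mrun g a (ini i q.2.2.1 (y+4+q.2.2.2)) q.2.2.2 (t0+m-q.2.2.2)) := by
  rcases Nat.lt_succ_iff_lt_or_eq.1 hm with hm | rfl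
  · exact h.cst q hq m hm hl
  · obtain ⟨h1, h2, h3⟩ := h.sub q hq
    rw [hrun, h3, lab_cons]
    cases hq
    refine ⟨rfl, ?_⟩
    simp only [cost, Option.bind_some, mv_some]

/-- one step, before a new chunk is picked -/
theorem core_step (ha : ∀ t, (a t).length = t + 1) (hB : Below g a i) (h : Core g a i x y t0 n ch cur pr c rest)
    (hrun : mrun g a (ini (i+1) x y) t0 n = some (((i,x,y),ch,cur,pr,c)::rest))
    {ch1 pr1 : List Chk} (hch1 : ch1 = ch.filter fun q => decide (q.1 <+: a (t0+n)))
    (hpr1 : pr1 = pr ++ ch.filter fun q => !(decide (q.1 <+: a (t0+n))))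
    {ch' : List Chk} {cur' : Option Chk} {c' : ℕ} {rest' : List Frame0}
    (hcase : (cur = none ∧ ch' = ch1 ∧ cur' = none ∧ c' = c) ∨
      (∃ q, cur = some q ∧ ¬ q.1 <+: a (t0+n) ∧ ch' = ch1 ∧ cur' = none ∧ c' = c+1) ∨
      (∃ q, cur = some q ∧ q.1 <+: a (t0+n) ∧ mstep g rest (a (t0+n)) = none ∧ ch' = q :: ch1 ∧ cur' = none ∧ c' = c) ∨
      (∃ q, cur = some q ∧ q.1 <+: a (t0+n) ∧ mstep g rest (a (t0+n)) = some rest' ∧ ch' = ch1 ∧ cur' = some q ∧ c' = c)) :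
    Core g a i x y t0 (n+1) ch' cur' pr1 c' rest' := by
  have hperm : ∀ o : List Chk, (pr1 ++ (o ++ ch1)).Perm (pr ++ (o ++ ch)) := by
    intro o
    have := List.filter_append_perm (fun q : Chk => decide (q.1 <+: a (t0+n))) ch
    rw [hpr1, hch1, List.append_assoc]
    apply List.Perm.append_left
    have h2 : (List.filter (fun q : Chk => !decide (q.1 <+: a (t0+n))) ch ++ (o ++ List.filter (fun q => decide (q.1 <+: a (t0+n))) ch)).Perm
      (o ++ (List.filter (fun q : Chk => decide (q.1 <+: a (t0+n))) ch ++ List.filter (fun q => !decide (q.1 <+: a (t0+n))) ch)) := by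
      refine List.perm_append_comm.trans ?_
      rw [List.append_assoc]
    exact h2.trans (List.Perm.append_left _ this)
  obtain ⟨o, ho, hol, hopre⟩ : ∃ o : List Chk, cur'.toList ++ ch' = o ++ ch1 ∧ o.Sublist cur.toList ∧ ∀ q ∈ o, q.1 <+: a (t0+n) := by
    rcases hcase with ⟨rfl, rfl, rfl, rfl⟩ | ⟨q, rfl, h1, rfl, rfl, rfl⟩ | ⟨q, rfl, h1, h2, rfl, rfl, rfl⟩ | ⟨q, rfl, h1, h2, rfl, rfl, rfl⟩
    · exact ⟨[], by simp⟩
    · exact ⟨[], by simp⟩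
    · exact ⟨[q], by simpa using h1⟩
    · exact ⟨[q], by simpa using h1⟩
  have hIsub : (cur'.toList ++ ch').Sublist (cur.toList ++ ch) := by
    rw [ho, hch1]
    exact List.Sublist.append hol List.filter_sublist
  have hIpre : ∀ q ∈ cur'.toList ++ ch', q.1 <+: a (t0+n) := by
    rw [ho, hch1]
    intro q hq
    rcases List.mem_append.1 hq with hq | hq
    · exact hopre q hq
    · simpa using (List.mem_filter.1 hq).2
  have hSub : (pr1 ++ (cur'.toList ++ ch')).Subperm (pr ++ (cur.toList ++ ch)) := by
    rw [ho]
    exact (hperm o).subperm.trans (List.Sublist.append (List.Sublist.refl _) (List.Sublist.append hol (List.Sublist.refl _))).subperm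
  have hcost : ∀ m, 0 ≤ cost x (mrun g a (ini (i+1) x y) t0 m) := fun m => cost_nonneg _ _
  have hch'mem : ∀ q ∈ ch', q ∈ ch ∨ (q ∈ cur ∧ mstep g rest (a (t0+n)) = none ∧ q.1 <+: a (t0+n)) := by
    intro q hq
    rcases hcase with ⟨rfl, rfl, rfl, rfl⟩ | ⟨q', rfl, h1, rfl, rfl, rfl⟩ | ⟨q', rfl, h1, h2, rfl, rfl, rfl⟩ | ⟨q', rfl, h1, h2, rfl, rfl, rfl⟩
    · rw [hch1] at hq; exact Or.inl (List.mem_filter.1 hq).1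
    · rw [hch1] at hq; exact Or.inl (List.mem_filter.1 hq).1
    · rcases List.mem_cons.1 hq with rfl | hq
      · exact Or.inr ⟨rfl, h2, h1⟩
      · rw [hch1] at hq; exact Or.inl (List.mem_filter.1 hq).1
    · rw [hch1] at hq; exact Or.inl (List.mem_filter.1 hq).1
  have hcur' : ∀ q ∈ cur', q ∈ cur ∧ mstep g rest (a (t0+n)) = some rest' ∧ c' = c := by
    intro q hq
    rcases hcase with ⟨rfl, rfl, rfl, rfl⟩ | ⟨q', rfl, h1, rfl, rfl, rfl⟩ | ⟨q', rfl, h1, h2, rfl, rfl, rfl⟩ | ⟨q', rfl, h1, h2, rfl, rfl, rfl⟩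
    · simp at hq
    · simp at hq
    · simp at hq
    · exact ⟨hq, h2, rfl⟩
  have hpr1mem : ∀ q ∈ pr1, q ∈ pr ∨ (q ∈ ch ∧ ¬ q.1 <+: a (t0+n)) := by
    intro q hq
    rw [hpr1] at hq
    rcases List.mem_append.1 hq with hq | hq
    · exact Or.inl hq
    · have := List.mem_filter.1 hq
      exact Or.inr ⟨this.1, by simpa using this.2⟩
  have hlabm : ∀ m < n+1, ∀ l, lab (mrun g a (ini (i+1) x y) t0 m) = some l → l ≤ t0 + m := by
    intro m hm l hl
    rcases Nat.lt_succ_iff_lt_or_eq.1 hm with hm | rfl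
    · exact h.labm m hm l hl
    · rw [hrun, lab_cons] at hl
      cases hc : cur with
      | none => rw [hc] at hl; simp at hl
      | some q =>
        rw [hc] at hl; simp at hl
        have := (h.sub q (by simp [hc])).2.1
        omega
  constructor
  case sub =>
    intro q hq
    obtain ⟨h1, h2, _⟩ := hcur' q hq
    obtain ⟨h3, h4, h5⟩ := h.sub q h1
    refine ⟨h3, by omega, ?_⟩
    rw [show t0 + (n+1) - q.2.2.2 = (t0 + n - q.2.2.2) + 1 by omega, mrun_succ, h5, Option.bind_some,
      show q.2.2.2 + (t0 + n - q.2.2.2) = t0 + n by omega, h2]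
  case cst =>
    intro q hq m hm hl
    exact h.cst' hrun (hcur' q hq).1 hm hl
  case tot =>
    have := lw_subperm hSub
    simp only [bts_append, lw_append] at this
    have h2 := h.tot
    simp only [bts_append, lw_append] at h2 ⊢
    linarith
  case it =>
    intro q hq
    obtain ⟨h1, h2, h3, h4⟩ := h.it q (hIsub.subset hq)
    refine ⟨h1, fun s hs hs' => ?_, h3, h4⟩
    rcases (Nat.lt_succ_iff_lt_or_eq.1 (show s < (t0+n)+1 by omega)) with hs' | rfl
    · exact h2 s hs hs'
    · exact hIpre q hq
  case per =>
    intro u z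
    exact (lw_sublist (hIsub.filter _)).trans (h.per u z)
  case curb =>
    intro q hq
    obtain ⟨h1, _, h3⟩ := hcur' q hq
    rw [h3]; exact h.curb q h1
  case nd =>
    obtain ⟨l', hl', hs⟩ := hSub
    exact (hl'.map _).nodup_iff.1 (h.nd.sublist (hs.map _))
  case lablt =>
    intro q hq
    rcases List.mem_append.1 hq with hq | hq
    · rcases hpr1mem q hq with hq | ⟨hq, _⟩
      · have := h.lablt q (by simp [hq]); omega
      · have := h.lablt q (by simp [hq]); omega
    · rcases hch'mem q hq with hq | ⟨hq, _⟩
      · have := h.lablt q (by simp [hq]); omega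
      · have := (h.sub q hq).2.1; omega
  case labm => exact hlabm
  case chk =>
    intro q hq
    rcases hch'mem q hq with hq | ⟨hq, hend, _⟩
    · refine (h.chk q hq).trans (sum_filter_mono hcost (by omega) fun m _ hm => ⟨hm.1, hm.2.trans (dd_mono _ (by omega) _)⟩)
    · obtain ⟨h3, h4, h5⟩ := h.sub q hq
      have := hB.kk q.2.2.2 q.2.2.1 (y+4+q.2.2.2) (t0+n-q.2.2.2) (by rw [h5]; rfl) (by
        rw [mrun_succ, h5, Option.bind_some, show q.2.2.2 + (t0 + n - q.2.2.2) = t0 + n by omega, hend])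
      refine this.trans ?_
      have hinj : Set.InjOn (fun m => q.2.2.2 - t0 + m) ((Finset.range (t0+n-q.2.2.2+1)).filter (fun m => i + 1 ≤ dd a (q.2.2.2+(t0+n-q.2.2.2)+1) (q.2.2.2+m)) : Set ℕ) := by
        intro m _ m' _ hmm
        simpa using hmm
      calc _ = ∑ m ∈ ((Finset.range (t0+n-q.2.2.2+1)).filter (fun m => i + 1 ≤ dd a (q.2.2.2+(t0+n-q.2.2.2)+1) (q.2.2.2+m))).image (fun m => q.2.2.2 - t0 + m),
            cost x (mrun g a (ini (i+1) x y) t0 m) := by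
            rw [Finset.sum_image hinj]
            apply Finset.sum_congr rfl
            intro m hm
            simp only [Finset.mem_filter, Finset.mem_range] at hm
            rw [(h.cst' hrun hq (m := q.2.2.2 - t0 + m) (by omega) (by omega)).2]
            congr 2; omega
        _ ≤ _ := by
            apply Finset.sum_le_sum_of_subset_of_nonneg
            · intro m' hm'
              simp only [Finset.mem_image, Finset.mem_filter, Finset.mem_range] at hm' ⊢
              obtain ⟨m, ⟨hm1, hm2⟩, rfl⟩ := hm'
              refine ⟨by omega, (h.cst' hrun hq (m := q.2.2.2 - t0 + m) (by omega) (by omega)).1, ?_⟩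
              rw [show t0 + (n+1) = q.2.2.2+(t0+n-q.2.2.2)+1 by omega, show t0 + (q.2.2.2 - t0 + m) = q.2.2.2+m by omega]
              exact hm2
            · intro m _ _; exact hcost m
  case prk =>
    intro q hq
    rcases hpr1mem q hq with hq | ⟨hq, hnp⟩
    · refine (h.prk q hq).trans (sum_filter_mono hcost (by omega) fun m _ hm => ⟨hm.1, hm.2.trans (dd_mono _ (by omega) _)⟩)
    · refine (h.chk q hq).trans (sum_filter_mono hcost (by omega) fun m hmn hm => ⟨hm.1, ?_⟩)
      obtain ⟨h1, h2, _, _⟩ := h.it q (by simp [hq])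
      have hlm := h.labm m hmn _ hm.1
      have := dd_succ ha (t := t0+n) (n := t0+m) (u := q.1) (by omega) (by omega) (fun s hs hs' => h2 s (by omega) hs') hnp
      have h5 := hm.2
      rw [show t0 + (n+1) = t0+n+1 by omega]
      omega
  case spent =>
    have hlw : lw (bts pr1) + lw (bts ch1) = lw (bts pr) + lw (bts ch) := by
      have := lw_perm (hperm [])
      simpa using this
    have hold := h.spent
    rw [Finset.sum_range_succ]
    have hpos : ∀ k : ℕ, (0:ℝ) ≤ (1/2)^k := fun k => by positivity
    have hsub : ∀ q ∈ cur, ∑ m ∈ Finset.range (t0+(n+1)-q.2.2.2), cost q.2.2.1 (mrun g a (ini i q.2.2.1 (y+4+q.2.2.2)) q.2.2.2 m) =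
        ∑ m ∈ Finset.range (t0+n-q.2.2.2), cost q.2.2.1 (mrun g a (ini i q.2.2.1 (y+4+q.2.2.2)) q.2.2.2 m) + cost x (mrun g a (ini (i+1) x y) t0 n) := by
      intro q hq
      have h2 := h.sub q hq
      rw [show t0+(n+1)-q.2.2.2 = (t0+n-q.2.2.2)+1 by omega, Finset.sum_range_succ, (h.cst' hrun hq (m := n) (by omega) (by omega)).2]
    have hend : ∀ k, k ≤ t0 + n → (1/2:ℝ)^(y+3+(t0+(n+1))) ≤ (1/2)^(y+4+k) := fun k hk =>
      pow_le_pow_of_le_one (by norm_num) (by norm_num) (by omega)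
    have hhalf : ∀ k, (1/2:ℝ)^(y+4+k) = (1/2) * (1/2)^(y+3+k) := fun k => by rw [← pow_succ']; congr 1; omega
    rcases hcase with ⟨rfl, rfl, rfl, rfl⟩ | ⟨q, rfl, h1, rfl, rfl, rfl⟩ | ⟨q, rfl, h1, h2, rfl, rfl, rfl⟩ | ⟨q, rfl, h1, h2, rfl, rfl, rfl⟩
    · have : cost x (mrun g a (ini (i+1) x y) t0 n) = 0 := by
        rw [hrun]; simp [cost, mv_none]
      rw [this]
      simp only [Option.elim_none] at hold ⊢
      have := hend (t0+n) le_rfl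
      rw [hhalf] at this
      have := hpos (y+3+(t0+n))
      linarith
    · have hs := hsub q rfl
      have hsp := hB.sp q.2.2.2 q.2.2.1 (y+4+q.2.2.2) (t0+(n+1)-q.2.2.2)
      simp only [Option.elim_none, Option.elim_some] at hold ⊢
      have hcb : (1/2:ℝ)^q.2.2.1 ≤ (1/2)^(y+4+c) := pow_le_pow_of_le_one (by norm_num) (by norm_num) (h.curb q rfl)
      have hl := hend q.2.2.2 (h.sub q rfl).2.1
      have e1 := hhalf c
      have e2 := hhalf q.2.2.2
      rw [show y + 3 + (c+1) = y+4+c by omega]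
      linarith
    · have hs := hsub q rfl
      have hsp := hB.sp q.2.2.2 q.2.2.1 (y+4+q.2.2.2) (t0+(n+1)-q.2.2.2)
      simp only [Option.elim_none, Option.elim_some] at hold ⊢
      have hl := hend q.2.2.2 (h.sub q rfl).2.1
      have e2 := hhalf q.2.2.2
      simp only [bts_cons, lw_cons]
      linarith
    · have hs := hsub q rfl
      simp only [Option.elim_some] at hold ⊢
      linarith

/-- starting a new chunk -/
theorem core_pick (ha : ∀ t, (a t).length = t + 1) (h : Core g a i x y t0 (n+1) ch none pr c rest) (hx : lw (bts pr) < (1/2)^x)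
    {k : ℕ} (hk : elig g y ch (a (t0+n)) = some k) {q : Chk} (hq : q = mkc (i,x,y) c (a (t0+n)) k) :
    Core g a i x y t0 (n+1) ch (some q) pr c (ini i q.2.2.1 (y+4+(t0+(n+1)))) := by
  have hlam : q.2.2.2 = t0+(n+1) := by
    rw [hq]; simp only [mkc]; rw [ha]; omega
  have hk' := List.mem_of_mem_head? hk
  rw [List.mem_filter] at hk'
  have hk2 := hk'.2
  unfold eligk at hk2
  simp only [Bool.and_eq_true, Bool.not_eq_true'] at hk2
  have hu : q.1 = (a (t0+n)).take k.unpair.1 := by rw [hq, mkc]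
  have hz : q.2.1 = k.unpair.2 := by rw [hq, mkc]
  have hbeta : q.2.2.1 = y + 4 + (Nat.unpair q.2.1).1 + c := by rw [hq, mkc]
  rw [← hu, ← hz] at hk2
  obtain ⟨⟨hnew, hok⟩, hsat⟩ := hk2
  have hit : ∀ q' ∈ (some q).toList ++ ch, q'.1.length ≤ q'.2.2.2 ∧ (∀ s, q'.2.2.2 ≤ s+1 → s < t0+(n+1) → q'.1 <+: a s) ∧
      newv g q'.1 q'.2.1 = true ∧ okv g q'.1 = true := by
    intro q' hq'
    simp only [Option.toList_some, List.cons_append, List.nil_append, List.mem_cons] at hq'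
    rcases hq' with rfl | hq'
    · refine ⟨?_, ?_, hnew, hok⟩
      · rw [hlam, hu]
        have := (List.take_prefix k.unpair.1 (a (t0+n))).length_le
        rw [ha] at this; omega
      · intro s hs hs'
        rw [hlam] at hs
        rw [show s = t0+n by omega, hu]; exact List.take_prefix _ _
    · exact h.it q' (by simpa using hq')
  have hper : ∀ u z, lw (bts (key u z ((some q).toList ++ ch))) ≤ 2 * (1/2)^(y+4+(Nat.unpair z).1) := by
    intro u z
    have hold := h.per u z
    simp only [Option.toList_none, List.nil_append] at hold
    simp only [Option.toList_some, List.cons_append, List.nil_append]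
    by_cases hc : q.1 = u ∧ q.2.1 = z
    · obtain ⟨rfl, rfl⟩ := hc
      have : key q.1 q.2.1 (q :: ch) = q :: key q.1 q.2.1 ch := by simp [key]
      rw [this, bts_cons, lw_cons]
      have hs : lw (bts (key q.1 q.2.1 ch)) < (1/2)^(y+4+(Nat.unpair q.2.1).1) := by
        by_contra hcon
        have := wge_iff.2 (not_lt.1 hcon)
        unfold satv at hsat
        unfold bts key at this
        rw [this] at hsat; simp at hsat
      have : (1/2:ℝ)^q.2.2.1 ≤ (1/2)^(y+4+(Nat.unpair q.2.1).1) := by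
        rw [hbeta]; exact pow_le_pow_of_le_one (by norm_num) (by norm_num) (by omega)
      linarith
    · have : key u z (q :: ch) = key u z ch := by
        simp only [key, List.filter_cons]
        rw [if_neg]
        simpa using hc
      rw [this]; exact hold
  constructor
  case sub =>
    intro q' hq'; cases hq'
    refine ⟨by omega, by omega, ?_⟩
    rw [hlam, Nat.sub_self]; rfl
  case cst => intro q' hq' m hm hl; cases hq'; omega
  case tot =>
    have := items_le (g := g) (y := y) ((some q).toList ++ ch) (a (t0+n)) (fun q' hq' => (hit q' hq').2.1 _ (by
      have := h.lablt
      simp only [Option.toList_some, List.cons_append, List.nil_append, List.mem_cons] at hq'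
      rcases hq' with rfl | hq'
      · omega
      · have := h.lablt q' (by simp [hq']); omega) (by omega)) (fun q' hq' => (hit q' hq').2.2.1) (fun q' hq' => (hit q' hq').2.2.2) hper
    linarith
  case it => exact hit
  case per => exact hper
  case curb => intro q' hq'; cases hq'; omega
  case nd =>
    have hh := h.nd
    simp only [Option.toList_none, List.nil_append, Option.toList_some, List.cons_append, lbs, List.map_append, List.map_cons] at hh ⊢
    rw [List.perm_middle.nodup_iff, List.nodup_cons]
    refine ⟨?_, hh⟩
    rw [← List.map_append]
    intro hmem
    obtain ⟨q', hq', he⟩ := List.mem_map.1 hmem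
    have := h.lablt q' hq'
    omega
  case lablt => exact h.lablt
  case labm => exact h.labm
  case chk => exact h.chk
  case prk => exact h.prk
  case spent =>
    have := h.spent
    simp only [Option.elim_none, Option.elim_some] at this ⊢
    rw [hlam, Nat.sub_self, Finset.range_zero, Finset.sum_empty, sub_zero]
    exact this

/-- the state after picking -/
theorem pick_cases (ha : ∀ t, (a t).length = t + 1) (h : Core g a i x y t0 (n+1) ch none pr c rest) (hx : lw (bts pr) < (1/2)^x) :
    ∃ cur' rest', pick g (i,x,y) ch pr c (a (t0+n)) = ((i,x,y), ch, cur', pr, c) :: rest' ∧ Core g a i x y t0 (n+1) ch cur' pr c rest' := by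
  unfold pick
  cases hk : elig g (i,x,y).2.2 ch (a (t0+n)) with
  | none => 
    refine ⟨none, [], rfl, ?_⟩
    exact { h with sub := by simp }
  | some k =>
    refine ⟨_, _, rfl, ?_⟩
    have := core_pick ha h hx hk rfl
    rw [show t0 + (n+1) = (a (t0+n)).length by rw [ha]; omega] at this
    exact this

theorem wge_false {l : List ℕ} {e : ℕ} (h : ¬ wge l e = true) : lw l < (1/2)^e := by
  rw [wge_iff] at h; exact not_le.1 h

theorem comb_case (g : List Bool × ℕ → Bool) (A : List Bool) (p : ℕ×ℕ×ℕ) (ch cur pr c) (acc : Option (List Frame0)) {ch1 pr1 : List Chk}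
    (hch1 : ch1 = ch.filter fun q => decide (q.1 <+: A))
    (hpr1 : pr1 = pr ++ ch.filter fun q => !(decide (q.1 <+: A))) :
    ∃ ch' cur' c' rest', ((cur = none ∧ ch' = ch1 ∧ cur' = none ∧ c' = c) ∨
      (∃ q, cur = some q ∧ ¬ q.1 <+: A ∧ ch' = ch1 ∧ cur' = none ∧ c' = c+1) ∨
      (∃ q, cur = some q ∧ q.1 <+: A ∧ acc = none ∧ ch' = q :: ch1 ∧ cur' = none ∧ c' = c) ∨
      (∃ q, cur = some q ∧ q.1 <+: A ∧ acc = some rest' ∧ ch' = ch1 ∧ cur' = some q ∧ c' = c)) ∧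
      (cur' = none → comb g A (p, ch, cur, pr, c) acc = if wge (bts pr1) p.2.1 then none else some (pick g p ch' pr1 c' A)) ∧
      (∀ q, cur' = some q → comb g A (p, ch, cur, pr, c) acc = if wge (bts pr1) p.2.1 then none else some ((p, ch', some q, pr1, c') :: rest')) := by
  subst hch1 hpr1
  cases cur with
  | none => 
    refine ⟨_, none, c, [], Or.inl ⟨rfl, rfl, rfl, rfl⟩, fun _ => rfl, by simp⟩
  | some q =>
    by_cases hq : q.1 <+: A
    · cases acc with
      | none => 
        refine ⟨_, none, c, [], Or.inr (Or.inr (Or.inl ⟨q, rfl, hq, rfl, rfl, rfl, rfl⟩)), fun _ => ?_, by simp⟩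
        simp only [comb, Option.elim_some, if_pos hq, Option.elim_none]; rfl
      | some r =>
        refine ⟨_, some q, c, r, Or.inr (Or.inr (Or.inr ⟨q, rfl, hq, rfl, rfl, rfl, rfl⟩)), by simp, ?_⟩
        rintro _ ⟨⟩
        simp only [comb, Option.elim_some, if_pos hq]; rfl
    · refine ⟨_, none, c+1, [], Or.inr (Or.inl ⟨q, rfl, hq, rfl, rfl, rfl⟩), fun _ => ?_, by simp⟩
      simp only [comb, Option.elim_some, if_neg hq]; rfl

/-- description of all states of a run -/
theorem run_core (ha : ∀ t, (a t).length = t + 1) (hB : Below g a i) (x y t0 : ℕ) : ∀ n S, mrun g a (ini (i+1) x y) t0 n = some S →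
    ∃ ch cur pr c rest, S = ((i,x,y),ch,cur,pr,c)::rest ∧ Core g a i x y t0 n ch cur pr c rest ∧ lw (bts pr) < (1/2)^x := by
  intro n
  induction n with
  | zero =>
    intro S hS
    simp only [mrun, Option.some.injEq] at hS
    subst hS
    exact ⟨[], none, [], 0, [], rfl, core_start .., by simp⟩
  | succ n ih =>
    intro S hS
    rw [mrun_succ, Option.bind_eq_some_iff] at hS
    obtain ⟨S0, h0, h1⟩ := hS
    obtain ⟨ch, cur, pr, c, rest, rfl, hC, hpr⟩ := ih S0 h0
    rw [mstep_cons] at h1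
    obtain ⟨ch', cur', c', rest', hcase, e1, e2⟩ := comb_case g (a (t0+n)) (i,x,y) ch cur pr c (mstep g rest (a (t0+n))) rfl rfl
    have hC' := core_step ha hB hC h0 rfl rfl hcase
    cases cur' with
    | none =>
      rw [e1 rfl] at h1
      split_ifs at h1 with hw
      have hw := wge_false hw
      obtain ⟨cur'', rest'', h3, h4⟩ := pick_cases ha hC' hw
      rw [h3] at h1
      exact ⟨_, _, _, _, _, (Option.some.inj h1).symm, h4, hw⟩
    | some q =>
      rw [e2 q rfl] at h1
      split_ifs at h1 with hw
      exact ⟨_, _, _, _, _, (Option.some.inj h1).symm, hC', wge_false hw⟩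

theorem lw_le_sum {F : ℕ → ℝ} (hF : ∀ m, 0 ≤ F m) {lb : ℕ → Option ℕ} {P : ℕ → Prop} [DecidablePred P] (n : ℕ) (l : List Chk)
    (hnd : (lbs l).Nodup) (h : ∀ q ∈ l, (1/2:ℝ)^q.2.2.1 ≤ ∑ m ∈ (Finset.range n).filter (fun m => lb m = some q.2.2.2 ∧ P m), F m) :
    lw (bts l) ≤ ∑ m ∈ (Finset.range n).filter (fun m => P m ∧ ∃ q ∈ l, lb m = some q.2.2.2), F m := by
  classical
  induction l with
  | nil => simp
  | cons q l ih =>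
    simp only [lbs, List.map_cons, List.nodup_cons] at hnd
    simp only [List.mem_cons, forall_eq_or_imp] at h
    have h1 := ih hnd.2 h.2
    rw [bts_cons, lw_cons]
    refine (add_le_add h.1 h1).trans ?_
    rw [← Finset.sum_union]
    · apply Finset.sum_le_sum_of_subset_of_nonneg
      · intro m hm
        simp only [Finset.mem_union, Finset.mem_filter] at hm ⊢
        rcases hm with ⟨h1, h2, h3⟩ | ⟨h1, h2, q', h3, h4⟩
        · exact ⟨h1, h3, q, by simp, h2⟩
        · exact ⟨h1, h2, q', by simp [h3], h4⟩
      · intro m _ _; exact hF m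
    · rw [Finset.disjoint_left]
      intro m hm hm'
      simp only [Finset.mem_filter] at hm hm'
      obtain ⟨_, _, q', h3, h4⟩ := hm'
      rw [hm.2.1] at h4
      apply hnd.1
      rw [List.mem_map]
      exact ⟨q', h3, (Option.some.inj h4).symm⟩

theorem mrun_none_mono (g a S t0) {n n' : ℕ} (h : n ≤ n') (hn : mrun g a S t0 n = none) : mrun g a S t0 n' = none := by
  induction n', h using Nat.le_induction with
  | base => exact hn
  | succ n' _ ih => rw [mrun_succ, ih]; rfl

theorem below_zero (g a) : Below g a 0 := by
  have h0 : ∀ x y t0, mrun g a (ini 0 x y) t0 0 = some [] := fun x y t0 => rfl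
  have h1 : ∀ x y t0 n, mrun g a (ini 0 x y) t0 (n+1) = none := fun x y t0 n =>
    mrun_none_mono g a _ _ (show 1 ≤ n+1 by omega) rfl
  have hc : ∀ x y t0, cost x (mrun g a (ini 0 x y) t0 0) = (1/2)^x := fun x y t0 => by
    rw [h0]; simp [cost, mv_nil]
  constructor
  · intro t0 x y n
    cases n with
    | zero => simp; positivity
    | succ n =>
      rw [Finset.sum_range_succ', hc]
      have : ∀ m, cost x (mrun g a (ini 0 x y) t0 (m+1)) = 0 := fun m => by rw [h1]; rfl
      simp only [this, Finset.sum_const_zero, zero_add]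
      have : (0:ℝ) ≤ (1/2)^y := by positivity
      linarith
  · intro t0 x y n hs hn
    cases n with
    | succ n => rw [h1] at hs; simp at hs
    | zero =>
      have : (Finset.range (0+1)).filter (fun m => 0 + 1 ≤ dd a (t0+0+1) (t0+m)) = {0} := by
        ext m
        simp only [Finset.mem_filter, Finset.mem_range, Finset.mem_singleton]
        constructor
        · omega
        · rintro rfl
          refine ⟨by omega, ?_⟩
          simp [dd]
      rw [this, Finset.sum_singleton, hc]

theorem below_succ (ha : ∀ t, (a t).length = t + 1) (hB : Below g a i) : Below g a (i+1) := by
  have hend : ∀ t0 x y n S, mrun g a (ini (i+1) x y) t0 n = some S → mrun g a (ini (i+1) x y) t0 (n+1) = none →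
      ∃ ch cur pr c rest, Core g a i x y t0 (n+1) ch cur pr c rest ∧ (1/2)^x ≤ lw (bts pr) := by
    intro t0 x y n S hS hn
    obtain ⟨ch, cur, pr, c, rest, rfl, hC, hpr⟩ := run_core ha hB x y t0 n S hS
    rw [mrun_succ, hS, Option.bind_some, mstep_cons] at hn
    obtain ⟨ch', cur', c', rest', hcase, e1, e2⟩ := comb_case g (a (t0+n)) (i,x,y) ch cur pr c (mstep g rest (a (t0+n))) rfl rfl
    have hC' := core_step ha hB hC hS rfl rfl hcase
    refine ⟨_, _, _, _, _, hC', ?_⟩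
    rw [← wge_iff]
    cases cur' with
    | none => rw [e1 rfl] at hn; split_ifs at hn with hw; exact hw
    | some q => rw [e2 q rfl] at hn; split_ifs at hn with hw; exact hw
  have hspent : ∀ t0 x y n, (∃ ch cur pr c rest, Core g a i x y t0 n ch cur pr c rest) →
      ∑ m ∈ Finset.range n, cost x (mrun g a (ini (i+1) x y) t0 m) ≤ (1/2)^x + (1/2)^y := by
    rintro t0 x y n ⟨ch, cur, pr, c, rest, hC⟩
    have h1 := hC.spent
    have h2 := hC.tot
    have h3 : (1/2:ℝ)^(y+3) = (1/8) * (1/2)^y := by rw [pow_add]; norm_num; ring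
    have h4 : (0:ℝ) < (1/2)^y := by positivity
    have h5 : (0:ℝ) < (1/2)^(y+3+c) := by positivity
    cases cur with
    | none =>
      simp only [Option.elim_none, Option.toList_none, List.nil_append] at h1 h2
      have h6 : (0:ℝ) < (1/2)^(y+3+(t0+n)) := by positivity
      linarith
    | some q =>
      simp only [Option.elim_some, Option.toList_some, List.cons_append, List.nil_append, bts_cons, lw_cons] at h1 h2
      have h6 : (0:ℝ) < (1/2)^(y+3+q.2.2.2) := by positivity
      have h8 : (1/2:ℝ)^(y+4+q.2.2.2) ≤ (1/2)^(y+3) := pow_le_pow_of_le_one (by norm_num) (by norm_num) (by omega)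
      have h7 := hB.sp q.2.2.2 q.2.2.1 (y+4+q.2.2.2) (t0+n-q.2.2.2)
      linarith
  constructor
  · intro t0 x y n
    induction n with
    | zero => simp; positivity
    | succ n ih =>
      cases h : mrun g a (ini (i+1) x y) t0 n with
      | none => 
        rw [Finset.sum_range_succ, h]
        simpa [cost] using ih
      | some S =>
        cases h' : mrun g a (ini (i+1) x y) t0 (n+1) with
        | none =>
          obtain ⟨ch, cur, pr, c, rest, hC, _⟩ := hend t0 x y n S h h'
          exact hspent t0 x y _ ⟨_, _, _, _, _, hC⟩
        | some S' => 
          obtain ⟨ch, cur, pr, c, rest, rfl, hC, hpr⟩ := run_core ha hB x y t0 _ S' h'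
          exact hspent t0 x y _ ⟨_, _, _, _, _, hC⟩
  · intro t0 x y n hs hn
    obtain ⟨S, hS⟩ := Option.isSome_iff_exists.1 hs
    obtain ⟨ch, cur, pr, c, rest, hC, hpr⟩ := hend t0 x y n S hS hn
    refine hpr.trans ?_
    have hnd : (lbs pr).Nodup := by
      have := hC.nd
      unfold lbs at this ⊢
      rw [List.map_append] at this
      exact this.of_append_left
    refine (lw_le_sum (F := fun m => cost x (mrun g a (ini (i+1) x y) t0 m)) (fun m => cost_nonneg _ _)
      (lb := fun m => lab (mrun g a (ini (i+1) x y) t0 m)) (P := fun m => i+2 ≤ dd a (t0+(n+1)) (t0+m)) (n+1) pr hnd hC.prk).trans ?_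
    exact sum_filter_mono (fun m => cost_nonneg _ _) le_rfl fun m _ hm => hm.1

theorem below_all (ha : ∀ t, (a t).length = t + 1) : ∀ i, Below g a i
  | 0 => below_zero g a
  | i+1 => below_succ ha (below_all ha i)
end machine

open MeasureTheory ENNReal

section term
variable {g : List Bool × ℕ → Bool} {a : ℕ → List Bool} {i x y t0 n : ℕ} {A : ℕ → Bool}

theorem satv_iff {chs : List Chk} {u : List Bool} {z : ℕ} : satv y chs u z = true ↔ (1/2:ℝ)^(y+4+(Nat.unpair z).1) ≤ lw (bts (key u z chs)) := by
  unfold satv; rw [wge_iff]; rfl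

theorem key_filter {u w : List Bool} {z : ℕ} (ch : List Chk) (h : u <+: w) :
    key u z (ch.filter fun q => decide (q.1 <+: w)) = key u z ch := by
  unfold key
  rw [List.filter_filter]
  apply List.filter_congr
  intro q _
  by_cases hq : q.1 = u
  · simp [hq, h]
  · simp [hq]

/-- description of a step of an infinite run -/
theorem run_step {p : ℕ×ℕ×ℕ} {ch cur pr c rest S t} (h : mrun g a S t0 n = some ((p,ch,cur,pr,c)::rest)) (h' : mrun g a S t0 (n+1) = some t) :
    ∃ ch' cur' c' rest', t = (p, ch', cur', pr ++ ch.filter (fun q => !(decide (q.1 <+: a (t0+n)))), c') :: rest' ∧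
    ((∃ q, cur = some q ∧ cur' = some q ∧ c' = c ∧ ch' = ch.filter (fun q => decide (q.1 <+: a (t0+n)))) ∨
     (cur' = (elig g p.2.2 ch' (a (t0+n))).map (mkc p c' (a (t0+n))) ∧ ((cur = none ∧ ch' = ch.filter (fun q => decide (q.1 <+: a (t0+n)))) ∨
       (∃ q, cur = some q ∧ ¬ q.1 <+: a (t0+n) ∧ ch' = ch.filter (fun q => decide (q.1 <+: a (t0+n)))) ∨
       (∃ q, cur = some q ∧ c' = c ∧ ch' = q :: ch.filter (fun q => decide (q.1 <+: a (t0+n))))))) := by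
  rw [mrun_succ, h, Option.bind_some, mstep_cons] at h'
  obtain ⟨ch', cur', c', rest', hcase, e1, e2⟩ := comb_case g (a (t0+n)) p ch cur pr c (mstep g rest (a (t0+n))) rfl rfl
  have hp : ∃ rest'', pick g p ch' (pr ++ ch.filter (fun q => !(decide (q.1 <+: a (t0+n))))) c' (a (t0+n)) =
      (p, ch', (elig g p.2.2 ch' (a (t0+n))).map (mkc p c' (a (t0+n))), pr ++ ch.filter (fun q => !(decide (q.1 <+: a (t0+n)))), c') :: rest'' := by
    unfold pick
    cases elig g p.2.2 ch' (a (t0+n)) with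
    | none => exact ⟨_, rfl⟩
    | some k => exact ⟨_, rfl⟩
  obtain ⟨rest'', hp⟩ := hp
  rcases hcase with ⟨rfl, rfl, rfl, rfl⟩ | ⟨q, rfl, h1, rfl, rfl, rfl⟩ | ⟨q, rfl, h1, h2, rfl, rfl, rfl⟩ | ⟨q, rfl, h1, h2, rfl, rfl, rfl⟩
  · rw [e1 rfl] at h'
    split_ifs at h' with hw
    rw [hp] at h'
    exact ⟨_, _, _, _, (Option.some.inj h').symm, Or.inr ⟨rfl, Or.inl ⟨rfl, rfl⟩⟩⟩
  · rw [e1 rfl] at h'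
    split_ifs at h' with hw
    rw [hp] at h'
    exact ⟨_, _, _, _, (Option.some.inj h').symm, Or.inr ⟨rfl, Or.inr (Or.inl ⟨q, rfl, h1, rfl⟩)⟩⟩
  · rw [e1 rfl] at h'
    split_ifs at h' with hw
    rw [hp] at h'
    exact ⟨_, _, _, _, (Option.some.inj h').symm, Or.inr ⟨rfl, Or.inr (Or.inr ⟨q, rfl, rfl, rfl⟩)⟩⟩
  · rw [e2 q rfl] at h'
    split_ifs at h' with hw
    exact ⟨_, _, _, _, (Option.some.inj h').symm, Or.inl ⟨q, rfl, rfl, rfl, rfl⟩⟩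

theorem elig_least {ch : List Chk} {w : List Bool} {k : ℕ} (hk : k < w.length) (h1 : eligk g y ch w k = true)
    (h2 : ∀ k' < k, ¬ eligk g y ch w k' = true) : elig g y ch w = some k := by
  unfold elig
  have hs : List.range w.length = List.range k ++ k :: (List.range (w.length - (k+1))).map (k+1+·) := by
    have : w.length = (k+1) + (w.length - (k+1)) := by omega
    conv_lhs => rw [this, List.range_add, List.range_succ]
    simp
  rw [hs, List.filter_append]
  have : (List.range k).filter (fun k => eligk g y ch w k) = [] := by
    rw [List.filter_eq_nil_iff]
    intro k' hk'
    exact h2 k' (List.mem_range.1 hk')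
  rw [this, List.filter_cons, if_pos h1]; rfl

theorem mrun_comp (hg : Primrec g) (hac : Computable a) (S : List Frame0) (t0 : ℕ) : Computable fun n => mrun g a S t0 n := by
  have h1 : Computable fun n : ℕ => (Nat.rec (some S) (fun n o => o.bind fun S => mstep g S (a (t0+n))) n : Option (List Frame0)) := by
    refine Computable.nat_rec (f := fun n : ℕ => n) (g := fun _ => some S)
      (h := fun _ (p : ℕ × Option (List Frame0)) => p.2.bind fun S => mstep g S (a (t0+p.1))) Computable.id (Computable.const _) ?_
    have h2 : Computable fun q : ℕ × ℕ × Option (List Frame0) => (q.2.2, a (t0 + q.2.1)) :=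
      (Primrec.to_comp (by fun_prop)).pair (hac.comp (Primrec.to_comp (by fun_prop)))
    have h3 : Computable fun r : Option (List Frame0) × List Bool => r.1.bind fun S => mstep g S r.2 := Primrec.to_comp (by fun_prop)
    exact h3.comp h2
  refine h1.of_eq fun n => ?_
  induction n with
  | zero => rfl
  | succ n ih => rw [mrun_succ, ← ih]

/-- termination -/
theorem term_succ (ha : ∀ t, (a t).length = t + 1) (hac : Computable a) (hg : Primrec g)
    (hconv : ∀ ℓ, ∃ t, ∀ t' ≥ t, strPrefix A ℓ <+: a t')
    (hbd : Bdd {z | ∃ ℓ, g (strPrefix A ℓ, z) = true} 1)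
    (hnc : ¬ ∃ M : Set ℕ, (REPred fun z => z ∈ M) ∧ (∃ C, Bdd M C) ∧ {z | ∃ ℓ, g (strPrefix A ℓ, z) = true} ⊆ M)
    (ih : ∀ t0 x y, ∃ n, mrun g a (ini i x y) t0 n = none) (t0 x y : ℕ) : ∃ n, mrun g a (ini (i+1) x y) t0 n = none := by
  by_contra hcon
  have hcon : ∀ n, ∃ S, mrun g a (ini (i+1) x y) t0 n = some S := fun n => by
    by_contra hh
    apply hcon
    refine ⟨n, ?_⟩
    cases h : mrun g a (ini (i+1) x y) t0 n with
    | none => rfl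
    | some S => exact absurd ⟨S, h⟩ hh
  choose S hS using hcon
  have hB := below_all (g := g) ha i
  choose ch cur pr c rest hSe hC hpr using fun n => run_core ha hB x y t0 n (S n) (hS n)
  have hrun : ∀ n, mrun g a (ini (i+1) x y) t0 n = some (((i,x,y),ch n,cur n,pr n,c n)::rest n) := fun n => by rw [hS, ← hSe]
  have hstep : ∀ n, pr (n+1) = pr n ++ (ch n).filter (fun q => !(decide (q.1 <+: a (t0+n)))) ∧
    ((∃ q, cur n = some q ∧ cur (n+1) = some q ∧ c (n+1) = c n ∧ ch (n+1) = (ch n).filter (fun q => decide (q.1 <+: a (t0+n)))) ∨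
     (cur (n+1) = (elig g y (ch (n+1)) (a (t0+n))).map (mkc (i,x,y) (c (n+1)) (a (t0+n))) ∧ ((cur n = none ∧ ch (n+1) = (ch n).filter (fun q => decide (q.1 <+: a (t0+n)))) ∨
       (∃ q, cur n = some q ∧ ¬ q.1 <+: a (t0+n) ∧ ch (n+1) = (ch n).filter (fun q => decide (q.1 <+: a (t0+n)))) ∨
       (∃ q, cur n = some q ∧ c (n+1) = c n ∧ ch (n+1) = q :: (ch n).filter (fun q => decide (q.1 <+: a (t0+n))))))) := by
    intro n
    obtain ⟨ch', cur', c', rest', h1, h2⟩ := run_step (hrun n) (hS (n+1))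
    rw [hSe] at h1
    simp only [List.cons.injEq, Prod.mk.injEq, true_and] at h1
    obtain ⟨⟨h3, h4, h5, h6⟩, h7⟩ := h1
    subst h3 h4 h6 h7
    exact ⟨h5, h2⟩
  -- monotonicity of totals
  have hsubp : ∀ n, (ch n ++ pr n).Subperm (ch (n+1) ++ pr (n+1)) := by
    intro n
    obtain ⟨h1, h2⟩ := hstep n
    have h3 : ((ch n).filter (fun q => decide (q.1 <+: a (t0+n)))).Sublist (ch (n+1)) := by
      rcases h2 with ⟨_, _, _, _, h⟩ | ⟨_, ⟨_, h⟩ | ⟨_, _, _, h⟩ | ⟨_, _, _, h⟩⟩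
      · rw [h]
      · rw [h]
      · rw [h]
      · rw [h]; exact List.sublist_cons_self _ _
    refine List.Subperm.trans ?_ (List.Sublist.append h3 (List.Sublist.refl _)).subperm
    rw [h1]
    have h4 := List.filter_append_perm (fun q : Chk => decide (q.1 <+: a (t0+n))) (ch n)
    refine (List.Perm.trans (h4.symm.append_right _) ?_).subperm
    rw [List.append_assoc]
    exact List.Perm.append_left _ List.perm_append_comm
  have hWmono : ∀ z, Monotone fun n => lw (bts ((ch n ++ pr n).filter fun q => decide (q.2.1 = z))) := fun z =>
    monotone_nat_of_le_succ fun n => lw_subperm ((hsubp n).filter _)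
  -- every current chunk ends
  have hcurend : ∀ n, ∃ m ≥ n, ¬ ∃ q, cur m = some q ∧ cur (m+1) = some q := by
    intro n
    by_contra hh
    push Not at hh
    obtain ⟨q, hq, _⟩ := hh n le_rfl
    have hall : ∀ d, cur (n+d) = some q := by
      intro d
      induction d with
      | zero => exact hq
      | succ d ihd =>
        obtain ⟨q', h1, h2⟩ := hh (n+d) (by omega)
        rw [ihd] at h1
        cases h1
        exact h2
    obtain ⟨j, hj⟩ := ih q.2.2.2 q.2.2.1 (y+4+q.2.2.2)
    have h1 := (hC n).sub q hq
    have h2 := (hC (n+j)).sub q (hall j)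
    have := mrun_none_mono g a _ _ (show j ≤ t0 + (n+j) - q.2.2.2 by omega) hj
    rw [h2.2.2] at this; simp at this
  -- the keys along A get satisfied
  have hsat : ∀ k : ℕ, newv g (strPrefix A k.unpair.1) k.unpair.2 = true → okv g (strPrefix A k.unpair.1) = true →
      ∃ N, ∀ n ≥ N, satv y (ch n) (strPrefix A k.unpair.1) k.unpair.2 = true := by
    intro k
    induction k using Nat.strong_induction_on with
    | _ k ihk =>
    intro hnew hok
    set u := strPrefix A k.unpair.1 with hu
    set z := k.unpair.2 with hz
    obtain ⟨t1, ht1⟩ := hconv k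
    have htake : ∀ k' ≤ k, ∀ t ≥ t1, (a t).take k'.unpair.1 = strPrefix A k'.unpair.1 := by
      intro k' hk' t ht
      have h1 := ht1 t ht
      have h2 : k'.unpair.1 ≤ k := (Nat.unpair_left_le k').trans hk'
      obtain ⟨v, hv⟩ := h1
      rw [← hv, List.take_append_of_le_length (by rw [strPrefix_length]; exact h2), strPrefix_take_of_le _ h2]
    have hN0 : ∃ N0, ∀ k' < k, newv g (strPrefix A k'.unpair.1) k'.unpair.2 = true → okv g (strPrefix A k'.unpair.1) = true →
        ∀ n ≥ N0, satv y (ch n) (strPrefix A k'.unpair.1) k'.unpair.2 = true := by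
      have : ∀ k', ∃ N, k' < k → newv g (strPrefix A k'.unpair.1) k'.unpair.2 = true → okv g (strPrefix A k'.unpair.1) = true →
        ∀ n ≥ N, satv y (ch n) (strPrefix A k'.unpair.1) k'.unpair.2 = true := by
        intro k'
        by_cases hh : k' < k ∧ newv g (strPrefix A k'.unpair.1) k'.unpair.2 = true ∧ okv g (strPrefix A k'.unpair.1) = true
        · obtain ⟨N, hN⟩ := ihk k' hh.1 hh.2.1 hh.2.2
          exact ⟨N, fun _ _ _ => hN⟩
        · exact ⟨0, fun h1 h2 h3 => absurd ⟨h1, h2, h3⟩ hh⟩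
      choose N hN using this
      refine ⟨(Finset.range k).sup N, fun k' hk' h1 h2 n hn => hN k' hk' h1 h2 n (le_trans ?_ hn)⟩
      exact Finset.le_sup (f := N) (Finset.mem_range.2 hk')
    obtain ⟨N0, hN0⟩ := hN0
    obtain ⟨N, hNt, hN1, hNk⟩ : ∃ N, t1 ≤ N ∧ N0 ≤ N ∧ k ≤ N := ⟨t1 + N0 + k, by omega, by omega, by omega⟩
    have hupre : ∀ n ≥ N, u <+: a (t0+n) := fun n hn => by
      rw [hu, ← htake k le_rfl (t0+n) (by omega)]; exact List.take_prefix _ _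
    have hwmono1 : ∀ n ≥ N, lw (bts (key u z (ch n))) ≤ lw (bts (key u z (ch (n+1)))) := by
      intro n hn
      have hkf := key_filter (z := z) (ch n) (hupre n hn)
      rcases (hstep n).2 with ⟨_, _, _, _, h⟩ | ⟨_, ⟨_, h⟩ | ⟨_, _, _, h⟩ | ⟨q, _, _, h⟩⟩
      · rw [h, hkf]
      · rw [h, hkf]
      · rw [h, hkf]
      · rw [h]
        refine (le_of_eq (congrArg (fun v => lw (bts v)) hkf.symm)).trans (lw_sublist ((List.sublist_cons_self q _).filter _))
    have hwmono : ∀ n ≥ N, ∀ m ≥ n, lw (bts (key u z (ch n))) ≤ lw (bts (key u z (ch m))) := by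
      intro n hn m hm
      induction m, hm using Nat.le_induction with
      | base => exact le_rfl
      | succ m hm ihm => exact ihm.trans (hwmono1 m (by omega))
    by_contra hns
    have hns : ∀ n ≥ N, ¬ satv y (ch n) u z = true := by
      intro n hn hs
      apply hns
      refine ⟨n, fun m hm => ?_⟩
      rw [satv_iff] at hs ⊢
      exact hs.trans (hwmono n hn m hm)
    have helig : ∀ n ≥ N, elig g y (ch (n+1)) (a (t0+n)) = some k := by
      intro n hn
      apply elig_least
      · rw [ha]; omega
      · unfold eligk
        rw [htake k le_rfl _ (by omega)]
        have := hns (n+1) (by omega)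
        simp only [Bool.and_eq_true, Bool.not_eq_true']
        exact ⟨⟨hnew, hok⟩, by simpa using this⟩
      · intro k' hk' he
        unfold eligk at he
        rw [htake k' hk'.le _ (by omega)] at he
        simp only [Bool.and_eq_true, Bool.not_eq_true'] at he
        have := hN0 k' hk' he.1.1 he.1.2 (n+1) (by omega)
        rw [this] at he; simp at he
    have hfresh : ∀ n ≥ N, (¬ ∃ q, cur n = some q ∧ cur (n+1) = some q) → ∃ q, cur (n+1) = some q ∧ q.1 = u ∧ q.2.1 = z ∧
        q.2.2.1 = y+4+(Nat.unpair z).1 + c (n+1) := by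
      intro n hn hh
      rcases (hstep n).2 with ⟨q, h1, h2, _⟩ | ⟨h1, _⟩
      · exact absurd ⟨q, h1, h2⟩ hh
      · rw [helig n hn] at h1
        refine ⟨_, h1, ?_, ?_, ?_⟩
        · simp only [mkc]; rw [htake k le_rfl _ (by omega)]
        · simp only [mkc]; rfl
        · simp only [mkc]; rfl
    obtain ⟨n0, hn0, hnc0⟩ := hcurend N
    obtain ⟨q1, hq1⟩ := hfresh n0 hn0 hnc0
    set c1 := c (n0+1) with hc1
    have hinv : ∀ n ≥ n0+1, c n = c1 ∧ ∃ q, cur n = some q ∧ q.1 = u ∧ q.2.1 = z ∧ q.2.2.1 = y+4+(Nat.unpair z).1 + c1 := by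
      intro n hn
      induction n, hn using Nat.le_induction with
      | base => exact ⟨rfl, q1, hq1⟩
      | succ n hn ihn =>
        obtain ⟨hcn, q, hqn, h1, h2, h3⟩ := ihn
        rcases (hstep n).2 with ⟨q', e1, e2, e3, _⟩ | ⟨e1, ⟨e, _⟩ | ⟨q', e, e2, _⟩ | ⟨q', e, e2, _⟩⟩
        · rw [hqn] at e1; cases e1
          exact ⟨e3.trans hcn, q, e2, h1, h2, h3⟩
        · rw [hqn] at e; simp at e
        · rw [hqn] at e; cases e
          rw [h1] at e2
          exact absurd (hupre n (by omega)) e2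
        · have hcc : c (n+1) = c1 := e2.trans hcn
          refine ⟨hcc, ?_⟩
          rw [helig n (by omega), hcc] at e1
          refine ⟨_, e1, ?_, ?_, ?_⟩
          · simp only [mkc]; rw [htake k le_rfl _ (by omega)]
          · simp only [mkc]; rfl
          · simp only [mkc]; rfl
    set δ : ℝ := (1/2)^(y+4+(Nat.unpair z).1 + c1) with hδ
    have hprog : ∀ n ≥ n0+1, ∃ m ≥ n, lw (bts (key u z (ch n))) + δ ≤ lw (bts (key u z (ch m))) := by
      intro n hn
      obtain ⟨m, hm, hmc⟩ := hcurend n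
      refine ⟨m+1, by omega, ?_⟩
      obtain ⟨hcn, q, hqn, h1, h2, h3⟩ := hinv m (by omega)
      have hkf := key_filter (z := z) (ch m) (hupre m (by omega))
      rcases (hstep m).2 with ⟨q', e1, e2, e3, _⟩ | ⟨e1, ⟨e, _⟩ | ⟨q', e, e2, _⟩ | ⟨q', e, e2, e3⟩⟩
      · exact absurd ⟨q', e1, e2⟩ hmc
      · rw [hqn] at e; simp at e
      · rw [hqn] at e; cases e
        rw [h1] at e2
        exact absurd (hupre m (by omega)) e2
      · rw [hqn] at e; cases e
        have : key u z (ch (m+1)) = q :: key u z (ch m) := by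
          rw [e3, ← hkf]
          simp only [key, List.filter_cons, h1, h2]; simp
        rw [this, bts_cons, lw_cons, h3]
        have := hwmono n (by omega) m hm
        linarith
    have hmany : ∀ j : ℕ, ∃ m ≥ n0+1, (j:ℝ) * δ ≤ lw (bts (key u z (ch m))) := by
      intro j
      induction j with
      | zero => exact ⟨n0+1, le_rfl, by simpa using lw_nonneg _⟩
      | succ j ihj =>
        obtain ⟨m, hm, h⟩ := ihj
        obtain ⟨m', hm', h'⟩ := hprog m hm
        refine ⟨m', by omega, ?_⟩
        push_cast; linarith
    obtain ⟨m, hm, h⟩ := hmany (2^c1)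
    apply hns m (by omega)
    rw [satv_iff]
    refine le_trans (le_of_eq ?_) h
    rw [hδ, pow_add _ _ c1]
    push_cast
    rw [mul_comm, mul_assoc, ← mul_pow]; norm_num
  -- conclusion
  apply hnc
  refine ⟨{z | ∃ n, (1/2:ℝ)^(y+4+(Nat.unpair z).1) ≤ lw (bts ((ch n ++ pr n).filter fun q => decide (q.2.1 = z)))}, ?_, ?_, ?_⟩
  · let tst : ℕ × Option (List Frame0) → Bool := fun v => (v.2.bind fun S => S.head?.map fun f =>
      wge (((f.2.1 ++ f.2.2.2.1).filter fun q => decide (q.2.1 = v.1)).map fun q => q.2.2.1) (y+4+(Nat.unpair v.1).1)).getD false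
    have htst : Primrec tst := by unfold tst; fun_prop
    refine re_of_comp (f := fun v => tst (v.1, mrun g a (ini (i+1) x y) t0 v.2)) ?_ ?_
    · exact htst.to_comp.comp ((Primrec.to_comp (by fun_prop)).pair ((mrun_comp hg hac _ _).comp (Primrec.to_comp (by fun_prop))))
    · intro z
      rw [Set.mem_ofPred_eq]
      refine exists_congr fun n => ?_
      simp only [tst, hrun, Option.bind_some, List.head?_cons, Option.map_some, Option.getD_some]
      rw [wge_iff]; rfl
  · refine ⟨2^(y+4) * ((1/2)^x + (1/2)^(y+3)), ?_⟩
    intro F hF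
    have : ∃ n, ∀ z ∈ F, (1/2:ℝ)^(y+4+(Nat.unpair z).1) ≤ lw (bts ((ch n ++ pr n).filter fun q => decide (q.2.1 = z))) := by
      have : ∀ z, ∃ n, z ∈ F → (1/2:ℝ)^(y+4+(Nat.unpair z).1) ≤ lw (bts ((ch n ++ pr n).filter fun q => decide (q.2.1 = z))) := by
        intro z
        by_cases hz : z ∈ F
        · obtain ⟨n, hn⟩ := hF hz
          exact ⟨n, fun _ => hn⟩
        · exact ⟨0, fun h => absurd h hz⟩
      choose N hN using this
      exact ⟨F.sup N, fun z hz => (hN z hz).trans (hWmono z (Finset.le_sup (f := N) hz))⟩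
    obtain ⟨n, hn⟩ := this
    have h1 : ∑ z ∈ F, (1/2:ℝ)^(y+4+(Nat.unpair z).1) ≤ (1/2)^x + (1/2)^(y+3) := by
      refine (Finset.sum_le_sum hn).trans ?_
      have hsup := lw_by_z (F ∪ ((ch n ++ pr n).map fun q => q.2.1).toFinset) (ch n ++ pr n) (fun q hq => by
        rw [Finset.mem_union, List.mem_toFinset]; exact Or.inr (List.mem_map.2 ⟨q, hq, rfl⟩))
      have h2 := (hC n).tot
      have h3 : lw (bts (ch n ++ pr n)) ≤ (1/2)^x + (1/2)^(y+3) := by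
        simp only [bts_append, lw_append] at h2 ⊢
        have := lw_nonneg (bts (cur n).toList)
        linarith
      refine le_trans ?_ h3
      rw [hsup]
      exact Finset.sum_le_sum_of_subset_of_nonneg Finset.subset_union_left fun z _ _ => lw_nonneg _
    have h2 : ∑ z ∈ F, wt z = 2^(y+4) * ∑ z ∈ F, (1/2:ℝ)^(y+4+(Nat.unpair z).1) := by
      rw [Finset.mul_sum]
      apply Finset.sum_congr rfl
      intro z _
      rw [pow_add _ (y+4), ← mul_assoc, ← mul_pow]; norm_num [wt]
    rw [h2]
    gcongr
  · rintro z ⟨ℓ0, hℓ0⟩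
    have hex : ∃ ℓ, vz g (strPrefix A ℓ) z = true := by
      refine ⟨ℓ0 + z + 1, ?_⟩
      unfold vz
      simp only [strPrefix_length, Bool.and_eq_true, decide_eq_true_eq, List.any_eq_true, List.mem_range]
      refine ⟨by omega, ℓ0, by omega, ?_⟩
      rw [strPrefix_take_of_le _ (by omega)]; exact hℓ0
    classical
    let ℓ := Nat.find hex
    have hℓ : vz g (strPrefix A ℓ) z = true := Nat.find_spec hex
    have hpos : 0 < ℓ := by
      by_contra h0
      have h0 : ℓ = 0 := by omega
      rw [h0] at hℓ
      unfold vz at hℓ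
      simp [strPrefix_length] at hℓ
    have hnew : newv g (strPrefix A ℓ) z = true := by
      unfold newv
      rw [hℓ, strPrefix_length, strPrefix_take_of_le _ (by omega)]
      have := Nat.find_min hex (m := ℓ - 1) (by omega)
      simpa using this
    have hok : okv g (strPrefix A ℓ) = true := by
      unfold okv
      rw [wle_iff]
      have := hbd (((List.range (strPrefix A ℓ).length).filter fun z => vz g (strPrefix A ℓ) z).toFinset) (by
        intro z' hz'
        simp only [List.coe_toFinset, List.mem_filter, Set.mem_ofPred_eq] at hz'
        have := hz'.2
        unfold vz at this
        simp only [Bool.and_eq_true, decide_eq_true_eq, List.any_eq_true, List.mem_range, strPrefix_length] at this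
        obtain ⟨_, ℓ', h1, h2⟩ := this
        rw [strPrefix_take_of_le _ (by omega)] at h2
        exact ⟨ℓ', h2⟩)
      rw [List.sum_toFinset _ (List.nodup_range.filter _)] at this
      unfold lw
      rw [List.map_map]
      exact this
    obtain ⟨N, hN⟩ := hsat (Nat.pair ℓ z) (by simpa using hnew) (by simpa using hok)
    have := hN N le_rfl
    simp only [Nat.unpair_pair] at this
    rw [satv_iff] at this
    refine ⟨N, this.trans (lw_sublist ?_)⟩
    unfold key
    rw [List.filter_append]
    refine List.Sublist.trans ?_ (List.sublist_append_left _ _)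
    apply List.monotone_filter_right
    intro q hq
    simp at hq ⊢
    exact hq.2

theorem term_all (ha : ∀ t, (a t).length = t + 1) (hac : Computable a) (hg : Primrec g)
    (hconv : ∀ ℓ, ∃ t, ∀ t' ≥ t, strPrefix A ℓ <+: a t')
    (hbd : Bdd {z | ∃ ℓ, g (strPrefix A ℓ, z) = true} 1)
    (hnc : ¬ ∃ M : Set ℕ, (REPred fun z => z ∈ M) ∧ (∃ C, Bdd M C) ∧ {z | ∃ ℓ, g (strPrefix A ℓ, z) = true} ⊆ M) (i : ℕ) :
    ∀ t0 x y, ∃ n, mrun g a (ini i x y) t0 n = none := by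
  induction i with
  | zero => exact fun t0 x y => ⟨1, rfl⟩
  | succ i ih => exact term_succ ha hac hg hconv hbd hnc ih
end term

open MeasureTheory ENNReal

theorem geomhalf (S : Finset ℕ) (r0 : ℕ) (h : ∀ r ∈ S, r0 ≤ r) : ∑ r ∈ S, (1/2:ℝ)^r ≤ 2 * (1/2)^r0 := by
  have h1 : ∀ M : ℕ, ∑ j ∈ Finset.range M, (1/2:ℝ)^(r0+j) = (2 - 2*(1/2)^M) * (1/2)^r0 := by
    intro M
    induction M with
    | zero => simp
    | succ M ih => rw [Finset.sum_range_succ, ih, pow_add, pow_succ]; ring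
  have h2 : S ⊆ (Finset.range (S.sup id + 1)).image (r0 + ·) := by
    intro r hr
    rw [Finset.mem_image]
    refine ⟨r - r0, ?_, by have := h r hr; omega⟩
    rw [Finset.mem_range]
    have : r ≤ S.sup id := Finset.le_sup (f := id) hr
    omega
  refine (Finset.sum_le_sum_of_subset_of_nonneg h2 fun r _ _ => by positivity).trans ?_
  rw [Finset.sum_image (by intro a _ b _ hab; simpa using hab), h1]
  have : (0:ℝ) ≤ (1/2)^r0 := by positivity
  have : (0:ℝ) ≤ (1/2)^(S.sup id + 1) := by positivity
  nlinarith

theorem KK_K : ∃ cK, ∀ k x, Nat.pair k x ∈ KK → Kcpx x ≤ k + cK := kraft_chaitin KK_re KK_bdd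

/-- length of the coded string -/
def lnc (z : ℕ) : Option ℕ := (Encodable.decode z.unpair.2 : Option (List Bool)).map List.length
@[fun_prop] theorem lnc_prim {α : Type*} [Primcodable α] {f : α → ℕ} (hf : Primrec f) :
    Primrec fun a => lnc (f a) := by unfold lnc; fun_prop
theorem lnc_pair (k : ℕ) (σ : List Bool) : lnc (Nat.pair k (Encodable.encode σ)) = some σ.length := by
  simp [lnc]

/-- descriptions of strings of length `n` found by stage `s` -/
noncomputable def dsl (n s : ℕ) : List ℕ := (List.range s).filter fun z => kkf (z, s) && decide (lnc z = some n)
@[fun_prop] theorem dsl_prim {α : Type*} [Primcodable α] {f h : α → ℕ} (hf : Primrec f) (hh : Primrec h) :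
    Primrec fun a => dsl (f a) (h a) := by unfold dsl; fun_prop

theorem lw_dsl (n s : ℕ) : lw ((dsl n s).map fun z => z.unpair.1) = ∑ z ∈ (dsl n s).toFinset, wt z := by
  unfold dsl
  rw [List.sum_toFinset _ (List.nodup_range.filter _)]
  unfold lw; rw [List.map_map]; rfl

theorem dsl_mono {n s s' : ℕ} (h : s ≤ s') : (dsl n s).toFinset ⊆ (dsl n s').toFinset := by
  intro z hz
  simp only [dsl, List.mem_toFinset, List.mem_filter, List.mem_range, Bool.and_eq_true] at hz ⊢
  exact ⟨by omega, kkf_mono h hz.2.1, hz.2.2⟩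

/-- the counting theorem -/
theorem counting (b : ℕ) : ∃ C : ℕ, ∀ n, ∀ F : Finset (List Bool), (∀ σ ∈ F, σ.length = n ∧
    Kcpx (Encodable.encode σ) ≤ KofNat n + b) → F.card ≤ C := by
  classical
  let W : Set ℕ := {z | ∃ v : ℕ × ℕ, z.unpair.2 = one v.1 ∧ wge ((dsl v.1 v.2).map fun z => z.unpair.1) z.unpair.1 = true}
  have hWre : REPred fun z => z ∈ W := by
    refine REPred.ex (p := fun x : ℕ × ℕ × ℕ => x.1.unpair.2 = one x.2.1 ∧ wge ((dsl x.2.1 x.2.2).map fun z => z.unpair.1) x.1.unpair.1 = true) ?_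
    exact (re_dec (Primrec.to_comp (by fun_prop))).and' (re_bool (Primrec.to_comp (by fun_prop)))
  have hWb : Bdd W 2 := by
    intro F hF
    have hF' : ∀ z, z ∈ F → ∃ v : ℕ × ℕ, z.unpair.2 = one v.1 ∧ wge ((dsl v.1 v.2).map fun z => z.unpair.1) z.unpair.1 = true := fun z hz => hF hz
    choose! v h1 h2 using hF'
    set S := F.sup fun z => (v z).2
    have h3 : ∀ z ∈ F, wt z ≤ ∑ z' ∈ (dsl (v z).1 S).toFinset, wt z' := by
      intro z hz
      have := wge_iff.1 (h2 z hz)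
      rw [lw_dsl] at this
      exact this.trans (Finset.sum_le_sum_of_subset_of_nonneg (dsl_mono (Finset.le_sup (f := fun z => (v z).2) hz)) fun z _ _ => (wt_pos z).le)
    rw [← Finset.sum_fiberwise_of_maps_to (s := F) (t := F.image fun z => (v z).1) (g := fun z => (v z).1) (fun z hz => Finset.mem_image_of_mem _ hz)]
    have h4 : ∀ n ∈ F.image fun z => (v z).1, ∑ z ∈ F with (v z).1 = n, wt z ≤ 2 * ∑ z' ∈ (dsl n S).toFinset, wt z' := by
      intro n hn
      obtain ⟨z0, hz0, rfl⟩ := Finset.mem_image.1 hn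
      have hne : (F.filter fun z => (v z).1 = (v z0).1).Nonempty := ⟨z0, by simp [hz0]⟩
      obtain ⟨z1, hz1, hmin⟩ := Finset.exists_min_image _ (fun z : ℕ => z.unpair.1) hne
      rw [Finset.mem_filter] at hz1
      have : ∑ z ∈ F with (v z).1 = (v z0).1, wt z = ∑ r ∈ (F.filter fun z => (v z).1 = (v z0).1).image (fun z => z.unpair.1), (1/2:ℝ)^r := by
        rw [Finset.sum_image]
        · rfl
        · intro p hp q hq hpq
          simp only [Finset.coe_filter, Set.mem_ofPred_eq] at hp hq
          have e1 := h1 p hp.1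
          have e2 := h1 q hq.1
          rw [hp.2] at e1; rw [hq.2] at e2
          rw [← Nat.pair_unpair p, ← Nat.pair_unpair q]
          simp only at hpq
          rw [hpq, e1, e2]
      rw [this]
      refine (geomhalf _ z1.unpair.1 ?_).trans ?_
      · intro r hr
        obtain ⟨z, hz, rfl⟩ := Finset.mem_image.1 hr
        exact hmin z hz
      · have := h3 z1 hz1.1
        rw [hz1.2] at this
        unfold wt at this ⊢
        linarith
    refine (Finset.sum_le_sum h4).trans ?_
    rw [← Finset.mul_sum, ← Finset.sum_biUnion]
    · have := KK_bdd ((F.image fun z => (v z).1).biUnion fun n => (dsl n S).toFinset) (by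
        intro z hz
        simp only [Finset.coe_biUnion, Set.mem_iUnion, Finset.mem_coe, List.mem_toFinset, dsl, List.mem_filter, Bool.and_eq_true] at hz
        obtain ⟨_, _, _, h, _⟩ := hz
        exact kkf_iff.2 ⟨S, h⟩)
      linarith
    · intro n _ n' _ hne
      rw [Function.onFun, Finset.disjoint_left]
      intro z hz hz'
      simp only [List.mem_toFinset, dsl, List.mem_filter, Bool.and_eq_true, decide_eq_true_eq] at hz hz'
      have := hz.2.2.symm.trans hz'.2.2
      exact hne (Option.some.inj this)
  obtain ⟨c, hc⟩ := kraft_chaitin hWre hWb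
  refine ⟨2^(b+c+1), fun n F hF => ?_⟩
  by_contra hcard
  push Not at hcard
  let Z := F.image fun σ => Nat.pair (Kcpx (Encodable.encode σ)) (Encodable.encode σ)
  have hZK : ∀ z ∈ Z, z ∈ KK := by
    intro z hz
    obtain ⟨σ, _, rfl⟩ := Finset.mem_image.1 hz
    exact KK_mem _
  have hst : ∃ s, Z ⊆ (dsl n s).toFinset := by
    have : ∀ z, ∃ s, z ∈ Z → kkf (z, s) = true := by
      intro z
      by_cases hz : z ∈ Z
      · obtain ⟨s, hs⟩ := kkf_iff.1 (hZK z hz); exact ⟨s, fun _ => hs⟩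
      · exact ⟨0, fun h => absurd h hz⟩
    choose st hst using this
    refine ⟨Z.sup st + Z.sup id + 1, fun z hz => ?_⟩
    simp only [dsl, List.mem_toFinset, List.mem_filter, List.mem_range, Bool.and_eq_true, decide_eq_true_eq]
    have e1 : st z ≤ Z.sup st := Finset.le_sup hz
    have e2 : z ≤ Z.sup id := Finset.le_sup (f := id) hz
    refine ⟨by omega, kkf_mono (by omega) (hst z hz), ?_⟩
    obtain ⟨σ, hσ, rfl⟩ := Finset.mem_image.1 hz
    rw [lnc_pair, (hF σ hσ).1]
  obtain ⟨s, hs⟩ := hst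
  have hsum : (2^(b+c+1) : ℝ) * (1/2)^(KofNat n + b) ≤ ∑ z ∈ Z, wt z := by
    rw [Finset.sum_image (by
      intro p _ q _ hpq
      simp only [Nat.pair_eq_pair] at hpq
      exact Encodable.encode_injective hpq.2)]
    calc (2^(b+c+1) : ℝ) * (1/2)^(KofNat n + b) ≤ F.card * (1/2)^(KofNat n + b) := by
          gcongr; exact_mod_cast hcard.le
      _ = ∑ _σ ∈ F, (1/2:ℝ)^(KofNat n + b) := by rw [Finset.sum_const, nsmul_eq_mul]
      _ ≤ _ := by
          apply Finset.sum_le_sum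
          intro σ hσ
          rw [wt_pair]
          exact pow_le_pow_of_le_one (by norm_num) (by norm_num) (hF σ hσ).2
  have h1 : ∑ z ∈ Z, wt z ≤ 1 := KK_bdd Z hZK
  rcases le_or_gt (b+c+1) (KofNat n + b) with hle | hgt
  · have hw : Nat.pair (KofNat n + b - (b+c+1)) (one n) ∈ W := by
      refine ⟨(n, s), by simp, ?_⟩
      rw [wge_iff, lw_dsl]
      simp only [Nat.unpair_pair]
      refine le_trans ?_ (hsum.trans (Finset.sum_le_sum_of_subset_of_nonneg hs fun z _ _ => (wt_pos z).le))
      apply le_of_eq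
      have : (1/2:ℝ)^(KofNat n + b) = (1/2)^(KofNat n + b - (b+c+1)) * (1/2)^(b+c+1) := by rw [← pow_add]; congr 1; omega
      rw [this, mul_comm, mul_assoc, ← mul_pow]; norm_num
    have := hc _ _ hw
    unfold KofNat one at *
    omega
  · have : (1:ℝ) < 2^(b+c+1) * (1/2)^(KofNat n + b) := by
      rw [one_div_pow, mul_one_div, lt_div_iff₀ (by positivity), one_mul]
      exact pow_lt_pow_right₀ (by norm_num) hgt
    linarith

/-- finitely many paths, so `A` is isolated -/
theorem isolated (A : ℕ → Bool) (b : ℕ) : ∃ n0, ∀ X : ℕ → Bool, (∀ m, Kcpx (Encodable.encode (strPrefix X m)) ≤ KofNat m + b) →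
    strPrefix X n0 = strPrefix A n0 → X = A := by
  classical
  obtain ⟨C, hC⟩ := counting b
  let P : Set (ℕ → Bool) := {X | ∀ m, Kcpx (Encodable.encode (strPrefix X m)) ≤ KofNat m + b}
  have hdiff : ∀ X Y : ℕ → Bool, ∃ n, X ≠ Y → ∀ n' ≥ n, strPrefix X n' ≠ strPrefix Y n' := by
    intro X Y
    by_cases h : X = Y
    · exact ⟨0, fun h' => absurd h h'⟩
    · obtain ⟨k, hk⟩ := Function.ne_iff.1 h
      refine ⟨k+1, fun _ n' hn' he => hk ?_⟩
      exact (strPrefix_eq_iff.1 he) k (by omega)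
  choose df hdf using hdiff
  have hfin : P.Finite := by
    by_contra hinf
    obtain ⟨F, hF, hcard⟩ := (show P.Infinite from hinf).exists_subset_card_eq (C+1)
    set n := (F ×ˢ F).sup fun v => df v.1 v.2
    have hinj : Set.InjOn (fun X => strPrefix X n) (F : Set (ℕ → Bool)) := by
      intro X hX Y hY he
      by_contra hne
      refine hdf X Y hne n ?_ he
      exact Finset.le_sup (f := fun v : (ℕ → Bool) × (ℕ → Bool) => df v.1 v.2) (Finset.mem_product.2 ⟨hX, hY⟩ : (X, Y) ∈ F ×ˢ F)
    have := hC n (F.image fun X => strPrefix X n) (by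
      intro σ hσ
      obtain ⟨X, hX, rfl⟩ := Finset.mem_image.1 hσ
      exact ⟨strPrefix_length .., hF hX n⟩)
    rw [Finset.card_image_of_injOn hinj, hcard] at this
    omega
  refine ⟨hfin.toFinset.sup fun X => df X A, fun X hX he => ?_⟩
  by_contra hne
  exact hdf X A hne _ (Finset.le_sup (f := fun X => df X A) (hfin.mem_toFinset.2 hX)) he

/-- compactness -/
theorem conv_of_isolated {A : ℕ → Bool} {a : ℕ → List Bool} (ha : ∀ t, (a t).length = t + 1)
    (h : ∀ X : ℕ → Bool, (∀ n, ∀ T, ∃ t ≥ T, strPrefix X n <+: a t) → X = A) :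
    ∀ ℓ, ∃ t, ∀ t' ≥ t, strPrefix A ℓ <+: a t' := by
  classical
  intro ℓ
  by_contra hcon
  push Not at hcon
  let B : Set ℕ := {t | ¬ strPrefix A ℓ <+: a t}
  have hne : (Filter.atTop ⊓ Filter.principal B).NeBot := by
    rw [Filter.inf_principal_neBot_iff]
    intro U hU
    obtain ⟨t, ht⟩ := Filter.mem_atTop_sets.1 hU
    obtain ⟨t', h1, h2⟩ := hcon t
    exact ⟨t', ht t' h1, h2⟩
  let U := Ultrafilter.of (Filter.atTop ⊓ Filter.principal B)
  have hU : (U : Filter ℕ) ≤ Filter.atTop ⊓ Filter.principal B := Ultrafilter.of_le _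
  have hUt : ∀ T, ∀ᶠ t in (U : Filter ℕ), T ≤ t := fun T => (hU.trans inf_le_left) (Filter.eventually_ge_atTop T)
  have hUB : ∀ᶠ t in (U : Filter ℕ), t ∈ B := (hU.trans inf_le_right) (Filter.mem_principal_self B)
  let X : ℕ → Bool := fun n => decide (∀ᶠ t in (U : Filter ℕ), (a t)[n]? = some true)
  have hX : ∀ n, ∀ᶠ t in (U : Filter ℕ), strPrefix X n <+: a t := by
    intro n
    induction n with
    | zero => filter_upwards with t; simp [strPrefix]
    | succ n ih =>
      have hb : ∀ᶠ t in (U : Filter ℕ), (a t)[n]? = some (X n) := by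
        by_cases hx : ∀ᶠ t in (U : Filter ℕ), (a t)[n]? = some true
        · have : X n = true := by simp only [X, decide_eq_true_eq]; exact hx
          rw [this]; exact hx
        · have : X n = false := by simp only [X, decide_eq_false_iff_not]; exact hx
          rw [this]
          have h1 := Ultrafilter.eventually_not.2 hx
          filter_upwards [h1, hUt n] with t h2 h3
          have hl : n < (a t).length := by rw [ha]; omega
          rw [List.getElem?_eq_getElem hl] at h2 ⊢
          cases hh : (a t)[n] <;> simp_all
      filter_upwards [ih, hb, hUt n] with t h1 h2 h3
      rw [strPrefix_succ]
      obtain ⟨w, hw⟩ := h1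
      rw [← hw, List.getElem?_append_right (by rw [strPrefix_length]), strPrefix_length, Nat.sub_self] at h2
      cases w with
      | nil => simp at h2
      | cons x w =>
        simp at h2
        rw [← hw, h2]
        exact ⟨w, by simp⟩
  have hXA := h X fun n T => by
    obtain ⟨t, h1, h2⟩ := ((hX n).and (hUt T)).exists
    exact ⟨t, h2, h1⟩
  obtain ⟨t, h1, h2⟩ := ((hX ℓ).and hUB).exists
  rw [hXA] at h1
  exact h2 h1

open MeasureTheory ENNReal

theorem comp_search {p : ℕ × ℕ → Bool} (hp : Computable p) (h : ∀ n, ∃ s, p (n, s) = true) :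
    ∃ f : ℕ → ℕ, Computable f ∧ ∀ n, p (n, f n) = true := by
  have h3 : Partrec fun n => Nat.rfind fun s => ((p (n, s) : Bool) : Part Bool) :=
    Partrec.rfind (p := fun n s => ((p (n, s) : Bool) : Part Bool)) (by exact hp.partrec)
  have hd : ∀ n, (Nat.rfind fun s => ((p (n, s) : Bool) : Part Bool)).Dom := by
    intro n
    obtain ⟨s, hs⟩ := h n
    exact Nat.rfind_dom.2 ⟨s, Part.mem_some_iff.2 hs.symm, fun _ => trivial⟩
  refine ⟨fun n => (Nat.rfind fun s => ((p (n, s) : Bool) : Part Bool)).get (hd n), ?_, fun n => ?_⟩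
  · exact Partrec.of_eq_tot h3 fun n => Part.get_mem _
  · exact (Part.mem_some_iff.1 (Nat.mem_rfind.1 (Part.get_mem (hd n))).1).symm

section game
variable {g : List Bool × ℕ → Bool} (b' : ℕ) (σ0 : List Bool) (cK : ℕ)

/-- the state of the machine after a history -/
def ps (g : List Bool × ℕ → Bool) (L : ℕ) (h : List (List Bool)) : Option (List Frame0) :=
  h.foldl (fun o a => o.bind fun S => mstep g S a) (some (ini L 0 0))

@[fun_prop] theorem ps_prim {α : Type*} [Primcodable α] (hg : Primrec g) {L : α → ℕ} {h : α → List (List Bool)}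
    (hL : Primrec L) (hh : Primrec h) : Primrec fun v => ps g (L v) (h v) := by unfold ps; fun_prop

theorem ps_mrun (g : List Bool × ℕ → Bool) (L : ℕ) (a : ℕ → List Bool) (n : ℕ) :
    ps g L ((List.range n).map a) = mrun g a (ini L 0 0) 0 n := by
  induction n with
  | zero => rfl
  | succ n ih =>
    rw [List.range_succ, List.map_append, mrun, ← ih]
    simp [ps]

/-- `x` has a description of length at most `k` by stage `s` -/
noncomputable def kst (x k s : ℕ) : Bool := (List.range (k+1)).any fun k' => kkf (Nat.pair k' x, s)
@[fun_prop] theorem kst_prim {α : Type*} [Primcodable α] {x k s : α → ℕ}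
    (hx : Primrec x) (hk : Primrec k) (hs : Primrec s) : Primrec fun v => kst (x v) (k v) (s v) := by unfold kst; fun_prop

/-- validity of an answer -/
noncomputable def vld (g : List Bool × ℕ → Bool) (c s : ℕ) (h : List (List Bool)) (α : List Bool) : Bool :=
  ((decide (σ0 <+: α) || decide (α <+: σ0)) && (List.range (α.length+1)).all fun m => (List.range (s+1)).all fun k =>
    !(kkf (Nat.pair k (one m), s)) || kst (Encodable.encode (α.take m)) (k+b') s) &&
  (List.range (h.length+1)).all fun n => ((ps g (2^(2*c+cK)) (h.take n)).bind (mv 0)).elim true fun r =>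
    kst (Encodable.encode (α.take n)) (r+2*c) s

@[fun_prop] theorem vld_prim {α : Type*} [Primcodable α] (hg : Primrec g) {c s : α → ℕ} {h : α → List (List Bool)} {u : α → List Bool}
    (hc : Primrec c) (hs : Primrec s) (hh : Primrec h) (hu : Primrec u) :
    Primrec fun v => vld b' σ0 cK g (c v) (s v) (h v) (u v) := by unfold vld; fun_prop

/-- one move of the opponent -/
noncomputable def gst (g : List Bool × ℕ → Bool) (c s : ℕ) (h : List (List Bool)) : List (List Bool) :=
  ((strL (h.length+1)).filter fun α => vld b' σ0 cK g c s h α).head?.elim h fun α => h ++ [α]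

/-- the game -/
noncomputable def gm (g : List Bool × ℕ → Bool) (c : ℕ) (s : ℕ) : List (List Bool) :=
  Nat.rec [] (fun s h => gst b' σ0 cK g c s h) s

@[fun_prop] theorem gm_prim {α : Type*} [Primcodable α] (hg : Primrec g) {c s : α → ℕ}
    (hc : Primrec c) (hs : Primrec s) :
    Primrec fun v => gm b' σ0 cK g (c v) (s v) := by unfold gm gst; fun_prop

theorem gm_succ (c s) : gm b' σ0 cK g c (s+1) = gst b' σ0 cK g c s (gm b' σ0 cK g c s) := rfl

theorem gst_cases (c s h) : (gst b' σ0 cK g c s h = h ∧ ∀ α, α.length = h.length + 1 → ¬ vld b' σ0 cK g c s h α = true) ∨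
    ∃ α, α.length = h.length + 1 ∧ vld b' σ0 cK g c s h α = true ∧ gst b' σ0 cK g c s h = h ++ [α] := by
  unfold gst
  cases h1 : ((strL (h.length+1)).filter fun α => vld b' σ0 cK g c s h α) with
  | nil =>
    left
    refine ⟨rfl, fun α hα hv => ?_⟩
    have := List.filter_eq_nil_iff.1 h1 α (mem_strL.2 hα)
    exact this hv
  | cons α l =>
    right
    have : α ∈ ((strL (h.length+1)).filter fun α => vld b' σ0 cK g c s h α) := by rw [h1]; simp
    rw [List.mem_filter] at this
    exact ⟨α, mem_strL.1 this.1, this.2, rfl⟩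

theorem gm_mono (c) {s s'} (h : s ≤ s') : gm b' σ0 cK g c s <+: gm b' σ0 cK g c s' := by
  induction h with
  | refl => exact List.prefix_rfl
  | step h ih =>
    refine ih.trans ?_
    rw [gm_succ]
    rcases gst_cases b' σ0 cK (g := g) c _ (gm b' σ0 cK g c _) with h | ⟨α, _, _, h⟩
    · rw [h.1]
    · rw [h]; exact List.prefix_append _ _

theorem gm_inv (c s) : (gm b' σ0 cK g c s).length ≤ s ∧ ∀ t α, (gm b' σ0 cK g c s)[t]? = some α → α.length = t + 1 ∧
    ∃ s', t ≤ s' ∧ vld b' σ0 cK g c s' ((gm b' σ0 cK g c s).take t) α = true := by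
  induction s with
  | zero => simp [gm]
  | succ s ih =>
    rw [gm_succ]
    set h := gm b' σ0 cK g c s
    rcases gst_cases b' σ0 cK (g := g) c s h with h1 | ⟨α, h1, h2, h3⟩
    · rw [h1.1]; exact ⟨by omega, ih.2⟩
    · rw [h3]
      refine ⟨by simp; omega, fun t β hβ => ?_⟩
      rcases lt_trichotomy t h.length with hlt | rfl | hgt
      · rw [List.getElem?_append_left hlt] at hβ
        rw [List.take_append_of_le_length hlt.le]
        exact ih.2 t β hβ
      · simp at hβ
        subst hβ
        refine ⟨h1, s, by omega, ?_⟩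
        rw [List.take_left]
        exact h2
      · rw [List.getElem?_eq_none (by simp; omega)] at hβ
        cases hβ

/-- move in the game -/
noncomputable def mvh (g : List Bool × ℕ → Bool) (c s n : ℕ) : Option ℕ :=
  if n ≤ (gm b' σ0 cK g c s).length then (ps g (2^(2*c+cK)) ((gm b' σ0 cK g c s).take n)).bind (mv 0) else none

theorem mvh_mono {c s s' n r} (h : s ≤ s') (h1 : mvh b' σ0 cK g c s n = some r) : mvh b' σ0 cK g c s' n = some r := by
  unfold mvh at *
  split_ifs at h1 with hn
  obtain ⟨l, hl⟩ := gm_mono b' σ0 cK (g := g) c h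
  rw [← hl, List.take_append_of_le_length hn, if_pos (by simp; omega)]
  exact h1

theorem mvh_sum (c s N : ℕ) : ∑ n ∈ Finset.range N, ((mvh b' σ0 cK g c s n).elim 0 fun r => (1/2:ℝ)^r) ≤ 2 := by
  set h := gm b' σ0 cK g c s with hh
  let a : ℕ → List Bool := fun t => (h[t]?).getD (List.replicate (t+1) false)
  have ha : ∀ t, (a t).length = t+1 := by
    intro t
    simp only [a]
    cases h1 : h[t]? with
    | none => simp
    | some α => exact ((gm_inv b' σ0 cK c s).2 t α h1).1
  have hB := (below_all (g := g) ha (2^(2*c+cK))).sp 0 0 0 N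
  refine le_trans (Finset.sum_le_sum fun n _ => ?_) (hB.trans (by norm_num))
  unfold mvh
  rw [← hh]
  split_ifs with hn
  · have : h.take n = (List.range n).map a := by
      apply List.ext_getElem?
      intro i
      rw [List.getElem?_take]
      split_ifs with hi
      · have : i < h.length := by omega
        simp [a, hi, this]
      · rw [List.getElem?_eq_none (by simp; omega)]
    rw [this, ps_mrun]
    exact le_rfl
  · exact cost_nonneg _ _

/-- the requests against plain numbers -/
def gW (g : List Bool × ℕ → Bool) : Set ℕ :=
  {z | ∃ v : ℕ × ℕ × ℕ, ((mvh b' σ0 cK g v.1 v.2.1 v.2.2).elim false fun r => decide (z = Nat.pair (r+v.1+1) (one v.2.2))) = true}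

theorem gW_re (hg : Primrec g) : REPred fun z => z ∈ gW b' σ0 cK g := by
  refine REPred.ex (p := fun x : ℕ × ℕ × ℕ × ℕ => ((mvh b' σ0 cK g x.2.1 x.2.2.1 x.2.2.2).elim false fun r => decide (x.1 = Nat.pair (r+x.2.1+1) (one x.2.2.2))) = true) ?_
  refine re_bool (Primrec.to_comp ?_)
  unfold mvh
  fun_prop

theorem gW_bdd : Bdd (gW b' σ0 cK g) 2 := by
  classical
  intro F hF
  have hF' : ∀ z, z ∈ F → ∃ v : ℕ × ℕ × ℕ × ℕ, mvh b' σ0 cK g v.1 v.2.1 v.2.2.1 = some v.2.2.2 ∧ z = Nat.pair (v.2.2.2+v.1+1) (one v.2.2.1) := by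
    intro z hz
    obtain ⟨⟨c, s, n⟩, h⟩ := hF hz
    simp only at h
    cases hm : mvh b' σ0 cK g c s n with
    | none => rw [hm] at h; cases h
    | some r => rw [hm] at h; exact ⟨(c, s, n, r), hm, by simpa using h⟩
  choose! v h1 h2 using hF'
  set S := F.sup fun z => (v z).2.1
  set N := F.sup fun z => (v z).2.2.1
  have h3 : ∀ z ∈ F, mvh b' σ0 cK g (v z).1 S (v z).2.2.1 = some (v z).2.2.2 := fun z hz =>
    mvh_mono _ _ _ (Finset.le_sup (f := fun z => (v z).2.1) hz) (h1 z hz)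
  rw [← Finset.sum_fiberwise_of_maps_to (s := F) (t := F.image fun z => (v z).1) (g := fun z => (v z).1) (fun z hz => Finset.mem_image_of_mem _ hz)]
  refine (Finset.sum_le_sum (g := fun c => (1/2:ℝ)^c) fun c _ => ?_).trans ((geomhalf _ 0 (by simp)).trans (by norm_num))
  have h4 : ∑ z ∈ F with (v z).1 = c, wt z = ∑ n ∈ (F.filter fun z => (v z).1 = c).image (fun z => (v z).2.2.1),
      (1/2:ℝ)^(c+1) * ((mvh b' σ0 cK g c S n).elim 0 fun r => (1/2:ℝ)^r) := by
    rw [Finset.sum_image]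
    · refine Finset.sum_congr rfl fun z hz => ?_
      rw [Finset.mem_filter] at hz
      have := h3 z hz.1
      rw [hz.2] at this
      rw [this]
      conv_lhs => rw [h2 z hz.1, wt_pair, hz.2]
      simp only [Option.elim]
      ring
    · intro p hp q hq hpq
      simp only [Finset.coe_filter, Set.mem_ofPred_eq] at hp hq
      simp only at hpq
      have e1 := h3 p hp.1
      have e2 := h3 q hq.1
      rw [hp.2] at e1; rw [hq.2] at e2
      rw [hpq, e2] at e1
      rw [h2 p hp.1, h2 q hq.1, hp.2, hq.2, hpq, Option.some.inj e1]
  rw [h4, ← Finset.mul_sum]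
  have h5 : ∑ n ∈ (F.filter fun z => (v z).1 = c).image (fun z => (v z).2.2.1), ((mvh b' σ0 cK g c S n).elim 0 fun r => (1/2:ℝ)^r) ≤ 2 := by
    refine (Finset.sum_le_sum_of_subset_of_nonneg (t := Finset.range (N+1)) ?_ ?_).trans (mvh_sum b' σ0 cK c S (N+1))
    · intro n hn
      obtain ⟨z, hz, rfl⟩ := Finset.mem_image.1 hn
      have : (v z).2.2.1 ≤ N := Finset.le_sup (f := fun z => (v z).2.2.1) (Finset.mem_filter.1 hz).1
      simp; omega
    · intro n _ _
      cases mvh b' σ0 cK g c S n <;> simp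
  have : (0:ℝ) < (1/2)^(c+1) := by positivity
  calc (1/2:ℝ)^(c+1) * _ ≤ (1/2:ℝ)^(c+1) * 2 := by gcongr
    _ = (1/2)^c := by rw [pow_succ]; ring
end game

theorem kst_of {x k s s' : ℕ} (h : Kcpx x ≤ k) (hs : kkf (Nat.pair (Kcpx x) x, s) = true) (hs' : s ≤ s') : kst x k s' = true := by
  unfold kst
  rw [List.any_eq_true]
  exact ⟨Kcpx x, by simp; omega, kkf_mono hs' hs⟩

theorem kst_le {cK : ℕ} (hcK : ∀ k x, Nat.pair k x ∈ KK → Kcpx x ≤ k + cK) {x k s : ℕ} (h : kst x k s = true) : Kcpx x ≤ k + cK := by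
  unfold kst at h
  rw [List.any_eq_true] at h
  obtain ⟨k', h1, h2⟩ := h
  have := hcK k' x (kkf_iff.2 ⟨s, h2⟩)
  simp at h1; omega

open MeasureTheory ENNReal

theorem game {A : ℕ → Bool} (hA : KTrivial A) {g : List Bool × ℕ → Bool} (hg : Primrec g) :
    ∃ a : ℕ → List Bool, Computable a ∧ (∀ t, (a t).length = t + 1) ∧ (∀ ℓ, ∃ t, ∀ t' ≥ t, strPrefix A ℓ <+: a t') ∧
      ∃ q, ∀ t n r, n ≤ t → (mrun g a (ini (2^q) 0 0) 0 n).bind (mv 0) = some r → Kcpx (Encodable.encode ((a t).take n)) ≤ r + q := by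
  classical
  obtain ⟨b, hb⟩ := hA
  obtain ⟨cK, hcK⟩ := KK_K
  obtain ⟨n0, hn0⟩ := isolated A (b + cK + cK)
  set b' := b + cK with hb'
  set σ0 := strPrefix A n0 with hσ0
  obtain ⟨c0, hc0⟩ := kraft_chaitin (gW_re b' σ0 cK hg) (gW_bdd b' σ0 cK)
  set c := c0 + 1 + b with hc
  have hmove : ∀ s n r, mvh b' σ0 cK g c s n = some r → Kcpx (Encodable.encode (strPrefix A n)) ≤ r + 2 * c := by
    intro s n r h
    have h1 := hc0 (r+c+1) (one n) ⟨(c, s, n), by simp [h]⟩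
    have h2 := hb n
    have h3 : KofNat n = Kcpx (one n) := rfl
    omega
  have hst : ∀ N, ∃ s, ∀ m ≤ N, kkf (Nat.pair (Kcpx (Encodable.encode (strPrefix A m))) (Encodable.encode (strPrefix A m)), s) = true := by
    intro N
    have : ∀ m, ∃ s, kkf (Nat.pair (Kcpx (Encodable.encode (strPrefix A m))) (Encodable.encode (strPrefix A m)), s) = true :=
      fun m => kkf_iff.1 (KK_mem _)
    choose f hf using this
    exact ⟨(Finset.range (N+1)).sup f, fun m hm => kkf_mono (Finset.le_sup (f := f) (by simp; omega)) (hf m)⟩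
  have htot : ∀ N, ∃ s, N ≤ (gm b' σ0 cK g c s).length := by
    intro N
    induction N with
    | zero => exact ⟨0, by simp⟩
    | succ N ih =>
      obtain ⟨s0, hs0⟩ := ih
      obtain ⟨s1, hs1⟩ := hst (N+1)
      by_contra hcon
      push Not at hcon
      obtain ⟨s, hs⟩ : ∃ s, s = max s0 s1 := ⟨_, rfl⟩
      have hlen : (gm b' σ0 cK g c s).length = N := by
        have := (gm_mono b' σ0 cK (g := g) c (show s0 ≤ s by omega)).length_le
        have := hcon s
        omega
      have h2 := hcon (s+1)
      rw [gm_succ] at h2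
      rcases gst_cases b' σ0 cK (g := g) c s (gm b' σ0 cK g c s) with h | ⟨α, _, _, h⟩
      · refine h.2 (strPrefix A (N+1)) (by rw [strPrefix_length, hlen]) ?_
        unfold vld
        simp only [Bool.and_eq_true, Bool.or_eq_true, decide_eq_true_eq, List.all_eq_true, List.mem_range, Bool.not_eq_true', strPrefix_length, hlen]
        refine ⟨⟨?_, fun m hm k hk => ?_⟩, fun n hn => ?_⟩
        · rcases le_total n0 (N+1) with h | h
          · left; exact strPrefix_mono_len _ h
          · right; exact strPrefix_mono_len _ h
        · rw [strPrefix_take_of_le _ (by omega)]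
          cases hk : kkf (Nat.pair k (one m), s)
          · left; rfl
          · right
            have h3 := hcK _ _ (kkf_iff.2 ⟨s, hk⟩)
            have h4 := hb m
            have h5 : KofNat m = Kcpx (one m) := rfl
            exact kst_of (by omega) (hs1 m (by omega)) (by omega)
        · rw [strPrefix_take_of_le _ (by omega)]
          cases hm : (ps g (2^(2*c+cK)) ((gm b' σ0 cK g c s).take n)).bind (mv 0) with
          | none => rfl
          | some r =>
            refine kst_of (hmove s n r ?_) (hs1 n (by omega)) (by omega)
            rw [mvh, if_pos (by omega)]
            exact hm
      · rw [h] at h2; simp at h2; omega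
  have hcomp : Computable fun x : ℕ × ℕ => decide (x.1 < (gm b' σ0 cK g c x.2).length) := Primrec.to_comp (by fun_prop)
  obtain ⟨f, hf, hf2⟩ := comp_search hcomp (fun n => by
    obtain ⟨s, hs⟩ := htot (n+1)
    exact ⟨s, by simp; omega⟩)
  simp only [decide_eq_true_eq] at hf2
  let a : ℕ → List Bool := fun t => ((gm b' σ0 cK g c (f t))[t]?).getD []
  have hac : Computable a := by
    have h1 : Computable fun x : ℕ × ℕ => ((gm b' σ0 cK g c x.2)[x.1]?).getD [] := Primrec.to_comp (by fun_prop)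
    exact h1.comp (Computable.id.pair hf)
  have hget : ∀ s t, t < (gm b' σ0 cK g c s).length → (gm b' σ0 cK g c s)[t]? = some (a t) := by
    intro s t h
    have key : ∀ s1 s2, s1 ≤ s2 → t < (gm b' σ0 cK g c s1).length → (gm b' σ0 cK g c s1)[t]? = (gm b' σ0 cK g c s2)[t]? := by
      intro s1 s2 h12 h
      obtain ⟨l, hl⟩ := gm_mono b' σ0 cK (g := g) c h12
      rw [← hl, List.getElem?_append_left h]
    have h1 : (gm b' σ0 cK g c s)[t]? = (gm b' σ0 cK g c (f t))[t]? := by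
      rcases le_total s (f t) with h' | h'
      · exact key _ _ h' h
      · exact (key _ _ h' (hf2 t)).symm
    rw [h1]
    simp only [a]
    rw [List.getElem?_eq_getElem (hf2 t)]
    rfl
  have htake : ∀ s n, n ≤ (gm b' σ0 cK g c s).length → (gm b' σ0 cK g c s).take n = (List.range n).map a := by
    intro s n hn
    apply List.ext_getElem?
    intro i
    rw [List.getElem?_take]
    split_ifs with hi
    · rw [hget s i (by omega)]; simp [hi]
    · rw [List.getElem?_eq_none (by simp; omega)]
  have hval : ∀ t, (a t).length = t + 1 ∧ ∃ s', t ≤ s' ∧ vld b' σ0 cK g c s' ((List.range t).map a) (a t) = true := by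
    intro t
    have := (gm_inv b' σ0 cK (g := g) c (f t)).2 t (a t) (hget _ _ (hf2 t))
    rwa [htake _ _ (hf2 t).le] at this
  refine ⟨a, hac, fun t => (hval t).1, ?_, 2*c+cK, ?_⟩
  · refine conv_of_isolated (fun t => (hval t).1) fun X hX => hn0 X (fun m => ?_) ?_
    · obtain ⟨s1, hs1⟩ := kkf_iff.1 (KK_mem (one m))
      obtain ⟨t, ht, hpre⟩ := hX m (max s1 (max (Kcpx (one m)) m))
      obtain ⟨hl, s', hs', hv⟩ := hval t
      unfold vld at hv
      simp only [Bool.and_eq_true, Bool.or_eq_true, decide_eq_true_eq, List.all_eq_true, List.mem_range, Bool.not_eq_true'] at hv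
      simp only [ge_iff_le, max_le_iff] at ht
      have h1 := hv.1.2 m (by omega) (Kcpx (one m)) (by omega)
      rw [kkf_mono (by omega) hs1] at h1
      have h2 := kst_le hcK (h1.resolve_left (by simp))
      have h3 : (a t).take m = strPrefix X m := by
        have := List.prefix_iff_eq_take.1 hpre
        rw [strPrefix_length] at this; exact this.symm
      rw [h3] at h2
      have h5 : KofNat m = Kcpx (one m) := rfl
      omega
    · obtain ⟨t, ht, hpre⟩ := hX n0 n0
      obtain ⟨hl, s', hs', hv⟩ := hval t
      unfold vld at hv
      simp only [Bool.and_eq_true, Bool.or_eq_true, decide_eq_true_eq] at hv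
      have h1 : σ0 <+: a t := by
        rcases hv.1.1 with h | h
        · exact h
        · have := h.length_le
          rw [strPrefix_length] at this; omega
      rw [List.prefix_iff_eq_take.1 hpre]
      have h2 := List.prefix_iff_eq_take.1 h1
      rw [hσ0] at h2 ⊢
      rw [h2]
      simp [strPrefix_length]
  · intro t n r hn hr
    obtain ⟨hl, s', hs', hv⟩ := hval t
    unfold vld at hv
    simp only [Bool.and_eq_true, Bool.or_eq_true, decide_eq_true_eq, List.all_eq_true, List.mem_range] at hv
    have h1 := hv.2 n (by simp; omega)
    have h2 : ((List.range t).map a).take n = (List.range n).map a := by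
      rw [← List.map_take, List.take_range, min_eq_left hn]
    rw [h2, ps_mrun, hr] at h1
    have := kst_le hcK h1
    omega

/-- K-trivials are Δ02 -/
theorem ktriv_approx {A : ℕ → Bool} (hA : KTrivial A) :
    ∃ a : ℕ → List Bool, Computable a ∧ (∀ t, (a t).length = t + 1) ∧ (∀ ℓ, ∃ t, ∀ t' ≥ t, strPrefix A ℓ <+: a t') := by
  obtain ⟨a, h1, h2, h3, _⟩ := game hA (g := fun _ => false) (by fun_prop)
  exact ⟨a, h1, h2, h3⟩

/-- K-trivials are low for K (in the form of covers of bounded c.e. request sets) -/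
theorem lk {A : ℕ → Bool} (hA : KTrivial A) {g : List Bool × ℕ → Bool} (hg : Primrec g)
    (hbd : Bdd {z | ∃ ℓ, g (strPrefix A ℓ, z) = true} 1) :
    ∃ M : Set ℕ, (REPred fun z => z ∈ M) ∧ (∃ C, Bdd M C) ∧ {z | ∃ ℓ, g (strPrefix A ℓ, z) = true} ⊆ M := by
  classical
  by_contra hnc
  obtain ⟨a, hac, ha, hconv, q, hq⟩ := game hA hg
  have hterm := term_all ha hac hg hconv hbd hnc (2^q) 0 0 0
  set n := Nat.find hterm with hn
  have hn1 := Nat.find_spec hterm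
  rw [← hn] at hn1
  obtain ⟨n', hn'⟩ : ∃ n', n = n' + 1 := by
    cases h : n with
    | zero => rw [h] at hn1; cases hn1
    | succ n' => exact ⟨n', rfl⟩
  have hmin := Nat.find_min hterm (m := n') (by omega)
  rw [hn'] at hn1
  have hk := (below_all (g := g) ha (2^q)).kk 0 0 0 n' (Option.isSome_iff_ne_none.2 hmin) hn1
  simp only [pow_zero, zero_add] at hk
  let zf : List Bool → ℕ := fun v => Nat.pair (Kcpx (Encodable.encode v)) (Encodable.encode v)
  have zfi : Function.Injective zf := by
    intro u v h
    exact Encodable.encode_injective (Nat.pair_eq_pair.1 h).2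
  set I := (Finset.range (n'+1)).filter fun m => 2^q + 1 ≤ dd a (n'+1) m
  let V : ℕ → Finset (List Bool) := fun m => (Finset.Ico m (n'+1)).image fun s => (a s).take m
  have hV : ∀ m, ∀ v ∈ V m, v.length = m := by
    intro m v hv
    obtain ⟨s, hs, rfl⟩ := Finset.mem_image.1 hv
    rw [Finset.mem_Ico] at hs
    rw [List.length_take, ha]; omega
  have hsum : ∑ z ∈ I.biUnion fun m => (V m).image zf, wt z ≤ 1 := by
    refine KK_bdd _ fun z hz => ?_
    simp only [Finset.coe_biUnion, Set.mem_iUnion, Finset.mem_coe, Finset.mem_image] at hz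
    obtain ⟨m, _, v, _, rfl⟩ := hz
    exact KK_mem _
  rw [Finset.sum_biUnion] at hsum
  · have h1 : ∀ m ∈ I, ((2:ℝ)^q+1)/2^q * cost 0 (mrun g a (ini (2^q) 0 0) 0 m) ≤ ∑ z ∈ (V m).image zf, wt z := by
      intro m hm
      rw [Finset.sum_image (fun x _ y _ h => zfi h)]
      unfold cost
      cases hr : (mrun g a (ini (2^q) 0 0) 0 m).bind (mv 0) with
      | none =>
        simp only [Option.elim, mul_zero]
        exact Finset.sum_nonneg fun v _ => (wt_pos _).le
      | some r =>
        have h2 : ∀ v ∈ V m, (1/2:ℝ)^(r+q) ≤ wt (zf v) := by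
          intro v hv
          obtain ⟨s, hs, rfl⟩ := Finset.mem_image.1 hv
          rw [Finset.mem_Ico] at hs
          rw [wt_pair]
          exact pow_le_pow_of_le_one (by norm_num) (by norm_num) (hq s m r hs.1 hr)
        have h3 : (2:ℝ)^q + 1 ≤ (V m).card := by exact_mod_cast (Finset.mem_filter.1 hm).2
        calc ((2:ℝ)^q+1)/2^q * (1/2)^r = ((2:ℝ)^q+1) * (1/2)^(r+q) := by
              rw [pow_add, one_div_pow 2 q]; ring
          _ ≤ (V m).card * (1/2)^(r+q) := by gcongr
          _ ≤ _ := by rw [← nsmul_eq_mul]; exact Finset.card_nsmul_le_sum _ _ _ h2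
    have h2 := (Finset.sum_le_sum h1).trans hsum
    rw [← Finset.mul_sum] at h2
    have h3 : (1:ℝ) < ((2:ℝ)^q+1)/2^q := by
      rw [lt_div_iff₀ (by positivity)]; linarith
    nlinarith
  · intro m _ m' _ hne
    rw [Function.onFun, Finset.disjoint_left]
    intro z hz hz'
    obtain ⟨v, hv, rfl⟩ := Finset.mem_image.1 hz
    obtain ⟨v', hv', h⟩ := Finset.mem_image.1 hz'
    have := zfi h
    subst this
    exact hne ((hV _ _ hv).symm.trans (hV _ _ hv'))

open MeasureTheory ENNReal

/-- bounded weight of a set of strings -/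
def WB (S : Set (List Bool)) (C : ℝ) : Prop := ∀ F : Finset (List Bool), ↑F ⊆ S → ∑ ρ ∈ F, (1/2:ℝ)^ρ.length ≤ C

theorem solovay_fin {T : Set (List Bool)} {C : ℝ} (hC : WB T C) {f : List Bool → Bool} (hf : ∀ σ, f σ = true → σ ∈ T)
    (N d : ℕ) : (2:ℝ)^d * mu {X | 2^d ≤ ((List.range (N+1)).filter fun k => f ((strPrefix X N).take k)).length} ≤ C := by
  classical
  have h1 := mu_cnt N fun σ => decide (2^d ≤ ((List.range (N+1)).filter fun k => f (σ.take k)).length)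
  simp only [decide_eq_true_eq] at h1
  rw [h1]
  set Q : List Bool → Bool := fun σ => decide (2^d ≤ ((List.range (N+1)).filter fun k => f (σ.take k)).length)
  have h2 : (2:ℝ)^d * cnt N Q ≤ ∑ σ ∈ (strL N).toFinset, ∑ k ∈ Finset.range (N+1), if f (σ.take k) = true then (1:ℝ) else 0 := by
    rw [← toFinset_card_strL, mul_comm, ← nsmul_eq_mul]
    refine (Finset.card_nsmul_le_sum _ (fun σ => ∑ k ∈ Finset.range (N+1), if f (σ.take k) = true then (1:ℝ) else 0) _ ?_).trans
      (Finset.sum_le_sum_of_subset_of_nonneg ?_ ?_)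
    · intro σ hσ
      simp only [List.mem_toFinset, List.mem_filter, Q, decide_eq_true_eq] at hσ
      rw [Finset.sum_ite, Finset.sum_const_zero, add_zero, Finset.sum_const, nsmul_eq_mul, mul_one]
      have : (Finset.filter (fun k => f (σ.take k) = true) (Finset.range (N+1))).card = ((List.range (N+1)).filter fun k => f (σ.take k)).length := by
        rw [← List.toFinset_card_of_nodup (List.nodup_range.filter _)]
        congr 1
        ext k; simp
      rw [this]
      exact_mod_cast hσ.2
    · intro σ hσ
      simp only [List.mem_toFinset, List.mem_filter] at hσ ⊢
      exact hσ.1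
    · intro σ _ _
      exact Finset.sum_nonneg fun k _ => by split_ifs <;> norm_num
  rw [Finset.sum_comm] at h2
  have h3 : ∀ k ∈ Finset.range (N+1), (∑ σ ∈ (strL N).toFinset, if f (σ.take k) = true then (1:ℝ) else 0) =
      2^N * ∑ ρ ∈ ((strL k).filter f).toFinset, (1/2:ℝ)^ρ.length := by
    intro k hk
    have e1 := mu_cnt N fun σ => f (σ.take k)
    have e2 := mu_cnt k f
    have e3 : {X | f ((strPrefix X N).take k) = true} = {X | f (strPrefix X k) = true} := by
      ext X
      rw [Set.mem_ofPred_eq, Set.mem_ofPred_eq, strPrefix_take_of_le _ (by simp at hk; omega)]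
    rw [e3, e2] at e1
    rw [Finset.sum_ite, Finset.sum_const_zero, add_zero, Finset.sum_const, nsmul_eq_mul, mul_one]
    have e4 : (Finset.filter (fun σ => f (σ.take k) = true) (strL N).toFinset).card = cnt N fun σ => f (σ.take k) := by
      rw [← toFinset_card_strL]; congr 1; ext; simp
    have e5 : ∑ ρ ∈ ((strL k).filter f).toFinset, (1/2:ℝ)^ρ.length = cnt k f / 2^k := by
      rw [Finset.sum_congr rfl (g := fun _ => (1/2:ℝ)^k), Finset.sum_const, toFinset_card_strL, nsmul_eq_mul, one_div_pow]
      · ring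
      · intro ρ hρ
        simp only [List.mem_toFinset, List.mem_filter, mem_strL] at hρ
        rw [hρ.1]
    rw [e4, e5, e1]
    field_simp
  rw [Finset.sum_congr rfl h3, ← Finset.mul_sum] at h2
  have h4 : ∑ k ∈ Finset.range (N+1), ∑ ρ ∈ ((strL k).filter f).toFinset, (1/2:ℝ)^ρ.length ≤ C := by
    rw [← Finset.sum_biUnion]
    · refine hC _ fun ρ hρ => ?_
      simp only [Finset.coe_biUnion, Set.mem_iUnion, Finset.mem_coe, List.mem_toFinset, List.mem_filter] at hρ
      obtain ⟨k, _, _, h⟩ := hρ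
      exact hf _ h
    · intro k _ k' _ hne
      rw [Function.onFun, Finset.disjoint_left]
      intro ρ hρ hρ'
      simp only [List.mem_toFinset, List.mem_filter, mem_strL] at hρ hρ'
      omega
  have hp : (0:ℝ) < 2^N := by positivity
  rw [← mul_div_assoc, div_le_iff₀ hp]
  nlinarith

theorem solovay {R : ℕ → Bool} (hR : MLRandom R) {T : Set (List Bool)} (hT : REPred fun σ => σ ∈ T) {C : ℝ} (hC : WB T C) :
    ∃ N, ∀ n ≥ N, strPrefix R n ∉ T := by
  classical
  obtain ⟨f, hf, hm, hiff⟩ := re_normal hT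
  obtain ⟨c, hc⟩ : ∃ c : ℕ, C ≤ 2^c := by
    obtain ⟨c, hc⟩ := pow_unbounded_of_one_lt C (one_lt_two)
    exact ⟨c, hc.le⟩
  have hpass := hR.passes (p := fun x : ℕ × List Bool => 2^(x.1+c) ≤ ((List.range (x.2.length+1)).filter fun k => f (x.2.take k, x.2.length)).length)
    (re_dec (Primrec.to_comp (by fun_prop))) ?_
  · obtain ⟨n, hn⟩ := hpass
    by_contra hcon
    push Not at hcon
    -- infinitely many prefixes
    have hinf : ∀ m : ℕ, ∃ F : Finset ℕ, F.card = m ∧ ∀ k ∈ F, strPrefix R k ∈ T := by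
      intro m
      induction m with
      | zero => exact ⟨∅, by simp⟩
      | succ m ih =>
        obtain ⟨F, h1, h2⟩ := ih
        obtain ⟨k, hk, hkT⟩ := hcon (F.sup id + 1)
        refine ⟨insert k F, ?_, ?_⟩
        · rw [Finset.card_insert_of_notMem, h1]
          intro hkF
          have : k ≤ F.sup id := Finset.le_sup (f := id) hkF
          omega
        · intro k' hk'
          rcases Finset.mem_insert.1 hk' with rfl | h
          · exact hkT
          · exact h2 _ h
    obtain ⟨F, h1, h2⟩ := hinf (2^(n+c))
    have : ∀ k, k ∈ F → ∃ s, f (strPrefix R k, s) = true := fun k hk => (hiff _).1 (h2 k hk)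
    choose! s hs using this
    set N := max (F.sup id) (F.sup s)
    apply hn N
    rw [strPrefix_length, ← h1, ← List.toFinset_card_of_nodup (List.nodup_range.filter _)]
    refine Finset.card_le_card fun k hk => ?_
    have hkN : k ≤ N := (Finset.le_sup (f := id) hk).trans (le_max_left _ _)
    have hsN : s k ≤ N := (Finset.le_sup (f := s) hk).trans (le_max_right _ _)
    simp only [List.mem_toFinset, List.mem_filter, List.mem_range]
    refine ⟨by omega, ?_⟩
    rw [strPrefix_take_of_le _ hkN]
    exact hm _ _ _ hsN (hs k hk)
  · intro n
    have hset : openOf {σ : List Bool | 2^(n+c) ≤ ((List.range (σ.length+1)).filter fun k => f (σ.take k, σ.length)).length} =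
        ⋃ N, {X | 2^(n+c) ≤ ((List.range (N+1)).filter fun k => f ((strPrefix X N).take k, N)).length} := by
      ext X
      rw [mem_openOf]
      simp
    simp only
    rw [hset, Monotone.measure_iUnion]
    · refine iSup_le fun N => ?_
      have h := solovay_fin hC (f := fun σ => f (σ, N)) (fun σ h => (hiff σ).2 ⟨N, h⟩) N (n+c)
      have h' : mu {X | 2^(n+c) ≤ ((List.range (N+1)).filter fun k => f ((strPrefix X N).take k, N)).length} ≤ (1/2)^n := by
        have h5 := h.trans hc
        generalize mu _ = v at h5 ⊢
        rw [pow_add] at h5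
        rw [one_div_pow, le_div_iff₀ (by positivity)]
        have : (0:ℝ) < 2^c := by positivity
        nlinarith
      rw [← ENNReal.ofReal_toReal (measure_ne_top μCantor _)]
      refine (ENNReal.ofReal_le_ofReal h').trans ?_
      rw [ENNReal.ofReal_pow (by norm_num)]
      gcongr
      rw [one_div, ENNReal.ofReal_inv_of_pos (by norm_num)]
      simp
    · intro N N' hN X hX
      simp only [Set.mem_ofPred_eq] at hX ⊢
      refine hX.trans ?_
      rw [← List.toFinset_card_of_nodup (List.nodup_range.filter _), ← List.toFinset_card_of_nodup (List.nodup_range.filter _)]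
      refine Finset.card_le_card fun k hk => ?_
      simp only [List.mem_toFinset, List.mem_filter, List.mem_range] at hk ⊢
      refine ⟨by omega, ?_⟩
      rw [strPrefix_take_of_le _ (by omega)] at hk ⊢
      exact hm _ _ _ hN hk.2

/-- general form of lowness for K -/
theorem lk_re {A : ℕ → Bool} (hA : KTrivial A) {p : List Bool × ℕ → Prop} (hp : REPred p) {C : ℝ}
    (hbd : Bdd {z | ∃ ℓ, p (strPrefix A ℓ, z)} C) :
    ∃ M : Set ℕ, (REPred fun z => z ∈ M) ∧ (∃ C, Bdd M C) ∧ {z | ∃ ℓ, p (strPrefix A ℓ, z)} ⊆ M := by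
  classical
  obtain ⟨f, hf, hm, hiff⟩ := re_normal hp
  obtain ⟨d, hd⟩ : ∃ c : ℕ, C ≤ 2^c := by
    obtain ⟨c, hc⟩ := pow_unbounded_of_one_lt C (one_lt_two)
    exact ⟨c, hc.le⟩
  let sh : ℕ → ℕ := fun z => Nat.pair (z.unpair.1 + d) z.unpair.2
  have shw : ∀ z, wt (sh z) = (1/2)^d * wt z := by
    intro z; simp only [sh, wt_pair]; rw [pow_add, wt]; ring
  have shi : Function.Injective sh := by
    intro z z' h
    have := Nat.pair_eq_pair.1 h
    rw [← Nat.pair_unpair z, ← Nat.pair_unpair z', this.2, Nat.add_right_cancel this.1]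
  let g : List Bool × ℕ → Bool := fun x => decide (d ≤ x.2.unpair.1) && (List.range (x.1.length+1)).any fun k =>
    f ((x.1.take k, Nat.pair (x.2.unpair.1 - d) x.2.unpair.2), x.1.length)
  have hg : Primrec g := by simp only [g]; fun_prop
  have h1 : {z | ∃ ℓ, g (strPrefix A ℓ, z) = true} ⊆ sh '' {z | ∃ ℓ, p (strPrefix A ℓ, z)} := by
    rintro z ⟨ℓ, h⟩
    simp only [g, Bool.and_eq_true, decide_eq_true_eq, List.any_eq_true, strPrefix_length, List.mem_range] at h
    obtain ⟨h0, k, hk, h⟩ := h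
    rw [strPrefix_take_of_le _ (by omega)] at h
    refine ⟨Nat.pair (z.unpair.1 - d) z.unpair.2, ⟨k, (hiff _).2 ⟨_, h⟩⟩, ?_⟩
    simp [sh, Nat.sub_add_cancel h0]
  have h2 : ∀ z ∈ {z | ∃ ℓ, p (strPrefix A ℓ, z)}, sh z ∈ {z | ∃ ℓ, g (strPrefix A ℓ, z) = true} := by
    rintro z ⟨k, hk⟩
    obtain ⟨s, hs⟩ := (hiff _).1 hk
    refine ⟨max k s, ?_⟩
    simp only [g, Bool.and_eq_true, decide_eq_true_eq, List.any_eq_true, strPrefix_length, List.mem_range]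
    refine ⟨by simp [sh], k, by omega, ?_⟩
    rw [strPrefix_take_of_le _ (by omega)]
    simp only [sh, Nat.unpair_pair, Nat.add_sub_cancel, Nat.pair_unpair]
    exact hm _ _ _ (by omega) hs
  have h3 : Bdd {z | ∃ ℓ, g (strPrefix A ℓ, z) = true} 1 := by
    intro F hF
    obtain ⟨F', hF', hF2⟩ : ∃ F' : Finset ℕ, ↑F' ⊆ {z | ∃ ℓ, p (strPrefix A ℓ, z)} ∧ F = F'.image sh := by
      obtain ⟨F', h, h'⟩ := Finset.subset_set_image_iff.1 (hF.trans h1)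
      exact ⟨F', h, h'.symm⟩
    rw [hF2, Finset.sum_image (fun x _ y _ h => shi h), Finset.sum_congr rfl fun z _ => shw z, ← Finset.mul_sum]
    have := (hbd F' hF').trans hd
    calc (1/2:ℝ)^d * ∑ z ∈ F', wt z ≤ (1/2:ℝ)^d * 2^d := by gcongr
      _ = 1 := by rw [← mul_pow]; norm_num
  obtain ⟨M, hM, ⟨C', hC'⟩, hsub⟩ := lk hA hg h3
  refine ⟨{z | sh z ∈ M}, hM.comp' (f := sh) (Primrec.to_comp (by simp only [sh]; fun_prop)), ⟨2^d * C', ?_⟩, fun z hz => hsub (h2 z hz)⟩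
  intro F hF
  have := hC' (F.image sh) (by
    intro z hz
    simp only [Finset.coe_image, Set.mem_image] at hz
    obtain ⟨z, hz, rfl⟩ := hz
    exact hF hz)
  rw [Finset.sum_image (fun x _ y _ h => shi h), Finset.sum_congr rfl fun z _ => shw z, ← Finset.mul_sum] at this
  calc ∑ z ∈ F, wt z = 2^d * ((1/2:ℝ)^d * ∑ z ∈ F, wt z) := by rw [← mul_assoc, ← mul_pow]; norm_num
    _ ≤ _ := by gcongr

/-- version for strings -/
theorem lk_str {A : ℕ → Bool} (hA : KTrivial A) {p : List Bool × List Bool → Prop} (hp : REPred p) {C : ℝ}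
    (hbd : WB {ρ | ∃ ℓ, p (strPrefix A ℓ, ρ)} C) :
    ∃ T : Set (List Bool), (REPred fun z => z ∈ T) ∧ (∃ C, WB T C) ∧ {z | ∃ ℓ, p (strPrefix A ℓ, z)} ⊆ T := by
  classical
  let sc : List Bool → ℕ := fun ρ => Nat.pair ρ.length (Encodable.encode ρ)
  have sci : Function.Injective sc := fun u v h => Encodable.encode_injective (Nat.pair_eq_pair.1 h).2
  have hscp : Computable sc := Primrec.to_comp (by simp only [sc]; fun_prop)
  obtain ⟨M, hM, ⟨C', hC'⟩, hsub⟩ := lk_re hA (C := C) (p := fun x => ∃ ρ : List Bool, x.2 = sc ρ ∧ p (x.1, ρ)) (by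
    refine REPred.ex (p := fun y : (List Bool × ℕ) × List Bool => y.1.2 = sc y.2 ∧ p (y.1.1, y.2)) ?_
    refine (re_dec (Primrec.to_comp ?_)).and' (hp.comp' (f := fun y : (List Bool × ℕ) × List Bool => (y.1.1, y.2)) (Primrec.to_comp (by fun_prop)))
    simp only [sc]; fun_prop) (by
    intro F hF
    obtain ⟨F', h, h'⟩ := Finset.subset_set_image_iff.1 (show ↑F ⊆ sc '' {ρ | ∃ ℓ, p (strPrefix A ℓ, ρ)} by
      intro z hz
      obtain ⟨ℓ, ρ, h1, h2⟩ := hF hz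
      exact ⟨ρ, ⟨ℓ, h2⟩, h1.symm⟩)
    rw [← h', Finset.sum_image (fun x _ y _ h => sci h)]
    simp only [sc, wt_pair]
    exact hbd F' h)
  refine ⟨{ρ | sc ρ ∈ M}, hM.comp' hscp, ⟨C', fun F hF => ?_⟩, fun ρ ⟨ℓ, h⟩ => hsub ⟨ℓ, ρ, rfl, h⟩⟩
  have := hC' (F.image sc) (by
    intro z hz
    simp only [Finset.coe_image, Set.mem_image] at hz
    obtain ⟨z, hz, rfl⟩ := hz
    exact hF hz)
  rw [Finset.sum_image (fun x _ y _ h => sci h)] at this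
  simpa only [sc, wt_pair] using this

/-- covers avoiding the prefixes of a random sequence -/
theorem lk_avoid {A R : ℕ → Bool} (hA : KTrivial A) (hR : MLRandom R) {p : List Bool × List Bool → Prop} (hp : REPred p) {C : ℝ}
    (hbd : WB {ρ | ∃ ℓ, p (strPrefix A ℓ, ρ)} C) (hav : ∀ ℓ n, ¬ p (strPrefix A ℓ, strPrefix R n)) :
    ∃ T : Set (List Bool), (REPred fun z => z ∈ T) ∧ (∀ ℓ ρ, p (strPrefix A ℓ, ρ) → ρ ∈ T) ∧ ∀ n, strPrefix R n ∉ T := by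
  obtain ⟨T, hT, ⟨C', hC'⟩, hsub⟩ := lk_str hA hp hbd
  obtain ⟨N, hN⟩ := solovay hR hT hC'
  refine ⟨{ρ | ρ ∈ T ∧ ¬ (ρ ∈ (List.range N).map (strPrefix R))}, ?_, fun ℓ ρ h => ⟨hsub ⟨ℓ, h⟩, ?_⟩, fun n h => ?_⟩
  · refine hT.and' (re_dec (Primrec.to_comp ?_))
    have : (fun a : List Bool => decide ¬a ∈ List.map (strPrefix R) (List.range N)) = fun a => !(((List.range N).map (strPrefix R)).any fun b => decide (a = b)) := by
      ext a
      rw [Bool.eq_iff_iff, decide_eq_true_eq, Bool.not_eq_true', List.any_eq_false]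
      simp only [decide_eq_true_eq]
      exact ⟨fun h b hb hab => h (hab ▸ hb), fun h ha => h a ha rfl⟩
    rw [this]; fun_prop
  · intro h'
    simp only [List.mem_map] at h'
    obtain ⟨n, _, rfl⟩ := h'
    exact hav ℓ n h
  · rcases lt_or_ge n N with h' | h'
    · exact h.2 (List.mem_map.2 ⟨n, by simpa using h', rfl⟩)
    · exact hN n h' h.1

open MeasureTheory ENNReal

/-- `ρ` not yet removed at stage `N` -/
def PP (f : List Bool × ℕ → Bool) (ρ : List Bool) (N : ℕ) : Bool := (List.range (ρ.length+1)).all fun k => !(f (ρ.take k, N))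
/-- count of the class above `σ` -/
def dns (f : List Bool × ℕ → Bool) (N : ℕ) (σ : List Bool) : ℕ := cnt N fun ρ => decide (σ <+: ρ) && PP f ρ N
/-- low density -/
def lowd (f : List Bool × ℕ → Bool) (N n : ℕ) (σ : List Bool) : Bool := decide (dns f N σ * 2^n * 2^σ.length < 2^N)

section
variable {f : List Bool × ℕ → Bool}

@[fun_prop] theorem PP_prim {α : Type*} [Primcodable α] (hf : Primrec f) {u : α → List Bool} {v : α → ℕ} (hu : Primrec u) (hv : Primrec v) :
    Primrec fun a => PP f (u a) (v a) := by unfold PP; fun_prop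
@[fun_prop] theorem lowd_prim {α : Type*} [Primcodable α] (hf : Primrec f) {u : α → List Bool} {v w : α → ℕ} (hu : Primrec u) (hv : Primrec v)
    (hw : Primrec w) : Primrec fun a => lowd f (v a) (w a) (u a) := by unfold lowd dns; fun_prop

theorem dns_mu (N : ℕ) (σ : List Bool) : (dns f N σ : ℝ) / 2^N = mu {X | σ <+: strPrefix X N ∧ PP f (strPrefix X N) N = true} := by
  unfold dns
  rw [← mu_cnt]
  simp

theorem lowd_mu {N n : ℕ} {σ : List Bool} : lowd f N n σ = true ↔ mu {X | σ <+: strPrefix X N ∧ PP f (strPrefix X N) N = true} < (1/2)^n * (1/2)^σ.length := by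
  rw [← dns_mu, lowd, decide_eq_true_eq]
  have : (dns f N σ * 2^n * 2^σ.length < 2^N) ↔ ((dns f N σ : ℝ) * 2^n * 2^σ.length < 2^N) := by exact_mod_cast Iff.rfl
  rw [this, one_div_pow, one_div_pow, one_div_mul_one_div, div_lt_div_iff₀ (by positivity) (by positivity), one_mul, mul_assoc]

theorem PP_anti (hm : ∀ a s t, s ≤ t → f (a, s) = true → f (a, t) = true) {X : ℕ → Bool} {N N' : ℕ} (h : N ≤ N')
    (h1 : PP f (strPrefix X N') N' = true) : PP f (strPrefix X N) N = true := by
  unfold PP at *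
  simp only [List.all_eq_true, List.mem_range, strPrefix_length, Bool.not_eq_true'] at *
  intro k hk
  have := h1 k (by omega)
  rw [strPrefix_take_of_le _ (by omega)] at this ⊢
  by_contra hc
  rw [Bool.not_eq_false] at hc
  rw [hm _ _ _ h hc] at this
  cases this

theorem lowd_mono (hm : ∀ a s t, s ≤ t → f (a, s) = true → f (a, t) = true) {n N N' : ℕ} {σ : List Bool} (hσ : σ.length ≤ N) (h : N ≤ N')
    (h1 : lowd f N n σ = true) : lowd f N' n σ = true := by
  rw [lowd_mu] at *
  refine lt_of_le_of_lt (measureReal_mono ?_ (measure_ne_top _ _)) h1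
  rintro X ⟨h2, h3⟩
  refine ⟨?_, PP_anti hm h h3⟩
  rw [prefix_strPrefix_iff (by omega)] at h2
  rwa [prefix_strPrefix_iff hσ]

theorem level_bound (N n : ℕ) (F : Finset (List Bool)) (hF : ∀ ρ ∈ F, ρ.length = N ∧ PP f ρ N = true ∧ ∃ ℓ ≤ N, lowd f N n (ρ.take ℓ) = true) :
    ∑ ρ ∈ F, (1/2:ℝ)^ρ.length ≤ (1/2)^n := by
  classical
  have hex : ∀ ρ, ρ ∈ F → ∃ ℓ, ℓ ≤ N ∧ lowd f N n (ρ.take ℓ) = true ∧ ∀ ℓ' < ℓ, ¬ lowd f N n (ρ.take ℓ') = true := by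
    intro ρ hρ
    obtain ⟨_, _, h⟩ := hF ρ hρ
    have h' : ∃ ℓ, ℓ ≤ N ∧ lowd f N n (ρ.take ℓ) = true := h
    refine ⟨Nat.find h', (Nat.find_spec h').1, (Nat.find_spec h').2, fun ℓ' hl hc => ?_⟩
    exact Nat.find_min h' hl ⟨by have := (Nat.find_spec h').1; omega, hc⟩
  choose! ℓ h1 h2 h3 using hex
  have hlen : ∀ ρ ∈ F, (ρ.take (ℓ ρ)).length = ℓ ρ := by
    intro ρ hρ
    rw [List.length_take, (hF ρ hρ).1]
    have := h1 ρ hρ; omega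
  rw [← Finset.sum_fiberwise_of_maps_to (s := F) (t := F.image fun ρ => ρ.take (ℓ ρ)) (g := fun ρ => ρ.take (ℓ ρ)) (fun z hz => Finset.mem_image_of_mem _ hz)]
  have h4 : ∀ σ ∈ F.image fun ρ => ρ.take (ℓ ρ), ∑ ρ ∈ F with ρ.take (ℓ ρ) = σ, (1/2:ℝ)^ρ.length ≤ (1/2)^n * (1/2)^σ.length := by
    intro σ hσ
    obtain ⟨ρ0, hρ0, rfl⟩ := Finset.mem_image.1 hσ
    have hl := h2 ρ0 hρ0
    rw [lowd_mu, ← dns_mu] at hl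
    refine le_trans ?_ hl.le
    rw [Finset.sum_congr rfl (g := fun _ => (1/2:ℝ)^N), Finset.sum_const, nsmul_eq_mul, one_div_pow, mul_one_div]
    · gcongr
      unfold dns
      rw [← toFinset_card_strL]
      refine Finset.card_le_card fun ρ hρ => ?_
      rw [Finset.mem_filter] at hρ
      simp only [List.mem_toFinset, List.mem_filter, mem_strL, Bool.and_eq_true, decide_eq_true_eq]
      exact ⟨(hF ρ hρ.1).1, by rw [← hρ.2]; exact List.take_prefix _ _, (hF ρ hρ.1).2.1⟩
    · intro ρ hρ
      rw [(hF ρ (Finset.mem_filter.1 hρ).1).1]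
  refine (Finset.sum_le_sum h4).trans ?_
  rw [← Finset.mul_sum]
  have h5 : ∑ σ ∈ F.image fun ρ => ρ.take (ℓ ρ), (1/2:ℝ)^σ.length ≤ 1 := by
    refine kraft (f := id) ?_
    intro σ hσ σ' hσ' hp
    obtain ⟨ρ, hρ, rfl⟩ := Finset.mem_image.1 hσ
    obtain ⟨ρ', hρ', rfl⟩ := Finset.mem_image.1 hσ'
    simp only [id] at hp
    have e1 := hlen ρ hρ
    have e2 := hlen ρ' hρ'
    have e3 := hp.length_le
    rw [e1, e2] at e3
    rcases e3.lt_or_eq with hlt | heq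
    · exfalso
      apply h3 ρ' hρ' (ℓ ρ) hlt
      have : ρ.take (ℓ ρ) = ρ'.take (ℓ ρ) := by
        have := List.prefix_iff_eq_take.1 (hp.trans (List.take_prefix _ _))
        rw [e1] at this; exact this
      rw [← this]; exact h2 ρ hρ
    · exact hp.eq_of_length (by rw [e1, e2, heq])
  have : (0:ℝ) < (1/2)^n := by positivity
  nlinarith

theorem density {R : ℕ → Bool} (hR : MLRandom R) (hinc : ¬ TuringLE zeroJump R) (hf : Primrec f)
    (hm : ∀ a s t, s ≤ t → f (a, s) = true → f (a, t) = true) (hRf : ∀ n s, f (strPrefix R n, s) = false) :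
    ∃ k, ∀ ℓ N, ℓ ≤ N → ¬ lowd f N k (strPrefix R ℓ) = true := by
  classical
  by_contra hcon
  push Not at hcon
  apply hinc
  obtain ⟨zf, hzf, hzm, hziff⟩ := re_normal zeroJump_re
  let ent : ℕ → ℕ → Bool := fun n s => zf (n, s) && (List.range s).all fun s' => !(zf (n, s'))
  have hent : ∀ n s s', ent n s = true → ent n s' = true → s = s' := by
    intro n s s' h h'
    simp only [ent, Bool.and_eq_true, List.all_eq_true, List.mem_range, Bool.not_eq_true'] at h h'
    rcases lt_trichotomy s s' with hlt | heq | hlt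
    · have := h'.2 s hlt; rw [h.1] at this; cases this
    · exact heq
    · have := h.2 s' hlt; rw [h'.1] at this; cases this
  let Te : Set (List Bool) := {ρ | (ent ρ.length.unpair.1 ρ.length.unpair.2 && PP f ρ ρ.length &&
    (List.range (ρ.length+1)).any fun ℓ => lowd f ρ.length ρ.length.unpair.1 (ρ.take ℓ)) = true}
  have hTe : REPred fun ρ => ρ ∈ Te := by
    refine re_bool (Primrec.to_comp ?_)
    simp only [ent]; fun_prop
  have hmem : ∀ ρ, ρ ∈ Te → ent ρ.length.unpair.1 ρ.length.unpair.2 = true ∧ PP f ρ ρ.length = true ∧ ∃ ℓ ≤ ρ.length, lowd f ρ.length ρ.length.unpair.1 (ρ.take ℓ) = true := by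
    intro ρ h
    have h : _ = true := h
    simp only [Bool.and_eq_true, List.any_eq_true, List.mem_range] at h
    obtain ⟨⟨h1, h2⟩, ℓ, h3, h4⟩ := h
    exact ⟨h1, h2, ℓ, by omega, h4⟩
  have hWB : WB Te 2 := by
    intro F hF
    rw [← Finset.sum_fiberwise_of_maps_to (s := F) (t := F.image List.length) (g := List.length) (fun z hz => Finset.mem_image_of_mem _ hz)]
    have h1 : ∀ N ∈ F.image List.length, ∑ ρ ∈ F with ρ.length = N, (1/2:ℝ)^ρ.length ≤ (1/2)^N.unpair.1 := by
      intro N _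
      refine level_bound (f := f) N _ _ fun ρ hρ => ?_
      rw [Finset.mem_filter] at hρ
      obtain ⟨hρF, rfl⟩ := hρ
      have := hmem ρ (hF hρF)
      exact ⟨rfl, this.2⟩
    refine (Finset.sum_le_sum h1).trans ?_
    have h2 : ∑ N ∈ F.image List.length, (1/2:ℝ)^N.unpair.1 = ∑ n ∈ (F.image List.length).image (fun N => N.unpair.1), (1/2:ℝ)^n := by
      refine (Finset.sum_image (f := fun n => (1/2:ℝ)^n) (g := fun N : ℕ => N.unpair.1) ?_).symm
      intro N hN N' hN' hNN
      simp only [Finset.coe_image, Set.mem_image, Finset.mem_coe] at hN hN'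
      obtain ⟨ρ, hρ, rfl⟩ := hN
      obtain ⟨ρ', hρ', rfl⟩ := hN'
      simp only at hNN
      have e1 := (hmem ρ (hF hρ)).1
      have e2 := (hmem ρ' (hF hρ')).1
      rw [← hNN] at e2
      rw [← Nat.pair_unpair ρ.length, ← Nat.pair_unpair ρ'.length, hNN, hent _ _ _ e1 e2]
    rw [h2]
    exact (geomhalf _ 0 (by simp)).trans (by norm_num)
  obtain ⟨N1, hN1⟩ := solovay hR hTe hWB
  have hclaim : ∀ n ≥ N1, ∀ ℓ N, ℓ ≤ N → lowd f N n (strPrefix R ℓ) = true → zf (n, N) = zeroJump n := by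
    intro n hn ℓ N hℓ hlow
    rw [Bool.eq_iff_iff]
    refine ⟨fun h => (hziff n).2 ⟨N, h⟩, fun h => ?_⟩
    have hex := (hziff n).1 h
    set s := Nat.find hex with hs
    have hs1 := Nat.find_spec hex
    rw [← hs] at hs1
    by_contra hc
    have hsN : N < s := by
      by_contra hle
      exact hc (hzm _ _ _ (by omega) hs1)
    have hge : s ≤ Nat.pair n s := Nat.right_le_pair n s
    have hge' : n ≤ Nat.pair n s := Nat.left_le_pair n s
    refine hN1 (Nat.pair n s) (by omega) ?_
    change _ = true
    simp only [strPrefix_length, Nat.unpair_pair, Bool.and_eq_true, List.any_eq_true, List.mem_range]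
    refine ⟨⟨?_, ?_⟩, ℓ, by omega, ?_⟩
    · simp only [ent, Bool.and_eq_true, List.all_eq_true, List.mem_range, Bool.not_eq_true']
      refine ⟨hs1, fun s' hs' => ?_⟩
      have := Nat.find_min hex hs'
      simpa using this
    · simp only [PP, List.all_eq_true, Bool.not_eq_true', List.mem_range, strPrefix_length]
      intro k hk
      rw [strPrefix_take_of_le _ (by omega)]
      exact hRf _ _
    · rw [strPrefix_take_of_le _ (by omega)]
      exact lowd_mono hm (by rw [strPrefix_length]; exact hℓ) (by omega) hlow
  refine turingLE_of (p := fun x => (if x.2.1 < N1 then decide (((List.range N1).map zeroJump)[x.2.1]? = some x.2.2) else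
    ((List.range (x.1.length+1)).any fun ℓ => lowd f x.1.length x.2.1 (x.1.take ℓ)) && decide (x.2.2 = zf (x.2.1, x.1.length))) = true) ?_ ?_ ?_
  · exact re_bool (Primrec.to_comp (by fun_prop))
  · intro n
    by_cases hn : n < N1
    · exact ⟨0, by simp [hn]⟩
    · obtain ⟨ℓ, N, hℓ, hlow⟩ := hcon n
      refine ⟨N, ?_⟩
      simp only [hn, if_false, Bool.and_eq_true, List.any_eq_true, List.mem_range, strPrefix_length, decide_eq_true_eq]
      exact ⟨⟨ℓ, by omega, by rwa [strPrefix_take_of_le _ hℓ]⟩, (hclaim n (by omega) ℓ N hℓ hlow).symm⟩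
  · intro n b N h
    by_cases hn : n < N1
    · simpa [hn, eq_comm] using h
    · simp only [hn, if_false, Bool.and_eq_true, List.any_eq_true, List.mem_range, strPrefix_length, decide_eq_true_eq] at h
      obtain ⟨⟨ℓ, hℓ, hlow⟩, hb⟩ := h
      rw [strPrefix_take_of_le _ (by omega)] at hlow
      rw [hb]
      exact hclaim n (by omega) ℓ N (by omega) hlow
end

open MeasureTheory ENNReal

/-! ### the final argument -/

/-- single valued oracle computation -/
def vl (e : ℕ) (σ : List Bool) (x : ℕ) : Option Bool :=
  ((List.range (σ.length+1)).filter (fun k => oc e (σ.take k) x 0 || oc e (σ.take k) x 1)).head?.map fun k => oc e (σ.take k) x 1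

@[fun_prop] theorem vl_prim {α : Type*} [Primcodable α] {e x : α → ℕ} {σ : α → List Bool} (he : Primrec e) (hσ : Primrec σ)
    (hx : Primrec x) : Primrec fun a => vl (e a) (σ a) (x a) := by unfold vl; fun_prop

theorem vl_iff {e x n : ℕ} {Y : ℕ → Bool} {b : Bool} : vl e (strPrefix Y n) x = some b ↔
    ∃ k ≤ n, (oc e (strPrefix Y k) x 0 || oc e (strPrefix Y k) x 1) = true ∧
      (∀ k' < k, ¬ (oc e (strPrefix Y k') x 0 || oc e (strPrefix Y k') x 1) = true) ∧ oc e (strPrefix Y k) x 1 = b := by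
  unfold vl
  rw [List.head?_filter, Option.map_eq_some_iff]
  simp only [List.find?_range_eq_some, strPrefix_length, List.mem_range]
  constructor
  · rintro ⟨k, ⟨h1, h2, h3⟩, h4⟩
    have hk : k ≤ n := by omega
    rw [strPrefix_take_of_le _ hk] at h1 h4
    refine ⟨k, hk, h1, fun k' hk' => ?_, h4⟩
    have := h3 k' hk'
    rw [strPrefix_take_of_le _ (by omega)] at this
    simpa using this
  · rintro ⟨k, hk, h1, h3, h4⟩
    refine ⟨k, ⟨?_, by omega, fun k' hk' => ?_⟩, ?_⟩
    · rwa [strPrefix_take_of_le _ hk]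
    · have := h3 k' hk'
      rw [strPrefix_take_of_le _ (by omega)]
      simpa using this
    · rwa [strPrefix_take_of_le _ hk]

theorem vl_mono {e x n m : ℕ} {Y : ℕ → Bool} {b : Bool} (h : n ≤ m) (hv : vl e (strPrefix Y n) x = some b) :
    vl e (strPrefix Y m) x = some b := by
  rw [vl_iff] at *
  obtain ⟨k, hk, h'⟩ := hv
  exact ⟨k, by omega, h'⟩

theorem vl_of {D Y : ℕ → Bool} {e : ℕ} (h1 : ∀ n, ∃ ℓ, oc e (strPrefix Y ℓ) n (natOfBool (D n)) = true)
    (h2 : ∀ n m ℓ, oc e (strPrefix Y ℓ) n m = true → m = natOfBool (D n)) :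
    (∀ x, ∃ ℓ, vl e (strPrefix Y ℓ) x = some (D x)) ∧ ∀ x ℓ b, vl e (strPrefix Y ℓ) x = some b → b = D x := by
  have hs : ∀ x ℓ b, vl e (strPrefix Y ℓ) x = some b → b = D x := by
    intro x ℓ b h
    rw [vl_iff] at h
    obtain ⟨k, _, h3, _, h4⟩ := h
    cases b
    · rw [h4, Bool.or_false] at h3
      have := h2 _ _ _ h3
      cases hD : D x
      · rfl
      · rw [hD] at this; simp [natOfBool] at this
    · have := h2 _ _ _ h4
      cases hD : D x
      · rw [hD] at this; simp [natOfBool] at this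
      · rfl
  refine ⟨fun x => ?_, hs⟩
  have hex : ∃ ℓ, (oc e (strPrefix Y ℓ) x 0 || oc e (strPrefix Y ℓ) x 1) = true := by
    obtain ⟨ℓ, h⟩ := h1 x
    refine ⟨ℓ, ?_⟩
    cases hD : D x <;> rw [hD] at h <;> simp only [natOfBool] at h <;> simp_all
  classical
  have : vl e (strPrefix Y (Nat.find hex)) x = some (oc e (strPrefix Y (Nat.find hex)) x 1) :=
    vl_iff.2 ⟨_, le_rfl, Nat.find_spec hex, fun k' hk' => Nat.find_min hex hk', rfl⟩
  exact ⟨_, by rw [this, hs _ _ _ this]⟩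

theorem exists_ext (ρ : List Bool) : ∃ X : ℕ → Bool, strPrefix X ρ.length = ρ := by
  refine ⟨fun i => ρ[i]?.getD false, ?_⟩
  refine List.ext_getElem? fun i => ?_
  rcases lt_or_ge i ρ.length with h | h
  · rw [strPrefix_getElem? _ h]; simp [h]
  · rw [List.getElem?_eq_none (by simpa using h), List.getElem?_eq_none h]

/-- question number -/
def cd (e q : ℕ) (τ : List Bool) (i : ℕ) : ℕ := Encodable.encode (e, q, τ, i)
/-- the class `E^j` -/
def Em (α : List Bool) (e q : ℕ) (τ : List Bool) (j : ℕ) (ρ : List Bool) : Bool :=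
  (List.range (2^q)).all fun i => decide (vl e (jn α ρ) (cd e q τ i) = some (decide (i < j)))
/-- `E^j` is large above `τ` -/
def big (α : List Bool) (e q : ℕ) (τ : List Bool) (j : ℕ) : Bool :=
  decide (2^α.length < 2^q * (cnt α.length fun ρ => decide (τ <+: ρ) && Em α e q τ j ρ) * 2^τ.length)
/-- enumeration of the set `D0` -/
def ww (α : List Bool) (x : ℕ) : Bool :=
  (Encodable.decode x : Option (ℕ × ℕ × List Bool × ℕ)).elim false fun y =>
    decide (y.2.2.2 < 2^y.2.1) && (List.range (y.2.2.2+1)).all fun j => big α y.1 y.2.1 y.2.2.1 j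
/-- the class `U` above `τ` -/
def UU (e q : ℕ) (α τ ρ : List Bool) : Bool := decide (τ <+: ρ) && decide (τ.length < ρ.length) &&
  (List.range (2^q+1)).any fun j => (decide (j = 0) || ww α (cd e q τ (j-1))) && Em α e q τ j ρ
/-- children of `τ` -/
def chd (e q : ℕ) (α τ ρ : List Bool) : Bool := UU e q α τ ρ &&
  decide ((cnt ρ.length fun ρ' => UU e q α τ ρ') * 2^τ.length * 2^q ≤ (2^q-1) * 2^ρ.length) &&
  (List.range ρ.length).all fun m => !(UU e q (α.take m) τ (ρ.take m))

section
variable {α : Type*} [Primcodable α] {e q i : α → ℕ} {u v w : α → List Bool}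
@[fun_prop] theorem cd_prim (he : Primrec e) (hq : Primrec q) (hu : Primrec u) (hi : Primrec i) : Primrec fun a => cd (e a) (q a) (u a) (i a) := by
  unfold cd; fun_prop
@[fun_prop] theorem Em_prim (he : Primrec e) (hq : Primrec q) (hu : Primrec u) (hi : Primrec i) (hv : Primrec v) (hw : Primrec w) :
    Primrec fun a => Em (u a) (e a) (q a) (v a) (i a) (w a) := by
  unfold Em; fun_prop
@[fun_prop] theorem big_prim (he : Primrec e) (hq : Primrec q) (hu : Primrec u) (hi : Primrec i) (hv : Primrec v) :
    Primrec fun a => big (u a) (e a) (q a) (v a) (i a) := by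
  unfold big; fun_prop
@[fun_prop] theorem ww_prim (hu : Primrec u) (hi : Primrec i) : Primrec fun a => ww (u a) (i a) := by
  unfold ww; fun_prop
@[fun_prop] theorem UU_prim (he : Primrec e) (hq : Primrec q) (hu : Primrec u) (hv : Primrec v) (hw : Primrec w) :
    Primrec fun a => UU (e a) (q a) (u a) (v a) (w a) := by
  unfold UU; fun_prop
@[fun_prop] theorem chd_prim (he : Primrec e) (hq : Primrec q) (hu : Primrec u) (hv : Primrec v) (hw : Primrec w) :
    Primrec fun a => chd (e a) (q a) (u a) (v a) (w a) := by
  unfold chd; fun_prop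
end

section
variable {A : ℕ → Bool}

theorem Em_iff {e q j ℓ : ℕ} {τ : List Bool} {X : ℕ → Bool} : Em (strPrefix A ℓ) e q τ j (strPrefix X ℓ) = true ↔
    ∀ i < 2^q, vl e (strPrefix (joinSet A X) (2*ℓ)) (cd e q τ i) = some (decide (i < j)) := by
  simp [Em, jn_join A X le_rfl]

theorem Em_mono {e q j ℓ ℓ' : ℕ} {τ : List Bool} {X : ℕ → Bool} (h : ℓ ≤ ℓ') (hE : Em (strPrefix A ℓ) e q τ j (strPrefix X ℓ) = true) :
    Em (strPrefix A ℓ') e q τ j (strPrefix X ℓ') = true := by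
  rw [Em_iff] at *
  exact fun i hi => vl_mono (by omega) (hE i hi)

theorem Em_disj {e q j j' ℓ : ℕ} {τ : List Bool} {X : ℕ → Bool} (hj : j < j') (hq : j < 2^q) (hE : Em (strPrefix A ℓ) e q τ j (strPrefix X ℓ) = true)
    (hE' : Em (strPrefix A ℓ) e q τ j' (strPrefix X ℓ) = true) : False := by
  rw [Em_iff] at *
  have h1 := hE j hq
  have h2 := hE' j hq
  rw [h1] at h2
  simp [hj] at h2

theorem prefix_mono {τ : List Bool} {X : ℕ → Bool} {ℓ ℓ' : ℕ} (h : ℓ ≤ ℓ') (hp : τ <+: strPrefix X ℓ) : τ <+: strPrefix X ℓ' :=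
  hp.trans (strPrefix_mono_len X h)

theorem big_iff {e q j ℓ : ℕ} {τ : List Bool} : big (strPrefix A ℓ) e q τ j = true ↔
    (1/2:ℝ)^q * (1/2)^τ.length < mu {X | τ <+: strPrefix X ℓ ∧ Em (strPrefix A ℓ) e q τ j (strPrefix X ℓ) = true} := by
  have := mu_cnt ℓ fun ρ => decide (τ <+: ρ) && Em (strPrefix A ℓ) e q τ j ρ
  simp only [Bool.and_eq_true, decide_eq_true_eq] at this
  rw [this, big, decide_eq_true_eq, strPrefix_length, one_div_pow, one_div_pow, one_div_mul_one_div,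
    div_lt_div_iff₀ (by positivity) (by positivity), one_mul]
  generalize cnt ℓ _ = c
  have h2 : (c : ℝ) * (2^q * 2^τ.length) = ((2^q * c * 2^τ.length : ℕ) : ℝ) := by push_cast; ring
  rw [h2]
  exact_mod_cast Iff.rfl

theorem big_mono {e q j ℓ ℓ' : ℕ} {τ : List Bool} (h : ℓ ≤ ℓ') (hb : big (strPrefix A ℓ) e q τ j = true) : big (strPrefix A ℓ') e q τ j = true := by
  rw [big_iff] at *
  refine lt_of_lt_of_le hb (measureReal_mono ?_ (measure_ne_top _ _))
  rintro X ⟨h1, h2⟩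
  exact ⟨prefix_mono h h1, Em_mono h h2⟩

theorem ww_mono {x ℓ ℓ' : ℕ} (h : ℓ ≤ ℓ') (hb : ww (strPrefix A ℓ) x = true) : ww (strPrefix A ℓ') x = true := by
  unfold ww at *
  cases hx : (Encodable.decode x : Option (ℕ × ℕ × List Bool × ℕ)) with
  | none => rw [hx] at hb; simp at hb
  | some y =>
    rw [hx] at hb
    simp only [Option.elim_some, Bool.and_eq_true, List.all_eq_true, List.mem_range] at hb ⊢
    exact ⟨hb.1, fun j hj => big_mono h (hb.2 j hj)⟩

theorem ww_cd {e q j ℓ : ℕ} {τ : List Bool} : ww (strPrefix A ℓ) (cd e q τ j) = true ↔ j < 2^q ∧ ∀ j' ≤ j, big (strPrefix A ℓ) e q τ j' = true := by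
  unfold ww cd
  rw [Encodable.encodek]
  simp [Nat.lt_succ_iff]

theorem UU_iff {e q ℓ : ℕ} {τ : List Bool} {X : ℕ → Bool} : UU e q (strPrefix A ℓ) τ (strPrefix X ℓ) = true ↔
    τ <+: strPrefix X ℓ ∧ τ.length < ℓ ∧ ∃ j ≤ 2^q, (j = 0 ∨ ww (strPrefix A ℓ) (cd e q τ (j-1)) = true) ∧
      Em (strPrefix A ℓ) e q τ j (strPrefix X ℓ) = true := by
  unfold UU
  simp [Nat.lt_succ_iff, and_assoc]

theorem UU_mono {e q ℓ ℓ' : ℕ} {τ : List Bool} {X : ℕ → Bool} (h : ℓ ≤ ℓ') (hU : UU e q (strPrefix A ℓ) τ (strPrefix X ℓ) = true) :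
    UU e q (strPrefix A ℓ') τ (strPrefix X ℓ') = true := by
  rw [UU_iff] at *
  obtain ⟨h1, h2, j, h3, h4, h5⟩ := hU
  exact ⟨prefix_mono h h1, by omega, j, h3, h4.imp_right (ww_mono h), Em_mono h h5⟩

theorem chd_iff {e q ℓ : ℕ} {τ : List Bool} {X : ℕ → Bool} : chd e q (strPrefix A ℓ) τ (strPrefix X ℓ) = true ↔
    UU e q (strPrefix A ℓ) τ (strPrefix X ℓ) = true ∧
    mu {Z | UU e q (strPrefix A ℓ) τ (strPrefix Z ℓ) = true} ≤ (1 - (1/2)^q) * (1/2)^τ.length ∧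
    ∀ m < ℓ, ¬ UU e q (strPrefix A m) τ (strPrefix X m) = true := by
  have h1 : (∀ m < ℓ, UU e q ((strPrefix A ℓ).take m) τ ((strPrefix X ℓ).take m) = false) ↔
      ∀ m < ℓ, ¬ UU e q (strPrefix A m) τ (strPrefix X m) = true := by
    refine forall_congr' fun m => forall_congr' fun hm => ?_
    rw [strPrefix_take_of_le _ hm.le, strPrefix_take_of_le _ hm.le, Bool.not_eq_true]
  unfold chd
  rw [mu_cnt ℓ fun ρ => UU e q (strPrefix A ℓ) τ ρ]
  simp only [Bool.and_eq_true, decide_eq_true_eq, List.all_eq_true, List.mem_range, strPrefix_length, Bool.not_eq_true', h1, and_assoc]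
  refine and_congr_right fun _ => and_congr_left fun _ => ?_
  have h2 : (1 - (1/2:ℝ)^q) * (1/2)^τ.length = (2^q - 1) / (2^q * 2^τ.length) := by
    rw [one_div_pow, one_div_pow]; field_simp
  rw [h2, div_le_div_iff₀ (by positivity) (by positivity)]
  generalize cnt ℓ _ = c
  have h3 : ((2:ℝ)^q - 1) * 2^ℓ = (((2^q-1) * 2^ℓ : ℕ) : ℝ) := by
    push_cast [Nat.one_le_two_pow]; ring
  have h4 : (c : ℝ) * (2^q * 2^τ.length) = ((c * 2^τ.length * 2^q : ℕ) : ℝ) := by push_cast; ring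
  rw [h3, h4]
  exact_mod_cast Iff.rfl
end

open MeasureTheory ENNReal

open Classical in
/-- the set `D0` -/
noncomputable def DD (A : ℕ → Bool) (x : ℕ) : Bool := decide (∃ ℓ, ww (strPrefix A ℓ) x = true)

section
variable {A R : ℕ → Bool}

theorem DD_iff {x : ℕ} : DD A x = true ↔ ∃ ℓ, ww (strPrefix A ℓ) x = true := by simp [DD]

theorem Bdd.fin_level {M : Set ℕ} {C : ℝ} (h : Bdd M C) (r : ℕ) : {z | z ∈ M ∧ z.unpair.1 = r}.Finite := by
  by_contra hinf
  obtain ⟨n, hn⟩ := exists_nat_gt (C * 2^r)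
  obtain ⟨F, hF, hc⟩ := Set.Infinite.exists_subset_card_eq hinf n
  have h1 := h F fun z hz => (hF hz).1
  have h2 : ∑ z ∈ F, wt z = ∑ z ∈ F, (1/2:ℝ)^r := Finset.sum_congr rfl fun z hz => by rw [wt, (hF hz).2]
  rw [h2, Finset.sum_const, hc, nsmul_eq_mul, one_div_pow, mul_one_div, div_le_iff₀ (by positivity)] at h1
  linarith

theorem DD_le (hA : KTrivial A) {X : ℕ → Bool} (hX : TuringLE zeroJump X) : TuringLE (DD A) X := by
  classical
  let p : List Bool × ℕ → Prop := fun y =>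
    (decide (y.2 = Nat.pair (y.2.unpair.2.unpair.1 + 1) (Nat.pair y.2.unpair.2.unpair.1 (Encodable.encode (dstr y.2.unpair.2.unpair.2)))) &&
      decide (dstr y.2.unpair.2.unpair.2 <+: y.1) && ww (dstr y.2.unpair.2.unpair.2) y.2.unpair.2.unpair.1 &&
      (List.range (dstr y.2.unpair.2.unpair.2).length).all fun k => !(ww ((dstr y.2.unpair.2.unpair.2).take k) y.2.unpair.2.unpair.1)) = true
  have hp : REPred p := re_bool (Primrec.to_comp (by fun_prop))
  have hpi : ∀ ℓ z, p (strPrefix A ℓ, z) → ∃ x m, z = Nat.pair (x+1) (Nat.pair x (Encodable.encode (strPrefix A m))) ∧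
      ww (strPrefix A m) x = true ∧ ∀ k < m, ww (strPrefix A k) x = false := by
    intro ℓ z h
    simp only [p, Bool.and_eq_true, decide_eq_true_eq, List.all_eq_true, List.mem_range, Bool.not_eq_true'] at h
    obtain ⟨⟨⟨h1, h2⟩, h3⟩, h4⟩ := h
    have h5 := prefix_strPrefix h2
    refine ⟨z.unpair.2.unpair.1, (dstr z.unpair.2.unpair.2).length, ?_, ?_, fun k hk => ?_⟩
    · rw [← h5]; exact h1
    · rw [← h5]; exact h3
    · have := h4 k hk
      rw [h5, strPrefix_take_of_le _ hk.le] at this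
      exact this
  have hip : ∀ x m, ww (strPrefix A m) x = true → (∀ k < m, ww (strPrefix A k) x = false) →
      p (strPrefix A m, Nat.pair (x+1) (Nat.pair x (Encodable.encode (strPrefix A m)))) := by
    intro x m h1 h2
    simp only [p, Nat.unpair_pair, dstr, Encodable.encodek, Option.getD_some, Bool.and_eq_true, decide_eq_true_eq,
      List.all_eq_true, List.mem_range, Bool.not_eq_true', strPrefix_length]
    refine ⟨⟨⟨trivial, List.prefix_refl _⟩, h1⟩, fun k hk => ?_⟩
    rw [strPrefix_take_of_le _ hk.le]; exact h2 k hk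
  have hbd : Bdd {z | ∃ ℓ, p (strPrefix A ℓ, z)} 2 := by
    intro F hF
    have h1 : ∑ z ∈ F, wt z = ∑ r ∈ F.image (fun z => z.unpair.1), (1/2:ℝ)^r := by
      refine (Finset.sum_image (f := fun n => (1/2:ℝ)^n) (g := fun N : ℕ => N.unpair.1) ?_).symm
      intro z hz z' hz' hzz
      obtain ⟨ℓ, h⟩ := hF hz
      obtain ⟨ℓ', h'⟩ := hF hz'
      obtain ⟨x, m, rfl, h1, h2⟩ := hpi _ _ h
      obtain ⟨x', m', rfl, h1', h2'⟩ := hpi _ _ h'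
      simp only [Nat.unpair_pair] at hzz
      obtain rfl : x = x' := by omega
      have : m = m' := by
        rcases lt_trichotomy m m' with hl | hl | hl
        · rw [h2' _ hl] at h1; cases h1
        · exact hl
        · rw [h2 _ hl] at h1'; cases h1'
      rw [this]
    rw [h1]
    exact (geomhalf _ 0 (by simp)).trans (by norm_num)
  obtain ⟨M, hM, ⟨C, hC⟩, hsub⟩ := lk_re hA hp hbd
  obtain ⟨g, hg, hgm, hgi⟩ := re_normal hM
  obtain ⟨a, ha, hal, hac⟩ := ktriv_approx hA
  let G : List Bool × ℕ × ℕ → Bool := fun y => (List.range (y.1.length+1)).any fun k =>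
    g (Nat.pair (y.2.1+1) (Nat.pair y.2.1 (Encodable.encode (y.1.take k))), y.2.2) && ww (y.1.take k) y.2.1
  have hG : Primrec G := by fun_prop
  refine limit_lemma (f := fun y => G (a y.2, y.1, y.2)) (hG.to_comp.comp ((ha.comp Computable.snd).pair Computable.id)) (fun x => ?_) hX
  have hGi : ∀ s, G (a s, x, s) = true ↔ ∃ k ≤ (a s).length, g (Nat.pair (x+1) (Nat.pair x (Encodable.encode ((a s).take k))), s) = true ∧
      ww ((a s).take k) x = true := by
    intro s; simp [G, Nat.lt_succ_iff]
  rcases hD : DD A x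
  · have hfin := hC.fin_level (x+1)
    obtain ⟨L, hL⟩ := (hfin.image fun z => (dstr z.unpair.2.unpair.2).length).bddAbove
    obtain ⟨t, ht⟩ := hac L
    refine ⟨t, fun t' htt => ?_⟩
    by_contra hc
    simp only [Bool.not_eq_false] at hc
    obtain ⟨k, hk, h1, h2⟩ := (hGi t').1 hc
    have h3 := hL (Set.mem_image_of_mem _ ⟨(hgi _).2 ⟨_, h1⟩, by simp⟩)
    simp only [Nat.unpair_pair, dstr, Encodable.encodek, Option.getD_some] at h3
    have h4 : (a t').take k <+: strPrefix A L := by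
      refine List.prefix_of_prefix_length_le (List.take_prefix _ _) (ht t' htt) (by simpa using h3)
    rw [prefix_strPrefix h4] at h2
    have := (DD_iff (A := A)).2 ⟨_, h2⟩
    rw [hD] at this; cases this
  · have hex := DD_iff.1 hD
    have hm1 := Nat.find_spec hex
    have hm2 := fun k (hk : k < Nat.find hex) => (Bool.not_eq_true _).mp (Nat.find_min hex hk)
    obtain ⟨m, hm⟩ : ∃ m, m = Nat.find hex := ⟨_, rfl⟩
    rw [← hm] at hm1 hm2
    have h1 := hsub ⟨m, hip x m hm1 hm2⟩
    obtain ⟨s, hs⟩ := (hgi _).1 h1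
    obtain ⟨t, ht⟩ := hac m
    refine ⟨max s t, fun t' htt => (hGi t').2 ⟨m, ?_, ?_⟩⟩
    · have := (ht t' ((le_max_right _ _).trans htt)).length_le
      simpa using this
    · have h2 := ht t' ((le_max_right _ _).trans htt)
      rw [List.prefix_iff_eq_take, strPrefix_length] at h2
      rw [← h2]
      exact ⟨hgm _ _ _ ((le_max_left _ _).trans htt) hs, hm1⟩

/-- evident mistake of the functional -/
def bad (e : ℕ) (α ρ : List Bool) : Bool := (List.range (ρ.length+1)).any fun x => ww α x && decide (vl e (jn α ρ) x = some false)

theorem bad_iff {e ℓ : ℕ} {X : ℕ → Bool} : bad e (strPrefix A ℓ) (strPrefix X ℓ) = true ↔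
    ∃ x ≤ ℓ, ww (strPrefix A ℓ) x = true ∧ vl e (strPrefix (joinSet A X) (2*ℓ)) x = some false := by
  simp [bad, jn_join A X le_rfl, Nat.lt_succ_iff]

/-- the class of oracles without mistakes -/
theorem bad_class (hA : KTrivial A) (hR : MLRandom R) {e : ℕ}
    (he : ∀ x ℓ b, vl e (strPrefix (joinSet A R) ℓ) x = some b → b = DD A x) :
    ∃ f : List Bool × ℕ → Bool, Primrec f ∧ (∀ a s t, s ≤ t → f (a, s) = true → f (a, t) = true) ∧ (∀ n s, f (strPrefix R n, s) = false) ∧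
      ∀ m, ∃ N ≥ m, ∀ X, bad e (strPrefix A m) (strPrefix X m) = true → PP f (strPrefix X N) N = false := by
  classical
  let p : List Bool × List Bool → Prop := fun y => (decide (y.2.length ≤ y.1.length) && bad e (y.1.take y.2.length) y.2 &&
    (List.range y.2.length).all fun k => !(bad e (y.1.take k) (y.2.take k))) = true
  have hp : REPred p := by
    refine re_bool (Primrec.to_comp ?_)
    unfold bad; fun_prop
  have hpi : ∀ ℓ ρ, p (strPrefix A ℓ, ρ) ↔ ρ.length ≤ ℓ ∧ bad e (strPrefix A ρ.length) ρ = true ∧ ∀ k < ρ.length, bad e (strPrefix A k) (ρ.take k) = false := by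
    intro ℓ ρ
    simp only [p, Bool.and_eq_true, decide_eq_true_eq, List.all_eq_true, List.mem_range, Bool.not_eq_true', strPrefix_length, and_assoc]
    refine and_congr_right fun h => ?_
    rw [strPrefix_take_of_le _ h]
    refine and_congr_right fun _ => forall_congr' fun k => forall_congr' fun hk => ?_
    rw [strPrefix_take_of_le _ (by omega)]
  have hbd : WB {ρ | ∃ ℓ, p (strPrefix A ℓ, ρ)} 1 := by
    intro F hF
    refine kraft (f := fun ρ => ρ) fun ρ hρ ρ' hρ' hpre => ?_
    obtain ⟨ℓ, h⟩ := hF hρ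
    obtain ⟨ℓ', h'⟩ := hF hρ'
    rw [hpi] at h h'
    by_contra hne
    have hlt : ρ.length < ρ'.length := by
      refine lt_of_le_of_ne hpre.length_le fun hl => hne (hpre.eq_of_length hl)
    have := h'.2.2 _ hlt
    rw [← List.prefix_iff_eq_take.1 hpre, h.2.1] at this
    cases this
  have hav : ∀ ℓ n, ¬ p (strPrefix A ℓ, strPrefix R n) := by
    intro ℓ n h
    rw [hpi, strPrefix_length, bad_iff] at h
    obtain ⟨_, ⟨x, _, h1, h2⟩, _⟩ := h
    have := he _ _ _ h2
    rw [(DD_iff (A := A)).2 ⟨_, h1⟩] at this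
    cases this
  obtain ⟨T, hT, hsub, hTR⟩ := lk_avoid hA hR hp hbd hav
  obtain ⟨f, hf, hfm, hfi⟩ := re_normal hT
  refine ⟨f, hf, hfm, fun n s => ?_, fun m => ?_⟩
  · by_contra hc
    exact hTR n ((hfi _).2 ⟨s, by simpa using hc⟩)
  · have hex : ∀ ρ : List Bool, ∃ s, ρ.length = m → bad e (strPrefix A m) ρ = true → ∃ k ≤ m, f (ρ.take k, s) = true := by
      intro ρ
      by_cases hl : ρ.length = m
      swap
      · exact ⟨0, fun h => absurd h hl⟩
      by_cases hb : bad e (strPrefix A m) ρ = true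
      swap
      · exact ⟨0, fun _ h => absurd h hb⟩
      have hex : ∃ k, bad e (strPrefix A k) (ρ.take k) = true := ⟨m, by rw [List.take_of_length_le hl.le]; exact hb⟩
      have hkm : Nat.find hex ≤ m := Nat.find_min' hex (by rw [List.take_of_length_le hl.le]; exact hb)
      have hlen : (ρ.take (Nat.find hex)).length = Nat.find hex := by rw [List.length_take]; omega
      have : ρ.take (Nat.find hex) ∈ T := by
        refine hsub m _ ((hpi _ _).2 ?_)
        rw [hlen]
        refine ⟨hkm, Nat.find_spec hex, fun k hk => ?_⟩
        rw [List.take_take, min_eq_left hk.le]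
        simpa using Nat.find_min hex hk
      obtain ⟨s, hs⟩ := (hfi _).1 this
      exact ⟨s, fun _ _ => ⟨_, hkm, hs⟩⟩
    choose s hs using hex
    refine ⟨max m ((strL m).toFinset.sup s), le_max_left _ _, fun X hX => ?_⟩
    obtain ⟨k, hk, h⟩ := hs _ (strPrefix_length _ _) hX
    obtain ⟨N, hN⟩ : ∃ N, N = max m ((strL m).toFinset.sup s) := ⟨_, rfl⟩
    rw [← hN]
    have h1 : s (strPrefix X m) ≤ (strL m).toFinset.sup s := Finset.le_sup (f := s) (by simp [mem_strL])
    have hmN : m ≤ N := by omega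
    by_contra hc
    simp only [Bool.not_eq_false, PP, List.all_eq_true, List.mem_range, strPrefix_length, Bool.not_eq_true'] at hc
    have h2 := hc k (by omega)
    rw [strPrefix_take_of_le _ (by omega)] at h2
    rw [strPrefix_take_of_le _ hk] at h
    rw [hfm _ _ _ (by omega) h] at h2
    cases h2
end

open MeasureTheory ENNReal
attribute [local irreducible] cd vl ww Em

section
variable {A R : ℕ → Bool}

theorem det_meas (N : ℕ) (Q : List Bool → Prop) : MeasurableSet {X : ℕ → Bool | Q (strPrefix X N)} := determined_measurable N {ρ | Q ρ}

theorem DD_down {e q j j' : ℕ} {τ : List Bool} (h : j' ≤ j) (hj : DD A (cd e q τ j) = true) : DD A (cd e q τ j') = true := by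
  rw [DD_iff] at *
  obtain ⟨ℓ, h1⟩ := hj
  rw [ww_cd] at h1
  exact ⟨ℓ, ww_cd.2 ⟨by omega, fun i hi => h1.2 i (by omega)⟩⟩

theorem exJ (A : ℕ → Bool) (e q : ℕ) (τ : List Bool) : ∃ J < 2^q, DD A (cd e q τ J) = false ∧ ∀ j < J, DD A (cd e q τ j) = true := by
  classical
  have hex : ∃ j, j < 2^q ∧ DD A (cd e q τ j) = false := by
    by_contra hc
    push Not at hc
    have h2 : 0 < 2^q := by positivity
    have h1 := hc (2^q-1) (by omega)
    rw [Bool.ne_false_iff, DD_iff] at h1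
    obtain ⟨ℓ, h1⟩ := h1
    rw [ww_cd] at h1
    let S : ℕ → Set (ℕ → Bool) := fun j => {X | τ <+: strPrefix X ℓ ∧ Em (strPrefix A ℓ) e q τ j (strPrefix X ℓ) = true}
    have hS : ∀ j < 2^q, (1/2:ℝ)^q * (1/2)^τ.length < mu (S j) := fun j hj => big_iff.1 (h1.2 j (by omega))
    have hd : ((Finset.range (2^q) : Finset ℕ) : Set ℕ).PairwiseDisjoint S := by
      intro i hi j hj hij
      simp only [Finset.coe_range, Set.mem_Iio] at hi hj
      refine Set.disjoint_left.2 fun X hX hX' => ?_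
      rcases lt_or_gt_of_ne hij with h | h
      · exact Em_disj h hi hX.2 hX'.2
      · exact Em_disj h hj hX'.2 hX.2
    have h3 : ∑ j ∈ Finset.range (2^q), mu (S j) = mu (⋃ j ∈ Finset.range (2^q), S j) :=
      (measureReal_biUnion_finset hd fun j _ => det_meas ℓ fun ρ => τ <+: ρ ∧ Em (strPrefix A ℓ) e q τ j ρ = true).symm
    have h4 : mu (⋃ j ∈ Finset.range (2^q), S j) ≤ mu (cylinder τ) := by
      refine measureReal_mono ?_ (measure_ne_top _ _)
      simp only [Set.iUnion_subset_iff]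
      rintro j _ X ⟨hX, _⟩
      rw [mem_cylinder_iff]
      exact (prefix_strPrefix hX).symm
    have h5 : ∑ j ∈ Finset.range (2^q), (1/2:ℝ)^q * (1/2)^τ.length < ∑ j ∈ Finset.range (2^q), mu (S j) :=
      Finset.sum_lt_sum_of_nonempty ⟨0, by simp⟩ fun j hj => hS j (by simpa using hj)
    rw [Finset.sum_const, Finset.card_range, nsmul_eq_mul, ← mul_assoc] at h5
    have h6 : ((2^q : ℕ) : ℝ) * (1/2)^q = 1 := by
      push_cast; rw [← mul_pow]; norm_num
    rw [h6, one_mul, h3] at h5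
    rw [mu_cylinder] at h4
    linarith
  refine ⟨Nat.find hex, (Nat.find_spec hex).1, (Nat.find_spec hex).2, fun j hj => ?_⟩
  have := Nat.find_min hex hj
  have hlt := (Nat.find_spec hex).1
  by_contra hc
  exact this ⟨by omega, by simpa using hc⟩

theorem U_small {e k : ℕ} {f : List Bool × ℕ → Bool}
    (hb : ∀ m, ∃ N ≥ m, ∀ X, bad e (strPrefix A m) (strPrefix X m) = true → PP f (strPrefix X N) N = false)
    {τ : List Bool} (hk : ∀ N, τ.length ≤ N → ¬ lowd f N k τ = true) (ℓ : ℕ) :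
    mu {Z | UU e (k+1) (strPrefix A ℓ) τ (strPrefix Z ℓ) = true} ≤ (1 - (1/2)^(k+1)) * (1/2)^τ.length := by
  obtain ⟨J, hJq, hJ, hJ'⟩ := exJ A e (k+1) τ
  have hst : ∀ n ≤ J, ∃ m, ∀ j < n, ww (strPrefix A m) (cd e (k+1) τ j) = true ∧ cd e (k+1) τ j ≤ m := by
    intro n
    induction n with
    | zero => exact fun _ => ⟨0, fun j hj => absurd hj (by omega)⟩
    | succ n ih =>
      intro hn
      obtain ⟨m, hm⟩ := ih (by omega)
      obtain ⟨m', hm'⟩ := DD_iff.1 (hJ' n (by omega))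
      refine ⟨max m (max m' (cd e (k+1) τ n)), fun j hj => ?_⟩
      rcases Nat.lt_succ_iff_lt_or_eq.1 hj with h | rfl
      · exact ⟨ww_mono (by omega) (hm j h).1, by have := (hm j h).2; omega⟩
      · exact ⟨ww_mono (by omega) hm', by omega⟩
  obtain ⟨m0, hm0⟩ := hst J le_rfl
  obtain ⟨m, hm⟩ : ∃ m, m = max m0 (max ℓ τ.length) := ⟨_, rfl⟩
  obtain ⟨N, hN, hPN⟩ := hb m
  obtain ⟨P, hP⟩ : ∃ P : Set (ℕ → Bool), P = {X | τ <+: strPrefix X N ∧ PP f (strPrefix X N) N = true} := ⟨_, rfl⟩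
  obtain ⟨E, hE⟩ : ∃ E : Set (ℕ → Bool), E = {X | τ <+: strPrefix X ℓ ∧ Em (strPrefix A ℓ) e (k+1) τ J (strPrefix X ℓ) = true} := ⟨_, rfl⟩
  have h1 : (1/2:ℝ)^k * (1/2)^τ.length ≤ mu P := by
    have := hk N (by omega)
    rw [lowd_mu, ← hP] at this
    linarith
  have h2 : mu E ≤ (1/2:ℝ)^(k+1) * (1/2)^τ.length := by
    by_contra hc
    push Not at hc
    rw [hE, ← big_iff] at hc
    have : DD A (cd e (k+1) τ J) = true := by
      rw [DD_iff]
      refine ⟨m, ww_cd.2 ⟨hJq, fun j' hj' => ?_⟩⟩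
      rcases hj'.lt_or_eq with h | rfl
      · exact (ww_cd.1 (ww_mono (by omega) (hm0 j' h).1)).2 j' le_rfl
      · exact big_mono (by omega) hc
    rw [hJ] at this; cases this
  have hsub : {Z | UU e (k+1) (strPrefix A ℓ) τ (strPrefix Z ℓ) = true} ⊆ (cylinder τ \ P) ∪ E := by
    intro Z hZ
    have hZ := UU_iff.1 hZ
    obtain ⟨a1, a2, j, a3, a4, a5⟩ := hZ
    have hjJ : j ≤ J := by
      rcases a4 with rfl | a4
      · omega
      · by_contra hc
        have := DD_down (show J ≤ j - 1 by omega) (DD_iff.2 ⟨_, a4⟩)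
        rw [hJ] at this; cases this
    rcases hjJ.lt_or_eq with hlt | rfl
    · left
      refine ⟨mem_cylinder_iff.2 (prefix_strPrefix a1).symm, fun hZP => ?_⟩
      rw [hP] at hZP
      have hbad : bad e (strPrefix A m) (strPrefix Z m) = true := by
        rw [bad_iff]
        refine ⟨cd e (k+1) τ j, by have := (hm0 j hlt).2; omega, ww_mono (by omega) (hm0 j hlt).1, ?_⟩
        have := Em_iff.1 (Em_mono (show ℓ ≤ m by omega) a5) j (by omega)
        simpa using this
      have h3 := hPN Z hbad
      rw [hZP.2] at h3; cases h3
    · right; rw [hE]; exact ⟨a1, a5⟩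
  have hPm : MeasurableSet P := by rw [hP]; exact det_meas N fun ρ => τ <+: ρ ∧ PP f ρ N = true
  have hPc : P ⊆ cylinder τ := by
    rw [hP]; rintro X ⟨hX, _⟩; exact mem_cylinder_iff.2 (prefix_strPrefix hX).symm
  have h3 : mu (cylinder τ \ P) = (1/2)^τ.length - mu P := by
    unfold mu
    rw [measureReal_diff hPc hPm]
    rw [← mu_cylinder]
  have h4 : mu {Z | UU e (k+1) (strPrefix A ℓ) τ (strPrefix Z ℓ) = true} ≤ mu (cylinder τ \ P) + mu E :=
    (measureReal_mono hsub (measure_ne_top _ _)).trans (measureReal_union_le _ _)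
  rw [h3] at h4
  rw [pow_succ] at *
  linarith

theorem U_in {e q : ℕ} (he : ∀ x, ∃ ℓ, vl e (strPrefix (joinSet A R) ℓ) x = some (DD A x)) (n : ℕ) :
    ∃ ℓ, UU e q (strPrefix A ℓ) (strPrefix R n) (strPrefix R ℓ) = true := by
  obtain ⟨J, hJq, hJ, hJ'⟩ := exJ A e q (strPrefix R n)
  have hst : ∀ b, ∃ m, ∀ i < b, vl e (strPrefix (joinSet A R) (2*m)) (cd e q (strPrefix R n) i) = some (DD A (cd e q (strPrefix R n) i)) := by
    intro b
    induction b with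
    | zero => exact ⟨0, fun j hj => absurd hj (by omega)⟩
    | succ b ih =>
      obtain ⟨m, hm⟩ := ih
      obtain ⟨m', hm'⟩ := he (cd e q (strPrefix R n) b)
      refine ⟨max m m', fun j hj => ?_⟩
      rcases Nat.lt_succ_iff_lt_or_eq.1 hj with h | rfl
      · exact vl_mono (by omega) (hm j h)
      · exact vl_mono (by omega) hm'
  obtain ⟨m, hm⟩ := hst (2^q)
  have hs : ∃ s, J = 0 ∨ ww (strPrefix A s) (cd e q (strPrefix R n) (J-1)) = true := by
    rcases Nat.eq_zero_or_pos J with h | h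
    · exact ⟨0, Or.inl h⟩
    · obtain ⟨s, hs⟩ := DD_iff.1 (hJ' (J-1) (by omega))
      exact ⟨s, Or.inr hs⟩
  obtain ⟨s, hs⟩ := hs
  refine ⟨max (max m s) (n+1), UU_iff.2 ⟨strPrefix_mono_len R (by omega), by rw [strPrefix_length]; omega, J, hJq.le, hs.imp_right (ww_mono (by omega)), ?_⟩⟩
  rw [Em_iff]
  intro i hi
  have h1 := vl_mono (show 2*m ≤ 2*(max (max m s) (n+1)) by omega) (hm i hi)
  rw [h1]
  congr 1
  by_cases hiJ : i < J
  · rw [hJ' i hiJ, decide_eq_true hiJ]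
  · rw [decide_eq_false hiJ]
    by_contra hc
    rw [Bool.not_eq_false] at hc
    have := DD_down (show J ≤ i by omega) hc
    rw [hJ] at this; cases this

/-- generations of descendants -/
def Sm (A : ℕ → Bool) (e q : ℕ) : ℕ → Set (List Bool)
  | 0 => {[]}
  | m+1 => {ρ | ∃ τ ∈ Sm A e q m, chd e q (strPrefix A ρ.length) τ ρ = true}

theorem chd_bound {e q : ℕ} {τ : List Bool} (F : Finset (List Bool)) (hF : ∀ ρ ∈ F, chd e q (strPrefix A ρ.length) τ ρ = true) :
    ∑ ρ ∈ F, (1/2:ℝ)^ρ.length ≤ (1 - (1/2)^q) * (1/2)^τ.length := by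
  rcases F.eq_empty_or_nonempty with rfl | hne
  · rw [Finset.sum_empty]
    have : (1/2:ℝ)^q ≤ 1 := pow_le_one₀ (by norm_num) (by norm_num)
    exact mul_nonneg (by linarith) (by positivity)
  have hch : ∀ ρ ∈ F, ∀ X, X ∈ cylinder ρ → chd e q (strPrefix A ρ.length) τ (strPrefix X ρ.length) = true := by
    intro ρ hρ X hX
    rw [mem_cylinder_iff.1 hX]; exact hF ρ hρ
  obtain ⟨ρ0, hρ0, hmax⟩ := Finset.exists_max_image F List.length hne
  obtain ⟨X0, hX0⟩ := exists_ext ρ0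
  refine le_trans (kraft_mu (f := fun ρ => ρ) ?_ ?_) (chd_iff.1 (hch ρ0 hρ0 X0 (mem_cylinder_iff.2 hX0))).2.1
  · intro ρ hρ ρ' hρ' hpre
    by_contra hne
    have hlt : ρ.length < ρ'.length := lt_of_le_of_ne hpre.length_le fun hl => hne (hpre.eq_of_length hl)
    obtain ⟨X, hX⟩ := exists_ext ρ'
    have h1 := mem_cylinder_iff.2 hX
    have h2 := chd_iff.1 (hch ρ' hρ' X h1)
    have h3 := chd_iff.1 (hch ρ hρ X (cylinder_subset hpre h1))
    exact h2.2.2 _ hlt h3.1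
  · intro ρ hρ X hX
    exact UU_mono (hmax ρ hρ) (chd_iff.1 (hch ρ hρ X hX)).1

theorem Sm_bound (e q m : ℕ) : WB (Sm A e q m) ((1 - (1/2)^q)^m) := by
  classical
  induction m with
  | zero =>
    intro F hF
    have : F ⊆ {[]} := by intro ρ hρ; simpa [Sm] using hF hρ
    refine (Finset.sum_le_sum_of_subset_of_nonneg this fun _ _ _ => by positivity).trans ?_
    simp
  | succ m ih =>
    intro F hF
    have hex : ∀ ρ, ρ ∈ F → ∃ τ, τ ∈ Sm A e q m ∧ chd e q (strPrefix A ρ.length) τ ρ = true := fun ρ hρ => hF hρ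
    choose! g h1 h2 using hex
    rw [← Finset.sum_fiberwise_of_maps_to (s := F) (t := F.image g) (g := g) (fun z hz => Finset.mem_image_of_mem _ hz)]
    have h3 : ∀ τ ∈ F.image g, ∑ ρ ∈ F with g ρ = τ, (1/2:ℝ)^ρ.length ≤ (1 - (1/2)^q) * (1/2)^τ.length := by
      intro τ _
      refine chd_bound (A := A) (e := e) _ fun ρ hρ => ?_
      rw [Finset.mem_filter] at hρ
      obtain ⟨h4, rfl⟩ := hρ
      exact h2 ρ h4
    refine (Finset.sum_le_sum h3).trans ?_
    rw [← Finset.mul_sum, pow_succ, mul_comm]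
    have : (1/2:ℝ)^q ≤ 1 := pow_le_one₀ (by norm_num) (by norm_num)
    refine mul_le_mul_of_nonneg_right (ih _ fun τ hτ => ?_) (by linarith)
    simp only [Finset.coe_image, Set.mem_image, Finset.mem_coe] at hτ
    obtain ⟨ρ, hρ, rfl⟩ := hτ
    exact h1 ρ hρ

theorem Sm_union (e q : ℕ) : WB {ρ | ∃ m, ρ ∈ Sm A e q m} (2^q) := by
  classical
  intro F hF
  have hex : ∀ ρ, ρ ∈ F → ∃ m, ρ ∈ Sm A e q m := fun ρ hρ => hF hρ
  choose! g h1 using hex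
  have h0 : (1/2:ℝ)^q ≤ 1 := pow_le_one₀ (by norm_num) (by norm_num)
  have h0' : 0 < (1/2:ℝ)^q := by positivity
  rw [← Finset.sum_fiberwise_of_maps_to (s := F) (t := F.image g) (g := g) (fun z hz => Finset.mem_image_of_mem _ hz)]
  have h3 : ∀ m ∈ F.image g, ∑ ρ ∈ F with g ρ = m, (1/2:ℝ)^ρ.length ≤ (1 - (1/2)^q)^m := by
    intro m _
    refine Sm_bound (A := A) e q m _ fun ρ hρ => ?_
    rw [Finset.mem_coe, Finset.mem_filter] at hρ
    obtain ⟨h4, rfl⟩ := hρ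
    exact h1 ρ h4
  refine (Finset.sum_le_sum h3).trans ?_
  have hs := summable_geometric_of_lt_one (r := 1 - (1/2:ℝ)^q) (by linarith) (by linarith)
  refine (hs.sum_le_tsum _ fun i _ => pow_nonneg (by linarith) i).trans ?_
  rw [tsum_geometric_of_lt_one (by linarith) (by linarith)]
  have h5 : 1 - (1 - (1/2:ℝ)^q) = (2^q)⁻¹ := by rw [one_div, inv_pow]; ring
  rw [h5, inv_inv]

/-- enumeration of the generations -/
def smL (e q : ℕ) (α : List Bool) (m : ℕ) : List (List Bool) :=
  Nat.rec [[]] (fun _ l => l.flatMap fun τ => ((List.range (α.length+1)).flatMap strL).filter fun ρ => chd e q (α.take ρ.length) τ ρ) m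

theorem mem_smL {e q ℓ m : ℕ} {ρ : List Bool} : ρ ∈ smL e q (strPrefix A ℓ) m ↔ ρ.length ≤ ℓ ∧ ρ ∈ Sm A e q m := by
  induction m generalizing ρ with
  | zero =>
    change ρ ∈ [[]] ↔ _ ∧ ρ ∈ ({[]} : Set (List Bool))
    simp only [List.mem_singleton, Set.mem_singleton_iff]
    exact ⟨fun h => ⟨by simp [h], h⟩, fun h => h.2⟩
  | succ m ih =>
    have : smL e q (strPrefix A ℓ) (m+1) = (smL e q (strPrefix A ℓ) m).flatMap fun τ => ((List.range ((strPrefix A ℓ).length+1)).flatMap strL).filter fun ρ => chd e q ((strPrefix A ℓ).take ρ.length) τ ρ := rfl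
    rw [this]
    simp only [List.mem_flatMap, List.mem_filter, List.mem_range, mem_strL, strPrefix_length, ih]
    change _ ↔ _ ∧ ∃ τ ∈ Sm A e q m, _
    constructor
    · rintro ⟨τ, ⟨h1, h2⟩, ⟨i, hi, h3⟩, h4⟩
      rw [strPrefix_take_of_le _ (by omega)] at h4
      exact ⟨by omega, τ, h2, h4⟩
    · rintro ⟨h1, τ, h2, h3⟩
      refine ⟨τ, ⟨?_, h2⟩, ⟨ρ.length, by omega, rfl⟩, ?_⟩
      · obtain ⟨X, hX⟩ := exists_ext ρ
        have h4 := h3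
        rw [← hX, strPrefix_length] at h4
        have := (UU_iff.1 (chd_iff.1 h4).1).2.1
        omega
      · rw [strPrefix_take_of_le _ (by omega)]; exact h3

theorem triv_base (hA : KTrivial A) (hR : MLRandom R) (h : TuringLE zeroJump (joinSet A R)) : TuringLE zeroJump R := by
  by_contra hinc
  obtain ⟨e, he1, he2⟩ := (DD_le hA h).elim
  obtain ⟨hv1, hv2⟩ := vl_of he1 he2
  obtain ⟨f, hf, hfm, hfR, hb⟩ := bad_class hA hR hv2
  obtain ⟨k, hk⟩ := density hR hinc hf hfm hfR
  let p : List Bool × List Bool → Prop := fun y => ∃ m, ((smL e (k+1) y.1 m).any fun ρ => decide (ρ = y.2)) = true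
  have hp : REPred p := by
    refine REPred.ex (p := fun y : (List Bool × List Bool) × ℕ => ((smL e (k+1) y.1.1 y.2).any fun ρ => decide (ρ = y.1.2)) = true) (re_bool (Primrec.to_comp ?_))
    unfold smL; fun_prop
  have hpi : ∀ ℓ ρ, p (strPrefix A ℓ, ρ) ↔ ρ.length ≤ ℓ ∧ ∃ m, ρ ∈ Sm A e (k+1) m := by
    intro ℓ ρ
    simp only [p, List.any_eq_true, decide_eq_true_eq, exists_eq_right, mem_smL]
    exact exists_and_left
  obtain ⟨T, hT, ⟨C, hC⟩, hsub⟩ := lk_str hA hp (C := 2^(k+1)) (by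
    intro F hF
    refine Sm_union (A := A) e (k+1) F fun ρ hρ => ?_
    obtain ⟨ℓ, h⟩ := hF hρ
    exact ((hpi _ _).1 h).2)
  obtain ⟨N, hN⟩ := solovay hR hT hC
  have hstep : ∀ n, ∃ n' > n, chd e (k+1) (strPrefix A n') (strPrefix R n) (strPrefix R n') = true := by
    intro n
    classical
    have hex := U_in (q := k+1) hv1 n
    have h1 := Nat.find_spec hex
    refine ⟨Nat.find hex, by simpa using (UU_iff.1 h1).2.1, chd_iff.2 ⟨h1, ?_, fun m hm => Nat.find_min hex hm⟩⟩
    exact U_small hb (fun N' hN' => hk n N' (by simpa using hN')) _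
  have hall : ∀ m, ∃ n ≥ m, strPrefix R n ∈ Sm A e (k+1) m := by
    intro m
    induction m with
    | zero => exact ⟨0, le_rfl, by simp [Sm, strPrefix]⟩
    | succ m ih =>
      obtain ⟨n, hn, h1⟩ := ih
      obtain ⟨n', hn', h2⟩ := hstep n
      exact ⟨n', by omega, strPrefix R n, h1, by rw [strPrefix_length]; exact h2⟩
  obtain ⟨n, hn, h1⟩ := hall N
  exact hN n hn (hsub ⟨n, (hpi _ _).2 ⟨by simp, _, h1⟩⟩)
end

/-- degree-theoretic characterization of non-K-triviality. -/
theorem stmt17 (A : ℕ → Bool) :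
    ¬ KTrivial A ↔
      ∀ D : ℕ → Bool, ¬ ComputableSet D →
        ∃ R : ℕ → Bool, MLRandom R ∧ ¬ TuringLE D R ∧
          TuringLE D (joinSet A R) := by
  refine ⟨fun hA D hD => forward hA hD, fun h hA => ?_⟩
  obtain ⟨R, hR, h1, h2⟩ := h zeroJump zeroJump_not_computable
  exact h1 (triv_base hA hR h2)
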